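/- Let n ≥ 3, let Γ be a lattice in SL(n, ℝ) (i.e. a discrete subgroup of SL(n, ℝ) such that the quotient SL(n, ℝ)/Γ has finite volume with respect to Haar measure), and let S be a closed surface (a compact connected 2-dimensional topological manifold without boundary). Then there is no action of Γ on S by homeomorphisms which is both distal and minimal. -/

import Mathlib

open MeasureTheory

/-- The group of self-homeomorphisms of a topological space, under composition. -/
instance Homeomorph.instGroupSelf {X : Type*} [TopologicalSpace X] : Group (X ≃ₜ X) where
  mul a b := b.trans a
  one := Homeomorph.refl X
  inv := Homeomorph.symm
  mul_assoc _ _ _ := rfl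
  one_mul a := Homeomorph.ext fun _ => rfl
  mul_one a := Homeomorph.ext fun _ => rfl
  inv_mul_cancel a := Homeomorph.ext fun x => a.symm_apply_apply x

/-- The topology on `SL(n, ℝ)` induced from the (entrywise) topology on matrices. -/
instance (n : ℕ) : TopologicalSpace (Matrix.SpecialLinearGroup (Fin n) ℝ) :=
  show TopologicalSpace {A : Matrix (Fin n) (Fin n) ℝ // A.det = 1} from inferInstance

/-- The Borel σ-algebra on `SL(n, ℝ)`. -/
instance (n : ℕ) : MeasurableSpace (Matrix.SpecialLinearGroup (Fin n) ℝ) :=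
  borel _

/-- A subgroup `Γ` of a topological group `G` is a lattice if it is discrete and the quotient
`G/Γ` has finite volume with respect to Haar measure, i.e. there is a fundamental domain for
the (right) translation action of `Γ` on `G` of finite Haar measure. -/
def Subgroup.IsLattice {G : Type*} [Group G] [TopologicalSpace G] [MeasurableSpace G]
    (Γ : Subgroup G) : Prop :=
  DiscreteTopology Γ ∧
    ∃ μ : Measure G, μ.IsHaarMeasure ∧
      ∃ F : Set G, IsFundamentalDomain Γ.op F μ ∧ μ F < ⊤

section
namespace DistalA

/-- no odd nonvanishing extension to disk -/
theorem no_odd_disk (g : ℂ → ℂ) (hg : ContinuousOn g (Metric.closedBall 0 1))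
    (h0 : ∀ z ∈ Metric.closedBall (0:ℂ) 1, g z ≠ 0)
    (hodd : ∀ z : ℂ, ‖z‖ = 1 → g (-z) = - g z) : False := by
  let ret : ℂ → ℂ := fun z => ((max 1 ‖z‖ : ℝ) : ℂ)⁻¹ * z
  have hmax : ∀ z : ℂ, (0:ℝ) < max 1 ‖z‖ := fun z => lt_max_of_lt_left one_pos
  have hretc : Continuous ret := by
    apply Continuous.mul _ continuous_id
    apply Continuous.inv₀
    · fun_prop
    · intro z; exact_mod_cast (hmax z).ne'
  have hretm : ∀ z, ret z ∈ Metric.closedBall (0:ℂ) 1 := by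
    intro z
    simp only [ret, Metric.mem_closedBall, dist_zero_right, norm_mul, norm_inv, Complex.norm_real,
      Real.norm_eq_abs, abs_of_pos (hmax z)]
    rw [inv_mul_le_iff₀ (hmax z)]
    simp
  have hret1 : ∀ z : ℂ, ‖z‖ = 1 → ret z = z := by
    intro z hz; simp [ret, hz]
  let G : C(ℂ, {z : ℂ // z ≠ 0}) :=
    ⟨fun z => ⟨g (ret z), h0 _ (hretm z)⟩, by
      apply Continuous.subtype_mk
      exact hg.comp_continuous hretc hretm⟩
  obtain ⟨F, ⟨-, hF⟩, -⟩ := Complex.isCoveringMap_exp.existsUnique_continuousMap_lifts G 0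
    (Complex.log (G 0)) (Subtype.ext (Complex.exp_log (G 0).2))
  have hFe : ∀ z : ℂ, ‖z‖ = 1 → Complex.exp (F z) = g z := by
    intro z hz
    have := congrArg Subtype.val (congrFun hF z)
    simpa [G, hret1 z hz] using this
  -- difference on circle
  have key : ∀ z : ℂ, ‖z‖ = 1 → ∃ n : ℤ, (F (-z) - F z) / (Real.pi * Complex.I) = 2 * n + 1 := by
    intro z hz
    have h1 : Complex.exp (F (-z)) = Complex.exp (F z + Real.pi * Complex.I) := by
      rw [hFe (-z) (by simpa using hz), Complex.exp_add, hFe z hz, Complex.exp_pi_mul_I, hodd z hz]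
      ring
    obtain ⟨n, hn⟩ := Complex.exp_eq_exp_iff_exists_int.1 h1
    refine ⟨n, ?_⟩
    rw [hn]
    have : (Real.pi * Complex.I : ℂ) ≠ 0 := by simp [Real.pi_ne_zero]
    field_simp
    ring
  let D : ℂ → ℝ := fun z => ((F (-z) - F z) / (Real.pi * Complex.I)).re
  have hD : Continuous D := by
    apply Complex.continuous_re.comp
    apply Continuous.div_const
    fun_prop
  have hDneg : ∀ z, D (-z) = - D z := by
    intro z
    simp only [D, neg_neg, ← Complex.neg_re]
    congr 1; ring
  have hpc : IsPreconnected (Metric.sphere (0:ℂ) 1) := by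
    apply isPreconnected_sphere
    simp [Complex.rank_real_complex]
  obtain ⟨n, hn⟩ := key 1 (by simp)
  have hD1 : D 1 = 2 * n + 1 := by
    simp only [D, hn]; simp
  have h1m : (1:ℂ) ∈ Metric.sphere (0:ℂ) 1 := by simp
  have h2m : (-1:ℂ) ∈ Metric.sphere (0:ℂ) 1 := by simp
  have hz : ∃ z ∈ Metric.sphere (0:ℂ) 1, D z = 0 := by
    rcases le_total 0 (D 1) with h | h
    · exact hpc.intermediate_value h2m h1m hD.continuousOn ⟨by rw [hDneg]; linarith, h⟩
    · exact hpc.intermediate_value h1m h2m hD.continuousOn ⟨h, by rw [hDneg]; linarith⟩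
  obtain ⟨z, hz, hz0⟩ := hz
  obtain ⟨m, hm⟩ := key z (by simpa using hz)
  have : D z = 2 * m + 1 := by simp only [D, hm]; simp
  rw [hz0] at this
  have h3 : (0:ℤ) = 2 * m + 1 := by exact_mod_cast this
  omega

theorem no_inj_ball (F : ℂ × ℝ → ℂ) (hF : ContinuousOn F {p | ‖p.1‖ ≤ 1 ∧ |p.2| ≤ 1})
    (hi : Set.InjOn F {p | ‖p.1‖ ≤ 1 ∧ |p.2| ≤ 1}) : False := by
  let q : ℂ → ℂ × ℝ := fun z => (z, √(1 - ‖z‖^2))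
  have hqc : Continuous q := by fun_prop
  have hqm : ∀ z ∈ Metric.closedBall (0:ℂ) 1, q z ∈ {p : ℂ × ℝ | ‖p.1‖ ≤ 1 ∧ |p.2| ≤ 1} := by
    intro z hz
    refine ⟨by simpa using hz, ?_⟩
    simp only [q]
    rw [abs_of_nonneg (Real.sqrt_nonneg _), Real.sqrt_le_one]
    nlinarith [sq_nonneg ‖z‖]
  have hqm' : ∀ z ∈ Metric.closedBall (0:ℂ) 1, - q z ∈ {p : ℂ × ℝ | ‖p.1‖ ≤ 1 ∧ |p.2| ≤ 1} := by
    intro z hz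
    simpa using hqm z hz
  apply no_odd_disk (fun z => F (q z) - F (- q z))
  · exact (hF.comp hqc.continuousOn hqm).sub (hF.comp hqc.neg.continuousOn hqm')
  · intro z hz h
    have h1 := hi (hqm z hz) (hqm' z hz) (sub_eq_zero.1 h)
    have h2 : q z = 0 := by
      have := self_eq_neg.1 h1
      exact this
    have h3 : z = 0 := congrArg Prod.fst h2
    have h4 : √(1 - ‖z‖^2) = 0 := congrArg Prod.snd h2
    rw [h3] at h4; simp at h4
  · intro z hz
    have h1 : q (-z) = - q z := by
      ext <;> simp [q, hz]
    simp only [h1, neg_neg, neg_sub]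

theorem no_cube {S : Type*} [TopologicalSpace S] [ChartedSpace (EuclideanSpace ℝ (Fin 2)) S]
    (σ : (Fin 3 → ℝ) → S) (hc : ContinuousOn σ (Set.Icc 0 1)) (hi : Set.InjOn σ (Set.Icc 0 1)) :
    False := by
  let x0 : Fin 3 → ℝ := fun _ => 1/2
  let ch := chartAt (EuclideanSpace ℝ (Fin 2)) (σ x0)
  have hx0 : Set.Icc (0 : Fin 3 → ℝ) 1 ∈ nhds x0 :=
    pi_Icc_mem_nhds (fun i => by norm_num [x0]) (fun i => by norm_num [x0])
  have hca : ContinuousAt σ x0 := hc.continuousAt hx0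
  have hsrc : σ ⁻¹' ch.source ∈ nhds x0 :=
    hca.preimage_mem_nhds (ch.open_source.mem_nhds (mem_chart_source _ _))
  obtain ⟨r, hr, hrs⟩ := Metric.mem_nhds_iff.1 (Filter.inter_mem hx0 hsrc)
  let P : ℂ × ℝ → (Fin 3 → ℝ) := fun p => x0 + (r/2) • ![p.1.re, p.1.im, p.2]
  have hPc : Continuous P := by
    apply Continuous.add continuous_const
    refine (continuous_const_smul (r/2)).comp ?_
    refine continuous_pi fun i => ?_
    fin_cases i
    · exact Complex.continuous_re.comp continuous_fst
    · exact Complex.continuous_im.comp continuous_fst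
    · exact continuous_snd
  have hPm : ∀ p ∈ {p : ℂ × ℝ | ‖p.1‖ ≤ 1 ∧ |p.2| ≤ 1}, P p ∈ Set.Icc 0 1 ∩ σ ⁻¹' ch.source := by
    rintro p ⟨h1, h2⟩
    apply hrs
    rw [Metric.mem_ball, dist_eq_norm, add_sub_cancel_left, norm_smul]
    have : ‖(![p.1.re, p.1.im, p.2] : Fin 3 → ℝ)‖ ≤ 1 := by
      rw [pi_norm_le_iff_of_nonneg zero_le_one]
      intro i; fin_cases i
      · exact (Complex.abs_re_le_norm _).trans h1
      · exact (Complex.abs_im_le_norm _).trans h1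
      · exact h2
    rw [Real.norm_of_nonneg (by positivity)]
    nlinarith
  have hPi : Function.Injective P := by
    intro p q h
    have h1 := add_left_cancel h
    have h2 := smul_right_injective (Fin 3 → ℝ) (by positivity : r/2 ≠ 0) h1
    have e0 := congrFun h2 0
    have e1 := congrFun h2 1
    have e2 := congrFun h2 2
    simp at e0 e1 e2
    exact Prod.ext (Complex.ext e0 e1) e2
  let toC : EuclideanSpace ℝ (Fin 2) → ℂ := fun v => ⟨v 0, v 1⟩
  have htoC : Continuous toC := by
    have : toC = fun v => ((v 0 : ℝ) : ℂ) + ((v 1 : ℝ) : ℂ) * Complex.I := by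
      funext v; simp [toC, Complex.ext_iff]
    rw [this]; fun_prop
  have htoCi : Function.Injective toC := by
    intro v w h
    ext i
    have := Complex.ext_iff.1 h
    fin_cases i
    · exact this.1
    · exact this.2
  apply no_inj_ball (fun p => toC (ch (σ (P p))))
  · apply htoC.comp_continuousOn
    apply ch.continuousOn.comp (hc.comp hPc.continuousOn fun p hp => (hPm p hp).1)
    exact fun p hp => (hPm p hp).2
  · intro p hp q hq h
    have h1 := htoCi h
    have h2 := ch.injOn (hPm p hp).2 (hPm q hq).2 h1
    exact hPi (hi (hPm p hp).1 (hPm q hq).1 h2)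

end DistalA
end

section
namespace DistalA

open Filter Topology NormedSpace
open scoped Matrix.Norms.L2Operator

/-- square real matrices -/
abbrev Mat (m : ℕ) := Matrix (Fin m) (Fin m) ℝ

/-- closed groups of orthogonal matrices -/
structure IsOGrp {m : ℕ} (L : Set (Mat m)) : Prop where
  one : 1 ∈ L
  mul : ∀ a ∈ L, ∀ b ∈ L, a * b ∈ L
  tr : ∀ a ∈ L, a.transpose ∈ L
  orth : ∀ a ∈ L, a * a.transpose = 1
  closed : IsClosed L

section
variable {m : ℕ} {L : Set (Mat m)}

theorem IsOGrp.orth' (h : IsOGrp L) {a : Mat m} (ha : a ∈ L) : a.transpose * a = 1 :=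
  mul_eq_one_comm.1 (h.orth a ha)

theorem IsOGrp.pow (h : IsOGrp L) {a : Mat m} (ha : a ∈ L) (n : ℕ) : a ^ n ∈ L := by
  induction n with
  | zero => simpa using h.one
  | succ n ih => rw [pow_succ]; exact h.mul _ ih _ ha

theorem mexp_cont : Continuous (exp : Mat m → Mat m) := by
  letI : NormedAlgebra ℚ (Mat m) := NormedAlgebra.restrictScalars ℚ ℝ _
  exact exp_continuous

theorem mexp_neg_mul (X : Mat m) : exp (-X) * exp X = 1 := by
  rw [← Matrix.exp_add_of_commute _ _ (Commute.neg_left (Commute.refl X))]; simp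

theorem mexp_mul_neg (X : Mat m) : exp X * exp (-X) = 1 := by
  rw [← Matrix.exp_add_of_commute _ _ (Commute.neg_right (Commute.refl X))]; simp

theorem IsOGrp.exp_neg (h : IsOGrp L) {X : Mat m} (hX : exp X ∈ L) : exp (-X) ∈ L := by
  have h1 := mexp_neg_mul X
  have : exp (-X) = (exp X).transpose := by
    calc exp (-X) = exp (-X) * (exp X * (exp X).transpose) := by rw [h.orth _ hX, mul_one]
      _ = _ := by rw [← mul_assoc, h1, one_mul]
  rw [this]; exact h.tr _ hX

theorem IsOGrp.key (h : IsOGrp L) {Z : ℕ → Mat m} {c : ℕ → ℝ} {W : Mat m}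
    (hZ : Tendsto Z atTop (𝓝 0)) (hc : ∀ k, 0 ≤ c k) (hZL : ∀ k, exp (Z k) ∈ L)
    (hW : Tendsto (fun k => c k • Z k) atTop (𝓝 W)) : exp W ∈ L := by
  have h1 : Tendsto (fun k => (c k - ⌊c k⌋₊) • Z k) atTop (𝓝 0) := by
    apply squeeze_zero_norm (a := fun k => ‖Z k‖)
    · intro k
      rw [norm_smul, Real.norm_of_nonneg (sub_nonneg.2 (Nat.floor_le (hc k)))]
      have := Nat.lt_floor_add_one (c k)
      nlinarith [norm_nonneg (Z k)]
    · simpa using hZ.norm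
  have h2 : Tendsto (fun k => ⌊c k⌋₊ • Z k) atTop (𝓝 W) := by
    have := hW.sub h1
    rw [sub_zero] at this
    refine this.congr fun k => ?_
    rw [← sub_smul, sub_sub_cancel, Nat.cast_smul_eq_nsmul]
  have h3 := (mexp_cont.tendsto W).comp h2
  refine h.closed.mem_of_tendsto h3 (Eventually.of_forall fun k => ?_)
  simp only [Function.comp]
  rw [Matrix.exp_nsmul]
  exact h.pow (hZL k) _

theorem IsOGrp.key' (h : IsOGrp L) {Z : ℕ → Mat m} {c : ℕ → ℝ} {W : Mat m}
    (hZ : Tendsto Z atTop (𝓝 0)) (hc : ∀ k, 0 ≤ c k) (hZL : ∀ k, exp (Z k) ∈ L)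
    (hW : Tendsto (fun k => c k • Z k) atTop (𝓝 W)) (t : ℝ) : exp (t • W) ∈ L := by
  have pos : ∀ t : ℝ, 0 ≤ t → exp (t • W) ∈ L := by
    intro t ht
    refine h.key (c := fun k => t * c k) hZ (fun k => mul_nonneg ht (hc k)) hZL ?_
    simpa [mul_smul] using hW.const_smul t
  rcases le_total 0 t with ht | ht
  · exact pos t ht
  · have := h.exp_neg (pos (-t) (by linarith))
    simpa using this

theorem mexp_deriv : HasStrictFDerivAt (exp : Mat m → Mat m) (1 : Mat m →L[ℝ] Mat m) 0 :=
  hasStrictFDerivAt_exp_zero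

/-- Lie algebra -/
def IsOGrp.lie (h : IsOGrp L) : Submodule ℝ (Mat m) where
  carrier := {Y | ∀ t : ℝ, exp (t • Y) ∈ L}
  zero_mem' := fun t => by simpa using h.one
  smul_mem' := fun c Y hY t => by rw [smul_smul]; exact hY _
  add_mem' := by
    intro Y Y' hY hY'
    have hd : HasStrictFDerivAt (exp : Mat m → Mat m)
      ((ContinuousLinearEquiv.refl ℝ (Mat m) : Mat m ≃L[ℝ] Mat m) : Mat m →L[ℝ] Mat m) 0 :=
      mexp_deriv
    have hl := hd.to_localInverse
    set lg := hd.localInverse _ _ _ with hlg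
    have hright : ∀ᶠ y in 𝓝 (exp (0 : Mat m)), exp (lg y) = y := hd.eventually_right_inverse
    have hlg1 : lg (exp 0) = 0 := hd.localInverse_apply_image
    rw [exp_zero] at hl hright hlg1
    -- curve
    have hc1 : ∀ Y : Mat m, HasDerivAt (fun t : ℝ => exp (t • Y)) Y 0 := by
      intro Y
      have := (hasDerivAt_exp_smul_const (𝕂 := ℝ) Y (0:ℝ))
      simpa using this
    have hcd : HasDerivAt (fun t : ℝ => exp (t • Y) * exp (t • Y')) (Y + Y') 0 := by
      have := (hc1 Y).mul (hc1 Y')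
      simp only [zero_smul, exp_zero, mul_one, one_mul] at this
      exact this
    have hz : HasDerivAt (fun t : ℝ => lg (exp (t • Y) * exp (t • Y'))) (Y + Y') 0 := by
      have hl' : HasFDerivAt lg (((ContinuousLinearEquiv.refl ℝ (Mat m) : Mat m ≃L[ℝ] Mat m)).symm :
        Mat m →L[ℝ] Mat m) (exp ((0:ℝ) • Y) * exp ((0:ℝ) • Y')) := by
        simpa using hl.hasFDerivAt
      have := hl'.comp_hasDerivAt (0:ℝ) hcd
      simpa using! this
    have hseq : Tendsto (fun k : ℕ => ((k:ℝ) + 1)⁻¹) atTop (𝓝 0) := by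
      simpa using tendsto_one_div_add_atTop_nhds_zero_nat (𝕜 := ℝ)
    have hseq' : Tendsto (fun k : ℕ => ((k:ℝ) + 1)⁻¹) atTop (𝓝[≠] 0) := by
      rw [tendsto_nhdsWithin_iff]
      refine ⟨hseq, Eventually.of_forall fun k => ?_⟩
      simp only [Set.mem_compl_iff, Set.mem_singleton_iff]
      positivity
    have hslope := (hasDerivAt_iff_tendsto_slope.1 hz).comp hseq'
    have hz0 : (fun t : ℝ => lg (exp (t • Y) * exp (t • Y'))) 0 = 0 := by simp [hlg1]
    have hzc : Tendsto (fun k : ℕ => lg (exp (((k:ℝ) + 1)⁻¹ • Y) * exp (((k:ℝ) + 1)⁻¹ • Y')))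
        atTop (𝓝 0) := by
      have := hz.continuousAt.tendsto.comp hseq
      have hz0' : lg (exp ((0:ℝ) • Y) * exp ((0:ℝ) • Y')) = 0 := hz0
      rw [hz0'] at this
      exact this
    have hev : ∀ᶠ k : ℕ in atTop,
        exp (lg (exp (((k:ℝ) + 1)⁻¹ • Y) * exp (((k:ℝ) + 1)⁻¹ • Y'))) =
          exp (((k:ℝ) + 1)⁻¹ • Y) * exp (((k:ℝ) + 1)⁻¹ • Y') := by
      have h0 : Tendsto (fun k : ℕ => exp (((k:ℝ) + 1)⁻¹ • Y) * exp (((k:ℝ) + 1)⁻¹ • Y')) atTop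
          (𝓝 1) := by
        have := hcd.continuousAt.tendsto.comp hseq
        simpa [Function.comp_def] using this
      exact h0.eventually hright
    obtain ⟨K, hK⟩ := eventually_atTop.1 hev
    refine fun t => h.key' (Z := fun k => lg (exp ((((k + K : ℕ):ℝ) + 1)⁻¹ • Y)
      * exp ((((k + K : ℕ):ℝ) + 1)⁻¹ • Y'))) (c := fun k => ((k + K : ℕ):ℝ) + 1) ?_ ?_ ?_ ?_ t
    · exact hzc.comp (tendsto_add_atTop_nat K)
    · intro k; positivity
    · intro k
      rw [hK (k + K) (by omega)]
      exact h.mul _ (hY _) _ (hY' _)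
    · have := hslope.comp (tendsto_add_atTop_nat K)
      refine this.congr fun k => ?_
      simp only [Function.comp, slope_def_module, hz0, sub_zero, inv_inv]

theorem IsOGrp.mem_lie (h : IsOGrp L) {Y : Mat m} : Y ∈ h.lie ↔ ∀ t : ℝ, exp (t • Y) ∈ L := Iff.rfl

theorem IsOGrp.exp_mem (h : IsOGrp L) {Y : Mat m} (hY : Y ∈ h.lie) : exp Y ∈ L := by
  simpa using hY 1

theorem IsOGrp.small (h : IsOGrp L) (M : Submodule ℝ (Mat m)) (hM : Disjoint h.lie M) :
    ∃ ε > 0, ∀ X ∈ M, ‖X‖ < ε → exp X ∈ L → X = 0 := by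
  by_contra hcon
  push Not at hcon
  have : ∀ k : ℕ, ∃ X ∈ M, ‖X‖ < 1 / ((k:ℝ) + 1) ∧ exp X ∈ L ∧ X ≠ 0 := fun k =>
    hcon _ (by positivity)
  choose X hXM hX hXL hX0 using this
  have hpos : ∀ k, 0 < ‖X k‖ := fun k => norm_pos_iff.2 (hX0 k)
  have hlim : Tendsto X atTop (𝓝 0) := squeeze_zero_norm (fun k => (hX k).le)
    tendsto_one_div_add_atTop_nhds_zero_nat
  have hsph : ∀ k, ‖X k‖⁻¹ • X k ∈ Metric.sphere (0 : Mat m) 1 := by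
    intro k; simp [norm_smul, (hpos k).ne']
  obtain ⟨W, hW, φ, hφ, hφW⟩ := (isCompact_sphere (0 : Mat m) 1).tendsto_subseq hsph
  have hWl : W ∈ h.lie := fun t => h.key' (Z := X ∘ φ) (c := fun k => ‖X (φ k)‖⁻¹)
    (hlim.comp hφ.tendsto_atTop) (fun k => by positivity) (fun k => hXL _) hφW t
  have hWM : W ∈ M := by
    have hcl : IsClosed (M : Set (Mat m)) := M.closed_of_finiteDimensional
    exact hcl.mem_of_tendsto hφW (Eventually.of_forall fun k => M.smul_mem _ (hXM _))
  have : W = 0 := Submodule.disjoint_def.1 hM W hWl hWM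
  rw [this] at hW; simp at hW

theorem IsOGrp.chart (h : IsOGrp L) (M : Submodule ℝ (Mat m)) (hM : IsCompl h.lie M) :
    ∃ Φ : OpenPartialHomeomorph (h.lie × M) (Mat m), (0, 0) ∈ Φ.source ∧
      (∀ p, Φ p = exp (p.1 : Mat m) * exp (p.2 : Mat m)) ∧
      ∀ p ∈ Φ.source, Φ p ∈ L → p.2 = 0 := by
  obtain ⟨ε, hε, hs⟩ := h.small M hM.disjoint
  let e : (h.lie × M) ≃L[ℝ] Mat m :=
    (Submodule.prodEquivOfIsCompl h.lie M hM).toContinuousLinearEquiv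
  let f : h.lie × M → Mat m := fun p => exp (p.1 : Mat m) * exp (p.2 : Mat m)
  have hf : HasStrictFDerivAt f (e : (h.lie × M) →L[ℝ] Mat m) 0 := by
    have h1 : HasStrictFDerivAt (fun p : h.lie × M => exp (p.1 : Mat m))
        ((1 : Mat m →L[ℝ] Mat m).comp (h.lie.subtypeL.comp (ContinuousLinearMap.fst ℝ h.lie M))) 0 := by
      apply HasStrictFDerivAt.comp (g := (exp : Mat m → Mat m))
      · simpa using mexp_deriv
      · exact (h.lie.subtypeL.comp (ContinuousLinearMap.fst ℝ h.lie M)).hasStrictFDerivAt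
    have h2 : HasStrictFDerivAt (fun p : h.lie × M => exp (p.2 : Mat m))
        ((1 : Mat m →L[ℝ] Mat m).comp (M.subtypeL.comp (ContinuousLinearMap.snd ℝ h.lie M))) 0 := by
      apply HasStrictFDerivAt.comp (g := (exp : Mat m → Mat m))
      · simpa using mexp_deriv
      · exact (M.subtypeL.comp (ContinuousLinearMap.snd ℝ h.lie M)).hasStrictFDerivAt
    have h3 := h1.mul' h2
    convert! h3 using 1
    ext p
    · simp [e]
    · simp [e]
  let Φ0 := hf.toOpenPartialHomeomorph f
  have hopen : IsOpen {p : h.lie × M | ‖(p.2 : Mat m)‖ < ε} :=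
    isOpen_lt (by fun_prop) continuous_const
  refine ⟨Φ0.restrOpen _ hopen, ?_, fun p => rfl, ?_⟩
  · refine ⟨hf.mem_toOpenPartialHomeomorph_source, ?_⟩
    simpa using hε
  · rintro p ⟨-, hp⟩ hpL
    have h1 : exp (p.1 : Mat m) * exp (p.2 : Mat m) ∈ L := hpL
    have h2 : exp (p.2 : Mat m) ∈ L := by
      have := h.mul _ (h.exp_neg (h.exp_mem p.1.2)) _ h1
      rwa [← mul_assoc, mexp_neg_mul, one_mul] at this
    exact Subtype.ext (hs _ p.2.2 hp h2)

theorem IsOGrp.retract (h : IsOGrp L) : ∃ (N : Set (Mat m)) (s : Mat m → Mat m), IsOpen N ∧ L ⊆ N ∧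
    ContinuousOn s N ∧ (∀ g ∈ N, s g ∈ L) ∧
    (∀ g ∈ N, ∀ l ∈ L, l * g ∈ N ∧ s (l * g) = l * s g) := by
  obtain ⟨M, hM⟩ := Submodule.exists_isCompl h.lie
  obtain ⟨Φ, h0, hΦ, hΦL⟩ := h.chart M hM
  have hexpc : Continuous fun X : M => exp (X : Mat m) := mexp_cont.comp continuous_subtype_val
  have hexpn : Continuous fun X : M => exp (-(X : Mat m)) :=
    mexp_cont.comp continuous_subtype_val.neg
  -- good radius
  have hev : ∀ᶠ q : M × M in 𝓝 (0, 0),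
      exp (q.2 : Mat m) * exp (-(q.1 : Mat m)) ∈ Φ.target ∧
      ((Φ.symm (exp (q.2 : Mat m) * exp (-(q.1 : Mat m)))).1, q.1) ∈ Φ.source ∧
      ((0 : h.lie), q.2) ∈ Φ.source := by
    have c1 : Continuous fun q : M × M => exp (q.2 : Mat m) * exp (-(q.1 : Mat m)) :=
      (hexpc.comp continuous_snd).mul (hexpn.comp continuous_fst)
    have e1 : exp (((0, 0) : M × M).2 : Mat m) * exp (-(((0, 0) : M × M).1 : Mat m)) = Φ (0, 0) := by
      rw [hΦ]; simp
    have t1 : ∀ᶠ q : M × M in 𝓝 (0, 0), exp (q.2 : Mat m) * exp (-(q.1 : Mat m)) ∈ Φ.target := by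
      apply c1.continuousAt.eventually_mem
      rw [e1]
      exact Φ.open_target.mem_nhds (Φ.map_source h0)
    have c2 : ContinuousAt (fun q : M × M =>
        ((Φ.symm (exp (q.2 : Mat m) * exp (-(q.1 : Mat m)))).1, q.1)) (0, 0) := by
      refine ContinuousAt.prodMk ?_ continuous_fst.continuousAt
      refine continuous_fst.continuousAt.comp ?_
      refine ContinuousAt.comp (g := Φ.symm) ?_ c1.continuousAt
      rw [e1]
      exact Φ.symm.continuousAt (Φ.map_source h0)
    have t2 := c2.eventually_mem (s := Φ.source) (by
      rw [e1, Φ.left_inv h0]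
      exact Φ.open_source.mem_nhds h0)
    have c3 : Continuous (fun q : M × M => ((0 : h.lie), q.2)) := by fun_prop
    have t3 := (c3.continuousAt (x := (0, 0))).eventually_mem (s := Φ.source)
      (Φ.open_source.mem_nhds h0)
    exact t1.and (t2.and t3)
  obtain ⟨ε, hε, hball⟩ := Metric.eventually_nhds_iff.1 hev
  let V : Set (h.lie × M) := Φ.source ∩ {p | ‖p.2‖ < ε}
  have hVo : IsOpen V := Φ.open_source.inter (isOpen_lt (by fun_prop) continuous_const)
  have hV0 : (0, 0) ∈ V := ⟨h0, by simpa using hε⟩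
  have uniq : ∀ l ∈ L, ∀ l' ∈ L, ∀ p ∈ V, ∀ p' ∈ V, l * Φ p = l' * Φ p' →
      l * exp (p.1 : Mat m) = l' * exp (p'.1 : Mat m) := by
    intro l hl l' hl' p hp p' hp' he
    rw [hΦ, hΦ] at he
    set k := exp (-(p'.1 : Mat m)) * (l'.transpose * (l * exp (p.1 : Mat m))) with hk
    have hkL : k ∈ L := h.mul _ (h.exp_neg (h.exp_mem p'.1.2)) _
      (h.mul _ (h.tr _ hl') _ (h.mul _ hl _ (h.exp_mem p.1.2)))
    have hk1 : k * exp (p.2 : Mat m) = exp (p'.2 : Mat m) := by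
      have : k * exp (p.2 : Mat m) = exp (-(p'.1 : Mat m)) * (l'.transpose *
          (l * (exp (p.1 : Mat m) * exp (p.2 : Mat m)))) := by
        simp only [hk, mul_assoc]
      rw [this, he, ← mul_assoc l'.transpose, h.orth' hl', one_mul, ← mul_assoc, mexp_neg_mul,
        one_mul]
    have hk2 : k = exp (p'.2 : Mat m) * exp (-(p.2 : Mat m)) := by
      rw [← hk1, mul_assoc, mexp_mul_neg, mul_one]
    obtain ⟨b1, b2, b3⟩ := @hball (p.2, p'.2) (by
      rw [dist_eq_norm, Prod.norm_def]
      simpa using ⟨hp.2, hp'.2⟩)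
    rw [← hk2] at b1 b2
    have hx0 : (Φ.symm k).2 = 0 := hΦL _ (Φ.map_target b1) (by rw [Φ.right_inv b1]; exact hkL)
    have hke : k = exp ((Φ.symm k).1 : Mat m) := by
      conv_lhs => rw [← Φ.right_inv b1, hΦ, hx0]
      simp
    have hinj := Φ.injOn b2 b3 (by
      rw [hΦ, hΦ]; simp only [← hke, hk1]; simp)
    have hy0 : (Φ.symm k).1 = 0 := congrArg Prod.fst hinj
    have hk3 : k = 1 := by rw [hke, hy0]; simp
    have : l' * (exp (p'.1 : Mat m) * k) = l * exp (p.1 : Mat m) := by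
      rw [hk, ← mul_assoc (exp _), mexp_mul_neg, one_mul, ← mul_assoc, h.orth _ hl', one_mul]
    rw [← this, hk3, mul_one]
  let N : Set (Mat m) := {g | ∃ l ∈ L, ∃ p ∈ V, g = l * Φ p}
  have hs : ∀ g : Mat m, ∃ k : Mat m, ∀ l ∈ L, ∀ p ∈ V, g = l * Φ p → k = l * exp (p.1 : Mat m) := by
    intro g
    by_cases hg : g ∈ N
    · obtain ⟨l, hl, p, hp, rfl⟩ := hg
      exact ⟨l * exp (p.1 : Mat m), fun l' hl' p' hp' he => uniq l hl l' hl' p hp p' hp' he⟩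
    · exact ⟨0, fun l hl p hp he => (hg ⟨l, hl, p, hp, he⟩).elim⟩
  choose s hs using hs
  have hnear : ∀ g0 ∈ N, ∃ l ∈ L, ∀ᶠ g in 𝓝 g0, l.transpose * g ∈ Φ.target ∧
      Φ.symm (l.transpose * g) ∈ V ∧ g = l * Φ (Φ.symm (l.transpose * g)) := by
    rintro g0 ⟨l, hl, p, hp, rfl⟩
    refine ⟨l, hl, ?_⟩
    have c : Continuous fun g : Mat m => l.transpose * g := continuous_const.mul continuous_id
    have e : l.transpose * (l * Φ p) = Φ p := by rw [← mul_assoc, h.orth' hl, one_mul]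
    have t1 := (c.continuousAt (x := l * Φ p)).eventually_mem (s := Φ.target) (by
      rw [e]; exact Φ.open_target.mem_nhds (Φ.map_source hp.1))
    have t2 : ∀ᶠ g in 𝓝 (l * Φ p), Φ.symm (l.transpose * g) ∈ V := by
      have c2 : ContinuousAt (fun g => Φ.symm (l.transpose * g)) (l * Φ p) := by
        refine ContinuousAt.comp (g := Φ.symm) ?_ c.continuousAt
        rw [e]; exact Φ.symm.continuousAt (Φ.map_source hp.1)
      apply c2.eventually_mem
      rw [e, Φ.left_inv hp.1]
      exact hVo.mem_nhds hp
    filter_upwards [t1, t2] with g g1 g2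
    refine ⟨g1, g2, ?_⟩
    rw [Φ.right_inv g1, ← mul_assoc, h.orth _ hl, one_mul]
  refine ⟨N, s, ?_, ?_, ?_, ?_, ?_⟩
  · rw [isOpen_iff_mem_nhds]
    intro g0 hg0
    obtain ⟨l, hl, hev⟩ := hnear g0 hg0
    filter_upwards [hev] with g hg
    exact ⟨l, hl, _, hg.2.1, hg.2.2⟩
  · intro l hl
    exact ⟨l, hl, (0, 0), hV0, by rw [hΦ]; simp⟩
  · intro g0 hg0
    apply ContinuousAt.continuousWithinAt
    obtain ⟨l, hl, hev⟩ := hnear g0 hg0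
    have c : Continuous fun g : Mat m => l.transpose * g := continuous_const.mul continuous_id
    have : ContinuousAt (fun g => l * exp (((Φ.symm (l.transpose * g)).1 : h.lie) : Mat m)) g0 := by
      apply ContinuousAt.mul continuousAt_const
      refine mexp_cont.continuousAt.comp ?_
      refine continuous_subtype_val.continuousAt.comp ?_
      refine continuous_fst.continuousAt.comp ?_
      refine ContinuousAt.comp (g := Φ.symm) ?_ c.continuousAt
      exact Φ.symm.continuousAt hev.self_of_nhds.1
    refine this.congr ?_
    filter_upwards [hev] with g hg
    exact (hs g l hl _ hg.2.1 hg.2.2).symm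
  · rintro g ⟨l, hl, p, hp, he⟩
    rw [hs g l hl p hp he]
    exact h.mul _ hl _ (h.exp_mem p.1.2)
  · rintro g ⟨l, hl, p, hp, he⟩ l' hl'
    have he' : l' * g = (l' * l) * Φ p := by rw [he, mul_assoc]
    refine ⟨⟨l' * l, h.mul _ hl' _ hl, p, hp, he'⟩, ?_⟩
    rw [hs g l hl p hp he, hs _ _ (h.mul _ hl' _ hl) p hp he', mul_assoc]

end

end DistalA
end

section
set_option linter.unusedSectionVars false

namespace DistalA

open Filter Topology Set

section Ellis
variable {Γ : Type*} [Group Γ] {S : Type*} [MetricSpace S] [CompactSpace S] [MulAction Γ S]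
  [ContinuousConstSMul Γ S]

variable (Γ S) in
/-- standing dynamical assumptions -/
structure DM : Prop where
  distal : ∀ x y : S, x ≠ y → ∃ ε > 0, ∀ g : Γ, ε ≤ dist (g • x) (g • y)
  minimal : ∀ x : S, Dense (range fun g : Γ => g • x)

variable (Γ S) in
/-- the Ellis semigroup -/
def El : Set (S → S) := closure (range fun (g : Γ) (x : S) => g • x)

variable (Γ S) in
theorem El_closed : IsClosed (El Γ S) := isClosed_closure

variable (Γ S) in
theorem El_compact : IsCompact (El Γ S) := (El_closed Γ S).isCompact

theorem El_smul (g : Γ) : (fun x : S => g • x) ∈ El Γ S := subset_closure ⟨g, rfl⟩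

theorem El_id : (id : S → S) ∈ El Γ S := by
  convert El_smul (S := S) (1 : Γ); simp

/-- invariance under the closure -/
theorem El_induct {q : S → S} (hq : q ∈ El Γ S) {C : Set (S → S)} (hC : IsClosed C)
    (h : ∀ g : Γ, (fun x : S => g • x) ∈ C) : q ∈ C :=
  closure_minimal (by rintro _ ⟨g, rfl⟩; exact h g) hC hq

theorem El_smul_comp (g : Γ) {q : S → S} (hq : q ∈ El Γ S) : (fun x => g • q x) ∈ El Γ S := by
  refine El_induct hq (C := (fun q : S → S => fun x => g • q x) ⁻¹' El Γ S) ?_ ?_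
  · exact (El_closed Γ S).preimage (by fun_prop)
  · intro h
    simpa [smul_smul] using El_smul (S := S) (g * h)

theorem El_comp {p q : S → S} (hp : p ∈ El Γ S) (hq : q ∈ El Γ S) : p ∘ q ∈ El Γ S := by
  refine El_induct hp (C := (fun p : S → S => p ∘ q) ⁻¹' El Γ S) ?_ ?_
  · exact (El_closed Γ S).preimage (by fun_prop)
  · intro g; exact El_smul_comp g hq

theorem El_rel {p : S → S} (hp : p ∈ El Γ S) {N : Set (S × S)} (hN : IsClosed N)
    (hinv : ∀ (g : Γ), ∀ z ∈ N, g • z ∈ N) {x y : S} (h : (x, y) ∈ N) : (p x, p y) ∈ N := by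
  refine El_induct hp (C := (fun p : S → S => (p x, p y)) ⁻¹' N) ?_ ?_
  · exact hN.preimage (by fun_prop)
  · intro g; exact hinv g _ h

theorem DM.inj (hD : DM Γ S) {p : S → S} (hp : p ∈ El Γ S) : Function.Injective p := by
  intro x y hxy
  by_contra hne
  obtain ⟨ε, hε, h⟩ := hD.distal x y hne
  have : p ∈ {p : S → S | ε ≤ dist (p x) (p y)} :=
    El_induct hp (isClosed_le continuous_const (by fun_prop)) h
  simp only [mem_ofPred_eq, hxy, dist_self] at this
  linarith

theorem DM.exists_inv (hD : DM Γ S) {p : S → S} (hp : p ∈ El Γ S) :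
    ∃ q ∈ El Γ S, (∀ x, q (p x) = x) ∧ (∀ x, p (q x) = x) := by
  let A : Set (S → S) := (fun q : S → S => q ∘ p) '' El Γ S
  have hA : IsCompact A := (El_compact Γ S).image (by fun_prop)
  have hAmul : ∀ a ∈ A, ∀ b ∈ A, a ∘ b ∈ A := by
    rintro _ ⟨a, ha, rfl⟩ _ ⟨b, hb, rfl⟩
    exact ⟨a ∘ p ∘ b, El_comp ha (El_comp hp hb), rfl⟩
  have hAE : ∀ a ∈ A, a ∈ El Γ S := by
    rintro _ ⟨a, ha, rfl⟩; exact El_comp ha hp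
  let sg : Semigroup A :=
    { mul := fun a b => ⟨a.1 ∘ b.1, hAmul _ a.2 _ b.2⟩
      mul_assoc := fun a b c => rfl }
  have : CompactSpace A := isCompact_iff_compactSpace.1 hA
  have : Nonempty A := ⟨⟨_, ⟨p, hp, rfl⟩⟩⟩
  obtain ⟨e, he⟩ := exists_idempotent_of_compact_t2_of_continuous_mul_left (M := A) (by
    intro r
    apply Continuous.subtype_mk
    exact continuous_pi fun x => (continuous_apply (r.1 x)).comp continuous_subtype_val)
  have he1 : ∀ x, e.1 (e.1 x) = e.1 x := fun x => congrFun (congrArg Subtype.val he) x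
  have he2 : ∀ x, e.1 x = x := fun x => hD.inj (hAE _ e.2) (he1 x)
  obtain ⟨q, hq, hqe⟩ := e.2
  have h1 : ∀ x, q (p x) = x := fun x => by
    rw [← he2 x]; exact (congrFun hqe _).trans (by rw [he2, he2])
  exact ⟨q, hq, h1, fun x => hD.inj hq (h1 _)⟩

theorem DM.trans (hD : DM Γ S) (x y : S) : ∃ p ∈ El Γ S, p x = y := by
  have hc : IsCompact ((fun p : S → S => p x) '' El Γ S) :=
    (El_compact Γ S).image (continuous_apply x)
  have : y ∈ closure (range fun g : Γ => g • x) := hD.minimal x y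
  exact closure_minimal (by rintro _ ⟨g, rfl⟩; exact ⟨_, El_smul g, rfl⟩) hc.isClosed this

theorem DM.openProj (hD : DM Γ S) {N : Set (S × S)} (hN : IsClosed N)
    (hinv : ∀ (g : Γ), ∀ z ∈ N, g • z ∈ N) {x y : S} (h : (x, y) ∈ N) {U : Set S} (hU : U ∈ 𝓝 y) :
    ∀ᶠ x' in 𝓝 x, ∃ y' ∈ U, (x', y') ∈ N := by
  by_contra hcon
  rw [not_eventually] at hcon
  choose P hPE hP using fun x' => hD.trans x x'
  have hne : (𝓝 x ⊓ 𝓟 {x' | ¬ ∃ y' ∈ U, (x', y') ∈ N}).NeBot := by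
    rwa [← frequently_mem_iff_neBot]
  obtain ⟨u, hu⟩ := @Ultrafilter.exists_le _ _ hne
  obtain ⟨p, hpE, hp⟩ := (El_compact Γ S).ultrafilter_le_nhds (u.map P) (by
    simp only [le_principal_iff, Ultrafilter.mem_coe, Ultrafilter.mem_map]
    exact Filter.univ_mem' hPE)
  have hux : (u : Filter S) ≤ 𝓝 x := hu.trans inf_le_left
  have hub : ∀ᶠ x' in (u : Filter S), ¬ ∃ y' ∈ U, (x', y') ∈ N :=
    le_principal_iff.1 (hu.trans inf_le_right)
  have hpt : Tendsto P u (𝓝 p) := hp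
  have hpx : p x = x := by
    have h1 : Tendsto (fun x' => P x' x) u (𝓝 (p x)) := ((continuous_apply x).tendsto p).comp hpt
    have h2 : Tendsto (fun x' => P x' x) u (𝓝 x) := by simpa [hP] using! hux
    exact tendsto_nhds_unique h1 h2
  obtain ⟨q, hqE, hqp, hpq⟩ := hD.exists_inv hpE
  have hqx : q x = x := by have := hqp x; rwa [hpx] at this
  have hN1 : (x, q y) ∈ N := by
    have := El_rel hqE hN hinv h
    rwa [hqx] at this
  have h3 : Tendsto (fun x' => P x' (q y)) u (𝓝 y) := by
    have := ((continuous_apply (q y)).tendsto p).comp hpt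
    rwa [hpq] at this
  obtain ⟨x', h4, h5⟩ := (hub.and (h3.eventually_mem hU)).exists
  apply h4
  refine ⟨_, h5, ?_⟩
  have := El_rel (hPE x') hN hinv hN1
  rwa [hP] at this

/-- closed invariant equivalence relations -/
structure IsCIE (Γ : Type*) [Group Γ] {S : Type*} [MetricSpace S] [MulAction Γ S]
    (r : Set (S × S)) : Prop where
  closed : IsClosed r
  inv : ∀ (g : Γ), ∀ z ∈ r, g • z ∈ r
  refl : ∀ x, (x, x) ∈ r
  symm : ∀ x y, (x, y) ∈ r → (y, x) ∈ r
  trans : ∀ x y z, (x, y) ∈ r → (y, z) ∈ r → (x, z) ∈ r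

variable (Γ) in
/-- points close at some time -/
def Oe (r : Set (S × S)) (ε : ℝ) : Set (S × S) :=
  {z | z ∈ r ∧ ∃ g : Γ, dist (g • z.1) (g • z.2) < ε}

variable (Γ) in
/-- relative regionally proximal relation -/
def Qe (r : Set (S × S)) : Set (S × S) := {z | ∀ ε > 0, z ∈ closure (Oe Γ r ε)}

theorem Oe_inv {r : Set (S × S)} (hr : IsCIE Γ r) {ε : ℝ} (g : Γ) {z : S × S} :
    g • z ∈ Oe Γ r ε ↔ z ∈ Oe Γ r ε := by
  have key : ∀ (g : Γ) (z : S × S), z ∈ Oe Γ r ε → g • z ∈ Oe Γ r ε := by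
    rintro g z ⟨hz, k, hk⟩
    exact ⟨hr.inv g z hz, k * g⁻¹, by simpa [mul_smul] using hk⟩
  refine ⟨fun h => ?_, key g z⟩
  simpa using key g⁻¹ _ h

theorem Oe_open {r : Set (S × S)} {ε : ℝ} {z : S × S} (hz : z ∈ Oe Γ r ε) :
    ∀ᶠ w in 𝓝 z, w ∈ r → w ∈ Oe Γ r ε := by
  obtain ⟨-, g, hg⟩ := hz
  have : Continuous fun w : S × S => dist (g • w.1) (g • w.2) := by fun_prop
  filter_upwards [(this.tendsto z).eventually (gt_mem_nhds hg)] with w hw hwr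
  exact ⟨hwr, g, hw⟩

theorem Qe_closed (r : Set (S × S)) : IsClosed (Qe Γ r) := by
  have : Qe Γ r = ⋂ ε : ℝ, ⋂ _ : 0 < ε, closure (Oe Γ r ε) := by
    ext; simp [Qe]
  rw [this]
  exact isClosed_iInter fun _ => isClosed_iInter fun _ => isClosed_closure

theorem Qe_sub {r : Set (S × S)} (hr : IsCIE Γ r) : Qe Γ r ⊆ r := by
  intro z hz
  exact closure_minimal (fun w hw => hw.1) hr.closed (hz 1 one_pos)

theorem Qe_inv {r : Set (S × S)} (hr : IsCIE Γ r) (g : Γ) (z) (hz : z ∈ Qe Γ r) :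
    g • z ∈ Qe Γ r := by
  intro ε hε
  have := hz ε hε
  have h2 : MapsTo (fun z : S × S => g • z) (Oe Γ r ε) (Oe Γ r ε) :=
    fun w hw => (Oe_inv hr g).2 hw
  exact h2.closure (continuous_const_smul g) this

/-- orbit closures in the square -/
def OC (Γ : Type*) [Group Γ] {S : Type*} [MetricSpace S] [MulAction Γ S] (z : S × S) :
    Set (S × S) := closure (range fun g : Γ => g • z)

theorem OC_inv (z : S × S) (g : Γ) (w) (hw : w ∈ OC Γ z) : g • w ∈ OC Γ z := by
  have h2 : MapsTo (fun z : S × S => g • z) (range fun g : Γ => g • z) (range fun g : Γ => g • z) := by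
    rintro _ ⟨k, rfl⟩; exact ⟨g * k, by simp [mul_smul]⟩
  exact h2.closure (continuous_const_smul g) hw

theorem OC_self (z : S × S) : z ∈ OC Γ z := subset_closure ⟨1, by simp⟩

theorem OC_sub {r : Set (S × S)} (hr : IsCIE Γ r) {z : S × S} (hz : z ∈ r) : OC Γ z ⊆ r :=
  closure_minimal (by rintro _ ⟨g, rfl⟩; exact hr.inv g _ hz) hr.closed

theorem DM.OC_min (hD : DM Γ S) {z w : S × S} (hw : w ∈ OC Γ z) : z ∈ OC Γ w := by
  have hc : IsCompact ((fun p : S → S => (p z.1, p z.2)) '' El Γ S) :=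
    (El_compact Γ S).image (by fun_prop)
  obtain ⟨p, hp, rfl⟩ := closure_minimal
    (by rintro _ ⟨g, rfl⟩; exact ⟨_, El_smul g, rfl⟩) hc.isClosed hw
  obtain ⟨q, hq, hqp, -⟩ := hD.exists_inv hp
  have := El_rel hq (N := OC Γ (p z.1, p z.2)) isClosed_closure (fun g w hw => OC_inv _ g w hw)
    (OC_self _)
  simpa [hqp] using this

theorem DM.OC_min' (hD : DM Γ S) {z w w' : S × S} (hw : w ∈ OC Γ z) (hw' : w' ∈ OC Γ z) :
    w' ∈ OC Γ w := by
  have h1 := hD.OC_min hw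
  refine closure_minimal ?_ isClosed_closure hw'
  rintro _ ⟨g, rfl⟩
  exact OC_inv _ g _ h1

/-- uniform visiting of `U` -/
theorem DM.visit (hD : DM Γ S) (z : S × S) {U : Set (S × S)} (hU : IsOpen U)
    (hUne : (U ∩ OC Γ z).Nonempty) {ε : ℝ} (hε : 0 < ε) :
    ∃ δ > 0, ∀ w ∈ OC Γ z, ∀ x y : S, (∃ g : Γ, dist (g • x) (g • y) < δ) →
      ∃ g : Γ, g • w ∈ U ∧ dist (g • x) (g • y) < ε := by
  obtain ⟨u, huU, hu⟩ := hUne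
  have hcomp : IsCompact (OC Γ z) := isClosed_closure.isCompact
  obtain ⟨t, ht⟩ := hcomp.elim_finite_subcover (fun g : Γ => (fun w : S × S => g • w) ⁻¹' U)
    (fun g => hU.preimage (continuous_const_smul g)) (by
      intro w hw
      have := hD.OC_min' hw hu
      obtain ⟨_, h1, ⟨g, rfl⟩⟩ := mem_closure_iff.1 this U hU huU
      exact mem_iUnion.2 ⟨g, h1⟩)
  have hδ : ∃ δ > 0, ∀ g ∈ t, ∀ x y : S, dist x y < δ → dist (g • x) (g • y) < ε := by
    have : ∀ g : Γ, ∃ δ > 0, ∀ x y : S, dist x y < δ → dist (g • x) (g • y) < ε := by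
      intro g
      have huc : UniformContinuous fun x : S => g • x :=
        CompactSpace.uniformContinuous_of_continuous (continuous_const_smul g)
      obtain ⟨δ, h1, h2⟩ := Metric.uniformContinuous_iff.1 huc ε hε
      exact ⟨δ, h1, fun x y h => h2 h⟩
    choose d hd hd2 using this
    by_cases htne : t.Nonempty
    · refine ⟨t.inf' htne d, (Finset.lt_inf'_iff _).2 fun g _ => hd g, fun g hg x y h => ?_⟩
      exact hd2 g x y (h.trans_le (Finset.inf'_le _ hg))
    · exact ⟨1, one_pos, fun g hg => (htne ⟨g, hg⟩).elim⟩
  obtain ⟨δ, hδ, hd⟩ := hδ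
  refine ⟨δ, hδ, ?_⟩
  rintro w hw x y ⟨g, hg⟩
  have := ht (OC_inv z g w hw)
  simp only [mem_iUnion, mem_preimage] at this
  obtain ⟨f, hf, hfU⟩ := this
  refine ⟨f * g, by simpa [mul_smul] using hfU, ?_⟩
  simpa [mul_smul] using hd f hf _ _ hg

/-- the generic lemma -/
theorem DM.generic (hD : DM Γ S) {r : Set (S × S)} (hr : IsCIE Γ r) (z0 : S × S) {G : Set (S × S)}
    (hG : IsOpen G) (hz0 : z0 ∈ G) :
    ∃ w ∈ G ∩ OC Γ z0, ∀ z : S, (w.2, z) ∈ Qe Γ r → ∀ V ∈ 𝓝 z, ∀ U ∈ 𝓝 w, ∀ ε > 0,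
      ∃ z' ∈ V, (w.2, z') ∈ r ∧ ∃ g : Γ, g • w ∈ U ∧ dist (g • z') (g • w.2) < ε := by
  classical
  let M : Set (S × S) := OC Γ z0
  have hMc : IsClosed M := isClosed_closure
  have : CompactSpace M := isCompact_iff_compactSpace.1 hMc.isCompact
  let BS := TopologicalSpace.countableBasis S
  let BU := TopologicalSpace.countableBasis (S × S)
  have hBS := TopologicalSpace.isBasis_countableBasis S
  have hBU := TopologicalSpace.isBasis_countableBasis (S × S)
  -- D V U n
  let D : BS × BU × ℕ → Set M := fun i => {w | ∃ z' ∈ (i.1 : Set S), (w.1.2, z') ∈ r ∧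
    ∃ g : Γ, g • w.1 ∈ (i.2.1 : Set (S × S)) ∧ dist (g • z') (g • w.1.2) < 1 / ((i.2.2 : ℝ) + 1)}
  have hDo : ∀ i, IsOpen (D i) := by
    rintro ⟨V, U, n⟩
    rw [isOpen_iff_mem_nhds]
    rintro w ⟨z', hz'V, hz'r, g, hgU, hg⟩
    have hVo : IsOpen (V : Set S) := hBS.isOpen V.2
    have hUo : IsOpen (U : Set (S × S)) := hBU.isOpen U.2
    have c1 : Continuous fun q : S × S => dist (g • q.1) (g • q.2) := by fun_prop
    have hn := (c1.tendsto (z', w.1.2)).eventually (gt_mem_nhds hg)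
    rw [nhds_prod_eq] at hn
    obtain ⟨A, hA, B, hB, hAB⟩ := Filter.eventually_prod_iff.1 hn
    have hop := hD.openProj hr.closed hr.inv hz'r (U := (V : Set S) ∩ {z | A z})
      (inter_mem (hVo.mem_nhds hz'V) hA)
    have c2 : Continuous fun w : M => w.1.2 := by fun_prop
    have c3 : Continuous fun w : M => g • w.1 := by fun_prop
    filter_upwards [(c2.tendsto w).eventually hop, (c2.tendsto w).eventually hB,
      (c3.tendsto w).eventually_mem (hUo.mem_nhds hgU)] with w' h1 h2 h3
    obtain ⟨y', ⟨hy1, hy2⟩, hy3⟩ := h1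
    exact ⟨y', hy1, hy3, g, h3, hAB hy2 h2⟩
  have hdense : ∀ i, Dense (D i ∪ (closure (D i))ᶜ) := by
    intro i w
    by_cases hw : w ∈ closure (D i)
    · exact closure_mono subset_union_left hw
    · exact subset_closure (Or.inr hw)
  have hBaire : Dense (⋂ i, (D i ∪ (closure (D i))ᶜ)) := by
    have : Countable BS := (TopologicalSpace.countable_countableBasis S).to_subtype
    have : Countable BU := (TopologicalSpace.countable_countableBasis (S × S)).to_subtype
    exact dense_iInter_of_isOpen (fun i => (hDo i).union isClosed_closure.isOpen_compl) hdense
  have hGM : IsOpen {w : M | w.1 ∈ G} := hG.preimage continuous_subtype_val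
  obtain ⟨w, hwG, hw⟩ := hBaire.exists_mem_open hGM ⟨⟨z0, OC_self z0⟩, hz0⟩
  refine ⟨w.1, ⟨hw, w.2⟩, ?_⟩
  intro z hz V hV U hU ε hε
  obtain ⟨V0, hV0B, hzV0, hV0V⟩ := hBS.mem_nhds_iff.1 hV
  obtain ⟨U0, hU0B, hwU0, hU0U⟩ := hBU.mem_nhds_iff.1 hU
  obtain ⟨n, hn⟩ := exists_nat_one_div_lt hε
  have h1 := mem_iInter.1 hwG (⟨V0, hV0B⟩, ⟨U0, hU0B⟩, n)
  have h2 : w ∈ closure (D (⟨V0, hV0B⟩, ⟨U0, hU0B⟩, n)) := by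
    rw [mem_closure_iff_nhds]
    intro A hA
    obtain ⟨A', hA', hAA⟩ := mem_nhds_subtype _ _ _ |>.1 hA
    obtain ⟨δ, hδ, hvis⟩ := hD.visit z0 (hBU.isOpen hU0B) ⟨w.1, hwU0, w.2⟩
      (ε := 1 / ((n : ℝ) + 1)) (by positivity)
    -- swap relation
    have hop := hD.openProj (N := Prod.swap ⁻¹' M) (hMc.preimage continuous_swap)
      (fun g z hz => OC_inv z0 g z.swap hz) (x := w.1.2) (y := w.1.1) (by simp [M]) (U := {a | ∀ᶠ b in 𝓝 w.1.2, (a, b) ∈ A'})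
      (by
        have : ∀ᶠ q in 𝓝 w.1, q ∈ A' := hA'
        rw [← Prod.mk.eta (p := w.1), nhds_prod_eq] at this
        exact this.curry)
    have hop2 : ∃ B ∈ 𝓝 w.1.1, ∃ C ∈ 𝓝 w.1.2, B ×ˢ C ⊆ A' := by
      have : A' ∈ 𝓝 (w.1.1, w.1.2) := hA'
      rwa [mem_nhds_prod_iff] at this
    obtain ⟨B, hB, C, hC, hBC⟩ := hop2
    have hop := hD.openProj (N := Prod.swap ⁻¹' M) (hMc.preimage continuous_swap)
      (fun g z hz => OC_inv z0 g z.swap hz) (x := w.1.2) (y := w.1.1) (by simp [M]) hB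
    have hcl := hz δ hδ
    have hnb : {q : S × S | (∃ y' ∈ B, (q.1, y') ∈ Prod.swap ⁻¹' M) ∧ q.1 ∈ C ∧ q.2 ∈ V0} ∈
        𝓝 (w.1.2, z) := by
      have a1 := (continuous_fst.tendsto (w.1.2, z)).eventually hop
      have a2 := (continuous_fst.tendsto (w.1.2, z)).eventually_mem hC
      have a3 := (continuous_snd.tendsto (w.1.2, z)).eventually_mem ((hBS.isOpen hV0B).mem_nhds hzV0)
      filter_upwards [a1, a2, a3] with q b1 b2 b3
      exact ⟨b1, b2, b3⟩
    obtain ⟨⟨b, z'⟩, ⟨⟨a, haB, haM⟩, hbC, hzV⟩, hbr, hbg⟩ := mem_closure_iff_nhds.1 hcl _ hnb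
    obtain ⟨g, hg1, hg2⟩ := hvis (a, b) haM b z' hbg
    exact ⟨⟨(a, b), haM⟩, hAA (hBC ⟨haB, hbC⟩), z', hzV, hbr, g, hg1, by rw [dist_comm]; exact hg2⟩
  have h3 : w ∈ D (⟨V0, hV0B⟩, ⟨U0, hU0B⟩, n) := by
    rcases h1 with h | h
    · exact h
    · exact (h h2).elim
  obtain ⟨z', hz'V, hz'r, g, hgU, hg⟩ := h3
  exact ⟨z', hV0V hz'V, hz'r, g, hU0U hgU, hg.trans hn⟩

theorem DM.Qe_cie (hD : DM Γ S) {r : Set (S × S)} (hr : IsCIE Γ r) : IsCIE Γ (Qe Γ r) where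
  closed := Qe_closed r
  inv := Qe_inv hr
  refl x ε hε := subset_closure ⟨hr.refl x, 1, by simpa using hε⟩
  symm x y h ε hε := by
    have h2 : MapsTo (Prod.swap : S × S → S × S) (Oe Γ r ε) (Oe Γ r ε) := by
      rintro w ⟨hw, g, hg⟩
      exact ⟨hr.symm _ _ hw, g, by rw [dist_comm]; exact hg⟩
    exact h2.closure continuous_swap (h ε hε)
  trans x y z hxy hyz ε hε := by
    rw [mem_closure_iff_nhds]
    intro A hA
    obtain ⟨X, hX, Z, hZ, hXZ⟩ := mem_nhds_prod_iff.1 hA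
    have hop := hD.openProj (Qe_closed r) (Qe_inv hr) hyz (interior_mem_nhds.2 hZ)
    obtain ⟨Y, hYs, hYo, hyY⟩ := eventually_nhds_iff.1 hop
    obtain ⟨⟨x1, y1⟩, ⟨hx1, hy1⟩, h1⟩ := mem_closure_iff_nhds.1 (hxy ε hε) (interior X ×ˢ Y)
      (prod_mem_nhds (interior_mem_nhds.2 hX) (hYo.mem_nhds hyY))
    obtain ⟨O, hOs, hOo, hO1⟩ := eventually_nhds_iff.1 (Oe_open h1)
    obtain ⟨⟨x2, y2⟩, ⟨⟨⟨hx2, hy2⟩, hO2⟩, h2M⟩, hgen⟩ := hD.generic hr (x1, y1)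
      (G := (interior X ×ˢ Y) ∩ O) ((isOpen_interior.prod hYo).inter hOo) ⟨⟨hx1, hy1⟩, hO1⟩
    have h2r : (x2, y2) ∈ r := OC_sub hr h1.1 h2M
    have h2O : (x2, y2) ∈ Oe Γ r ε := hOs _ hO2 h2r
    obtain ⟨z2, hz2, hyz2⟩ := hYs y2 hy2
    obtain ⟨B, hB, C, hC, hBC⟩ := mem_nhds_prod_iff.1 (Oe_open h2O)
    obtain ⟨η, hη, hηC⟩ := Metric.mem_nhds_iff.1 hC
    obtain ⟨z', hz'Z, hz'r, g, hgU, hg⟩ := hgen z2 hyz2 _ (isOpen_interior.mem_nhds hz2)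
      (B ×ˢ Metric.ball y2 (η/2)) (prod_mem_nhds hB (Metric.ball_mem_nhds _ (by positivity)))
      (η/2) (by positivity)
    have hxz' : (x2, z') ∈ r := hr.trans _ _ _ h2r hz'r
    have : (g • x2, g • z') ∈ Oe Γ r ε := by
      refine hBC (a := (g • x2, g • z')) ⟨hgU.1, hηC ?_⟩ (hr.inv g _ hxz')
      have h3 : dist (g • y2) y2 < η / 2 := hgU.2
      calc dist (g • z') y2 ≤ dist (g • z') (g • y2) + dist (g • y2) y2 := dist_triangle _ _ _
        _ < η := by
          have : dist (g • z') (g • y2) < η / 2 := hg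
          linarith
    have h4 : (x2, z') ∈ Oe Γ r ε := (Oe_inv hr g (z := (x2, z'))).1 this
    exact ⟨(x2, z'), hXZ ⟨interior_subset hx2, interior_subset hz'Z⟩, h4⟩

theorem DM.Qe_ne (hD : DM Γ S) {r : Set (S × S)} (hr : IsCIE Γ r) (h : r ⊆ Qe Γ r) :
    ∀ x y, (x, y) ∈ r → x = y := by
  have : CompactSpace r := isCompact_iff_compactSpace.1 hr.closed.isCompact
  let D : ℕ → Set r := fun n => {w | w.1 ∈ Oe Γ r (1 / ((n:ℝ) + 1))}
  have hDo : ∀ n, IsOpen (D n) := by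
    intro n
    rw [isOpen_iff_mem_nhds]
    intro w hw
    have := (continuous_subtype_val.tendsto w).eventually (Oe_open hw)
    filter_upwards [this] with w' hw'
    exact hw' w'.2
  have hDd : ∀ n, Dense (D n) := by
    intro n w
    rw [mem_closure_iff_nhds]
    intro A hA
    obtain ⟨A', hA', hAA⟩ := mem_nhds_subtype _ _ _ |>.1 hA
    obtain ⟨v, hv1, hv2⟩ := mem_closure_iff_nhds.1 (h w.2 (1 / ((n:ℝ) + 1)) (by positivity)) A' hA'
    exact ⟨⟨v, hv2.1⟩, hAA hv1, hv2⟩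
  have hB := dense_iInter_of_isOpen hDo hDd
  have hsub : (⋂ n, D n) ⊆ {w : r | w.1.1 = w.1.2} := by
    intro w hw
    by_contra hne
    obtain ⟨ε, hε, h2⟩ := hD.distal _ _ hne
    obtain ⟨n, hn⟩ := exists_nat_one_div_lt hε
    obtain ⟨-, g, hg⟩ := mem_iInter.1 hw n
    have := h2 g
    linarith
  have hcl : IsClosed {w : r | w.1.1 = w.1.2} := isClosed_eq (by fun_prop) (by fun_prop)
  intro x y hxy
  have := closure_minimal hsub hcl (hB ⟨(x, y), hxy⟩)
  exact this

/-- separating function -/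
theorem DM.exists_sep (hD : DM Γ S) {Q : Set (S × S)} (hQ : IsCIE Γ Q) {a b : S}
    (hab : (a, b) ∉ Q) : ∃ f : C(S, ℝ), (∀ x y, (x, y) ∈ Q → f x = f y) ∧ f a ≠ f b := by
  let s : Setoid S := ⟨fun x y => (x, y) ∈ Q, ⟨hQ.refl, hQ.symm _ _, hQ.trans _ _ _⟩⟩
  have hq : IsOpenQuotientMap (Quotient.mk s) := by
    refine ⟨Quotient.mk_surjective, continuous_quotient_mk', ?_⟩
    intro U hU
    rw [← isQuotientMap_quotient_mk'.isOpen_preimage, isOpen_iff_mem_nhds]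
    rintro x ⟨y, hy, hyx⟩
    have hyx' : (y, x) ∈ Q := Quotient.exact hyx
    filter_upwards [hD.openProj hQ.closed hQ.inv (hQ.symm _ _ hyx') (hU.mem_nhds hy)]
      with x' ⟨y', hy', hxy'⟩
    exact ⟨y', hy', Quotient.sound (hQ.symm _ _ hxy')⟩
  have ht2 : T2Space (Quotient s) := by
    rw [t2Space_iff_of_isOpenQuotientMap hq]
    convert hQ.closed using 1
    ext ⟨x, y⟩
    exact Quotient.eq (r := s)
  have hne : (Quotient.mk s a) ≠ Quotient.mk s b := fun h => hab (Quotient.exact h)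
  obtain ⟨f, hf0, hf1, -⟩ := exists_continuous_zero_one_of_isClosed
    (isClosed_singleton (x := Quotient.mk s a)) (isClosed_singleton (x := Quotient.mk s b))
    (by simpa using hne)
  refine ⟨⟨fun x => f (Quotient.mk s x), f.continuous.comp hq.continuous⟩, ?_, ?_⟩
  · intro x y h
    exact congrArg f (Quotient.sound h)
  · have h0 : f (Quotient.mk s a) = 0 := hf0 rfl
    have h1 : f (Quotient.mk s b) = 1 := hf1 rfl
    simp [h0, h1]

variable [TopologicalSpace Γ] [DiscreteTopology Γ]

/-- orbit function map -/
noncomputable def Psi (f : C(S, ℝ)) (x : S) : BoundedContinuousFunction Γ ℝ :=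
  BoundedContinuousFunction.mkOfDiscrete (fun g => f (g • x)) (2 * ‖f‖) fun g h => by
    rw [Real.dist_eq]
    have h1 := f.norm_coe_le_norm (g • x)
    have h2 := f.norm_coe_le_norm (h • x)
    calc _ ≤ ‖f (g • x)‖ + ‖f (h • x)‖ := norm_sub_le _ _
      _ ≤ _ := by linarith

theorem Psi_apply (f : C(S, ℝ)) (x : S) (g : Γ) : Psi f x g = f (g • x) := rfl

variable (Γ) in
/-- the pseudo metric -/
noncomputable def rho (f : C(S, ℝ)) (x y : S) : ℝ := dist (Psi (Γ := Γ) f x) (Psi f y)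

theorem rho_le (f : C(S, ℝ)) {x y : S} {c : ℝ} (hc : 0 ≤ c) :
    rho Γ f x y ≤ c ↔ ∀ g : Γ, dist (f (g • x)) (f (g • y)) ≤ c :=
  BoundedContinuousFunction.dist_le hc

theorem rho_smul (f : C(S, ℝ)) (g : Γ) (x y : S) : rho Γ f (g • x) (g • y) = rho Γ f x y := by
  have key : ∀ (g : Γ) (x y : S), rho Γ f (g • x) (g • y) ≤ rho Γ f x y := by
    intro g x y
    rw [rho_le f (show 0 ≤ rho Γ f x y from dist_nonneg)]
    intro h
    have := (rho_le (Γ := Γ) f (x := x) (y := y) (show 0 ≤ rho Γ f x y from dist_nonneg)).1 le_rfl (h * g)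
    simpa [mul_smul] using this
  refine le_antisymm (key g x y) ?_
  simpa using key g⁻¹ (g • x) (g • y)

theorem rho_OC_le (f : C(S, ℝ)) {z w : S × S} (hw : w ∈ OC Γ z) :
    rho Γ f w.1 w.2 ≤ rho Γ f z.1 z.2 := by
  have hcl : IsClosed {w : S × S | rho Γ f w.1 w.2 ≤ rho Γ f z.1 z.2} := by
    have : {w : S × S | rho Γ f w.1 w.2 ≤ rho Γ f z.1 z.2} =
      ⋂ g : Γ, {w | dist (f (g • w.1)) (f (g • w.2)) ≤ rho Γ f z.1 z.2} := by
      ext w; simp [rho_le f (show 0 ≤ rho Γ f z.1 z.2 from dist_nonneg)]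
    rw [this]
    exact isClosed_iInter fun g => isClosed_le (by fun_prop) continuous_const
  refine closure_minimal ?_ hcl hw
  rintro _ ⟨g, rfl⟩
  exact (rho_smul f g z.1 z.2).le

theorem DM.rho_OC (hD : DM Γ S) (f : C(S, ℝ)) {z w : S × S} (hw : w ∈ OC Γ z) :
    rho Γ f w.1 w.2 = rho Γ f z.1 z.2 :=
  le_antisymm (rho_OC_le f hw) (rho_OC_le f (hD.OC_min hw))

theorem rho_diag {r : Set (S × S)} (hr : IsCIE Γ r) (f : C(S, ℝ))
    (hf : ∀ x y, (x, y) ∈ Qe Γ r → f x = f y) {c : ℝ} (hc : 0 < c) :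
    ∃ δ > 0, ∀ x y, (x, y) ∈ r → dist x y < δ → rho Γ f x y ≤ c := by
  by_contra hcon
  push Not at hcon
  have : ∀ n : ℕ, ∃ z : S × S, z ∈ Oe Γ r (1 / ((n:ℝ) + 1)) ∧ c ≤ dist (f z.1) (f z.2) := by
    intro n
    obtain ⟨x, y, hxy, hd, hlt⟩ := hcon (1 / ((n:ℝ) + 1)) (by positivity)
    have := mt (rho_le (Γ := Γ) f (x := x) (y := y) hc.le).2 (not_le.2 hlt)
    push Not at this
    obtain ⟨g, hg⟩ := this
    exact ⟨g • (x, y), (Oe_inv hr g).2 ⟨hxy, 1, by simpa using hd⟩, hg.le⟩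
  choose z hz hzc using this
  obtain ⟨w, -, φ, hφ, hw⟩ := isCompact_univ.tendsto_subseq (fun n => mem_univ (z n))
  have hwQ : w ∈ Qe Γ r := by
    intro ε hε
    obtain ⟨n, hn⟩ := exists_nat_one_div_lt hε
    refine mem_closure_of_tendsto hw ?_
    filter_upwards [eventually_ge_atTop n] with k hk
    obtain ⟨h1, g, hg⟩ := hz (φ k)
    refine ⟨h1, g, hg.trans (lt_of_le_of_lt ?_ hn)⟩
    have : (n : ℝ) ≤ φ k := by exact_mod_cast hk.trans (hφ.id_le k)
    gcongr
  have h1 : Tendsto (fun k => dist (f (z (φ k)).1) (f (z (φ k)).2)) atTop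
      (𝓝 (dist (f w.1) (f w.2))) := by
    have c1 : Continuous fun q : S × S => dist (f q.1) (f q.2) := by fun_prop
    exact (c1.tendsto w).comp hw
  have h2 : c ≤ dist (f w.1) (f w.2) := ge_of_tendsto' h1 fun k => hzc _
  rw [hf w.1 w.2 hwQ, dist_self] at h2
  linarith

/-- Existence of relatively isometric functions. -/
theorem DM.exists_iso (hD : DM Γ S) {r : Set (S × S)} (hr : IsCIE Γ r)
    (hne : ∃ x y, (x, y) ∈ r ∧ x ≠ y) :
    ∃ f : C(S, ℝ), (∃ a b, (a, b) ∈ r ∧ f a ≠ f b) ∧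
      ContinuousOn (fun z : S × S => rho Γ f z.1 z.2) r := by
  have : ∃ z ∈ r, z ∉ Qe Γ r := by
    by_contra h
    push Not at h
    obtain ⟨x, y, hxy, hn⟩ := hne
    exact hn (hD.Qe_ne hr h x y hxy)
  obtain ⟨⟨a, b⟩, hab, habQ⟩ := this
  obtain ⟨f, hfQ, hfab⟩ := hD.exists_sep (hD.Qe_cie hr) habQ
  refine ⟨f, ⟨a, b, hab, hfab⟩, ?_⟩
  rintro ⟨x, y⟩ hxy
  rw [ContinuousWithinAt, Metric.tendsto_nhds]
  intro c hc
  obtain ⟨δ, hδ, hdiag⟩ := rho_diag hr f hfQ (half_pos hc)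
  have hop := hD.openProj (N := OC Γ (x, y)) isClosed_closure (fun g w hw => OC_inv _ g w hw)
    (OC_self _) (Metric.ball_mem_nhds y (half_pos hδ))
  have h1 : ∀ᶠ z : S × S in 𝓝 (x, y), ∃ y' ∈ Metric.ball y (δ/2), (z.1, y') ∈ OC Γ (x, y) :=
    (continuous_fst.tendsto (x, y)).eventually hop
  have h2 : ∀ᶠ z : S × S in 𝓝 (x, y), z.2 ∈ Metric.ball y (δ/2) :=
    (continuous_snd.tendsto (x, y)).eventually_mem (Metric.ball_mem_nhds y (half_pos hδ))
  filter_upwards [mem_nhdsWithin_of_mem_nhds h1, mem_nhdsWithin_of_mem_nhds h2,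
    self_mem_nhdsWithin] with z ⟨y', hy', hz1⟩ hz2 hzr
  have e1 : rho Γ f z.1 y' = rho Γ f x y := hD.rho_OC f hz1
  have hr' : (z.1, y') ∈ r := OC_sub hr hxy hz1
  have hyy : (z.2, y') ∈ r := hr.trans _ _ _ (hr.symm _ _ hzr) hr'
  have hdd : dist z.2 y' < δ := by
    calc dist z.2 y' ≤ dist z.2 y + dist y' y := dist_triangle_right _ _ _
      _ < δ := by
        have := Metric.mem_ball.1 hz2; have := Metric.mem_ball.1 hy'; linarith
  have h3 := hdiag _ _ hyy hdd
  simp only [← e1]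
  rw [Real.dist_eq]
  have h4 : |rho Γ f z.1 z.2 - rho Γ f z.1 y'| ≤ rho Γ f z.2 y' := by
    simp only [rho]
    rw [dist_comm (Psi f z.1) (Psi f z.2), dist_comm (Psi f z.1) (Psi f y')]
    exact abs_dist_sub_le _ _ _
  linarith

theorem rho_El {r : Set (S × S)} (hr : IsCIE Γ r) {f : C(S, ℝ)}
    (hf : ContinuousOn (fun z : S × S => rho Γ f z.1 z.2) r) {p : S → S} (hp : p ∈ El Γ S)
    {x y : S} (hxy : (x, y) ∈ r) : rho Γ f (p x) (p y) = rho Γ f x y := by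
  have hcl : IsClosed (r ∩ (fun z : S × S => rho Γ f z.1 z.2) ⁻¹' {rho Γ f x y}) :=
    hf.preimage_isClosed_of_isClosed hr.closed isClosed_singleton
  exact (El_rel hp hcl (fun g z hz => ⟨hr.inv g z hz.1, (rho_smul f g _ _).trans hz.2⟩)
    ⟨hxy, rfl⟩).2

end Ellis

end DistalA
end

section
set_option linter.unusedSectionVars false

namespace DistalA

open Filter Topology Set MeasureTheory

section Iso
variable {Y : Type*} [MetricSpace Y] [CompactSpace Y]

/-- pointwise topology on the isometry group -/
instance isoTop : TopologicalSpace (Y ≃ᵢ Y) :=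
  TopologicalSpace.induced (fun u : Y ≃ᵢ Y => ((u : Y → Y), (u.symm : Y → Y))) inferInstance

theorem iso_ind : IsInducing (fun u : Y ≃ᵢ Y => ((u : Y → Y), (u.symm : Y → Y))) := ⟨rfl⟩

theorem iso_emb : IsEmbedding (fun u : Y ≃ᵢ Y => ((u : Y → Y), (u.symm : Y → Y))) :=
  ⟨iso_ind, fun u v h => IsometryEquiv.ext fun x => congrFun (congrArg Prod.fst h) x⟩

theorem iso_range : range (fun u : Y ≃ᵢ Y => ((u : Y → Y), (u.symm : Y → Y))) =
    {w | ∀ x y, dist (w.1 x) y = dist x (w.2 y)} := by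
  ext ⟨u, v⟩
  constructor
  · rintro ⟨e, he⟩ x y
    obtain ⟨rfl, rfl⟩ := Prod.mk.inj he
    dsimp
    rw [← e.dist_eq x, e.apply_symm_apply]
  · intro h
    simp only [mem_ofPred_eq] at h
    have h1 : ∀ x, v (u x) = x := fun x => by
      have := h x (u x); rw [dist_self] at this; exact (dist_eq_zero.1 this.symm).symm
    have h2 : ∀ x, u (v x) = x := fun x => by
      have := h (v x) x; rw [dist_self] at this; exact (dist_eq_zero.1 this)
    refine ⟨⟨⟨u, v, h1, h2⟩, Isometry.of_dist_eq fun x y => ?_⟩, rfl⟩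
    show dist (u x) (u y) = _
    rw [h, h1]

instance : CompactSpace (Y ≃ᵢ Y) := by
  have : IsClosedEmbedding (fun u : Y ≃ᵢ Y => ((u : Y → Y), (u.symm : Y → Y))) := by
    refine ⟨iso_emb, ?_⟩
    rw [iso_range]
    simp only [setOf_forall]
    exact isClosed_iInter fun x => isClosed_iInter fun y => isClosed_eq (by fun_prop) (by fun_prop)
  exact this.compactSpace

instance : T2Space (Y ≃ᵢ Y) := iso_emb.t2Space

theorem iso_eval (y : Y) : Continuous fun u : Y ≃ᵢ Y => u y :=
  (continuous_apply y).comp (continuous_fst.comp iso_ind.continuous)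

theorem iso_eval' (y : Y) : Continuous fun u : Y ≃ᵢ Y => u.symm y :=
  (continuous_apply y).comp (continuous_snd.comp iso_ind.continuous)

theorem iso_mul_aux {X : Type*} [TopologicalSpace X] {a b : X → (Y ≃ᵢ Y)}
    (ha : ∀ y, Continuous fun x => a x y) (hb : ∀ y, Continuous fun x => b x y) (y : Y) :
    Continuous fun x => a x (b x y) := by
  rw [continuous_iff_continuousAt]
  intro x0
  rw [ContinuousAt, tendsto_iff_dist_tendsto_zero]
  have h1 : Tendsto (fun x => dist (b x y) (b x0 y) + dist (a x (b x0 y)) (a x0 (b x0 y)))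
      (𝓝 x0) (𝓝 (0 + 0)) :=
    (tendsto_iff_dist_tendsto_zero.1 ((hb y).tendsto x0)).add
      (tendsto_iff_dist_tendsto_zero.1 ((ha _).tendsto x0))
  rw [add_zero] at h1
  refine squeeze_zero (fun _ => dist_nonneg) (fun x => ?_) h1
  calc _ ≤ dist (a x (b x y)) (a x (b x0 y)) + dist (a x (b x0 y)) (a x0 (b x0 y)) :=
        dist_triangle _ _ _
    _ = _ := by rw [(a x).dist_eq]

instance : IsTopologicalGroup (Y ≃ᵢ Y) where
  continuous_mul := by
    rw [iso_ind.continuous_iff]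
    refine Continuous.prodMk (continuous_pi fun y => ?_) (continuous_pi fun y => ?_)
    · exact iso_mul_aux (a := fun w : (Y ≃ᵢ Y) × (Y ≃ᵢ Y) => w.1) (b := fun w => w.2)
        (fun y => (iso_eval y).comp continuous_fst) (fun y => (iso_eval y).comp continuous_snd) y
    · exact iso_mul_aux (a := fun w : (Y ≃ᵢ Y) × (Y ≃ᵢ Y) => w.2.symm) (b := fun w => w.1.symm)
        (fun y => (iso_eval' y).comp continuous_snd) (fun y => (iso_eval' y).comp continuous_fst) y
  continuous_inv := by
    rw [iso_ind.continuous_iff]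
    exact Continuous.prodMk (continuous_pi fun y => iso_eval' y) (continuous_pi fun y => iso_eval y)

theorem exists_inv_measure [MeasurableSpace Y] [BorelSpace Y]
    (hom : ∀ a b : Y, ∃ u : Y ≃ᵢ Y, u a = b) (y0 : Y) :
    ∃ l : Measure Y, IsProbabilityMeasure l ∧ l.IsOpenPosMeasure ∧
      ∀ u : Y ≃ᵢ Y, MeasurePreserving u l l := by
  letI : MeasurableSpace (Y ≃ᵢ Y) := borel _
  haveI : BorelSpace (Y ≃ᵢ Y) := ⟨rfl⟩
  let μ : Measure (Y ≃ᵢ Y) := Measure.haarMeasure ⊤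
  have hm : Measurable (fun u : Y ≃ᵢ Y => u y0) := (iso_eval y0).measurable
  have hμ : IsProbabilityMeasure μ := ⟨Measure.haarMeasure_self⟩
  have hinv : ∀ u : Y ≃ᵢ Y, MeasurePreserving u (μ.map (fun u : Y ≃ᵢ Y => u y0))
      (μ.map (fun u : Y ≃ᵢ Y => u y0)) := by
    intro u
    refine ⟨u.continuous.measurable, ?_⟩
    rw [Measure.map_map u.continuous.measurable hm]
    have : (u ∘ fun v : Y ≃ᵢ Y => v y0) = (fun v : Y ≃ᵢ Y => v y0) ∘ (fun v => u * v) := rfl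
    rw [this, ← Measure.map_map hm (by fun_prop), map_mul_left_eq_self]
  refine ⟨μ.map (fun u : Y ≃ᵢ Y => u y0), Measure.isProbabilityMeasure_map hm.aemeasurable,
    ⟨fun U hU hUne => ?_⟩, hinv⟩
  rw [Measure.map_apply hm hU.measurableSet]
  obtain ⟨y, hy⟩ := hUne
  obtain ⟨u, hu⟩ := hom y0 y
  exact (hU.preimage (iso_eval y0)).measure_ne_zero μ ⟨u, by simpa [hu] using hy⟩

end Iso

end DistalA
end

section
set_option linter.all false

namespace DistalA

open Filter Topology Set MeasureTheory

section Spec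
variable {Y : Type*} [MetricSpace Y] [CompactSpace Y]

theorem lip_compact (M : ℝ) : IsCompact {h : C(Y, ℝ) | (∀ x, h x ∈ Icc (-M) M) ∧
    ∀ x y, |h x - h y| ≤ M * dist x y} := by
  apply ArzelaAscoli.isCompact_of_equicontinuous
  · have : ContinuousMap.toFun '' {h : C(Y, ℝ) | (∀ x, h x ∈ Icc (-M) M) ∧
        ∀ x y, |h x - h y| ≤ M * dist x y} = (Set.univ.pi fun _ => Icc (-M) M) ∩
        {h : Y → ℝ | ∀ x y, |h x - h y| ≤ M * dist x y} := by
      ext h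
      constructor
      · rintro ⟨g, ⟨h1, h2⟩, rfl⟩
        exact ⟨fun x _ => h1 x, h2⟩
      · rintro ⟨h1, h2⟩
        refine ⟨⟨h, ?_⟩, ⟨fun x => h1 x trivial, h2⟩, rfl⟩
        have : LipschitzWith (Real.toNNReal M) h := LipschitzWith.of_dist_le_mul fun x y => by
          rw [Real.dist_eq]
          refine (h2 x y).trans ?_
          gcongr
          exact Real.le_coe_toNNReal M
        exact this.continuous
    rw [this]
    refine (isCompact_univ_pi fun _ => isCompact_Icc).inter_right ?_
    simp only [ofPred_forall]
    exact isClosed_iInter fun x => isClosed_iInter fun y =>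
      isClosed_le (by fun_prop) continuous_const
  · refine Metric.equicontinuous_of_continuity_modulus (fun t => M * t) ?_ _ ?_
    · have : Continuous fun t : ℝ => M * t := by fun_prop
      simpa using this.tendsto 0
    · rintro x y ⟨h, h1, h2⟩
      exact h2 x y

theorem iso_package (hom : ∀ a b : Y, ∃ u : Y ≃ᵢ Y, u a = b) (hne : ∃ a b : Y, a ≠ b) :
    ∃ (I : C(Y, ℝ) →ₗ[ℝ] ℝ) (m : ℕ) (f : Fin m → C(Y, ℝ)), Continuous I ∧
      (∀ (u : Y ≃ᵢ Y) (g : C(Y, ℝ)), I (g.comp ⟨u, u.continuous⟩) = I g) ∧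
      (∀ i j, I (f i * f j) = if i = j then 1 else 0) ∧
      (∀ (u : Y ≃ᵢ Y) i, (f i).comp ⟨u, u.continuous⟩ =
        ∑ j, I ((f i).comp ⟨u, u.continuous⟩ * f j) • f j) ∧
      ∃ i a b, f i a ≠ f i b := by
  obtain ⟨y0, y1, hy⟩ := hne
  let _ : MeasurableSpace Y := borel Y
  have _ : BorelSpace Y := ⟨rfl⟩
  obtain ⟨l, hl1, hl2, hl3⟩ := exists_inv_measure hom y0
  have hintegr : ∀ g : Y → ℝ, Continuous g → Integrable g l := fun g hg =>
    hg.integrable_of_hasCompactSupport (HasCompactSupport.of_compactSpace _)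
  have hinv : ∀ (u : Y ≃ᵢ Y) (g : Y → ℝ), ∫ y, g (u y) ∂l = ∫ y, g y ∂l := fun u g =>
    (hl3 u).integral_comp u.toHomeomorph.measurableEmbedding g
  let κ : ℝ := ∫ y, dist y0 y ∂l
  have hκ : ∀ x, ∫ y, dist x y ∂l = κ := by
    intro x
    obtain ⟨u, rfl⟩ := hom y0 x
    rw [← hinv u]
    simp [κ, u.dist_eq]
  let k : Y → Y → ℝ := fun x y => dist x y - κ
  have hk : Continuous fun z : Y × Y => k z.1 z.2 := by fun_prop
  have hksymm : ∀ x y, k x y = k y x := fun x y => by simp [k, dist_comm]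
  have hk0 : ∀ x, ∫ y, k x y ∂l = 0 := by
    intro x
    simp only [k]
    rw [integral_sub (hintegr _ (by fun_prop)) (hintegr _ (by fun_prop)), hκ]
    simp
  let kc : Y → C(Y, ℝ) := fun x => ⟨fun y => k x y, by fun_prop⟩
  have hkc : ∀ x x', ‖kc x - kc x'‖ ≤ dist x x' := by
    intro x x'
    rw [ContinuousMap.norm_le _ dist_nonneg]
    intro y
    simp only [kc, k, ContinuousMap.sub_apply, ContinuousMap.coe_mk, Real.norm_eq_abs]
    have := abs_dist_sub_le x x' y
    simpa using this
  let J : C(Y, ℝ) →L[ℝ] Lp ℝ 2 l := ContinuousMap.toLp 2 l ℝ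
  have hJinj : Function.Injective J := ContinuousMap.toLp_injective l
  have hJin : ∀ a b : C(Y, ℝ), inner ℝ (J a) (J b) = ∫ x, a x * b x ∂l := by
    intro a b
    rw [ContinuousMap.inner_toLp]
    simp [mul_comm]
  have hJn : ∀ a, ‖J a‖ ≤ ‖J‖ * ‖a‖ := fun a => J.le_opNorm a
  let K : Y → Lp ℝ 2 l := fun x => J (kc x)
  obtain ⟨M, hM0, hM1, hM2⟩ : ∃ M : ℝ, 0 ≤ M ∧ ‖J‖ ≤ M ∧ ∀ x, ‖K x‖ ≤ M := by
    refine ⟨‖J‖ + ‖J‖ * (‖kc y0‖ + Metric.diam (univ : Set Y)), by positivity,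
      le_add_of_nonneg_right (by positivity), fun x => ?_⟩
    have h1 : ‖kc x‖ ≤ ‖kc y0‖ + Metric.diam (univ : Set Y) := by
      have h2 := hkc x y0
      have h3 : dist x y0 ≤ Metric.diam (univ : Set Y) :=
        Metric.dist_le_diam_of_mem isCompact_univ.isBounded trivial trivial
      have h4 := norm_le_norm_add_norm_sub' (kc x) (kc y0)
      linarith
    calc ‖K x‖ ≤ ‖J‖ * ‖kc x‖ := hJn _
      _ ≤ ‖J‖ * (‖kc y0‖ + Metric.diam (univ : Set Y)) := by gcongr
      _ ≤ _ := le_add_of_nonneg_left (norm_nonneg J)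
  have hKl : ∀ x x', ‖K x - K x'‖ ≤ M * dist x x' := by
    intro x x'
    simp only [K]
    rw [← map_sub]
    exact (hJn _).trans (mul_le_mul hM1 (hkc x x') (norm_nonneg _) hM0)
  have hKc : Continuous K := by
    have : LipschitzWith (Real.toNNReal M) K := LipschitzWith.of_dist_le_mul fun x y => by
      rw [dist_eq_norm]
      refine (hKl x y).trans ?_
      gcongr
      exact Real.le_coe_toNNReal M
    exact this.continuous
  let A : Lp ℝ 2 l →L[ℝ] C(Y, ℝ) := LinearMap.mkContinuous
    { toFun := fun g => ⟨fun x => inner ℝ (K x) g, by fun_prop⟩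
      map_add' := fun a b => by ext x; simp [inner_add_right]
      map_smul' := fun c a => by ext x; simp [inner_smul_right] } M (by
      intro g
      rw [ContinuousMap.norm_le _ (by positivity)]
      intro x
      simp only [LinearMap.coe_mk, AddHom.coe_mk, ContinuousMap.coe_mk]
      exact (norm_inner_le_norm _ _).trans (by gcongr; exact hM2 x))
  have hA : ∀ g x, A g x = inner ℝ (K x) g := fun g x => rfl
  have hAJ : ∀ (g : C(Y, ℝ)) x, A (J g) x = ∫ y, k x y * g y ∂l := fun g x => by
    rw [hA]; simp only [K]; rw [hJin]; rfl
  have swap : ∀ a b : C(Y, ℝ), ∫ x, A (J a) x * b x ∂l = ∫ y, a y * A (J b) y ∂l := by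
    intro a b
    simp only [hAJ, ← integral_mul_const, ← integral_const_mul]
    rw [integral_integral_swap_of_hasCompactSupport
      (f := fun x y => k x y * a y * b x) (by
        show Continuous fun z : Y × Y => k z.1 z.2 * a z.2 * b z.1
        fun_prop) (HasCompactSupport.of_compactSpace _)]
    congr 1; ext y; congr 1; ext x
    rw [hksymm]; ring
  let T : Lp ℝ 2 l →L[ℝ] Lp ℝ 2 l := J ∘L A
  have hTc : IsCompactOperator T := by
    have : IsCompactOperator A := by
      refine (isCompactOperator_iff_image_closedBall_subset_compact (A.toLinearMap) (r := 1)
        (by norm_num)).2 ?_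
      refine ⟨_, lip_compact (Y := Y) M, ?_⟩
      rintro _ ⟨g, hg, rfl⟩
      rw [mem_closedBall_zero_iff] at hg
      constructor
      · intro x
        rw [mem_Icc, ← abs_le]
        show |inner ℝ (K x) g| ≤ M
        refine (abs_real_inner_le_norm _ _).trans ?_
        calc _ ≤ M * 1 := mul_le_mul (hM2 x) hg (norm_nonneg _) hM0
          _ = M := mul_one M
      · intro x y
        show |inner ℝ (K x) g - inner ℝ (K y) g| ≤ _
        rw [← inner_sub_left]
        refine (abs_real_inner_le_norm _ _).trans ?_
        calc _ ≤ (M * dist x y) * 1 := mul_le_mul (hKl x y) hg (norm_nonneg _) (by positivity)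
          _ = _ := mul_one _
    exact this.clm_comp J
  have hTs : T.IsSymmetric := by
    have hd : DenseRange J := ContinuousMap.toLp_denseRange ℝ l ℝ (by norm_num)
    intro a b
    show inner ℝ (T a) b = inner ℝ a (T b)
    refine hd.induction_on₂ (p := fun a b => inner ℝ (T a) b = inner ℝ a (T b))
      (isClosed_eq (by fun_prop) (by fun_prop)) ?_ a b
    intro a b
    show inner ℝ (J (A (J a))) (J b) = inner ℝ (J a) (J (A (J b)))
    rw [hJin, hJin, swap]
  have hT0 : T ≠ 0 := by
    intro h0
    have h1 : J (A (J (kc y0))) = 0 := by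
      show T (J (kc y0)) = 0
      rw [h0]; rfl
    have h2 : A (J (kc y0)) = 0 := hJinj (by rw [h1, map_zero])
    have h3 : inner ℝ (K y0) (K y0) = 0 := by
      rw [← hA (K y0) y0]; simp only [K]; rw [h2]; rfl
    have h4 : kc y0 = 0 := hJinj (by rw [map_zero]; exact inner_self_eq_zero.1 h3)
    have h5 : k y0 y0 = 0 := DFunLike.congr_fun h4 y0
    have h6 : k y0 y1 = 0 := DFunLike.congr_fun h4 y1
    simp only [k, dist_self] at h5 h6
    exact hy (dist_eq_zero.1 (by linarith))
  obtain ⟨μ, hμe, hμ0⟩ : ∃ μ, Module.End.HasEigenvalue (T : Module.End ℝ (Lp ℝ 2 l)) μ ∧ μ ≠ 0 := by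
    by_contra hcon
    push Not at hcon
    exact hT0 ((ContinuousLinearMap.eq_zero_of_forall_hasEigenvalue_eq_zero hTc hTs).1 hcon)
  obtain ⟨g, hg⟩ := hμe.exists_hasEigenvector
  have hg1 : J (A g) = μ • g := hg.apply_eq_smul
  let W : Submodule ℝ C(Y, ℝ) := LinearMap.ker ((A ∘L J : C(Y, ℝ) →L[ℝ] C(Y, ℝ)).toLinearMap
    - μ • LinearMap.id)
  have hW : ∀ w, w ∈ W ↔ A (J w) = μ • w := by
    intro w
    rw [LinearMap.mem_ker]
    simp [sub_eq_zero]
  have hw0 : A g ∈ W := by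
    rw [hW, hg1, map_smul]
  have hw0' : A g ≠ 0 := by
    intro h
    rw [h, map_zero] at hg1
    exact (smul_ne_zero hμ0 hg.2) hg1.symm
  have hWfd : FiniteDimensional ℝ (W.map J.toLinearMap) := by
    have h1 := ContinuousLinearMap.finite_dimensional_eigenspace hTc μ hμ0
    refine Submodule.finiteDimensional_of_le (S₂ := Module.End.eigenspace T.toLinearMap μ) ?_
    rintro _ ⟨w, hw, rfl⟩
    rw [Module.End.mem_eigenspace_iff]
    show J (A (J w)) = μ • J w
    rw [(hW w).1 hw, map_smul]
  have hinvW : ∀ (u : Y ≃ᵢ Y), ∀ w ∈ W, w.comp ⟨u, u.continuous⟩ ∈ W := by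
    intro u w hw
    rw [hW] at hw ⊢
    ext x
    rw [hAJ]
    have h1 := DFunLike.congr_fun hw (u x)
    rw [hAJ, ← hinv u] at h1
    simp only [k, u.dist_eq] at h1
    simpa [k] using h1
  let b := stdOrthonormalBasis ℝ (W.map J.toLinearMap)
  have hb : ∀ i, ∃ w ∈ W, J w = b i := fun i => (b i).2
  choose f hfW hfb using hb
  let I : C(Y, ℝ) →ₗ[ℝ] ℝ :=
    { toFun := fun a => ∫ x, a x ∂l
      map_add' := fun a c => integral_add (hintegr _ a.continuous) (hintegr _ c.continuous)
      map_smul' := fun c a => by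
        simp only [ContinuousMap.smul_apply]
        exact integral_smul c _ }
  have hI : ∀ a, I a = ∫ x, a x ∂l := fun a => rfl
  have hexp : ∀ w ∈ W, w = ∑ j, I (w * f j) • f j := by
    intro w hw
    apply hJinj
    have h1 := b.sum_repr' ⟨J w, ⟨w, hw, rfl⟩⟩
    have h2 := congrArg Subtype.val h1
    rw [map_sum]
    simp only [map_smul]
    rw [← show _ = J w from h2]
    push_cast
    refine Finset.sum_congr rfl fun i _ => ?_
    rw [hfb]
    congr 1
    have : inner ℝ (b i) (⟨J w, ⟨w, hw, rfl⟩⟩ : W.map J.toLinearMap) = inner ℝ (J (f i)) (J w) := by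
      rw [hfb]; rfl
    rw [this, hJin, hI]
    simp [mul_comm]
  have hon : ∀ i j, I (f i * f j) = if i = j then 1 else 0 := by
    intro i j
    have : I (f i * f j) = inner ℝ (J (f i)) (J (f j)) := (hJin _ _).symm
    rw [this, hfb, hfb]
    exact (orthonormal_iff_ite.1 b.orthonormal) i j
  refine ⟨I, _, f, ?_, fun u a => ?_, hon, fun u i => hexp _ (hinvW u _ (hfW i)), ?_⟩
  · refine AddMonoidHomClass.continuous_of_bound I 1 fun a => ?_
    rw [one_mul]
    have := norm_integral_le_of_norm_le_const (μ := l) (f := a) (C := ‖a‖)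
      (Eventually.of_forall fun x => a.norm_coe_le_norm x)
    simpa using! this
  · exact hinv u a
  · by_contra hcon
    push Not at hcon
    have hmean : ∀ w ∈ W, I w = 0 := by
      intro w hw
      have h1 := swap w 1
      have h2 : ∀ y, A (J 1) y = 0 := fun y => by rw [hAJ]; simpa using hk0 y
      rw [(hW w).1 hw] at h1
      simp only [h2, mul_zero, integral_zero] at h1
      simp [integral_const_mul, hμ0] at h1
      exact h1
    have hz : ∀ i, f i = 0 := by
      intro i
      have h1 := hmean _ (hfW i)
      rw [hI] at h1
      ext y
      have h2 : ∀ x, f i x = f i y := fun x => hcon i x y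
      simp only [h2] at h1
      simpa using h1
    apply hw0'
    rw [hexp _ hw0]
    simp [hz]

end Spec

end DistalA
end

section
set_option linter.all false

namespace DistalA

open Filter Topology Set
open scoped Matrix.Norms.L2Operator Matrix

section Step
variable {Γ : Type*} [Group Γ] {S : Type*} [MetricSpace S] [CompactSpace S] [MulAction Γ S]
  [ContinuousConstSMul Γ S]

variable (Γ) in
/-- the stabilizer of the class of `x0` in the Ellis group -/
def GE (r : Set (S × S)) (x0 : S) : Set (S → S) := {q | q ∈ El Γ S ∧ (q x0, x0) ∈ r}

variable (Γ) in
/-- an isometric step below `r` -/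
structure Step (r : Set (S × S)) (x0 : S) (m : ℕ) (F : S → Fin m → ℝ) (τ : (S → S) → Mat m)
    (L : Set (Mat m)) : Prop where
  grp : IsOGrp L
  img : L = τ '' GE Γ r x0
  equi : ∀ q ∈ GE Γ r x0, ∀ a, (x0, a) ∈ r → F (q a) = τ q *ᵥ F a
  mul : ∀ q ∈ GE Γ r x0, ∀ q' ∈ GE Γ r x0, τ (q ∘ q') = τ q * τ q'
  closedF : IsClosed {w : (S → S) × S × (Fin m → ℝ) | w.1 ∈ El Γ S ∧
    ∃ a, (x0, a) ∈ r ∧ w.1 a = w.2.1 ∧ F a = w.2.2}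
  bdd : ∃ C, ∀ a, (x0, a) ∈ r → ‖F a‖ ≤ C
  nontriv : ∃ a b, (x0, a) ∈ r ∧ (x0, b) ∈ r ∧ F a ≠ F b
  span : ∀ w : Fin m → ℝ, (∀ a, (x0, a) ∈ r → w ⬝ᵥ F a = 0) → w = 0
  triv : ∀ p0 ∈ El Γ S, ∃ A : (S → S) → Mat m, ContinuousOn A (El Γ S) ∧ A p0 = 1 ∧
    ∀ p ∈ El Γ S, ∀ q ∈ GE Γ r x0, A (p ∘ q) = (τ q)ᵀ * A p
  cont : ContinuousOn τ (GE Γ r x0)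

theorem GE_rel {r : Set (S × S)} (hr : IsCIE Γ r) {x0 : S} {q : S → S} (hq : q ∈ GE Γ r x0)
    {a : S} (ha : (x0, a) ∈ r) : (x0, q a) ∈ r :=
  hr.trans _ _ _ (hr.symm _ _ hq.2) (El_rel hq.1 hr.closed hr.inv ha)

theorem GE_comp {r : Set (S × S)} (hr : IsCIE Γ r) {x0 : S} {q q' : S → S} (hq : q ∈ GE Γ r x0)
    (hq' : q' ∈ GE Γ r x0) : q ∘ q' ∈ GE Γ r x0 :=
  ⟨El_comp hq.1 hq'.1, hr.symm _ _ (GE_rel hr hq (hr.symm _ _ hq'.2))⟩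

theorem GE_closed {r : Set (S × S)} (hr : IsCIE Γ r) (x0 : S) : IsClosed (GE Γ r x0) :=
  (El_closed Γ S).inter (hr.closed.preimage (f := fun q : S → S => (q x0, x0)) (by fun_prop))

theorem GE_inv (hD : DM Γ S) {r : Set (S × S)} (hr : IsCIE Γ r) {x0 : S} {q : S → S}
    (hq : q ∈ GE Γ r x0) : ∃ q' ∈ GE Γ r x0, (∀ x, q' (q x) = x) ∧ (∀ x, q (q' x) = x) := by
  obtain ⟨q', h1, h2, h3⟩ := hD.exists_inv hq.1
  refine ⟨q', ⟨h1, ?_⟩, h2, h3⟩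
  have := El_rel h1 hr.closed hr.inv hq.2
  rw [h2] at this
  exact hr.symm _ _ this

theorem GE_id {r : Set (S × S)} (hr : IsCIE Γ r) (x0 : S) : id ∈ GE Γ r x0 :=
  ⟨El_id, hr.refl _⟩

theorem DM.exists_step (hD : DM Γ S) {r : Set (S × S)} (hr : IsCIE Γ r)
    (hne : ∃ x y, (x, y) ∈ r ∧ x ≠ y) (x0 : S) :
    ∃ m F τ L, Step Γ r x0 m F τ L := by
  classical
  let _ : TopologicalSpace Γ := ⊥
  have _ : DiscreteTopology Γ := ⟨rfl⟩
  obtain ⟨f, ⟨a0, b0, hab, hfab⟩, hrho⟩ := hD.exists_iso hr hne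
  let P : S → BoundedContinuousFunction Γ ℝ := fun x => Psi f x
  have hP : ∀ x y, dist (P x) (P y) = rho Γ f x y := fun _ _ => rfl
  have hEl : ∀ p ∈ El Γ S, ∀ a b, (a, b) ∈ r → dist (P (p a)) (P (p b)) = dist (P a) (P b) :=
    fun p hp a b hab => rho_El hr hrho hp hab
  let F0 : Set S := {a | (x0, a) ∈ r}
  have hF0r : ∀ a ∈ F0, ∀ b ∈ F0, (a, b) ∈ r := fun a ha b hb =>
    hr.trans _ _ _ (hr.symm _ _ ha) hb
  have hF0c : IsCompact F0 :=
    (hr.closed.preimage (f := fun a : S => (x0, a)) (by fun_prop)).isCompact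
  have hPc : ContinuousOn P F0 := by
    intro b hb
    rw [ContinuousWithinAt, tendsto_iff_dist_tendsto_zero]
    have h1 : Tendsto (fun a => (a, b)) (𝓝[F0] b) (𝓝[r] (b, b)) := by
      refine tendsto_nhdsWithin_iff.2 ⟨?_, ?_⟩
      · exact tendsto_nhdsWithin_of_tendsto_nhds (Continuous.tendsto' (by fun_prop) _ _ rfl)
      · filter_upwards [self_mem_nhdsWithin] with a ha using hF0r a ha b hb
    have h2 := (hrho (b, b) (hr.refl b)).tendsto.comp h1
    have h3 : rho Γ f b b = 0 := dist_self _
    simp only [h3] at h2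
    exact h2
  let Y : Set (BoundedContinuousFunction Γ ℝ) := P '' F0
  have hYc : CompactSpace Y := isCompact_iff_compactSpace.1 (hF0c.image_of_continuousOn hPc)
  let mk : (a : S) → (x0, a) ∈ r → Y := fun a ha => ⟨P a, ⟨a, ha, rfl⟩⟩
  have hmk : ∀ y : Y, ∃ a ha, mk a ha = y := by
    rintro ⟨_, a, ha, rfl⟩; exact ⟨a, ha, rfl⟩
  choose rep hrep hrep' using hmk
  have hmkd : ∀ a ha b hb, dist (mk a ha) (mk b hb) = dist (P a) (P b) := fun _ _ _ _ => rfl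
  have hdrep : ∀ y z : Y, dist y z = dist (P (rep y)) (P (rep z)) := fun y z => by
    have := hmkd _ (hrep y) _ (hrep z)
    rwa [hrep', hrep'] at this
  have hmkeq : ∀ p ∈ El Γ S, ∀ a ha b hb, mk a ha = mk b hb → P (p a) = P (p b) := by
    intro p hp a ha b hb h
    have h1 : P a = P b := congrArg Subtype.val h
    have h2 := hEl p hp a b (hF0r a ha b hb)
    rw [h1, dist_self] at h2
    exact dist_eq_zero.1 h2
  -- the isometries
  have hu : ∀ q ∈ GE Γ r x0, ∃ u : Y ≃ᵢ Y, ∀ a ha hqa, u (mk a ha) = mk (q a) hqa := by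
    intro q hq
    obtain ⟨q', hq', h1, h2⟩ := GE_inv hD hr hq
    have key : ∀ q (hq : q ∈ GE Γ r x0) a ha hqa,
        mk (q (rep (mk a ha))) (GE_rel hr hq (hrep _)) = mk (q a) hqa := by
      intro q hq a ha hqa
      exact Subtype.ext (hmkeq q hq.1 _ (hrep (mk a ha)) _ ha (hrep' _))
    refine ⟨IsometryEquiv.mk' (fun y => mk (q (rep y)) (GE_rel hr hq (hrep _)))
      (fun y => mk (q' (rep y)) (GE_rel hr hq' (hrep _))) ?_ ?_, ?_⟩
    · intro y
      obtain ⟨a, ha, rfl⟩ : ∃ a ha, mk a ha = y := ⟨rep y, hrep y, hrep' y⟩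
      have e1 := key q' hq' a ha (GE_rel hr hq' ha)
      have e2 := key q hq (q' a) (GE_rel hr hq' ha) (by rw [h2]; exact ha)
      have e3 : mk (q (q' a)) (by rw [h2]; exact ha) = mk a ha := Subtype.ext (congrArg P (h2 a))
      simp only [e1]
      exact e2.trans e3
    · refine Isometry.of_dist_eq fun y z => ?_
      rw [hmkd _ (GE_rel hr hq (hrep _)) _ (GE_rel hr hq (hrep _)), hEl q hq.1 _ _ (hF0r _ (hrep y) _ (hrep z))]
      exact (hdrep y z).symm
    · intro a ha hqa
      exact key q hq a ha hqa
  choose! u hu using hu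
  have hhom : ∀ y z : Y, ∃ v : Y ≃ᵢ Y, v y = z := by
    intro y z
    obtain ⟨p, hp, hpy⟩ := hD.trans (rep y) (rep z)
    have hpG : p ∈ GE Γ r x0 := by
      refine ⟨hp, ?_⟩
      have := El_rel hp hr.closed hr.inv (hrep y)
      rw [hpy] at this
      exact hr.trans _ _ _ this (hr.symm _ _ (hrep z))
    refine ⟨u p, ?_⟩
    rw [← hrep' y, hu p hpG _ (hrep y) (GE_rel hr hpG (hrep y)), ← hrep' z]
    exact Subtype.ext (congrArg P hpy)
  have hYne : ∃ y z : Y, y ≠ z := by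
    obtain ⟨p, hp, hpy⟩ := hD.trans a0 x0
    have h1 := El_rel hp hr.closed hr.inv hab
    rw [hpy] at h1
    refine ⟨mk x0 (hr.refl _), mk (p b0) h1, fun h => hfab ?_⟩
    have h2 := hEl p hp _ _ hab
    have h3 : P x0 = P (p b0) := congrArg Subtype.val h
    rw [hpy, h3, dist_self] at h2
    have h4 := dist_eq_zero.1 h2.symm
    have h5 := DFunLike.congr_fun h4 (1 : Γ)
    simpa [P, Psi_apply] using h5
  obtain ⟨I, m, fY, hIc, hIinv, hon, hexp, i0, ya, yb, hyab⟩ := iso_package hhom hYne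
  let uc : (S → S) → C(Y, Y) := fun q => ⟨u q, (u q).continuous⟩
  let F : S → Fin m → ℝ := fun a => if h : (x0, a) ∈ r then fun i => fY i (mk a h) else 0
  have hF : ∀ a (h : (x0, a) ∈ r), F a = fun i => fY i (mk a h) := fun a h => by
    simp only [F, dif_pos h]
  let τ : (S → S) → Mat m := fun q => Matrix.of fun i j => I ((fY i).comp (uc q) * fY j)
  have hτ : ∀ q i j, τ q i j = I ((fY i).comp (uc q) * fY j) := fun _ _ _ => rfl
  have hexp' : ∀ q i, (fY i).comp (uc q) = ∑ j, τ q i j • fY j := fun q i => hexp (u q) i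
  have hucomp : ∀ q ∈ GE Γ r x0, ∀ q' ∈ GE Γ r x0, uc (q ∘ q') = (uc q).comp (uc q') := by
    intro q hq q' hq'
    ext1 y
    show u (q ∘ q') y = u q (u q' y)
    obtain ⟨a, ha, rfl⟩ : ∃ a ha, mk a ha = y := ⟨rep y, hrep y, hrep' y⟩
    rw [hu q' hq' a ha (GE_rel hr hq' ha), hu q hq _ (GE_rel hr hq' ha) (GE_rel hr hq (GE_rel hr hq' ha)),
      hu _ (GE_comp hr hq hq') a ha (GE_rel hr hq (GE_rel hr hq' ha))]
    rfl
  have hmul : ∀ q ∈ GE Γ r x0, ∀ q' ∈ GE Γ r x0, τ (q ∘ q') = τ q * τ q' := by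
    intro q hq q' hq'
    ext i k
    rw [Matrix.mul_apply, hτ, hucomp q hq q' hq', ← ContinuousMap.comp_assoc, hexp']
    have : (∑ j, τ q i j • fY j).comp (uc q') * fY k
        = ∑ j, τ q i j • ((fY j).comp (uc q') * fY k) := by
      ext y
      simp [Finset.sum_mul, mul_assoc]
    rw [this, map_sum]
    simp [hτ]
  have horth : ∀ q, τ q * (τ q)ᵀ = 1 := by
    intro q
    ext i j
    rw [Matrix.mul_apply, Matrix.one_apply, ← hon i j, ← hIinv (u q)]
    have : (fY i * fY j).comp (⟨u q, (u q).continuous⟩ : C(Y, Y))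
        = ∑ k, τ q i k • ((fY j).comp (uc q) * fY k) := by
      have h1 : (fY i * fY j).comp (⟨u q, (u q).continuous⟩ : C(Y, Y))
        = (fY i).comp (uc q) * (fY j).comp (uc q) := rfl
      rw [h1]
      nth_rewrite 1 [hexp']
      rw [Finset.sum_mul]
      refine Finset.sum_congr rfl fun k _ => ?_
      ext y; simp only [ContinuousMap.mul_apply, ContinuousMap.smul_apply, smul_eq_mul]; ring
    rw [this, map_sum]
    simp [hτ]
  have hid : τ id = 1 := by
    have h1 : uc id = ContinuousMap.id Y := by
      ext1 y
      obtain ⟨a, ha, rfl⟩ : ∃ a ha, mk a ha = y := ⟨rep y, hrep y, hrep' y⟩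
      exact hu id (GE_id hr x0) a ha ha
    ext i j
    rw [hτ, h1, Matrix.one_apply, ← hon i j]
    rfl
  -- the pointwise orbit functions
  let R : S → (Γ → ℝ) := fun x g => f (g • x)
  have hRc : Continuous R := by
    refine continuous_pi fun g => ?_
    exact f.continuous.comp (continuous_const_smul g)
  have hRP : ∀ x y, R x = R y ↔ P x = P y := fun x y => by
    constructor
    · intro h; ext g; exact congrFun h g
    · intro h; ext g; exact DFunLike.congr_fun h g
  let K : Set (Γ → ℝ) := range R
  have hK : CompactSpace K := isCompact_iff_compactSpace.1 (isCompact_range hRc)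
  let w : El Γ S × Y → K := fun z => ⟨R (z.1.1 (rep z.2)), ⟨_, rfl⟩⟩
  have hwmk : ∀ p : El Γ S, ∀ a ha, (w (p, mk a ha)).1 = R (p.1 a) := by
    intro p a ha
    exact (hRP _ _).2 (hmkeq p.1 p.2 _ (hrep (mk a ha)) _ ha (hrep' _))
  have hwd : ∀ (p : El Γ S) (y z : Y) (g : Γ), dist ((w (p, y)).1 g) ((w (p, z)).1 g) ≤ dist y z := by
    intro p y z g
    have h1 : dist y z = dist (P (p.1 (rep y))) (P (p.1 (rep z))) := by
      rw [hEl p.1 p.2 _ _ (hF0r _ (hrep y) _ (hrep z))]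
      exact hdrep y z
    rw [h1]
    exact BoundedContinuousFunction.dist_coe_le_dist (f := P (p.1 (rep y))) (g := P (p.1 (rep z))) g
  have hwc : Continuous w := by
    refine Continuous.subtype_mk (continuous_pi fun g => ?_) _
    rw [continuous_iff_continuousAt]
    rintro ⟨p0, y0⟩
    rw [ContinuousAt, tendsto_iff_dist_tendsto_zero]
    have h1 : Continuous fun z : El Γ S × Y => dist z.2 y0 +
        dist ((w (z.1, y0)).1 g) ((w (p0, y0)).1 g) := by
      have h2 : Continuous fun z : El Γ S × Y => (w (z.1, y0)).1 g := by
        show Continuous fun z : El Γ S × Y => f (g • (z.1.1 (rep y0)))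
        have : Continuous fun z : El Γ S × Y => z.1.1 (rep y0) :=
          (continuous_apply (rep y0)).comp (continuous_subtype_val.comp continuous_fst)
        exact f.continuous.comp ((continuous_const_smul g).comp this)
      exact (continuous_snd.dist continuous_const).add (h2.dist continuous_const)
    have h3 := h1.tendsto (p0, y0)
    simp only [dist_self, add_zero] at h3
    refine squeeze_zero (fun _ => dist_nonneg) (fun z => ?_) h3
    refine (dist_triangle _ ((w (z.1, y0)).1 g) _).trans ?_
    gcongr
    exact hwd z.1 z.2 y0 g
  have hwinj : ∀ p : El Γ S, Function.Injective fun y => w (p, y) := by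
    intro p y z h
    have h1 : P (p.1 (rep y)) = P (p.1 (rep z)) := (hRP _ _).1 (congrArg Subtype.val h)
    have h2 := hEl p.1 p.2 _ _ (hF0r _ (hrep y) _ (hrep z))
    rw [h1, dist_self, ← hmkd _ (hrep y) _ (hrep z), hrep', hrep'] at h2
    exact dist_eq_zero.1 h2.symm
  have htriv : ∀ p0 ∈ El Γ S, ∃ A : (S → S) → Mat m, ContinuousOn A (El Γ S) ∧ A p0 = 1 ∧
      ∀ p ∈ El Γ S, ∀ q ∈ GE Γ r x0, A (p ∘ q) = (τ q)ᵀ * A p := by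
    intro p0 hp0
    have hemb : IsClosedEmbedding (fun y => w (⟨p0, hp0⟩, y)) :=
      Continuous.isClosedEmbedding (by fun_prop) (hwinj _)
    have hex : ∀ j, ∃ h : C(K, ℝ), ∀ y, h (w (⟨p0, hp0⟩, y)) = fY j y := by
      intro j
      obtain ⟨h, hh⟩ := ContinuousMap.exists_extension hemb (fY j)
      exact ⟨h, fun y => DFunLike.congr_fun hh y⟩
    choose h hh using hex
    let H : Fin m → El Γ S → C(Y, ℝ) := fun j => ContinuousMap.curry ⟨fun z => h j (w z), by fun_prop⟩
    have hH : ∀ j p y, H j p y = h j (w (p, y)) := fun _ _ _ => rfl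
    have hHc : ∀ j, Continuous (H j) := fun j => ContinuousMap.continuous _
    let A0 : El Γ S → Mat m := fun p => Matrix.of fun i j => I (fY i * H j p)
    have hA0c : Continuous A0 := by
      refine continuous_matrix fun i j => ?_
      exact hIc.comp (continuous_const.mul (hHc j))
    let A : (S → S) → Mat m := fun p => if hp : p ∈ El Γ S then A0 ⟨p, hp⟩ else 0
    have hA : ∀ p (hp : p ∈ El Γ S), A p = A0 ⟨p, hp⟩ := fun p hp => by simp only [A, dif_pos hp]
    refine ⟨A, ?_, ?_, ?_⟩
    · rw [continuousOn_iff_continuous_restrict]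
      convert hA0c using 1
      ext1 p
      exact hA p.1 p.2
    · rw [hA p0 hp0]
      ext i j
      show I (fY i * H j ⟨p0, hp0⟩) = _
      have : H j ⟨p0, hp0⟩ = fY j := by ext y; exact hh j y
      rw [this, hon, Matrix.one_apply]
    · intro p hp q hq
      rw [hA p hp, hA _ (El_comp hp hq.1)]
      ext i j
      rw [Matrix.mul_apply]
      show I (fY i * H j ⟨p ∘ q, _⟩) = ∑ k, τ q k i * I (fY k * H j ⟨p, hp⟩)
      have h1 : H j ⟨p ∘ q, El_comp hp hq.1⟩ = (H j ⟨p, hp⟩).comp (uc q) := by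
        ext1 y
        rw [hH, ContinuousMap.comp_apply, hH]
        congr 1
        obtain ⟨a, ha, rfl⟩ : ∃ a ha, mk a ha = y := ⟨rep y, hrep y, hrep' y⟩
        apply Subtype.ext
        show _ = (w (⟨p, hp⟩, u q (mk a ha))).1
        rw [hu q hq a ha (GE_rel hr hq ha), hwmk _ _ (GE_rel hr hq ha), hwmk _ _ ha]
        rfl
      let us : C(Y, Y) := ⟨(u q).symm, (u q).symm.continuous⟩
      have hus : us.comp (uc q) = ContinuousMap.id Y := by
        ext1 y; exact (u q).symm_apply_apply y
      have h2 : fY i * (H j ⟨p, hp⟩).comp (uc q) = ((fY i).comp us * H j ⟨p, hp⟩).comp (uc q) := by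
        have : ((fY i).comp us * H j ⟨p, hp⟩).comp (uc q)
          = (fY i).comp (us.comp (uc q)) * (H j ⟨p, hp⟩).comp (uc q) := rfl
        rw [this, hus]; rfl
      rw [h1, h2]
      rw [hIinv (u q)]
      have h3 : (fY i).comp us = ∑ k, τ q k i • fY k := by
        refine (hexp (u q).symm i).trans (Finset.sum_congr rfl fun k _ => ?_)
        congr 1
        rw [hτ, ← hIinv (u q)]
        congr 1
        have : ((fY i).comp us * fY k).comp (uc q)
          = (fY i).comp (us.comp (uc q)) * (fY k).comp (uc q) := rfl
        refine this.trans ?_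
        rw [hus, mul_comm]; rfl
      rw [h3, Finset.sum_mul, map_sum]
      simp
  have hcont : ContinuousOn τ (GE Γ r x0) := by
    obtain ⟨A, hA1, hA2, hA3⟩ := htriv id El_id
    have h1 : ∀ q ∈ GE Γ r x0, τ q = (A q)ᵀ := by
      intro q hq
      have := hA3 id El_id q hq
      rw [hA2, mul_one] at this
      rw [← Matrix.transpose_transpose (τ q), ← this]; rfl
    refine ContinuousOn.congr ?_ h1
    have : Continuous fun B : Mat m => Bᵀ := Continuous.matrix_transpose continuous_id
    exact this.comp_continuousOn (hA1.mono fun q hq => hq.1)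
  refine ⟨m, F, τ, τ '' GE Γ r x0, ?_, rfl, ?_, hmul, ?_, ?_, ?_, ?_, htriv, hcont⟩
  · refine ⟨⟨id, GE_id hr x0, hid⟩, ?_, ?_, ?_, ?_⟩
    · rintro _ ⟨q, hq, rfl⟩ _ ⟨q', hq', rfl⟩
      exact ⟨_, GE_comp hr hq hq', hmul q hq q' hq'⟩
    · rintro _ ⟨q, hq, rfl⟩
      obtain ⟨q', hq', h1, h2⟩ := GE_inv hD hr hq
      refine ⟨q', hq', ?_⟩
      have h3 := hmul q' hq' q hq
      rw [show q' ∘ q = id from funext h1, hid] at h3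
      calc τ q' = τ q' * (τ q * (τ q)ᵀ) := by rw [horth, mul_one]
        _ = (τ q)ᵀ := by rw [← mul_assoc, ← h3, one_mul]
    · rintro _ ⟨q, hq, rfl⟩
      exact horth q
    · exact ((GE_closed hr x0).isCompact.image_of_continuousOn hcont).isClosed
  · intro q hq a ha
    rw [hF a ha, hF _ (GE_rel hr hq ha)]
    ext i
    have h1 := DFunLike.congr_fun (hexp' q i) (mk a ha)
    have h2 : (fY i).comp (uc q) (mk a ha) = fY i (mk (q a) (GE_rel hr hq ha)) := by
      show fY i (u q (mk a ha)) = _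
      rw [hu q hq a ha (GE_rel hr hq ha)]
    rw [h2] at h1
    rw [h1, Matrix.mulVec, dotProduct]
    simp
  · let Z : Set (((S → S) × S × (Fin m → ℝ)) × Y) := {z | ∃ hp : z.1.1 ∈ El Γ S,
      (z.1.1 x0, z.1.2.1) ∈ r ∧ (w (⟨z.1.1, hp⟩, z.2)).1 = R z.1.2.1 ∧
      z.1.2.2 = fun i => fY i z.2}
    have hZ : IsClosed Z := by
      let e : (El Γ S × S × (Fin m → ℝ)) × Y → ((S → S) × S × (Fin m → ℝ)) × Y :=
        fun z => ((z.1.1.1, z.1.2), z.2)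
      have he : IsClosedEmbedding e :=
        ((El_closed Γ S).isClosedEmbedding_subtypeVal.prodMap IsClosedEmbedding.id).prodMap
          IsClosedEmbedding.id
      have : Z = e '' {z | (z.1.1.1 x0, z.1.2.1) ∈ r ∧ (w (z.1.1, z.2)).1 = R z.1.2.1 ∧
          z.1.2.2 = fun i => fY i z.2} := by
        ext ⟨⟨p, x, v⟩, y⟩
        constructor
        · rintro ⟨hp, h⟩
          exact ⟨((⟨p, hp⟩, x, v), y), h, rfl⟩
        · rintro ⟨⟨⟨⟨p', hp⟩, x', v'⟩, y'⟩, h, h'⟩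
          simp only [e, Prod.mk.injEq] at h'
          obtain ⟨⟨rfl, rfl, rfl⟩, rfl⟩ := h'
          exact ⟨hp, h⟩
      rw [this]
      apply he.isClosedMap
      refine IsClosed.inter ?_ (IsClosed.inter ?_ ?_)
      · exact hr.closed.preimage (f := fun z : (El Γ S × S × (Fin m → ℝ)) × Y =>
          (z.1.1.1 x0, z.1.2.1))
          (((continuous_apply x0).comp (continuous_subtype_val.comp
            (continuous_fst.comp continuous_fst))).prodMk (by fun_prop))
      · exact isClosed_eq (by fun_prop) (by fun_prop)
      · exact isClosed_eq (by fun_prop) (by fun_prop)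
    have : {w : (S → S) × S × (Fin m → ℝ) | w.1 ∈ El Γ S ∧
        ∃ a, (x0, a) ∈ r ∧ w.1 a = w.2.1 ∧ F a = w.2.2} = Prod.fst '' Z := by
      ext ⟨p, x, v⟩
      constructor
      · rintro ⟨hp, a, ha, h1, h2⟩
        dsimp only at hp h1 h2
        refine ⟨((p, x, v), mk a ha), ⟨hp, ?_, ?_, ?_⟩, rfl⟩
        · rw [← h1]; exact El_rel hp hr.closed hr.inv ha
        · rw [hwmk _ _ ha, ← h1]
        · rw [← h2, hF a ha]
      · rintro ⟨⟨⟨p', x', v'⟩, y⟩, ⟨hp, h1, h2, h3⟩, h'⟩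
        simp only [Prod.mk.injEq] at h'
        obtain ⟨rfl, rfl, rfl⟩ := h'
        dsimp only at hp h1 h2 h3
        obtain ⟨q, hq, hqp, hpq⟩ := hD.exists_inv hp
        have hqx : (x0, q x') ∈ r := by
          have := El_rel hq hr.closed hr.inv h1
          rwa [hqp] at this
        refine ⟨hp, q x', hqx, hpq x', ?_⟩
        have h4 : mk _ hqx = y := by
          apply hwinj ⟨p', hp⟩
          apply Subtype.ext
          dsimp only
          rw [hwmk _ _ hqx, h2]; exact congrArg R (hpq x')
        rw [hF _ hqx, h4, h3]
    rw [this]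
    exact isClosedMap_fst_of_compactSpace _ hZ
  · refine ⟨∑ i, ‖fY i‖, fun a ha => ?_⟩
    rw [hF a ha, pi_norm_le_iff_of_nonneg (Finset.sum_nonneg fun i _ => norm_nonneg _)]
    intro i
    exact ((fY i).norm_coe_le_norm _).trans
      (Finset.single_le_sum (f := fun i => ‖fY i‖) (fun i _ => norm_nonneg _) (Finset.mem_univ i))
  · refine ⟨rep ya, rep yb, hrep _, hrep _, fun h => hyab ?_⟩
    rw [hF _ (hrep ya), hF _ (hrep yb), hrep', hrep'] at h
    exact congrFun h i0
  · intro v hv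
    have h1 : ∑ i, v i • fY i = 0 := by
      ext y
      have := hv (rep y) (hrep y)
      rw [hF _ (hrep y), hrep'] at this
      simpa [dotProduct] using this
    ext j
    have h2 : I ((∑ i, v i • fY i) * fY j) = v j := by
      rw [Finset.sum_mul, map_sum]
      simp [hon]
    rw [h1, zero_mul, map_zero] at h2
    exact h2.symm

end Step

end DistalA
end

section
set_option linter.all false

namespace DistalA

open Filter Topology Set
open scoped Matrix.Norms.L2Operator Matrix

section Lift
variable {Γ : Type*} [Group Γ] {S : Type*} [MetricSpace S] [CompactSpace S] [MulAction Γ S]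
  [ContinuousConstSMul Γ S]

abbrev X3 := Fin 3 → ℝ

variable (Γ) in
/-- a closed family of `r`-classes over the cube -/
structure Fam (r : Set (S × S)) (C : Set (X3 × S)) : Prop where
  cie : IsCIE Γ r
  closed : IsClosed C
  sub : ∀ z ∈ C, z.1 ∈ Icc (0 : X3) 1
  cls : ∀ t ∈ Icc (0 : X3) 1, ∃ x, ∀ y, (t, y) ∈ C ↔ (x, y) ∈ r

theorem Fam.compact {r : Set (S × S)} {C : Set (X3 × S)} (h : Fam Γ r C) : IsCompact C :=
  (isCompact_Icc.prod isCompact_univ).of_isClosed_subset h.closed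
    fun z hz => ⟨h.sub z hz, mem_univ _⟩

theorem Fam.rel {r : Set (S × S)} {C : Set (X3 × S)} (h : Fam Γ r C) {t : X3} {x y : S}
    (hx : (t, x) ∈ C) : (t, y) ∈ C ↔ (x, y) ∈ r := by
  obtain ⟨z, hz⟩ := h.cls t (h.sub _ hx)
  have hzx := (hz x).1 hx
  rw [hz]
  exact ⟨fun hh => h.cie.trans _ _ _ (h.cie.symm _ _ hzx) hh, fun hh => h.cie.trans _ _ _ hzx hh⟩

variable (Γ) in
def EE (C : Set (X3 × S)) (x0 : S) : Set (X3 × (S → S)) := {z | z.2 ∈ El Γ S ∧ (z.1, z.2 x0) ∈ C}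

theorem EE_compact {r : Set (S × S)} {C : Set (X3 × S)} (h : Fam Γ r C) (x0 : S) :
    IsCompact (EE Γ C x0) := by
  refine (isCompact_Icc (a := (0 : X3)) (b := 1)).prod (El_compact Γ S) |>.of_isClosed_subset ?_
    fun z hz => ⟨h.sub _ hz.2, hz.1⟩
  exact ((El_closed Γ S).preimage continuous_snd).inter
    (h.closed.preimage (f := fun z : X3 × (S → S) => (z.1, z.2 x0)) (by fun_prop))

theorem EE_comp {r : Set (S × S)} {C : Set (X3 × S)} (h : Fam Γ r C) {x0 : S} {t : X3}
    {p q : S → S} (hp : (t, p) ∈ EE Γ C x0) (hq : q ∈ GE Γ r x0) : (t, p ∘ q) ∈ EE Γ C x0 := by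
  refine ⟨(El_comp (p := p) hp.1 hq.1 : p ∘ q ∈ El Γ S), ?_⟩
  have := El_rel hp.1 h.cie.closed h.cie.inv hq.2
  exact (h.rel hp.2).2 (h.cie.symm _ _ this)

theorem EE_diff (hD : DM Γ S) {r : Set (S × S)} {C : Set (X3 × S)} (h : Fam Γ r C) {x0 : S} {t : X3}
    {p p' : S → S} (hp : (t, p) ∈ EE Γ C x0) (hp' : (t, p') ∈ EE Γ C x0) :
    ∃ q ∈ GE Γ r x0, p' = p ∘ q := by
  obtain ⟨i, hi, h1, h2⟩ := hD.exists_inv hp.1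
  refine ⟨i ∘ p', ⟨El_comp hi hp'.1, ?_⟩, funext fun x => (h2 _).symm⟩
  have := (h.rel hp'.2).1 hp.2
  have := El_rel hi h.cie.closed h.cie.inv this
  dsimp only at this
  rwa [h1] at this

theorem EE_ne (hD : DM Γ S) {r : Set (S × S)} {C : Set (X3 × S)} (h : Fam Γ r C) (x0 : S) {t : X3}
    (ht : t ∈ Icc (0 : X3) 1) : ∃ p, (t, p) ∈ EE Γ C x0 := by
  obtain ⟨x, hx⟩ := h.cls t ht
  obtain ⟨p, hp, hpx⟩ := hD.trans x0 x
  refine ⟨p, hp, ?_⟩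
  dsimp only
  rw [hpx]
  exact (hx x).2 (h.cie.refl x)

variable (Γ) in
structure Sec (r : Set (S × S)) (C : Set (X3 × S)) (x0 : S) {m : ℕ} (τ : (S → S) → Mat m)
    (L : Set (Mat m)) (B : Set X3) (s : X3 → (S → S) → Mat m) : Prop where
  cont : ContinuousOn (fun z : X3 × (S → S) => s z.1 z.2) (EE Γ C x0 ∩ Prod.fst ⁻¹' B)
  mem : ∀ t ∈ B, ∀ p, (t, p) ∈ EE Γ C x0 → s t p ∈ L
  equi : ∀ t ∈ B, ∀ p, (t, p) ∈ EE Γ C x0 → ∀ q ∈ GE Γ r x0, s t (p ∘ q) = (τ q)ᵀ * s t p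

variable {r : Set (S × S)} {C : Set (X3 × S)} {x0 : S} {m : ℕ} {F : S → Fin m → ℝ}
  {τ : (S → S) → Mat m} {L : Set (Mat m)}

theorem Sec.mono {B B' : Set X3} {s} (h : Sec Γ r C x0 τ L B s) (hB : B' ⊆ B) :
    Sec Γ r C x0 τ L B' s :=
  ⟨h.cont.mono (inter_subset_inter_right _ (preimage_mono hB)),
    fun t ht => h.mem t (hB ht), fun t ht => h.equi t (hB ht)⟩

theorem sec_local (hD : DM Γ S) (h : Fam Γ r C) (st : Step Γ r x0 m F τ L) (t0 : X3)
    (ht0 : t0 ∈ Icc (0 : X3) 1) : ∃ U ∈ 𝓝 t0, ∃ s, Sec Γ r C x0 τ L (U ∩ Icc 0 1) s := by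
  obtain ⟨p0, hp0⟩ := EE_ne hD h x0 ht0
  obtain ⟨A, hA1, hA2, hA3⟩ := st.triv p0 hp0.1
  obtain ⟨N, s, hN, hLN, hsc, hsL, hs⟩ := st.grp.retract
  have hAc : ContinuousOn (fun z : X3 × (S → S) => A z.2) (EE Γ C x0) :=
    hA1.comp continuous_snd.continuousOn fun z hz => hz.1
  have hτL : ∀ q ∈ GE Γ r x0, (τ q)ᵀ ∈ L := fun q hq => st.grp.tr _ (st.img ▸ ⟨q, hq, rfl⟩)
  obtain ⟨D, hD1, hD2⟩ := (continuousOn_iff_isClosed.1 hAc) Nᶜ hN.isClosed_compl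
  have hK : IsCompact (Prod.fst '' (EE Γ C x0 ∩ D)) :=
    ((EE_compact h x0).inter_right hD1).image continuous_fst
  refine ⟨(Prod.fst '' (EE Γ C x0 ∩ D))ᶜ, hK.isClosed.isOpen_compl.mem_nhds ?_, fun t p => s (A p),
    ?_, ?_, ?_⟩
  · rintro ⟨⟨t, p⟩, hz, rfl⟩
    have hz1 : (t, p) ∈ (fun z : X3 × (S → S) => A z.2) ⁻¹' Nᶜ ∩ EE Γ C x0 := by
      rw [hD2]; exact ⟨hz.2, hz.1⟩
    obtain ⟨q, hq, rfl⟩ := EE_diff hD h hp0 hz.1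
    apply hz1.1
    show A (p0 ∘ q) ∈ N
    rw [hA3 p0 hp0.1 q hq, hA2, mul_one]
    exact hLN (hτL q hq)
  all_goals
    have hAN : ∀ t ∈ (Prod.fst '' (EE Γ C x0 ∩ D))ᶜ, ∀ p, (t, p) ∈ EE Γ C x0 → A p ∈ N := by
      intro t ht p hp
      by_contra hn
      have : (t, p) ∈ D ∩ EE Γ C x0 := by rw [← hD2]; exact ⟨hn, hp⟩
      exact ht ⟨(t, p), ⟨this.2, this.1⟩, rfl⟩
  · exact hsc.comp (hAc.mono inter_subset_left) fun z hz => hAN z.1 hz.2.1 z.2 hz.1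
  · intro t ht p hp
    exact hsL _ (hAN t ht.1 p hp)
  · intro t ht p hp q hq
    show s (A (p ∘ q)) = _
    rw [hA3 p hp.1 q hq]
    exact (hs _ (hAN t ht.1 p hp) _ (hτL q hq)).2

theorem mem_orth (hL : IsOGrp L) {a : Mat m} (ha : a ∈ L) : a * aᵀ = 1 := hL.orth a ha

theorem sec_glue (hD : DM Γ S) (h : Fam Γ r C) (st : Step Γ r x0 m F τ L) {B1 B2 : Set X3}
    (h1c : IsClosed B1) (h2c : IsClosed B2) (h1 : B1 ⊆ Icc 0 1) (h2 : B2 ⊆ Icc 0 1) {π : X3 → X3}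
    (hπ : Continuous π)
    (hπ2 : ∀ t ∈ B2, π t ∈ B1 ∩ B2) (hπ3 : ∀ t ∈ B1 ∩ B2, π t = t)
    (e1 : ∃ s, Sec Γ r C x0 τ L B1 s) (e2 : ∃ s, Sec Γ r C x0 τ L B2 s) :
    ∃ s, Sec Γ r C x0 τ L (B1 ∪ B2) s := by
  classical
  obtain ⟨s1, hs1⟩ := e1
  obtain ⟨s2, hs2⟩ := e2
  have hτL : ∀ q ∈ GE Γ r x0, τ q ∈ L := fun q hq => st.img ▸ ⟨q, hq, rfl⟩
  have hl : ∀ t ∈ B1 ∩ B2, ∃ l ∈ L, ∀ p, (t, p) ∈ EE Γ C x0 → (s2 t p)ᵀ * s1 t p = l := by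
    intro t ht
    obtain ⟨p0, hp0⟩ := EE_ne hD h x0 (h1 ht.1)
    refine ⟨(s2 t p0)ᵀ * s1 t p0, st.grp.mul _ (st.grp.tr _ (hs2.mem t ht.2 p0 hp0)) _
      (hs1.mem t ht.1 p0 hp0), fun p hp => ?_⟩
    obtain ⟨q, hq, rfl⟩ := EE_diff hD h hp0 hp
    rw [hs1.equi t ht.1 p0 hp0 q hq, hs2.equi t ht.2 p0 hp0 q hq, Matrix.transpose_mul,
      Matrix.transpose_transpose, mul_assoc, ← mul_assoc (τ q), st.grp.orth _ (hτL q hq), one_mul]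
  choose! l hlL hl using hl
  have hlc : ContinuousOn l (B1 ∩ B2) := by
    have hc : ContinuousOn (fun z : X3 × (S → S) => (s2 z.1 z.2)ᵀ * s1 z.1 z.2)
        (EE Γ C x0 ∩ Prod.fst ⁻¹' (B1 ∩ B2)) := by
      refine ContinuousOn.mul ?_ (hs1.cont.mono fun z hz => ⟨hz.1, hz.2.1⟩)
      have : Continuous fun B : Mat m => Bᵀ := Continuous.matrix_transpose continuous_id
      exact this.comp_continuousOn (hs2.cont.mono fun z hz => ⟨hz.1, hz.2.2⟩)
    rw [continuousOn_iff_isClosed]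
    intro D hDc
    obtain ⟨D', hD1, hD2⟩ := (continuousOn_iff_isClosed.1 hc) D hDc
    have hK : IsCompact (EE Γ C x0 ∩ Prod.fst ⁻¹' (B1 ∩ B2) ∩ D') :=
      ((EE_compact h x0).inter_right ((h1c.inter h2c).preimage continuous_fst)).inter_right hD1
    refine ⟨Prod.fst '' (EE Γ C x0 ∩ Prod.fst ⁻¹' (B1 ∩ B2) ∩ D'),
      (hK.image continuous_fst).isClosed, ?_⟩
    ext t
    constructor
    · rintro ⟨ht1, ht2⟩
      obtain ⟨p, hp⟩ := EE_ne hD h x0 (h1 ht2.1)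
      have : (t, p) ∈ D' ∩ (EE Γ C x0 ∩ Prod.fst ⁻¹' (B1 ∩ B2)) := by
        rw [← hD2]
        refine ⟨?_, hp, ht2⟩
        show (s2 t p)ᵀ * s1 t p ∈ D
        rw [hl t ht2 p hp]; exact ht1
      exact ⟨⟨(t, p), ⟨this.2, this.1⟩, rfl⟩, ht2⟩
    · rintro ⟨⟨⟨t, p⟩, hz, rfl⟩, ht2⟩
      have hz1 : (t, p) ∈ D' ∩ (EE Γ C x0 ∩ Prod.fst ⁻¹' (B1 ∩ B2)) := ⟨hz.2, hz.1⟩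
      rw [← hD2] at hz1
      refine ⟨?_, ht2⟩
      have := hz1.1
      show l t ∈ D
      rw [← hl t ht2 p hz.1.1]; exact this
  let s3 : X3 → (S → S) → Mat m := fun t p => s2 t p * l (π t)
  have hs3 : Sec Γ r C x0 τ L B2 s3 := by
    refine ⟨?_, ?_, ?_⟩
    · refine hs2.cont.mul ?_
      exact hlc.comp (hπ.comp continuous_fst).continuousOn fun z hz => hπ2 _ hz.2
    · intro t ht p hp
      exact st.grp.mul _ (hs2.mem t ht p hp) _ (hlL _ (hπ2 t ht))
    · intro t ht p hp q hq
      show s2 t (p ∘ q) * _ = _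
      rw [hs2.equi t ht p hp q hq, mul_assoc]
  have h13 : ∀ t ∈ B1 ∩ B2, ∀ p, (t, p) ∈ EE Γ C x0 → s3 t p = s1 t p := by
    intro t ht p hp
    show s2 t p * l (π t) = _
    rw [hπ3 t ht, ← hl t ht p hp, ← mul_assoc, st.grp.orth _ (hs2.mem t ht.2 p hp), one_mul]
  let s : X3 → (S → S) → Mat m := fun t p => if t ∈ B1 then s1 t p else s3 t p
  have hss1 : ∀ t ∈ B1, ∀ p, s t p = s1 t p := fun t ht p => if_pos ht
  have hss3 : ∀ t ∈ B2, ∀ p, (t, p) ∈ EE Γ C x0 → s t p = s3 t p := by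
    intro t ht p hp
    by_cases h1' : t ∈ B1
    · rw [hss1 t h1', h13 t ⟨h1', ht⟩ p hp]
    · exact if_neg h1'
  refine ⟨s, ?_, ?_, ?_⟩
  · rw [preimage_union, inter_union_distrib_left]
    refine ContinuousOn.union_of_isClosed ?_ ?_ ?_ ?_
    · exact hs1.cont.congr fun z hz => hss1 _ hz.2 _
    · exact hs3.cont.congr fun z hz => hss3 _ hz.2 _ hz.1
    · exact (EE_compact h x0).isClosed.inter (h1c.preimage continuous_fst)
    · exact (EE_compact h x0).isClosed.inter (h2c.preimage continuous_fst)
  · rintro t (ht | ht) p hp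
    · rw [hss1 t ht]; exact hs1.mem t ht p hp
    · rw [hss3 t ht p hp]; exact hs3.mem t ht p hp
  · rintro t (ht | ht) p hp q hq
    · rw [hss1 t ht, hss1 t ht]; exact hs1.equi t ht p hp q hq
    · rw [hss3 t ht p hp, hss3 t ht _ (EE_comp h hp hq)]; exact hs3.equi t ht p hp q hq

theorem box_upd {P : X3 → X3 → Prop}
    (hsplit : ∀ a b : X3, ∀ i, ∀ c, a i ≤ c → c ≤ b i → P a (Function.update b i c) →
      P (Function.update a i c) b → P a b) (κ : X3) (hκ : ∀ i, 0 < κ i)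
    (hP : ∀ a b, 0 ≤ a → a ≤ b → b ≤ 1 → (∀ i, b i - a i ≤ κ i) → P a b) (i : Fin 3) (n : ℕ) :
    ∀ a b, 0 ≤ a → a ≤ b → b ≤ 1 → (∀ j, b j - a j ≤ Function.update κ i ((n + 1) * κ i) j) →
      P a b := by
  induction n with
  | zero =>
    intro a b h0 hab h1 hb
    refine hP a b h0 hab h1 fun j => ?_
    have := hb j
    by_cases hj : j = i
    · subst hj; simpa using this
    · simpa [hj] using this
  | succ n ih =>
    intro a b h0 hab h1 hb
    set c := max (a i) (b i - κ i) with hc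
    have hac : a i ≤ c := le_max_left _ _
    have hcb : c ≤ b i := max_le (hab i) (by linarith [hκ i])
    have hbi := hb i
    simp only [Function.update_self] at hbi
    push_cast at hbi
    have hn : (0 : ℝ) ≤ n := n.cast_nonneg
    refine hsplit a b i c hac hcb (ih a _ h0 ?_ ?_ ?_) (hP _ b ?_ ?_ h1 ?_)
    · intro j
      by_cases hj : j = i
      · subst hj; simpa using hac
      · simpa [hj] using hab j
    · intro j
      by_cases hj : j = i
      · subst hj; simpa using hcb.trans (h1 j)
      · simpa [hj] using h1 j
    · intro j
      by_cases hj : j = i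
      · subst hj
        simp only [Function.update_self]
        have := hκ j
        have h3 : c - a j ≤ max 0 (b j - κ j - a j) := by
          rcases max_cases (a j) (b j - κ j) with h | h
          · rw [hc, h.1]; simp
          · rw [hc, h.1]; exact le_max_right _ _
        refine h3.trans (max_le (by positivity) (by linarith))
      · have := hb j
        simp only [Function.update_of_ne hj] at this ⊢
        exact this
    · intro j
      by_cases hj : j = i
      · subst hj; simpa using (h0 j).trans hac
      · simpa [hj] using h0 j
    · intro j
      by_cases hj : j = i
      · subst hj; simpa using hcb
      · simpa [hj] using hab j
    · intro j
      by_cases hj : j = i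
      · subst hj
        simp only [Function.update_self]
        linarith [le_max_right (a j) (b j - κ j)]
      · have := hb j
        simp only [Function.update_of_ne hj] at this ⊢
        exact this

theorem box_all {P : X3 → X3 → Prop}
    (hsplit : ∀ a b : X3, ∀ i, ∀ c, a i ≤ c → c ≤ b i → P a (Function.update b i c) →
      P (Function.update a i c) b → P a b) (δ : ℝ) (hδ : 0 < δ)
    (hP : ∀ a b, 0 ≤ a → a ≤ b → b ≤ 1 → (∀ i, b i - a i ≤ δ) → P a b) : P 0 1 := by
  obtain ⟨n, hn⟩ := exists_nat_gt (1 / δ)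
  have hn' : 1 ≤ (n + 1) * δ := by
    rw [div_lt_iff₀ hδ] at hn
    nlinarith
  have key : ∀ (κ : X3) (hκ : ∀ i, 0 < κ i) (i : Fin 3), ∀ j, 0 < Function.update κ i ((n + 1) * κ i) j := by
    intro κ hκ i j
    by_cases hj : j = i
    · subst hj; have := hκ j; simp; positivity
    · simpa [hj] using hκ j
  let κ0 : X3 := fun _ => δ
  have h0 : ∀ i, 0 < κ0 i := fun _ => hδ
  have p1 := box_upd hsplit κ0 h0 hP 0 n
  have p2 := box_upd hsplit _ (key κ0 h0 0) p1 1 n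
  have p3 := box_upd hsplit _ (key _ (key κ0 h0 0) 1) p2 2 n
  refine p3 0 1 le_rfl (fun _ => by simp) le_rfl ?_
  intro j
  fin_cases j <;> simp [κ0, Function.update] <;> linarith

theorem sec_global (hD : DM Γ S) (h : Fam Γ r C) (st : Step Γ r x0 m F τ L) :
    ∃ s, Sec Γ r C x0 τ L (Icc 0 1) s := by
  have hloc : ∃ δ > 0, ∀ t ∈ Icc (0 : X3) 1, ∃ s, Sec Γ r C x0 τ L (Metric.ball t δ ∩ Icc 0 1) s := by
    choose! U hU hs using fun t ht => sec_local hD h st t ht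
    obtain ⟨δ, hδ, hh⟩ := Metric.uniformity_basis_dist.lebesgue_number_lemma_nhds'
      (K := Icc (0 : X3) 1) (U := fun t _ => U t) isCompact_Icc hU
    refine ⟨δ, hδ, fun t ht => ?_⟩
    obtain ⟨y, hy⟩ := hh t ht
    obtain ⟨s, hs⟩ := hs y.1 y.2
    refine ⟨s, hs.mono (inter_subset_inter_left _ fun z hz => hy ?_)⟩
    show dist t z < δ
    rw [dist_comm]; exact hz
  obtain ⟨δ, hδ, hloc⟩ := hloc
  have := box_all (P := fun a b => 0 ≤ a → b ≤ 1 → ∃ s, Sec Γ r C x0 τ L (Icc a b) s) ?_ (δ / 2) (by positivity) ?_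
  · exact this le_rfl le_rfl
  · intro a b i c hac hcb hs1 hs2 h0 h1
    have ha' : a ≤ Function.update a i c := by
      intro j
      by_cases hj : j = i
      · subst hj; simpa using hac
      · simp [hj]
    have hb' : Function.update b i c ≤ b := by
      intro j
      by_cases hj : j = i
      · subst hj; simpa using hcb
      · simp [hj]
    have e1 := hs1 h0 (hb'.trans h1)
    have e2 := hs2 (h0.trans ha') h1
    have hmem1 : ∀ t, t ∈ Icc a (Function.update b i c) ↔ t ∈ Icc a b ∧ t i ≤ c := by
      intro t
      constructor
      · intro ht
        refine ⟨⟨ht.1, ht.2.trans hb'⟩, by simpa using ht.2 i⟩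
      · rintro ⟨ht, hti⟩
        refine ⟨ht.1, fun j => ?_⟩
        by_cases hj : j = i
        · subst hj; simpa using hti
        · simpa [hj] using ht.2 j
    have hmem2 : ∀ t, t ∈ Icc (Function.update a i c) b ↔ t ∈ Icc a b ∧ c ≤ t i := by
      intro t
      constructor
      · intro ht
        refine ⟨⟨ha'.trans ht.1, ht.2⟩, by simpa using ht.1 i⟩
      · rintro ⟨ht, hti⟩
        refine ⟨fun j => ?_, ht.2⟩
        by_cases hj : j = i
        · subst hj; simpa using hti
        · simpa [hj] using ht.1 j
    have hun : Icc a (Function.update b i c) ∪ Icc (Function.update a i c) b = Icc a b := by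
      ext t
      rw [mem_union, hmem1, hmem2]
      constructor
      · rintro (h | h) <;> exact h.1
      · intro ht
        rcases le_total (t i) c with h | h
        · exact Or.inl ⟨ht, h⟩
        · exact Or.inr ⟨ht, h⟩
    rw [← hun]
    refine sec_glue hD h st isClosed_Icc isClosed_Icc (Icc_subset_Icc h0 (hb'.trans h1))
      (Icc_subset_Icc (h0.trans ha') h1) (π := fun t => Function.update t i c)
      (by fun_prop) ?_ ?_ e1 e2
    · intro t ht
      have ht' := ((hmem2 t).1 ht).1
      have : Function.update t i c ∈ Icc a b := by
        constructor
        · intro j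
          by_cases hj : j = i
          · subst hj; simpa using hac
          · simpa [hj] using ht'.1 j
        · intro j
          by_cases hj : j = i
          · subst hj; simpa using hcb
          · simpa [hj] using ht'.2 j
      exact ⟨(hmem1 _).2 ⟨this, by simp⟩, (hmem2 _).2 ⟨this, by simp⟩⟩
    · rintro t ⟨ht1, ht2⟩
      have : t i = c := le_antisymm ((hmem1 t).1 ht1).2 ((hmem2 t).1 ht2).2
      rw [← this]; exact Function.update_eq_self i t
  · intro a b h0 hab h1 hδ' _ _
    obtain ⟨s, hs⟩ := hloc a ⟨h0, hab.trans h1⟩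
    refine ⟨s, hs.mono fun t ht => ⟨?_, h0.trans ht.1, ht.2.trans h1⟩⟩
    rw [Metric.mem_ball, dist_pi_lt_iff hδ]
    intro i
    rw [Real.dist_eq, abs_of_nonneg (sub_nonneg.2 (ht.1 i))]
    have := hδ' i
    have := ht.2 i
    linarith


def FF (Γ : Type*) [Group Γ] [MulAction Γ S] (r : Set (S × S)) (x0 : S) {m : ℕ} (F : S → Fin m → ℝ) : Set ((S → S) × S × (Fin m → ℝ)) :=
  {w | w.1 ∈ El Γ S ∧ ∃ a, (x0, a) ∈ r ∧ w.1 a = w.2.1 ∧ F a = w.2.2}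

def rnew (Γ : Type*) [Group Γ] [MulAction Γ S] (r : Set (S × S)) (x0 : S) {m : ℕ} (F : S → Fin m → ℝ) : Set (S × S) :=
  {z | ∃ p v, (p, z.1, v) ∈ FF Γ r x0 F ∧ (p, z.2, v) ∈ FF Γ r x0 F}

theorem GE_of (hr : IsCIE Γ r) {q : S → S} (hq : q ∈ El Γ S) {a b : S} (ha : (x0, a) ∈ r)
    (hb : (x0, b) ∈ r) (hqa : q a = b) : q ∈ GE Γ r x0 := by
  refine ⟨hq, ?_⟩
  have := El_rel hq hr.closed hr.inv ha
  rw [hqa] at this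
  exact hr.trans _ _ _ this (hr.symm _ _ hb)

theorem rnew_cie (hD : DM Γ S) (hr : IsCIE Γ r) (st : Step Γ r x0 m F τ L) :
    IsCIE Γ (rnew Γ r x0 F) := by
  refine ⟨?_, ?_, ?_, ?_, ?_⟩
  · obtain ⟨c, hc⟩ := st.bdd
    let K : Set ((S → S) × (Fin m → ℝ) × S × S) :=
      {z | (z.1, z.2.2.1, z.2.1) ∈ FF Γ r x0 F} ∩ {z | (z.1, z.2.2.2, z.2.1) ∈ FF Γ r x0 F}
    have hKc : IsClosed K :=
      (st.closedF.preimage (f := fun z : (S → S) × (Fin m → ℝ) × S × S => (z.1, z.2.2.1, z.2.1))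
        (by fun_prop)).inter
      (st.closedF.preimage (f := fun z : (S → S) × (Fin m → ℝ) × S × S => (z.1, z.2.2.2, z.2.1))
        (by fun_prop))
    have hK : IsCompact K := by
      refine ((El_compact Γ S).prod ((isCompact_closedBall (0 : Fin m → ℝ) c).prod
        (isCompact_univ (X := S × S)))).of_isClosed_subset hKc ?_
      rintro ⟨p, v, x, y⟩ ⟨⟨hp, a, ha, -, hv⟩, -⟩
      refine ⟨hp, ?_, mem_univ _⟩
      rw [mem_closedBall_zero_iff]
      dsimp only at hv ⊢
      rw [← hv]; exact hc a ha
    have : rnew Γ r x0 F = (fun z : (S → S) × (Fin m → ℝ) × S × S => z.2.2) '' K := by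
      ext ⟨x, y⟩
      constructor
      · rintro ⟨p, v, h1, h2⟩
        exact ⟨(p, v, x, y), ⟨h1, h2⟩, rfl⟩
      · rintro ⟨⟨p, v, x, y⟩, ⟨h1, h2⟩, h3⟩
        rw [← h3]
        exact ⟨p, v, h1, h2⟩
    rw [this]
    exact (hK.image (by fun_prop)).isClosed
  · rintro g ⟨x, y⟩ ⟨p, v, ⟨hp, a, ha, h1, h2⟩, ⟨-, b, hb, h3, h4⟩⟩
    dsimp only at h1 h2 h3 h4
    have hgp : (fun s => g • p s) ∈ El Γ S := El_smul_comp g hp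
    refine ⟨fun s => g • p s, v, ⟨hgp, a, ha, ?_, h2⟩, ⟨hgp, b, hb, ?_, h4⟩⟩
    · show g • p a = g • x
      rw [h1]
    · show g • p b = g • y
      rw [h3]
  · intro x
    obtain ⟨p, hp, hpx⟩ := hD.trans x0 x
    exact ⟨p, F x0, ⟨hp, x0, hr.refl _, hpx, rfl⟩, ⟨hp, x0, hr.refl _, hpx, rfl⟩⟩
  · rintro x y ⟨p, v, h1, h2⟩
    exact ⟨p, v, h2, h1⟩
  · rintro x y z ⟨p, v, ⟨hp, a, ha, h1, h2⟩, ⟨-, b, hb, h3, h4⟩⟩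
      ⟨p', v', ⟨hp', b', hb', h1', h2'⟩, ⟨-, c', hc', h3', h4'⟩⟩
    dsimp only at *
    obtain ⟨i, hi, i1, i2⟩ := hD.exists_inv hp
    have hq : i ∘ p' ∈ GE Γ r x0 := GE_of hr (El_comp hi hp') hb' hb (by
      show i (p' b') = b
      rw [h1', ← h3, i1])
    refine ⟨p, v, ⟨hp, a, ha, h1, h2⟩, ⟨hp, (i ∘ p') c', GE_rel hr hq hc', ?_, ?_⟩⟩
    · show p (i (p' c')) = z
      rw [i2, h3']
    · dsimp only
      rw [st.equi _ hq _ hc', h4', ← h2', ← st.equi _ hq _ hb', ← h4]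
      congr 1
      show i (p' b') = b
      rw [h1', ← h3, i1]

theorem rnew_sub (hr : IsCIE Γ r) : rnew Γ r x0 F ⊆ r := by
  rintro ⟨x, y⟩ ⟨p, v, ⟨hp, a, ha, h1, h2⟩, ⟨-, b, hb, h3, h4⟩⟩
  dsimp only at *
  have := El_rel hp hr.closed hr.inv (hr.trans _ _ _ (hr.symm _ _ ha) hb)
  rwa [h1, h3] at this

theorem rnew_ne (hr : IsCIE Γ r) (st : Step Γ r x0 m F τ L) : ¬ r ⊆ rnew Γ r x0 F := by
  intro hsub
  obtain ⟨a, b, ha, hb, hab⟩ := st.nontriv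
  obtain ⟨p, v, ⟨hp, a', ha', h1, h2⟩, ⟨-, b', hb', h3, h4⟩⟩ :=
    hsub (hr.trans _ _ _ (hr.symm _ _ ha) hb)
  dsimp only at *
  have hq : p ∈ GE Γ r x0 := GE_of hr hp ha' ha h1
  apply hab
  rw [← h1, ← h3, st.equi _ hq _ ha', st.equi _ hq _ hb', h2, h4]

theorem fam_step (hD : DM Γ S) (h : Fam Γ r C) (st : Step Γ r x0 m F τ L) :
    ∃ C', C' ⊆ C ∧ Fam Γ (rnew Γ r x0 F) C' := by
  obtain ⟨s, hs⟩ := sec_global hD h st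
  have hr := h.cie
  have hsub : ∀ z ∈ EE Γ C x0, z.1 ∈ Icc (0 : X3) 1 := fun z hz => h.sub _ hz.2
  let Z : Set (X3 × (S → S)) := EE Γ C x0 ∩ {z | s z.1 z.2 = 1}
  have hZ : IsCompact Z := by
    have hc : ContinuousOn (fun z : X3 × (S → S) => s z.1 z.2) (EE Γ C x0) :=
      hs.cont.mono fun z hz => ⟨hz, hsub z hz⟩
    obtain ⟨D, hD1, hD2⟩ := (continuousOn_iff_isClosed.1 hc) {1} isClosed_singleton
    have : Z = EE Γ C x0 ∩ D := by
      rw [inter_comm _ D, ← hD2, inter_comm]; rfl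
    rw [this]
    exact (EE_compact h x0).inter_right hD1
  let C' : Set (X3 × S) := {w | ∃ p, (w.1, p) ∈ Z ∧ (p, w.2, F x0) ∈ FF Γ r x0 F}
  have hC'C : C' ⊆ C := by
    rintro ⟨t, x⟩ ⟨p, hp, ⟨-, a, ha, h1, h2⟩⟩
    dsimp only at *
    rw [h.rel hp.1.2, ← h1]
    exact El_rel hp.1.1 hr.closed hr.inv ha
  refine ⟨C', hC'C, rnew_cie hD hr st, ?_, fun z hz => h.sub _ (hC'C hz), ?_⟩
  · let K : Set ((X3 × (S → S)) × S) := {z | z.1 ∈ Z ∧ (z.1.2, z.2, F x0) ∈ FF Γ r x0 F}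
    have hK : IsCompact K := by
      have : K = (Z ×ˢ univ) ∩ {z | (z.1.2, z.2, F x0) ∈ FF Γ r x0 F} := by
        ext z; simp [K]
      rw [this]
      exact (hZ.prod isCompact_univ).inter_right (st.closedF.preimage
        (f := fun z : (X3 × (S → S)) × S => (z.1.2, z.2, F x0)) (by fun_prop))
    have : C' = (fun z : (X3 × (S → S)) × S => (z.1.1, z.2)) '' K := by
      ext ⟨t, x⟩
      constructor
      · rintro ⟨p, h1, h2⟩
        exact ⟨((t, p), x), ⟨h1, h2⟩, rfl⟩
      · rintro ⟨⟨⟨t, p⟩, x⟩, ⟨h1, h2⟩, h3⟩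
        simp only [Prod.mk.injEq] at h3
        obtain ⟨rfl, rfl⟩ := h3
        exact ⟨p, h1, h2⟩
    rw [this]
    exact (hK.image (by fun_prop)).isClosed
  · intro t ht
    obtain ⟨p, hp, hp1⟩ : ∃ p, (t, p) ∈ EE Γ C x0 ∧ s t p = 1 := by
      obtain ⟨p0, hp0⟩ := EE_ne hD h x0 ht
      have h1 := hs.mem t ht p0 hp0
      have h1' := h1
      rw [st.img] at h1
      obtain ⟨q, hq, hq1⟩ := h1
      refine ⟨p0 ∘ q, EE_comp h hp0 hq, ?_⟩
      rw [hs.equi t ht p0 hp0 q hq, hq1]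
      exact st.grp.orth' h1'
    refine ⟨p x0, fun y => ?_⟩
    obtain ⟨i, hi, i1, i2⟩ := hD.exists_inv (p := p) hp.1
    constructor
    · rintro ⟨p1, ⟨hp1E, hp1s⟩, ⟨-, a, ha, h1, h2⟩⟩
      dsimp only at *
      obtain ⟨q, hq, rfl⟩ := EE_diff hD h hp hp1E
      have hτ : τ q = 1 := by
        have h3 : s t (p ∘ q) = 1 := hp1s
        rw [hs.equi t ht p hp q hq, hp1, mul_one] at h3
        rw [← Matrix.transpose_transpose (τ q), h3, Matrix.transpose_one]
      refine ⟨p, F x0, ⟨hp.1, x0, hr.refl _, rfl, rfl⟩, ⟨hp.1, q a, GE_rel hr hq ha, h1, ?_⟩⟩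
      dsimp only
      rw [st.equi q hq a ha, hτ, Matrix.one_mulVec, h2]
    · rintro ⟨p1, v, ⟨hp1', a, ha, h1, h2⟩, ⟨-, b, hb, h3, h4⟩⟩
      dsimp only at *
      have hia : (i ∘ p1) a = x0 := by
        show i (p1 a) = x0
        rw [h1, i1]
      have hq : i ∘ p1 ∈ GE Γ r x0 := GE_of hr (El_comp hi hp1') ha (hr.refl _) hia
      refine ⟨p, ⟨hp, hp1⟩, ⟨hp.1, (i ∘ p1) b, GE_rel hr hq hb, ?_, ?_⟩⟩
      · show p (i (p1 b)) = y
        rw [i2, h3]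
      · dsimp only
        rw [st.equi _ hq _ hb, h4, ← h2, ← st.equi _ hq _ ha, hia]

theorem fam_chain (c : Set (Set (S × S) × Set (X3 × S))) (hc : ∀ w ∈ c, Fam Γ w.1 w.2)
    (hne : c.Nonempty) (hch : IsChain (fun a b => b.1 ⊆ a.1 ∧ b.2 ⊆ a.2) c) :
    Fam Γ (⋂ w ∈ c, w.1) (⋂ w ∈ c, w.2) := by
  obtain ⟨w0, hw0⟩ := hne
  refine ⟨⟨?_, ?_, ?_, ?_, ?_⟩, ?_, ?_, ?_⟩
  · exact isClosed_biInter fun w hw => (hc w hw).cie.closed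
  · intro g z hz
    simp only [mem_iInter] at hz ⊢
    exact fun w hw => (hc w hw).cie.inv g z (hz w hw)
  · intro x
    simp only [mem_iInter]
    exact fun w hw => (hc w hw).cie.refl x
  · intro x y hz
    simp only [mem_iInter] at hz ⊢
    exact fun w hw => (hc w hw).cie.symm _ _ (hz w hw)
  · intro x y z hz hz'
    simp only [mem_iInter] at hz hz' ⊢
    exact fun w hw => (hc w hw).cie.trans _ _ _ (hz w hw) (hz' w hw)
  · exact isClosed_biInter fun w hw => (hc w hw).closed
  · intro z hz
    simp only [mem_iInter] at hz
    exact (hc w0 hw0).sub z (hz w0 hw0)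
  · intro t ht
    have hcl : ∀ w ∈ c, IsClosed {x | (t, x) ∈ w.2} := fun w hw =>
      (hc w hw).closed.preimage (f := fun x : S => (t, x)) (by fun_prop)
    haveI : Nonempty c := ⟨⟨w0, hw0⟩⟩
    have hx : (⋂ w : c, {x | (t, x) ∈ w.1.2}).Nonempty := by
      refine IsCompact.nonempty_iInter_of_directed_nonempty_isCompact_isClosed _ ?_ ?_
        (fun w => (hcl w.1 w.2).isCompact) (fun w => hcl w.1 w.2)
      · rintro ⟨w, hw⟩ ⟨w', hw'⟩
        by_cases hww : w = w'
        · subst hww; exact ⟨⟨w, hw⟩, fun x hx => hx, fun x hx => hx⟩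
        · rcases hch hw hw' hww with h | h
          · exact ⟨⟨w', hw'⟩, fun x hx => h.2 hx, fun x hx => hx⟩
          · exact ⟨⟨w, hw⟩, fun x hx => hx, fun x hx => h.2 hx⟩
      · rintro ⟨w, hw⟩
        obtain ⟨x, hx⟩ := (hc w hw).cls t ht
        exact ⟨x, (hx x).2 ((hc w hw).cie.refl x)⟩
    obtain ⟨x, hx⟩ := hx
    simp only [mem_iInter] at hx
    refine ⟨x, fun y => ?_⟩
    simp only [mem_iInter]
    refine forall₂_congr fun w hw => (hc w hw).rel (hx ⟨w, hw⟩)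

theorem no_fam [ChartedSpace (EuclideanSpace ℝ (Fin 2)) S] (hD : DM Γ S) (h : Fam Γ r C)
    (hdisj : ∀ t t' x, (t, x) ∈ C → (t', x) ∈ C → t = t') : False := by
  let A := {w : Set (S × S) × Set (X3 × S) // Fam Γ w.1 w.2 ∧ w.2 ⊆ C}
  let R : A → A → Prop := fun a b => b.1.1 ⊆ a.1.1 ∧ b.1.2 ⊆ a.1.2
  obtain ⟨M, hM⟩ := exists_maximal_of_chains_bounded (r := R) (fun c hc => by
    rcases c.eq_empty_or_nonempty with rfl | hne
    · exact ⟨⟨(r, C), h, subset_rfl⟩, by simp⟩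
    have hch := fam_chain (Γ := Γ) (Subtype.val '' c) (by
      rintro _ ⟨w, -, rfl⟩; exact w.2.1) (hne.image _) (by
      rintro _ ⟨w, hw, rfl⟩ _ ⟨w', hw', rfl⟩ hww
      exact hc hw hw' (fun e => hww (congrArg _ e)))
    obtain ⟨w0, hw0⟩ := hne
    have hm : ∀ a ∈ c, a.1 ∈ Subtype.val '' c := fun a ha => ⟨a, ha, rfl⟩
    refine ⟨⟨(⋂ w ∈ Subtype.val '' c, w.1, ⋂ w ∈ Subtype.val '' c, w.2), hch, (biInter_subset_of_mem (hm w0 hw0)).trans w0.2.2⟩, fun a ha => ?_⟩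
    exact ⟨biInter_subset_of_mem (hm a ha), biInter_subset_of_mem (hm a ha)⟩)
    (fun h1 h2 => ⟨h2.1.trans h1.1, h2.2.trans h1.2⟩)
  obtain ⟨⟨r1, C1⟩, hF, hC1⟩ := M
  dsimp only at hF hC1
  obtain ⟨x0, hx0⟩ := hF.cls 0 (by simp)
  by_cases hne : ∃ x y, (x, y) ∈ r1 ∧ x ≠ y
  · obtain ⟨m, F, τ, L, st⟩ := hD.exists_step hF.cie hne x0
    obtain ⟨C', hC', hF'⟩ := fam_step hD hF st
    have := hM ⟨(rnew Γ r1 x0 F, C'), hF', hC'.trans hC1⟩ ⟨rnew_sub hF.cie, hC'⟩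
    exact rnew_ne hF.cie st this.1
  · push Not at hne
    haveI : Nonempty S := ⟨x0⟩
    choose! σ hσ using hF.cls
    have hσC : ∀ t ∈ Icc (0 : X3) 1, (t, σ t) ∈ C1 := fun t ht => (hσ t ht _).2 (hF.cie.refl _)
    have huniq : ∀ t x, (t, x) ∈ C1 → σ t = x := fun t x hx =>
      hne _ _ ((hσ t (hF.sub _ hx) x).1 hx)
    refine no_cube σ ?_ ?_
    · rw [continuousOn_iff_isClosed]
      intro D hD
      refine ⟨Prod.fst '' (C1 ∩ Prod.snd ⁻¹' D),
        ((hF.compact.inter_right (hD.preimage continuous_snd)).image continuous_fst).isClosed, ?_⟩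
      ext t
      constructor
      · rintro ⟨h1, h2⟩
        exact ⟨⟨(t, σ t), ⟨hσC t h2, h1⟩, rfl⟩, h2⟩
      · rintro ⟨⟨⟨t, x⟩, ⟨h1, h3⟩, rfl⟩, h2⟩
        refine ⟨?_, h2⟩
        show σ t ∈ D
        rw [huniq t x h1]; exact h3
    · intro t ht t' ht' he
      refine hdisj t t' (σ t) (hC1 (hσC t ht)) (hC1 ?_)
      rw [he]; exact hσC t' ht'

end Lift

end DistalA
end

section
set_option linter.all false

namespace DistalA

open Filter Topology NormedSpace
open scoped Matrix.Norms.L2Operator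

section
variable {m : ℕ} {L : Set (Mat m)}

theorem IsOGrp.compact (h : IsOGrp L) : IsCompact L := by
  have : L ⊆ (Matrix.unitaryGroup (Fin m) ℝ : Set (Mat m)) := by
    intro a ha
    rw [SetLike.mem_coe, Matrix.mem_unitaryGroup_iff]
    simpa [Matrix.star_eq_conjTranspose] using h.orth a ha
  refine IsCompact.of_isClosed_subset ?_ h.closed this
  refine Metric.isCompact_of_isClosed_isBounded ?_ ?_
  · have : (Matrix.unitaryGroup (Fin m) ℝ : Set (Mat m)) = {a | a * star a = 1} := by
      ext a; simp [Matrix.mem_unitaryGroup_iff]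
    rw [this]
    exact isClosed_eq (continuous_id.mul continuous_star) continuous_const
  · rw [isBounded_iff_forall_norm_le]
    refine ⟨1, fun a ha => ?_⟩
    have h2 : star a * a = 1 := Matrix.mem_unitaryGroup_iff'.1 ha
    have := CStarRing.norm_star_mul_self (x := a)
    rw [h2] at this
    have h1 : ‖(1 : Mat m)‖ ≤ 1 := by
      rcases isEmpty_or_nonempty (Fin m) with he | he
      · have : (1 : Mat m) = 0 := Subsingleton.elim _ _
        rw [this]; simp
      · simp
    nlinarith [norm_nonneg a]

theorem IsOGrp.cover3 (h : IsOGrp L) (H M : Submodule ℝ (Mat m)) (hH : H ≤ h.lie) (hM : M ≤ h.lie)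
    (hHM : h.lie ≤ H ⊔ M) :
    ∃ ε > 0, ∀ l ∈ L, ‖l - 1‖ < ε → ∃ Y ∈ H, ∃ X ∈ M, l = exp Y * exp X := by
  obtain ⟨N, hN⟩ := Submodule.exists_isCompl h.lie
  obtain ⟨ε, hε, hs⟩ := h.small N hN.disjoint
  let p1 : (H × M × N) →L[ℝ] Mat m := H.subtypeL.comp (ContinuousLinearMap.fst ℝ H (M × N))
  let p2 : (H × M × N) →L[ℝ] Mat m := M.subtypeL.comp ((ContinuousLinearMap.fst ℝ M N).comp
    (ContinuousLinearMap.snd ℝ H (M × N)))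
  let p3 : (H × M × N) →L[ℝ] Mat m := N.subtypeL.comp ((ContinuousLinearMap.snd ℝ M N).comp
    (ContinuousLinearMap.snd ℝ H (M × N)))
  have he : ∀ p : (H × M × N) →L[ℝ] Mat m, HasStrictFDerivAt (fun z => exp (p z)) p 0 := by
    intro p
    have : HasStrictFDerivAt (fun z => exp (p z)) ((1 : Mat m →L[ℝ] Mat m).comp p) 0 := by
      apply HasStrictFDerivAt.comp (g := (exp : Mat m → Mat m))
      · simpa using mexp_deriv
      · exact p.hasStrictFDerivAt
    convert! this using 1
  have hf : HasStrictFDerivAt (fun z => exp (p1 z) * exp (p2 z) * exp (p3 z)) (p1 + p2 + p3) 0 := by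
    have h3 := ((he p1).mul' (he p2)).mul' (he p3)
    convert! h3 using 1
    apply ContinuousLinearMap.ext
    intro p
    simp
    abel
  have hsurj : ((p1 + p2 + p3 : (H × M × N) →L[ℝ] Mat m)).range = ⊤ := by
    rw [eq_top_iff]
    intro A _
    have hA : A ∈ h.lie ⊔ N := by rw [hN.sup_eq_top]; trivial
    obtain ⟨B, hB, C, hC, rfl⟩ := Submodule.mem_sup.1 hA
    obtain ⟨Y, hY, X, hX, rfl⟩ := Submodule.mem_sup.1 (hHM hB)
    exact ⟨(⟨Y, hY⟩, ⟨X, hX⟩, ⟨C, hC⟩), rfl⟩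
  have hmap := hf.map_nhds_eq_of_surj hsurj
  have hset : {z : H × M × N | ‖p3 z‖ < ε} ∈ 𝓝 (0 : H × M × N) := by
    apply IsOpen.mem_nhds (isOpen_lt (by fun_prop) continuous_const)
    simpa using hε
  have h2 := image_mem_map (m := fun z => exp (p1 z) * exp (p2 z) * exp (p3 z)) hset
  rw [hmap] at h2
  simp only [map_zero, exp_zero, mul_one] at h2
  obtain ⟨δ, hδ, hb⟩ := Metric.mem_nhds_iff.1 h2
  refine ⟨δ, hδ, fun l hl hl1 => ?_⟩
  obtain ⟨z, hz, hzl⟩ := hb (show l ∈ Metric.ball 1 δ by rwa [mem_ball_iff_norm])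
  have hzl : exp (p1 z) * exp (p2 z) * exp (p3 z) = l := hzl
  have e1 : exp (p1 z) ∈ L := h.exp_mem (hH z.1.2)
  have e2 : exp (p2 z) ∈ L := h.exp_mem (hM z.2.1.2)
  have e3 : exp (p3 z) ∈ L := by
    have : exp (p3 z) = (exp (p1 z) * exp (p2 z)).transpose * l := by
      rw [← hzl, ← mul_assoc, h.orth' (h.mul _ e1 _ e2), one_mul]
    rw [this]
    exact h.mul _ (h.tr _ (h.mul _ e1 _ e2)) _ hl
  have : p3 z = 0 := hs _ z.2.2.2 hz e3
  refine ⟨_, z.1.2, _, z.2.1.2, ?_⟩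
  rw [← hzl, this]
  simp only [exp_zero, mul_one]
  rfl

theorem hasDeriv_exp (Y : Mat m) : HasDerivAt (fun t : ℝ => exp (t • Y)) Y 0 := by
  have := (hasDerivAt_exp_smul_const (𝕂 := ℝ) Y (0:ℝ))
  simpa using this

theorem IsOGrp.lie_skew (h : IsOGrp L) {Y : Mat m} (hY : Y ∈ h.lie) : Y.transpose = -Y := by
  have h1 := (hasDeriv_exp Y).mul (hasDeriv_exp Y.transpose)
  have h2 : (fun t : ℝ => exp (t • Y)) * (fun t : ℝ => exp (t • Y.transpose)) = fun _ => 1 := by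
    funext t
    have := h.orth _ (hY t)
    rw [← Matrix.exp_transpose, Matrix.transpose_smul] at this
    exact this
  rw [h2] at h1
  have := h1.unique (hasDerivAt_const (0:ℝ) (1 : Mat m))
  simp at this
  exact (neg_eq_of_add_eq_zero_right this).symm

theorem IsOGrp.inv_eq (h : IsOGrp L) {l : Mat m} (hl : l ∈ L) : l⁻¹ = l.transpose :=
  Matrix.inv_eq_right_inv (h.orth l hl)

theorem IsOGrp.exp_conj (h : IsOGrp L) {l : Mat m} (hl : l ∈ L) (Y : Mat m) :
    exp (l * Y * l.transpose) = l * exp Y * l.transpose := by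
  rw [← h.inv_eq hl]
  exact Matrix.exp_conj l Y ((Matrix.isUnit_iff_isUnit_det l).2
    (Matrix.isUnit_det_of_right_inverse (h.orth l hl)))

theorem IsOGrp.lie_conj (h : IsOGrp L) {l : Mat m} (hl : l ∈ L) {Y : Mat m} (hY : Y ∈ h.lie) :
    l * Y * l.transpose ∈ h.lie := by
  intro t
  have : t • (l * Y * l.transpose) = l * (t • Y) * l.transpose := by simp
  rw [this, h.exp_conj hl]
  exact h.mul _ (h.mul _ hl _ (hY t)) _ (h.tr _ hl)

theorem IsOGrp.exp_tr (h : IsOGrp L) {Y : Mat m} (hY : Y ∈ h.lie) :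
    (exp Y).transpose = exp (-Y) := by
  rw [← Matrix.exp_transpose, h.lie_skew hY]

theorem deriv_bracket (P : Submodule ℝ (Mat m)) (Y X : Mat m)
    (hP : ∀ t : ℝ, exp (t • Y) * X * exp (t • (-Y)) ∈ P) : Y * X - X * Y ∈ P := by
  have h1 := ((hasDeriv_exp Y).mul_const X).mul (hasDeriv_exp (-Y))
  have hcl : IsClosed (P : Set (Mat m)) := P.closed_of_finiteDimensional
  have hs := hasDerivAt_iff_tendsto_slope.1 h1
  have := hcl.mem_of_tendsto hs (Eventually.of_forall fun t => ?_)
  · simpa [sub_eq_add_neg] using this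
  · rw [slope_def_module]
    exact P.smul_mem _ (P.sub_mem (hP _) (hP _))

theorem IsOGrp.lie_bracket (h : IsOGrp L) {Y X : Mat m} (hY : Y ∈ h.lie) (hX : X ∈ h.lie) :
    Y * X - X * Y ∈ h.lie := by
  apply deriv_bracket
  intro t
  have := h.lie_conj (hY t) hX
  rw [h.exp_tr (h.lie.smul_mem t hY)] at this
  simpa using this

/-- stabilizer of a vector -/
def stab (L : Set (Mat m)) (v : Fin m → ℝ) : Set (Mat m) := {l | l ∈ L ∧ l.mulVec v = v}

theorem IsOGrp.stab (h : IsOGrp L) (v : Fin m → ℝ) : IsOGrp (stab L v) where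
  one := ⟨h.one, by simp⟩
  mul a ha b hb := ⟨h.mul _ ha.1 _ hb.1, by rw [← Matrix.mulVec_mulVec, hb.2, ha.2]⟩
  tr a ha := ⟨h.tr _ ha.1, by
    conv_lhs => rw [← ha.2]
    rw [Matrix.mulVec_mulVec, h.orth' ha.1, Matrix.one_mulVec]⟩
  orth a ha := h.orth _ ha.1
  closed := h.closed.inter (isClosed_eq (by fun_prop) continuous_const)

theorem IsOGrp.stab_le (h : IsOGrp L) (v : Fin m → ℝ) : (h.stab v).lie ≤ h.lie :=
  fun Y hY t => (hY t).1

theorem IsOGrp.stab_kill (h : IsOGrp L) (v : Fin m → ℝ) {Y : Mat m} (hY : Y ∈ (h.stab v).lie) :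
    Y.mulVec v = 0 := by
  have h1 := hasDeriv_exp Y
  let T : Mat m →ₗ[ℝ] (Fin m → ℝ) :=
    { toFun := fun A => A.mulVec v
      map_add' := fun A B => Matrix.add_mulVec A B v
      map_smul' := fun c A => Matrix.smul_mulVec c A v }
  have h2 := (LinearMap.toContinuousLinearMap T).hasFDerivAt.comp_hasDerivAt (0:ℝ) h1
  have h3 : ((LinearMap.toContinuousLinearMap T) ∘ fun t : ℝ => exp (t • Y)) = fun _ => v := by
    funext t; exact (hY t).2
  rw [h3] at h2
  exact h2.unique (hasDerivAt_const (0:ℝ) v)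

/-- trace form -/
def ip (A B : Mat m) : ℝ := (A.transpose * B).trace

theorem ip_add_right (A B C : Mat m) : ip A (B + C) = ip A B + ip A C := by
  simp [ip, mul_add]
theorem ip_add_left (A B C : Mat m) : ip (A + B) C = ip A C + ip B C := by
  simp [ip, add_mul]
theorem ip_sub_right (A B C : Mat m) : ip A (B - C) = ip A B - ip A C := by
  simp [ip, mul_sub]
theorem ip_sub_left (A B C : Mat m) : ip (A - B) C = ip A C - ip B C := by
  simp [ip, sub_mul]
theorem ip_smul_right (c : ℝ) (A B : Mat m) : ip A (c • B) = c * ip A B := by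
  simp [ip]
theorem ip_smul_left (c : ℝ) (A B : Mat m) : ip (c • A) B = c * ip A B := by
  simp [ip]
theorem ip_comm (A B : Mat m) : ip A B = ip B A := by
  rw [ip, ip, ← Matrix.trace_transpose]; simp
theorem ip_zero_right (A : Mat m) : ip A 0 = 0 := by simp [ip]
theorem ip_sum_right {ι : Type*} (s : Finset ι) (A : Mat m) (f : ι → Mat m) :
    ip A (∑ i ∈ s, f i) = ∑ i ∈ s, ip A (f i) := by
  simp [ip, Finset.mul_sum, Matrix.trace_sum]
theorem ip_eq_sum (A B : Mat m) : ip A B = ∑ j, ∑ i, A i j * B i j := by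
  simp [ip, Matrix.trace, Matrix.mul_apply]
theorem ip_self_eq_zero {A : Mat m} (h : ip A A = 0) : A = 0 := by
  rw [ip_eq_sum] at h
  ext i j
  have h1 := (Finset.sum_eq_zero_iff_of_nonneg (fun j _ =>
    Finset.sum_nonneg fun i _ => mul_self_nonneg (A i j))).1 h j (Finset.mem_univ _)
  have h2 := (Finset.sum_eq_zero_iff_of_nonneg (fun i _ => mul_self_nonneg (A i j))).1 h1 i
    (Finset.mem_univ _)
  simpa using h2

theorem ip_conj {l : Mat m} (hl : l.transpose * l = 1) (A B : Mat m) :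
    ip (l * A * l.transpose) (l * B * l.transpose) = ip A B := by
  have : (l * A * l.transpose).transpose * (l * B * l.transpose) =
      l * (A.transpose * B) * l.transpose := by
    simp only [Matrix.transpose_mul, Matrix.transpose_transpose]
    calc _ = l * A.transpose * (l.transpose * l) * B * l.transpose := by simp only [mul_assoc]
      _ = _ := by rw [hl]; simp [mul_assoc]
  rw [ip, ip, this, Matrix.trace_mul_comm, ← mul_assoc, hl, one_mul]

theorem ip_bracket {Y : Mat m} (hY : Y.transpose = -Y) (A B : Mat m) :
    ip (Y * A - A * Y) B = - ip A (Y * B - B * Y) := by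
  simp only [ip, Matrix.transpose_sub, Matrix.transpose_mul, hY, mul_sub, sub_mul, Matrix.trace_sub,
    mul_neg, neg_mul, Matrix.trace_neg]
  have e1 : (A.transpose * (B * Y)).trace = (Y * A.transpose * B).trace := by
    rw [← mul_assoc, Matrix.trace_mul_comm, mul_assoc]
  rw [e1, ← mul_assoc]
  ring

theorem exists_onb (W : Submodule ℝ (Mat m)) : ∃ B : Fin (Module.finrank ℝ W) → Mat m,
    (∀ i, B i ∈ W) ∧ (∀ i j, ip (B i) (B j) = if i = j then 1 else 0) ∧
    ∀ A ∈ W, A = ∑ i, ip (B i) A • B i := by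
  let e : Mat m ≃ₗ[ℝ] EuclideanSpace ℝ (Fin m × Fin m) :=
    (LinearEquiv.curry ℝ ℝ (Fin m) (Fin m)).symm ≪≫ₗ (WithLp.linearEquiv 2 ℝ (Fin m × Fin m → ℝ)).symm
  have hin : ∀ A B : Mat m, inner ℝ (e A) (e B) = ip A B := by
    intro A B
    rw [ip_eq_sum, Finset.sum_comm, PiLp.inner_apply, ← Finset.univ_product_univ, Finset.sum_product]
    refine Finset.sum_congr rfl fun i _ => Finset.sum_congr rfl fun j _ => ?_
    simp [e, mul_comm]
    rfl
  let W' := W.map (e : Mat m →ₗ[ℝ] EuclideanSpace ℝ (Fin m × Fin m))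
  have hfr : Module.finrank ℝ W' = Module.finrank ℝ W := LinearEquiv.finrank_map_eq e W
  let b := (stdOrthonormalBasis ℝ W').reindex (finCongr hfr)
  have hb : ∀ i, ∃ A ∈ W, e A = (b i : EuclideanSpace ℝ (Fin m × Fin m)) := fun i => (b i).2
  choose B hBW hB using hb
  refine ⟨B, hBW, ?_, ?_⟩
  · intro i j
    rw [← hin, hB, hB, ← Submodule.coe_inner]
    exact orthonormal_iff_ite.1 b.orthonormal i j
  · intro A hA
    apply e.injective
    have := b.sum_repr' ⟨e A, ⟨A, hA, rfl⟩⟩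
    have h2 := congrArg Subtype.val this
    rw [map_sum]
    simp only [map_smul, ← hin, hB]
    simp [Submodule.coe_inner] at h2
    exact h2.symm

end
end DistalA
end

section
set_option linter.all false

namespace DistalA

open Filter Topology NormedSpace
open scoped Matrix.Norms.L2Operator

section
variable {m : ℕ} {L : Set (Mat m)}

/-- orthogonal complement of a subspace for the trace form -/
def ipPerp (W : Submodule ℝ (Mat m)) : Submodule ℝ (Mat m) where
  carrier := {A | ∀ Y ∈ W, ip Y A = 0}
  zero_mem' := fun Y _ => ip_zero_right Y
  add_mem' := fun {A B} hA hB Y hY => by rw [ip_add_right, hA Y hY, hB Y hY, add_zero]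
  smul_mem' := fun c A hA Y hY => by rw [ip_smul_right, hA Y hY, mul_zero]

/-- the complement of the stabilizer algebra -/
def IsOGrp.mp (h : IsOGrp L) (v : Fin m → ℝ) : Submodule ℝ (Mat m) :=
  h.lie ⊓ ipPerp (h.stab v).lie

theorem IsOGrp.mp_le (h : IsOGrp L) (v : Fin m → ℝ) : h.mp v ≤ h.lie := inf_le_left

theorem IsOGrp.le_sup_mp (h : IsOGrp L) (v : Fin m → ℝ) : h.lie ≤ (h.stab v).lie ⊔ h.mp v := by
  intro A hA
  obtain ⟨B, hB, hon, hsum⟩ := exists_onb (h.stab v).lie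
  set P := ∑ i, ip (B i) A • B i with hP
  have hPm : P ∈ (h.stab v).lie := Submodule.sum_mem _ fun i _ => Submodule.smul_mem _ _ (hB i)
  refine Submodule.mem_sup.2 ⟨P, hPm, A - P, ⟨h.lie.sub_mem hA (h.stab_le v hPm), ?_⟩, by abel⟩
  intro Y hY
  have hBi : ∀ i, ip (B i) (A - P) = 0 := by
    intro i
    rw [ip_sub_right, hP, ip_sum_right]
    simp [ip_smul_right, hon]
  rw [hsum Y hY, ip_comm, ip_sum_right]
  refine Finset.sum_eq_zero fun i _ => ?_
  rw [ip_smul_right, ip_comm (A - P), hBi, mul_zero]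

theorem IsOGrp.disj_mp (h : IsOGrp L) (v : Fin m → ℝ) : Disjoint (h.stab v).lie (h.mp v) := by
  rw [Submodule.disjoint_def]
  intro A hA hA'
  exact ip_self_eq_zero (hA'.2 A hA)

theorem IsOGrp.mp_bracket (h : IsOGrp L) (v : Fin m → ℝ) {Y X : Mat m} (hY : Y ∈ (h.stab v).lie)
    (hX : X ∈ h.mp v) : Y * X - X * Y ∈ h.mp v := by
  refine ⟨h.lie_bracket (h.stab_le v hY) hX.1, fun Z hZ => ?_⟩
  have := ip_bracket (h.lie_skew (h.stab_le v hY)) Z X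
  rw [eq_neg_iff_add_eq_zero, add_eq_zero_iff_neg_eq] at this
  rw [← this, hX.2 _ ((h.stab v).lie_bracket hY hZ), neg_zero]

theorem orth_dot {l : Mat m} (hl : l.transpose * l = 1) (u : Fin m → ℝ) :
    l.mulVec u ⬝ᵥ l.mulVec u = u ⬝ᵥ u := by
  rw [Matrix.dotProduct_mulVec, Matrix.vecMul_mulVec, hl, Matrix.vecMul_one]

theorem IsOGrp.orbit_small (h : IsOGrp L) (v : Fin m → ℝ) : ∃ δ > 0, ∀ l ∈ L,
    (l.mulVec v - v) ⬝ᵥ (l.mulVec v - v) < δ → ∃ X ∈ h.mp v, l.mulVec v = (exp X).mulVec v := by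
  obtain ⟨ε, hε, hc⟩ := h.cover3 _ _ (h.stab_le v) (h.mp_le v) (h.le_sup_mp v)
  by_contra hcon
  push Not at hcon
  have : ∀ k : ℕ, ∃ l ∈ L, (l.mulVec v - v) ⬝ᵥ (l.mulVec v - v) < 1 / ((k:ℝ) + 1) ∧
    ∀ X ∈ h.mp v, l.mulVec v ≠ (exp X).mulVec v := fun k => hcon _ (by positivity)
  choose l hl hlt hne using this
  obtain ⟨g, hg, φ, hφ, hlim⟩ := h.compact.tendsto_subseq hl
  have hgv : g.mulVec v = v := by
    have c : Continuous fun l : Mat m => (l.mulVec v - v) ⬝ᵥ (l.mulVec v - v) := by fun_prop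
    have h1 := (c.tendsto g).comp hlim
    have h2 : Tendsto (fun k => (1:ℝ) / ((φ k : ℝ) + 1)) atTop (𝓝 0) :=
      (tendsto_one_div_add_atTop_nhds_zero_nat (𝕜 := ℝ)).comp hφ.tendsto_atTop
    have h3 := le_of_tendsto_of_tendsto' h1 h2 fun k => (hlt _).le
    have h4 : (g.mulVec v - v) ⬝ᵥ (g.mulVec v - v) = 0 :=
      le_antisymm h3 (Finset.sum_nonneg fun i _ => mul_self_nonneg _)
    exact sub_eq_zero.1 (dotProduct_self_eq_zero.1 h4)
  have c : Continuous fun l : Mat m => g * l.transpose := by fun_prop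
  have h1 := (c.tendsto g).comp hlim
  rw [h.orth g hg] at h1
  obtain ⟨k, hk⟩ := ((Metric.tendsto_nhds.1 h1) ε hε).exists
  rw [dist_eq_norm] at hk
  obtain ⟨Y, hY, X, hX, he⟩ := hc _ (h.mul _ hg _ (h.tr _ (hl (φ k)))) hk
  refine hne (φ k) (-X) ((h.mp v).neg_mem hX) ?_
  have e1 : l (φ k) * g.transpose = exp (-X) * exp (-Y) := by
    rw [← h.exp_tr (h.mp_le v hX), ← h.exp_tr (h.stab_le v hY), ← Matrix.transpose_mul, ← he]
    simp
  have e2 : g.transpose.mulVec v = v := ((h.stab v).tr g ⟨hg, hgv⟩).2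
  have e3 : (exp (-Y)).mulVec v = v := ((h.stab v).exp_mem ((h.stab v).lie.neg_mem hY)).2
  calc (l (φ k)).mulVec v = (l (φ k) * g.transpose).mulVec v := by
        rw [← Matrix.mulVec_mulVec, e2]
    _ = _ := by rw [e1, ← Matrix.mulVec_mulVec, e3]

theorem IsOGrp.kill (h : IsOGrp L) (v : Fin m → ℝ)
    (hconn : IsPreconnected ((fun l : Mat m => l.mulVec v) '' L))
    {Y : Mat m} (hY : ∀ X ∈ h.mp v, Y * X = X * Y) (hYv : Y.mulVec v = 0) :
    ∀ l ∈ L, Y.mulVec (l.mulVec v) = 0 := by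
  obtain ⟨δ, hδ, hsm⟩ := h.orbit_small v
  let D := Submonoid.closure ((fun X : Mat m => exp X) '' (h.mp v : Set (Mat m)))
  have hDL : ∀ d ∈ D, d ∈ L := by
    intro d hd
    induction hd using Submonoid.closure_induction with
    | mem x hx => obtain ⟨X, hX, rfl⟩ := hx; exact h.exp_mem (h.mp_le v hX)
    | one => exact h.one
    | mul x y _ _ hx hy => exact h.mul _ hx _ hy
  have hDc : ∀ d ∈ D, Commute Y d := by
    intro d hd
    induction hd using Submonoid.closure_induction with
    | mem x hx =>
      obtain ⟨X, hX, rfl⟩ := hx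
      exact (show Commute Y X from hY X hX).exp_right
    | one => exact Commute.one_right _
    | mul x y _ _ hx hy => exact hx.mul_right hy
  let q : (Fin m → ℝ) → ℝ := fun u => u ⬝ᵥ u
  have hqc : Continuous q := by fun_prop
  have hqs : ∀ u w, q (u - w) = q (w - u) := by
    intro u w; simp only [q]; rw [← neg_sub w u, neg_dotProduct_neg]
  set M := (fun l : Mat m => l.mulVec v) '' L with hM
  let u : Set (Fin m → ℝ) := {w | ∃ d ∈ D, w = d.mulVec v}
  have hstep : ∀ w ∈ u, ∀ w' ∈ M, q (w' - w) < δ → w' ∈ u := by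
    rintro _ ⟨d, hd, rfl⟩ _ ⟨l, hl, rfl⟩ hlt
    obtain ⟨X, hX, he⟩ := hsm (d.transpose * l) (h.mul _ (h.tr _ (hDL d hd)) _ hl) (by
      have e : (d.transpose * l).mulVec v - v = d.transpose.mulVec (l.mulVec v - d.mulVec v) := by
        rw [Matrix.mulVec_sub, Matrix.mulVec_mulVec, Matrix.mulVec_mulVec, h.orth' (hDL d hd)]; simp
      rw [e, orth_dot (by simpa using h.orth d (hDL d hd))]
      exact hlt)
    refine ⟨d * exp X, D.mul_mem hd (Submonoid.subset_closure ⟨X, hX, rfl⟩), ?_⟩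
    rw [← Matrix.mulVec_mulVec, ← he, Matrix.mulVec_mulVec, ← mul_assoc, h.orth d (hDL d hd), one_mul]
  have hnb : ∀ w, IsOpen {x | q (x - w) < δ} := fun w =>
    isOpen_lt (hqc.comp (continuous_id.sub continuous_const)) continuous_const
  have hself : ∀ w, q (w - w) < δ := by intro w; simpa [q] using hδ
  let U : Set (Fin m → ℝ) := ⋃ w ∈ u, {x | q (x - w) < δ}
  let V : Set (Fin m → ℝ) := ⋃ w ∈ M \ u, {x | q (x - w) < δ}
  have hMu : M ⊆ u := by
    have := (isPreconnected_iff_subset_of_disjoint.1 hconn) U V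
      (isOpen_biUnion fun w _ => hnb w) (isOpen_biUnion fun w _ => hnb w) ?_ ?_
    · rcases this with h1 | h1
      · intro w hw
        obtain ⟨w', hw', hlt⟩ := Set.mem_iUnion₂.1 (h1 hw)
        exact hstep w' hw' w hw hlt
      · exfalso
        have hv : v ∈ M := ⟨1, h.one, by simp⟩
        have hvu : v ∈ u := ⟨1, D.one_mem, by simp⟩
        obtain ⟨w', hw', hlt⟩ := Set.mem_iUnion₂.1 (h1 hv)
        exact hw'.2 (hstep v hvu w' hw'.1 (by rw [hqs]; exact hlt))
    · intro w hw
      by_cases hwu : w ∈ u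
      · exact Or.inl (Set.mem_iUnion₂.2 ⟨w, hwu, hself w⟩)
      · exact Or.inr (Set.mem_iUnion₂.2 ⟨w, ⟨hw, hwu⟩, hself w⟩)
    · rw [Set.eq_empty_iff_forall_notMem]
      rintro w ⟨hw, h1, h2⟩
      obtain ⟨w1, hw1, hlt1⟩ := Set.mem_iUnion₂.1 h1
      obtain ⟨w2, hw2, hlt2⟩ := Set.mem_iUnion₂.1 h2
      have := hstep w1 hw1 w hw hlt1
      exact hw2.2 (hstep w this w2 hw2.1 (by rw [hqs]; exact hlt2))
  intro l hl
  obtain ⟨d, hd, he⟩ := hMu ⟨l, hl, rfl⟩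
  have he : l.mulVec v = d.mulVec v := he
  rw [he, Matrix.mulVec_mulVec, (hDc d hd).eq, ← Matrix.mulVec_mulVec, hYv, Matrix.mulVec_zero]

theorem IsOGrp.inj_small (h : IsOGrp L) (v : Fin m → ℝ) : ∃ ε > 0, ∀ X ∈ h.mp v, ∀ X' ∈ h.mp v,
    ‖X‖ < ε → ‖X'‖ < ε → (exp X).mulVec v = (exp X').mulVec v → X = X' := by
  have hH := h.stab v
  obtain ⟨M, hmM, hM⟩ := (h.disj_mp v).symm.exists_isCompl
  obtain ⟨Φ, h0, hΦ, hΦL⟩ := (h.stab v).chart M hM.symm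
  have hev : ∀ᶠ q : M × M in 𝓝 (0, 0),
      exp (-(q.2 : Mat m)) * exp (q.1 : Mat m) ∈ Φ.target ∧
      ((Φ.symm (exp (-(q.2 : Mat m)) * exp (q.1 : Mat m))).1, -q.1) ∈ Φ.source ∧
      ((0 : (h.stab v).lie), -q.2) ∈ Φ.source := by
    have c1 : Continuous fun q : M × M => exp (-(q.2 : Mat m)) * exp (q.1 : Mat m) :=
      (mexp_cont.comp (continuous_subtype_val.comp continuous_snd).neg).mul
        (mexp_cont.comp (continuous_subtype_val.comp continuous_fst))
    have e1 : exp (-(((0, 0) : M × M).2 : Mat m)) * exp (((0, 0) : M × M).1 : Mat m) = Φ (0, 0) := by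
      rw [hΦ]; simp
    have t1 : ∀ᶠ q : M × M in 𝓝 (0, 0), exp (-(q.2 : Mat m)) * exp (q.1 : Mat m) ∈ Φ.target := by
      apply c1.continuousAt.eventually_mem
      rw [e1]
      exact Φ.open_target.mem_nhds (Φ.map_source h0)
    have c2 : ContinuousAt (fun q : M × M =>
        ((Φ.symm (exp (-(q.2 : Mat m)) * exp (q.1 : Mat m))).1, -q.1)) (0, 0) := by
      refine ContinuousAt.prodMk ?_ continuous_fst.neg.continuousAt
      refine continuous_fst.continuousAt.comp ?_
      refine ContinuousAt.comp (g := Φ.symm) ?_ c1.continuousAt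
      rw [e1]
      exact Φ.symm.continuousAt (Φ.map_source h0)
    have t2 := c2.eventually_mem (s := Φ.source) (by
      rw [e1, Φ.left_inv h0]
      simpa using Φ.open_source.mem_nhds h0)
    have c3 : Continuous (fun q : M × M => ((0 : (h.stab v).lie), -q.2)) := by fun_prop
    have t3 := (c3.continuousAt (x := (0, 0))).eventually_mem (s := Φ.source)
      (by simpa using Φ.open_source.mem_nhds h0)
    exact t1.and (t2.and t3)
  obtain ⟨ε, hε, hball⟩ := Metric.eventually_nhds_iff.1 hev
  refine ⟨ε, hε, fun X hX X' hX' hn hn' he => ?_⟩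
  obtain ⟨b1, b2, b3⟩ := @hball (⟨X, hmM hX⟩, ⟨X', hmM hX'⟩) (by
      rw [dist_eq_norm, Prod.norm_def]
      simpa using ⟨hn, hn'⟩)
  simp only at b1 b2 b3
  set g := exp (-X') * exp X with hg
  have hgH : g ∈ DistalA.stab L v := by
    refine ⟨h.mul _ (h.exp_mem (h.lie.neg_mem (h.mp_le v hX'))) _ (h.exp_mem (h.mp_le v hX)), ?_⟩
    rw [hg, ← Matrix.mulVec_mulVec, he, Matrix.mulVec_mulVec, mexp_neg_mul, Matrix.one_mulVec]
  have hx0 : (Φ.symm g).2 = 0 := hΦL _ (Φ.map_target b1) (by rw [Φ.right_inv b1]; exact hgH)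
  have hke : g = exp ((Φ.symm g).1 : Mat m) := by
    conv_lhs => rw [← Φ.right_inv b1, hΦ, hx0]
    simp
  have hinj := Φ.injOn b2 b3 (by
    rw [hΦ, hΦ]
    show exp ((Φ.symm g).1 : Mat m) * exp (-X) =
      exp (((0 : (h.stab v).lie) : (h.stab v).lie) : Mat m) * exp (-X')
    rw [← hke, hg, mul_assoc, mexp_mul_neg]; simp)
  have := congrArg (fun p => (p.2 : Mat m)) hinj
  simpa using this

end
end DistalA
end

section
set_option linter.all false

namespace DistalA

open Filter Topology Set NormedSpace
open scoped Matrix.Norms.L2Operator Matrix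

section Absolute
variable {Γ : Type*} [Group Γ] {S : Type*} [MetricSpace S] [CompactSpace S] [MulAction Γ S]
  [ContinuousConstSMul Γ S]

variable (Γ) in
/-- an isometric factor given by an orthogonal representation -/
structure Abs (m : ℕ) (F : S → Fin m → ℝ) (ρ : Γ →* Mat m) (L : Set (Mat m)) (x0 : S) : Prop where
  grp : IsOGrp L
  cont : Continuous F
  mem : ∀ g, ρ g ∈ L
  equi : ∀ g a, F (g • a) = ρ g *ᵥ F a
  rng : range F = (fun l : Mat m => l *ᵥ F x0) '' L
  nontriv : ∃ a b, F a ≠ F b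
  span : ∀ w : Fin m → ℝ, (∀ a, w ⬝ᵥ F a = 0) → w = 0

theorem DM.abs (hD : DM Γ S) (hne : ∃ x y : S, x ≠ y) : ∃ m F, ∃ (ρ : Γ →* Mat m), ∃ L x0,
    Abs Γ (S := S) m F ρ L x0 := by
  have hu : IsCIE Γ (univ : Set (S × S)) :=
    { closed := isClosed_univ, inv := fun _ _ _ => trivial, refl := fun _ => trivial,
      symm := fun _ _ _ => trivial, trans := fun _ _ _ _ _ => trivial }
  obtain ⟨x0, y0, hxy⟩ := hne
  obtain ⟨m, F, τ, L, h⟩ := hD.exists_step hu ⟨x0, y0, trivial, hxy⟩ x0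
  have hGE : ∀ g : Γ, (fun x : S => g • x) ∈ GE Γ (univ : Set (S × S)) x0 := fun g => ⟨El_smul g, trivial⟩
  have hF : Continuous F := by
    have hG : IsClosed {p : S × (Fin m → ℝ) | F p.1 = p.2} := by
      have := h.closedF.preimage (f := fun p : S × (Fin m → ℝ) => ((id : S → S), p.1, p.2))
        (by fun_prop)
      convert this using 1
      ext p
      constructor
      · intro hp
        exact ⟨El_id, p.1, trivial, rfl, hp⟩
      · rintro ⟨-, a, -, ha, hb⟩
        have ha : a = p.1 := ha
        subst ha
        exact hb
    obtain ⟨C, hC⟩ := h.bdd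
    have hGc : IsCompact {p : S × (Fin m → ℝ) | F p.1 = p.2} := by
      refine (isCompact_univ.prod (isCompact_closedBall (0 : Fin m → ℝ) C)).of_isClosed_subset hG ?_
      intro p hp
      refine ⟨trivial, ?_⟩
      rw [mem_closedBall_zero_iff, ← show F p.1 = p.2 from hp]
      exact hC _ trivial
    rw [continuous_iff_isClosed]
    intro K hK
    have : F ⁻¹' K = Prod.fst '' ({p : S × (Fin m → ℝ) | F p.1 = p.2} ∩ Prod.snd ⁻¹' K) := by
      ext x
      constructor
      · intro hx; exact ⟨(x, F x), ⟨rfl, hx⟩, rfl⟩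
      · rintro ⟨p, ⟨hp, hK⟩, rfl⟩
        have hp : F p.1 = p.2 := hp
        rw [mem_preimage, hp]; exact hK
    rw [this]
    exact ((hGc.inter_right (hK.preimage continuous_snd)).image continuous_fst).isClosed
  have heq : ∀ q ∈ GE Γ (univ : Set (S × S)) x0, ∀ a, F (q a) = τ q *ᵥ F a :=
    fun q hq a => h.equi q hq a trivial
  have hτ1 : τ id = 1 := by
    have h1 : (id : S → S) ∈ GE Γ (univ : Set (S × S)) x0 := ⟨El_id, trivial⟩
    have h2 := h.mul _ h1 _ h1
    have hL : τ id ∈ L := by rw [h.img]; exact ⟨_, h1, rfl⟩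
    have h3 := congrArg (fun z => (τ id)ᵀ * z) h2
    simp only [Function.comp_id, ← mul_assoc, h.grp.orth' hL, one_mul] at h3
    exact h3.symm
  let ρ : Γ →* Mat m :=
    { toFun := fun g => τ (fun x => g • x)
      map_one' := by
        have : (fun x : S => (1 : Γ) • x) = id := by funext x; simp
        rw [this]; exact hτ1
      map_mul' := fun g k => by
        rw [← h.mul _ (hGE g) _ (hGE k)]
        congr 1
        funext x; simp [mul_smul] }
  refine ⟨m, F, ρ, L, x0, h.grp, hF, fun g => ?_, fun g a => heq _ (hGE g) a, ?_, ?_, ?_⟩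
  · rw [h.img]; exact ⟨_, hGE g, rfl⟩
  · ext w
    constructor
    · rintro ⟨a, rfl⟩
      obtain ⟨p, hp, rfl⟩ := hD.trans x0 a
      refine ⟨τ p, ?_, (heq p ⟨hp, trivial⟩ x0).symm⟩
      rw [h.img]; exact ⟨p, ⟨hp, trivial⟩, rfl⟩
    · rintro ⟨l, hl, rfl⟩
      rw [h.img] at hl
      obtain ⟨p, hp, rfl⟩ := hl
      exact ⟨p x0, heq p hp x0⟩
  · obtain ⟨a, b, -, -, hab⟩ := h.nontriv
    exact ⟨a, b, hab⟩
  · exact fun w hw => h.span w fun a _ => hw a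

variable {m : ℕ} {F : S → Fin m → ℝ} {ρ : Γ →* Mat m} {L : Set (Mat m)} {x0 : S}

theorem Abs.no_three [ChartedSpace (EuclideanSpace ℝ (Fin 2)) S] (hD : DM Γ S)
    (h : Abs Γ m F ρ L x0) (B : Fin 3 → Mat m) (hB : ∀ i, B i ∈ h.grp.mp (F x0))
    (hon : ∀ i j, ip (B i) (B j) = if i = j then 1 else 0) : False := by
  obtain ⟨ε, hε, hinj⟩ := h.grp.inj_small (F x0)
  let K := 1 + ∑ i, ‖B i‖
  have hK : 0 < K := by positivity
  let T : X3 → Mat m := fun t => (ε / (2 * K)) • ∑ i, t i • B i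
  have hT : Continuous T := by fun_prop
  have hTm : ∀ t, T t ∈ h.grp.mp (F x0) := fun t => Submodule.smul_mem _ _
    (Submodule.sum_mem _ fun i _ => Submodule.smul_mem _ _ (hB i))
  have hTn : ∀ t ∈ Icc (0 : X3) 1, ‖T t‖ < ε := by
    intro t ht
    have h1 : ‖∑ i, t i • B i‖ ≤ ∑ i, ‖B i‖ := by
      refine norm_sum_le_of_le _ fun i _ => ?_
      rw [norm_smul, Real.norm_of_nonneg (ht.1 i)]
      exact mul_le_of_le_one_left (norm_nonneg _) (ht.2 i)
    have h2 : ‖∑ i, t i • B i‖ ≤ K := by simp only [K]; linarith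
    rw [norm_smul, Real.norm_of_nonneg (by positivity)]
    calc ε / (2 * K) * ‖∑ i, t i • B i‖ ≤ ε / (2 * K) * K := by gcongr
      _ = ε / 2 := by field_simp
      _ < ε := by linarith
  have hTi : ∀ t t', T t = T t' → t = t' := by
    intro t t' he
    funext j
    have h1 : ∀ t, ip (B j) (T t) = (ε / (2 * K)) * t j := by
      intro t
      simp only [T, ip_smul_right, ip_sum_right, hon]
      simp
    have h2 := h1 t
    rw [he, h1 t'] at h2
    exact (mul_left_cancel₀ (by positivity) h2).symm
  let r : Set (S × S) := {z | F z.1 = F z.2}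
  let C : Set (X3 × S) := {z | z.1 ∈ Icc (0 : X3) 1 ∧ F z.2 = exp (T z.1) *ᵥ F x0}
  refine no_fam hD (r := r) (C := C) ?_ ?_
  · refine ⟨⟨?_, ?_, ?_, ?_, ?_⟩, ?_, fun z hz => hz.1, ?_⟩
    · exact isClosed_eq (h.cont.comp continuous_fst) (h.cont.comp continuous_snd)
    · intro g z hz
      have hz : F z.1 = F z.2 := hz
      show F (g • z.1) = F (g • z.2)
      rw [h.equi, h.equi, hz]
    · exact fun x => rfl
    · exact fun x y hxy => Eq.symm hxy
    · exact fun x y z hxy hyz => Eq.trans hxy hyz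
    · have hc : Continuous fun z : X3 × S => exp (T z.1) *ᵥ F x0 := by
        have : Continuous fun z : X3 × S => exp (T z.1) := mexp_cont.comp (hT.comp continuous_fst)
        exact this.matrix_mulVec continuous_const
      exact (isClosed_Icc.preimage continuous_fst).inter
        (isClosed_eq (h.cont.comp continuous_snd) hc)
    · intro t ht
      have : exp (T t) *ᵥ F x0 ∈ range F := by
        rw [h.rng]
        exact ⟨_, h.grp.exp_mem (h.grp.mp_le _ (hTm t)), rfl⟩
      obtain ⟨x, hx⟩ := this
      refine ⟨x, fun y => ⟨fun hy => ?_, fun hy => ⟨ht, ?_⟩⟩⟩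
      · exact hx.trans hy.2.symm
      · exact (Eq.symm hy).trans hx
  · rintro t t' x ⟨h1, h2⟩ ⟨h3, h4⟩
    exact hTi _ _ (hinj _ (hTm t) _ (hTm t') (hTn t h1) (hTn t' h3) (h2.symm.trans h4))

theorem Abs.dim_le [ConnectedSpace S] [ChartedSpace (EuclideanSpace ℝ (Fin 2)) S] (hD : DM Γ S)
    (h : Abs Γ m F ρ L x0) : Module.finrank ℝ h.grp.lie ≤ 3 := by
  set v := F x0 with hv
  have hconn : IsPreconnected ((fun l : Mat m => l *ᵥ v) '' L) := by
    rw [← h.rng]; exact isPreconnected_range h.cont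
  obtain ⟨B, hB, hon, hsum⟩ := exists_onb (h.grp.mp v)
  by_cases hk : 3 ≤ Module.finrank ℝ (h.grp.mp v)
  · exact (h.no_three hD (fun i => B (Fin.castLE hk i)) (fun i => hB _) (fun i j => by
      rw [hon]; simp)).elim
  · push Not at hk
    let X : ℕ → Mat m := fun i => if hi : i < Module.finrank ℝ (h.grp.mp v) then B ⟨i, hi⟩ else 0
    have hX : ∀ i, X i ∈ h.grp.mp v := by
      intro i; simp only [X]; split_ifs
      · exact hB _
      · exact Submodule.zero_mem _
    have hsp : ∀ A ∈ h.grp.mp v, ∃ a b : ℝ, A = a • X 0 + b • X 1 := by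
      intro A hA
      have h1 : A ∈ Submodule.span ℝ {X 0, X 1} := by
        rw [hsum A hA]
        refine Submodule.sum_mem _ fun i _ => Submodule.smul_mem _ _ ?_
        have : B i = X i.1 := by simp [X]
        rw [this]
        have : i.1 = 0 ∨ i.1 = 1 := by omega
        rcases this with h | h <;> rw [h] <;> exact Submodule.subset_span (by simp)
      obtain ⟨a, b, hab⟩ := Submodule.mem_span_pair.1 h1
      exact ⟨a, b, hab.symm⟩
    have hspan : h.grp.mp v ≤ Submodule.span ℝ (range ![X 0, X 1]) := by
      intro A hA
      obtain ⟨a, b, rfl⟩ := hsp A hA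
      exact Submodule.add_mem _ (Submodule.smul_mem _ _ (Submodule.subset_span ⟨0, rfl⟩))
        (Submodule.smul_mem _ _ (Submodule.subset_span ⟨1, rfl⟩))
    have hm2 : Module.finrank ℝ (h.grp.mp v) ≤ 2 := by omega
    let H := (h.grp.stab v).lie
    let f : H →ₗ[ℝ] ℝ :=
      { toFun := fun Y => ip (Y * X 0 - X 0 * Y : Mat m) (X 1)
        map_add' := fun Y Z => by
          simp only [Submodule.coe_add, add_mul, mul_add, ip_sub_left, ip_add_left]; ring
        map_smul' := fun c Y => by
          simp only [Submodule.coe_smul, smul_mul_assoc, mul_smul_comm, ← smul_sub, ip_smul_left]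
          simp }
    have hf : Function.Injective f := by
      rw [← LinearMap.ker_eq_bot, LinearMap.ker_eq_bot']
      rintro ⟨Y, hY⟩ hfY
      have hfY : ip (Y * X 0 - X 0 * Y) (X 1) = 0 := hfY
      have hsk := h.grp.lie_skew (h.grp.stab_le v hY)
      have hdiag : ∀ A : Mat m, ip (Y * A - A * Y) A = 0 := by
        intro A
        have := ip_bracket hsk A A
        rw [ip_comm A] at this
        linarith
      have hz : ∀ A ∈ h.grp.mp v, ip A (X 0) = 0 → ip A (X 1) = 0 → A = 0 := by
        intro A hA h0 h1
        obtain ⟨a, b, hab⟩ := hsp A hA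
        apply ip_self_eq_zero
        conv_lhs => rhs; rw [hab]
        rw [ip_add_right, ip_smul_right, ip_smul_right, h0, h1]; simp
      have c0 : Y * X 0 - X 0 * Y = 0 := hz _ (h.grp.mp_bracket v hY (hX 0)) (hdiag _) hfY
      have c1 : Y * X 1 - X 1 * Y = 0 := hz _ (h.grp.mp_bracket v hY (hX 1)) (by
        rw [ip_bracket hsk, ip_comm, hfY, neg_zero]) (hdiag _)
      have hcomm : ∀ A ∈ h.grp.mp v, Y * A = A * Y := by
        intro A hA
        obtain ⟨a, b, rfl⟩ := hsp A hA
        rw [mul_add, add_mul, mul_smul_comm, mul_smul_comm, smul_mul_assoc, smul_mul_assoc,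
          sub_eq_zero.1 c0, sub_eq_zero.1 c1]
      have hkill := h.grp.kill v hconn hcomm (h.grp.stab_kill v hY)
      have : Y = 0 := by
        ext i j
        have := h.span (Y i) (fun a => ?_)
        · rw [this]; rfl
        · have hr : F a ∈ range F := ⟨a, rfl⟩
          rw [h.rng] at hr
          obtain ⟨l, hl, he⟩ := hr
          rw [← he]
          exact congrFun (hkill l hl) i
      exact Subtype.ext this
    have hH1 : Module.finrank ℝ H ≤ 1 := by
      have := LinearMap.finrank_le_finrank_of_injective hf
      simpa using this
    calc Module.finrank ℝ h.grp.lie ≤ Module.finrank ℝ (H ⊔ h.grp.mp v : Submodule ℝ (Mat m)) :=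
          Submodule.finrank_mono (h.grp.le_sup_mp v)
      _ ≤ Module.finrank ℝ H + Module.finrank ℝ (h.grp.mp v) :=
          Submodule.finrank_add_le_finrank_add_finrank _ _
      _ ≤ 3 := by omega

end Absolute
end DistalA
end

section
set_option linter.all false

namespace DistalA

open Filter Topology Set NormedSpace
open scoped Matrix.Norms.L2Operator Matrix

section Groups
variable {Γ : Type*} [Group Γ] {m : ℕ} {ρ : Γ →* Mat m} {L : Set (Mat m)}

theorem IsOGrp.norm_le (h : IsOGrp L) {a : Mat m} (ha : a ∈ L) : ‖a‖ ≤ 1 := by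
  have h2 : star a * a = 1 := by
    simpa [Matrix.star_eq_conjTranspose] using h.orth' ha
  have := CStarRing.norm_star_mul_self (x := a)
  rw [h2] at this
  have h1 : ‖(1 : Mat m)‖ ≤ 1 := by
    rcases isEmpty_or_nonempty (Fin m) with he | he
    · have : (1 : Mat m) = 0 := Subsingleton.elim _ _
      rw [this]; simp
    · simp
  nlinarith [norm_nonneg a]

theorem IsOGrp.map_inv (h : IsOGrp L) (hρ : ∀ g, ρ g ∈ L) (g : Γ) : ρ g⁻¹ = (ρ g)ᵀ := by
  have h1 : ρ g⁻¹ * ρ g = 1 := by rw [← map_mul]; simp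
  calc ρ g⁻¹ = ρ g⁻¹ * (ρ g * (ρ g)ᵀ) := by rw [h.orth _ (hρ g), mul_one]
    _ = _ := by rw [← mul_assoc, h1, one_mul]

/-- elements commuting with the centralizer of a subspace -/
def dcent (ρ : Γ →* Mat m) (W : Set (Mat m)) : Subgroup Γ where
  carrier := {g | ∀ Z : Mat m, (∀ A ∈ W, Commute Z A) → Commute Z (ρ g)}
  one_mem' := fun Z _ => by rw [map_one]; exact Commute.one_right Z
  mul_mem' := fun {a b} ha hb Z hZ => by rw [map_mul]; exact (ha Z hZ).mul_right (hb Z hZ)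
  inv_mem' := fun {a} ha Z hZ => by
    have h1 : ρ a⁻¹ * ρ a = 1 := by rw [← map_mul]; simp
    have h2 : ρ a * ρ a⁻¹ = 1 := by rw [← map_mul]; simp
    have h3 : Z * ρ a = ρ a * Z := ha Z hZ
    show Z * ρ a⁻¹ = ρ a⁻¹ * Z
    calc Z * ρ a⁻¹ = ρ a⁻¹ * (ρ a * Z) * ρ a⁻¹ := by rw [← mul_assoc (ρ a⁻¹), h1, one_mul]
      _ = ρ a⁻¹ * Z * (ρ a * ρ a⁻¹) := by rw [← h3]; simp only [mul_assoc]
      _ = _ := by rw [h2, mul_one]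

theorem IsOGrp.dcent_fi (h : IsOGrp L) (hρ : ∀ g, ρ g ∈ L) :
    (dcent ρ (h.lie : Set (Mat m))).FiniteIndex := by
  obtain ⟨ε, hε, hc⟩ := h.cover3 h.lie ⊥ le_rfl bot_le (by simp)
  have key : ∀ g, ‖ρ g - 1‖ < ε → g ∈ dcent ρ (h.lie : Set (Mat m)) := by
    intro g hg Z hZ
    obtain ⟨Y, hY, X, hX, he⟩ := hc _ (hρ g) hg
    rw [Submodule.mem_bot] at hX
    rw [he, hX, exp_zero, mul_one]
    exact (hZ Y hY).exp_right
  obtain ⟨t, htf, ht⟩ := Metric.totallyBounded_iff.1 h.compact.totallyBounded (ε / 2) (by positivity)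
  have hsel : ∀ g : Γ, ∃ c : t, dist (ρ g) c < ε / 2 := by
    intro g
    obtain ⟨c, hc, hg⟩ := mem_iUnion₂.1 (ht (hρ g))
    exact ⟨⟨c, hc⟩, hg⟩
  choose c hc using hsel
  have : Finite t := htf
  have : Finite (Γ ⧸ dcent ρ (h.lie : Set (Mat m))) := by
    apply Finite.of_injective (fun q : Γ ⧸ dcent ρ (h.lie : Set (Mat m)) => c q.out)
    intro q q' hq
    have hq : c q.out = c q'.out := hq
    rw [← q.out_eq', ← q'.out_eq']
    apply Quotient.sound'
    rw [QuotientGroup.leftRel_apply]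
    apply key
    rw [map_mul, h.map_inv hρ, ← h.orth' (hρ q.out), ← mul_sub]
    have h1 := hc q.out
    have h2 := hc q'.out
    rw [hq] at h1
    have h3 : dist (ρ q'.out) (ρ q.out) < ε := by
      have := dist_triangle_right (ρ q'.out) (ρ q.out) (c q'.out); linarith
    rw [dist_eq_norm] at h3
    refine lt_of_le_of_lt (norm_mul_le _ _) ?_
    have h4 := h.norm_le (h.tr _ (hρ q.out))
    nlinarith [norm_nonneg (ρ q'.out - ρ q.out)]
  exact Subgroup.finiteIndex_of_finite_quotient

theorem finite_ker (f : Γ →* Mat m) (hf : (range f).Finite) : ∃ Γ' : Subgroup Γ, Γ'.FiniteIndex ∧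
    ∀ g ∈ Γ', f g = 1 := by
  refine ⟨f.toHomUnits.ker, ?_, ?_⟩
  · have : Finite f.toHomUnits.range := by
      have : Finite (range f) := hf
      apply Finite.of_injective (fun u : f.toHomUnits.range => (⟨(u.1 : Mat m), by
        obtain ⟨g, hg⟩ := u.2
        exact ⟨g, by rw [← hg]; rfl⟩⟩ : range f))
      intro u u' huu
      have := congrArg Subtype.val huu
      exact Subtype.ext (Units.ext this)
    exact Subgroup.finiteIndex_ker _
  · intro g hg
    have := congrArg Units.val (MonoidHom.mem_ker.1 hg)
    exact this

theorem finite_of_fi (f : Γ →* Mat m) (Γ' : Subgroup Γ) [Γ'.FiniteIndex]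
    (hf : (range (f.comp Γ'.subtype)).Finite) : (range f).Finite := by
  have : range f ⊆ ⋃ q : Γ ⧸ Γ', (fun A => f q.out * A) '' range (f.comp Γ'.subtype) := by
    rintro _ ⟨g, rfl⟩
    refine mem_iUnion.2 ⟨(g : Γ ⧸ Γ'), f ((g : Γ ⧸ Γ').out⁻¹ * g), ⟨⟨_, ?_⟩, rfl⟩, ?_⟩
    · exact QuotientGroup.eq.1 (Quotient.out_eq' _)
    · simp only [← map_mul]; simp
  exact (finite_iUnion fun q => hf.image _).subset this

end Groups

section Final
variable {Γ : Type*} [Group Γ] {S : Type*} [MetricSpace S] [CompactSpace S] [MulAction Γ S]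
  [ContinuousConstSMul Γ S]

theorem surface_nontriv [Nonempty S] [ChartedSpace (EuclideanSpace ℝ (Fin 2)) S] :
    ∃ x y : S, x ≠ y := by
  by_contra hcon
  push Not at hcon
  obtain ⟨x⟩ := ‹Nonempty S›
  let φ := chartAt (EuclideanSpace ℝ (Fin 2)) x
  have hx : x ∈ φ.source := mem_chart_source _ x
  have h1 : φ.target ⊆ {φ x} := by
    intro y hy
    rw [mem_singleton_iff, ← φ.right_inv hy, hcon (φ.symm y) x]
  have h2 : φ.target ∈ 𝓝 (φ x) := φ.open_target.mem_nhds (φ.map_source hx)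
  have h3 : ({φ x} : Set (EuclideanSpace ℝ (Fin 2))) ∈ 𝓝 (φ x) := mem_of_superset h2 h1
  have h4 : IsOpen ({φ x} : Set (EuclideanSpace ℝ (Fin 2))) := by
    rw [isOpen_singleton_iff_nhds_eq_pure]
    exact le_antisymm (by simpa using h3) (pure_le_nhds _)
  exact not_isOpen_singleton _ h4

/-- representation-theoretic reduction -/
theorem no_DM [ConnectedSpace S] [ChartedSpace (EuclideanSpace ℝ (Fin 2)) S] (hD : DM Γ S)
    (H1 : ∀ k ≤ 3, ∀ ρ : Γ →* Mat k, (∀ g, ρ g * (ρ g)ᵀ = 1) → (range ρ).Finite)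
    (H2 : ∀ Γ' : Subgroup Γ, Γ'.FiniteIndex → ∀ m (ρ : Γ' →* Mat m), (∀ g, ρ g * (ρ g)ᵀ = 1) →
      (∀ g h, ρ g * ρ h = ρ h * ρ g) → (range ρ).Finite) : False := by
  obtain ⟨m, F, ρ, L, x0, h⟩ := hD.abs surface_nontriv
  have hdim := h.dim_le hD
  obtain ⟨B, hB, hon, hsum⟩ := exists_onb h.grp.lie
  have hexp : ∀ g j, ρ g * B j * (ρ g)ᵀ = ∑ i, ip (B i) (ρ g * B j * (ρ g)ᵀ) • B i :=
    fun g j => hsum _ (h.grp.lie_conj (h.mem g) (hB j))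
  let Ad : Γ →* Mat (Module.finrank ℝ h.grp.lie) :=
    { toFun := fun g => Matrix.of fun i j => ip (B i) (ρ g * B j * (ρ g)ᵀ)
      map_one' := by
        ext i j
        simp [hon, Matrix.one_apply]
      map_mul' := fun g k => by
        ext i j
        rw [Matrix.mul_apply]
        simp only [Matrix.of_apply]
        have : ρ (g * k) * B j * (ρ (g * k))ᵀ = ρ g * (ρ k * B j * (ρ k)ᵀ) * (ρ g)ᵀ := by
          rw [map_mul, Matrix.transpose_mul]; simp only [mul_assoc]
        rw [this]
        conv_lhs => rw [hexp k j, Finset.mul_sum, Finset.sum_mul, ip_sum_right]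
        refine Finset.sum_congr rfl fun l _ => ?_
        rw [mul_smul_comm, smul_mul_assoc, ip_smul_right, mul_comm] }
  have hAd : ∀ g, Ad g * (Ad g)ᵀ = 1 := by
    intro g
    have : (Ad g)ᵀ = Ad g⁻¹ := by
      ext i j
      show ip (B j) (ρ g * B i * (ρ g)ᵀ) = ip (B i) (ρ g⁻¹ * B j * (ρ g⁻¹)ᵀ)
      rw [h.grp.map_inv h.mem]
      rw [← ip_conj (l := ρ g) (h.grp.orth' (h.mem g)) (B i), ip_comm]
      congr 1
      calc B j = (ρ g * (ρ g)ᵀ) * B j * (ρ g * (ρ g)ᵀ) := by rw [h.grp.orth _ (h.mem g)]; simp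
        _ = _ := by simp only [Matrix.transpose_transpose, mul_assoc]
    rw [this, ← map_mul]; simp
  obtain ⟨Γ1, hΓ1, hker⟩ := finite_ker Ad (H1 _ hdim Ad hAd)
  have hc1 : ∀ g ∈ Γ1, ∀ A ∈ h.grp.lie, Commute (ρ g) A := by
    intro g hg
    have hBj : ∀ j, ρ g * B j * (ρ g)ᵀ = B j := by
      intro j
      rw [hexp g j]
      have : ∀ i, ip (B i) (ρ g * B j * (ρ g)ᵀ) = if i = j then 1 else 0 := by
        intro i
        have := congrFun (congrFun (hker g hg) i) j
        rw [Matrix.one_apply] at this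
        exact this
      simp [this]
    have hBc : ∀ j, Commute (ρ g) (B j) := by
      intro j
      show ρ g * B j = B j * ρ g
      conv_rhs => rw [← hBj j]
      rw [mul_assoc, h.grp.orth' (h.mem g), mul_one]
    intro A hA
    rw [hsum A hA]
    exact Commute.sum_right _ _ _ fun i _ => (hBc i).smul_right _
  have hfi := h.grp.dcent_fi h.mem
  let Γ2 := Γ1 ⊓ dcent ρ (h.grp.lie : Set (Mat m))
  have hΓ2 : Γ2.FiniteIndex := inferInstanceAs (Γ1 ⊓ dcent ρ (h.grp.lie : Set (Mat m))).FiniteIndex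
  have hfin := finite_of_fi ρ Γ2 (H2 Γ2 hΓ2 m (ρ.comp Γ2.subtype) (fun g => h.grp.orth _ (h.mem _))
    (fun g k => k.2.2 (ρ g) (hc1 g g.2.1)))
  have hFfin : (range F).Finite := by
    have h1 : ((fun A : Mat m => A *ᵥ F x0) '' range ρ).Finite := hfin.image _
    refine h1.subset ?_
    have h2 : DenseRange fun g : Γ => g • x0 := hD.minimal x0
    rintro _ ⟨a, rfl⟩
    have h3 : IsClosed (F ⁻¹' ((fun A : Mat m => A *ᵥ F x0) '' range ρ)) :=
      h1.isClosed.preimage h.cont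
    refine h3.closure_subset_iff.2 ?_ (h2 a)
    rintro _ ⟨g, rfl⟩
    exact ⟨ρ g, ⟨g, rfl⟩, (h.equi g x0).symm⟩
  obtain ⟨a, b, hab⟩ := h.nontriv
  exact (isPreconnected_range h.cont).infinite_of_nontrivial ⟨_, ⟨a, rfl⟩, _, ⟨b, rfl⟩, hab⟩ hFfin

end Final
end DistalA
end

section
set_option linter.all false
namespace DistalProof
open MeasureTheory WeakDual Filter Topology ComplexConjugate

section spectral
variable {A : Type*} [CommCStarAlgebra A]

/-- real continuous function to the algebra -/
noncomputable def ofR (f : C(characterSpace ℂ A, ℝ)) : A :=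
  (gelfandStarTransform A).symm ⟨fun χ => (f χ : ℂ), by fun_prop⟩

lemma ofR_apply (f : C(characterSpace ℂ A, ℝ)) (χ : characterSpace ℂ A) : χ (ofR f) = (f χ : ℂ) := by
  have h : gelfandStarTransform A (ofR f) = ⟨fun χ => (f χ : ℂ), by fun_prop⟩ :=
    (gelfandStarTransform A).apply_symm_apply _
  exact DFunLike.congr_fun h χ

lemma ext_char {a b : A} (h : ∀ χ : characterSpace ℂ A, χ a = χ b) : a = b := by
  apply (gelfandStarTransform A).injective
  ext χ
  exact h χ

lemma norm_le_char {a : A} {c : ℝ} (hc : 0 ≤ c) (h : ∀ χ : characterSpace ℂ A, ‖χ a‖ ≤ c) : ‖a‖ ≤ c := by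
  have h1 : ‖gelfandTransform ℂ A a‖ = ‖a‖ := by
    have := (gelfandTransform_isometry A).norm_map_of_map_zero (map_zero _) a
    exact this
  rw [← h1, ContinuousMap.norm_le _ hc]
  exact h

lemma exists_measure (ψ : A →ₗ[ℂ] ℂ) (hψ : ∀ a, 0 ≤ (ψ (star a * a)).re)
    [MeasurableSpace (characterSpace ℂ A)] [BorelSpace (characterSpace ℂ A)] :
    ∃ μ : Measure (characterSpace ℂ A), μ.Regular ∧ IsFiniteMeasure μ ∧
      ∀ f : C(characterSpace ℂ A, ℝ), ∫ χ, f χ ∂μ = (ψ (ofR f)).re := by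
  let L : CompactlySupportedContinuousMap (characterSpace ℂ A) ℝ →ₗ[ℝ] ℝ :=
    { toFun := fun f => (ψ (ofR f.toContinuousMap)).re
      map_add' := by
        intro f g
        have : ofR (A := A) (f + g).toContinuousMap = ofR f.toContinuousMap + ofR g.toContinuousMap := by
          apply ext_char
          intro χ
          rw [map_add]
          simp only [ofR_apply]
          simp
        rw [this]; simp
      map_smul' := by
        intro c f
        have : ofR (A := A) (c • f).toContinuousMap = (c : ℂ) • ofR f.toContinuousMap := by
          apply ext_char
          intro χ
          rw [map_smul]
          simp only [ofR_apply]
          simp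
        rw [this]; simp }
  have hpos : ∀ f, 0 ≤ f → 0 ≤ L f := by
    intro f hf
    change 0 ≤ (ψ (ofR f.toContinuousMap)).re
    have : ofR (A := A) f.toContinuousMap = star (ofR ⟨fun χ => Real.sqrt (f χ), by fun_prop⟩) * (ofR ⟨fun χ => Real.sqrt (f χ), by fun_prop⟩) := by
      apply ext_char
      intro χ
      rw [map_mul, map_star]
      simp only [ofR_apply]
      have h0 : 0 ≤ f χ := hf χ
      simp
      rw [← Complex.ofReal_mul, Real.mul_self_sqrt h0]
    rw [this]
    exact hψ _
  let Λ := PositiveLinearMap.mk₀ L hpos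
  refine ⟨RealRMK.rieszMeasure Λ, inferInstance, inferInstance, ?_⟩
  intro f
  have := RealRMK.integral_rieszMeasure Λ (CompactlySupportedContinuousMap.continuousMapEquiv f)
  exact this

end spectral

section sector

lemma meas_comp {K : Type*} [TopologicalSpace K] [CompactSpace K] [T2Space K] [MeasurableSpace K] [BorelSpace K]
    (μ : Measure K) [μ.Regular] [IsFiniteMeasure μ] (α : K → K) (hα : Continuous α) (δ : ℝ)
    (h : ∀ f : C(K, ℝ), (∀ χ, 0 ≤ f χ ∧ f χ ≤ 1) → ∫ χ, f (α χ) ∂μ ≤ ∫ χ, f χ ∂μ + δ)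
    (E : Set K) (hE : MeasurableSet E) : μ.real (α ⁻¹' E) ≤ μ.real E + δ := by
  have hE' : MeasurableSet (α ⁻¹' E) := hα.measurable hE
  refine le_of_forall_pos_le_add fun ε hε => ?_
  have hε' : ENNReal.ofReal (ε/2) ≠ 0 := by simpa using by linarith
  obtain ⟨C, hCE, hC, hμC⟩ := hE'.exists_isCompact_lt_add (measure_ne_top μ _) hε'
  have hαC : IsCompact (α '' C) := hC.image hα
  obtain ⟨U, hU, hUo, hμU⟩ := (α '' C).exists_isOpen_lt_add (measure_ne_top μ _) hε'
  obtain ⟨f, hf0, hf1, hf⟩ := exists_continuous_zero_one_of_isClosed (hUo.isClosed_compl) hαC.isClosed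
    (Set.disjoint_left.mpr fun a ha hb => ha (hU hb))
  have h1 := h f hf
  have hintegr : ∀ g : K → ℝ, Continuous g → Integrable g μ := fun g hg =>
    hg.integrable_of_hasCompactSupport (HasCompactSupport.of_compactSpace _)
  have h2 : μ.real C ≤ ∫ χ, f (α χ) ∂μ := by
    rw [← integral_indicator_one hC.measurableSet]
    refine integral_mono ((integrable_const 1).indicator hC.measurableSet) (hintegr _ (by fun_prop)) ?_
    intro χ
    by_cases hχ : χ ∈ C
    · simp [hχ]
      have := hf1 (Set.mem_image_of_mem α hχ)
      simp at this
      linarith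
    · simp [hχ, (hf _).1]
  have h3 : ∫ χ, f χ ∂μ ≤ μ.real U := by
    rw [← integral_indicator_one hUo.measurableSet]
    refine integral_mono (hintegr _ (by fun_prop)) ((integrable_const 1).indicator hUo.measurableSet) ?_
    intro χ
    by_cases hχ : χ ∈ U
    · simp [hχ, (hf _).2]
    · have := hf0 hχ
      simp at this
      simp [hχ, this]
  have e1 : μ.real (α ⁻¹' E) ≤ μ.real C + ε/2 := by
    have := ENNReal.toReal_mono (by finiteness) hμC.le
    rwa [ENNReal.toReal_add (by finiteness) (by finiteness), ENNReal.toReal_ofReal (by linarith)] at this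
  have e2 : μ.real U ≤ μ.real E + ε/2 := by
    have := ENNReal.toReal_mono (by finiteness) hμU.le
    rw [ENNReal.toReal_add (by finiteness) (by finiteness), ENNReal.toReal_ofReal (by linarith)] at this
    have h4 : μ.real (α '' C) ≤ μ.real E := measureReal_mono (by
      rintro _ ⟨c, hc, rfl⟩; exact hCE hc)
    simp only [Measure.real] at *
    linarith
  linarith

lemma sector_half {K : Type*} [MeasurableSpace K] (μ : Measure K) [IsFiniteMeasure μ] (x y : K → ℝ)
    (hx : Measurable x) (hy : Measurable y) (c δ η s : ℝ) (hs : s = 1 ∨ s = -1)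
    (α β : K → K)
    (hα : ∀ E, MeasurableSet E → μ.real (α ⁻¹' E) ≤ μ.real E + δ)
    (hβ : ∀ E, MeasurableSet E → μ.real (β ⁻¹' E) ≤ μ.real E + δ)
    (hα' : ∀ k, |x k| ≤ c → |y k| ≤ c → x (α k) = x k ∧ y (α k) = y k + 2 * s * x k)
    (hβ' : ∀ k, |x k| ≤ c → |y k| ≤ c → x (β k) = x k + s * y k ∧ y (β k) = y k)
    (hη : μ.real {k | c < |x k| ∨ c < |y k|} ≤ η) :
    μ.real {k | 0 ≤ s * x k * y k ∧ |x k| ≤ c ∧ |y k| ≤ c} ≤ μ.real {k | x k = 0 ∧ y k = 0} + 2 * δ + η := by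
  set E : Set K := {k | 0 ≤ s * x k * y k ∧ |x k| ≤ c ∧ |y k| ≤ c} with hEdef
  set P1 : Set K := {k | 0 ≤ s * x k * y k ∧ 2 * |x k| ≤ |y k|}
  set P2 : Set K := {k | 0 ≤ s * x k * y k ∧ |y k| ≤ |x k|}
  set B : Set K := {k | c < |x k| ∨ c < |y k|}
  set Z : Set K := {k | x k = 0 ∧ y k = 0}
  have mE : MeasurableSet E := by measurability
  have mP1 : MeasurableSet P1 := by
    have h1 : MeasurableSet {k | 0 ≤ s * x k * y k} := measurableSet_le (by fun_prop) (by fun_prop)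
    have h2 : MeasurableSet {k | 2 * |x k| ≤ |y k|} := measurableSet_le (by fun_prop) (by fun_prop)
    exact h1.inter h2
  have mP2 : MeasurableSet P2 := by
    have h1 : MeasurableSet {k | 0 ≤ s * x k * y k} := measurableSet_le (by fun_prop) (by fun_prop)
    have h2 : MeasurableSet {k | |y k| ≤ |x k|} := measurableSet_le (by fun_prop) (by fun_prop)
    exact h1.inter h2
  have s2 : s * s = 1 := by rcases hs with rfl | rfl <;> norm_num
  have i1 : E ⊆ α ⁻¹' P1 := by
    rintro k ⟨h1, h2, h3⟩
    obtain ⟨ha, hb⟩ := hα' k h2 h3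
    refine ⟨?_, ?_⟩
    · rw [ha, hb]; nlinarith [sq_nonneg (x k)]
    · rw [ha, hb]
      rw [← abs_two (α := ℝ), ← abs_mul, ← sq_le_sq, abs_two]
      nlinarith [sq_nonneg (x k), sq_nonneg (y k)]
  have i2 : E ⊆ β ⁻¹' P2 := by
    rintro k ⟨h1, h2, h3⟩
    obtain ⟨ha, hb⟩ := hβ' k h2 h3
    refine ⟨?_, ?_⟩
    · rw [ha, hb]; nlinarith [sq_nonneg (y k)]
    · rw [ha, hb, ← sq_le_sq]
      nlinarith [sq_nonneg (x k), sq_nonneg (y k)]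
  have a1 := (measureReal_mono i1 (by finiteness)).trans (hα P1 mP1)
  have a2 := (measureReal_mono i2 (by finiteness)).trans (hβ P2 mP2)
  have a3 := measureReal_union_add_inter (μ := μ) (s := P1) mP2 (by finiteness) (by finiteness)
  have a4 : μ.real (P1 ∩ P2) ≤ μ.real Z := by
    refine measureReal_mono ?_ (by finiteness)
    rintro k ⟨⟨_, h1⟩, ⟨_, h2⟩⟩
    have := abs_nonneg (x k)
    have := abs_nonneg (y k)
    exact ⟨abs_eq_zero.mp (by linarith), abs_eq_zero.mp (by linarith)⟩
  have a5 : μ.real (P1 ∪ P2) ≤ μ.real E + μ.real B := by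
    refine (measureReal_mono ?_ (by finiteness)).trans (measureReal_union_le E B)
    intro k hk
    by_cases hB : k ∈ B
    · exact Or.inr hB
    · left
      have hB' : ¬ (c < |x k| ∨ c < |y k|) := hB
      push Not at hB'
      refine ⟨?_, hB'.1, hB'.2⟩
      rcases hk with h | h <;> exact h.1
  linarith

lemma sector_meas {K : Type*} [MeasurableSpace K] (μ : Measure K) [IsFiniteMeasure μ] (x y : K → ℝ)
    (hx : Measurable x) (hy : Measurable y) (c δ η : ℝ)
    (α β : ℝ → K → K)
    (hα : ∀ s, s = 1 ∨ s = -1 → ∀ E, MeasurableSet E → μ.real (α s ⁻¹' E) ≤ μ.real E + δ)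
    (hβ : ∀ s, s = 1 ∨ s = -1 → ∀ E, MeasurableSet E → μ.real (β s ⁻¹' E) ≤ μ.real E + δ)
    (hα' : ∀ s, s = 1 ∨ s = -1 → ∀ k, |x k| ≤ c → |y k| ≤ c → x (α s k) = x k ∧ y (α s k) = y k + 2 * s * x k)
    (hβ' : ∀ s, s = 1 ∨ s = -1 → ∀ k, |x k| ≤ c → |y k| ≤ c → x (β s k) = x k + s * y k ∧ y (β s k) = y k)
    (hη : μ.real {k | c < |x k| ∨ c < |y k|} ≤ η) :
    μ.real Set.univ ≤ 2 * μ.real {k | x k = 0 ∧ y k = 0} + 4 * δ + 3 * η := by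
  have h1 := sector_half μ x y hx hy c δ η 1 (by simp) (α 1) (β 1) (hα 1 (by simp)) (hβ 1 (by simp)) (hα' 1 (by simp)) (hβ' 1 (by simp)) hη
  have h2 := sector_half μ x y hx hy c δ η (-1) (by simp) (α (-1)) (β (-1)) (hα _ (by simp)) (hβ _ (by simp)) (hα' _ (by simp)) (hβ' _ (by simp)) hη
  have h3 : μ.real Set.univ ≤ μ.real {k | 0 ≤ (1:ℝ) * x k * y k ∧ |x k| ≤ c ∧ |y k| ≤ c} + μ.real {k | 0 ≤ (-1) * x k * y k ∧ |x k| ≤ c ∧ |y k| ≤ c} + μ.real {k | c < |x k| ∨ c < |y k|} := by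
    refine (measureReal_mono ?_ (by finiteness)).trans ((measureReal_union_le _ _).trans (add_le_add_left (measureReal_union_le _ _) _))
    intro k _
    by_cases hB : c < |x k| ∨ c < |y k|
    · right; exact hB
    · push Not at hB
      left
      rcases le_total 0 (x k * y k) with h | h
      · left; exact ⟨by linarith, hB⟩
      · right; exact ⟨by linarith, hB⟩
  linarith

end sector

section abs
variable {A : Type*} [CommCStarAlgebra A]
variable {H : Type*} [NormedAddCommGroup H] [InnerProductSpace ℂ H] [CompleteSpace H]

lemma char_unit {X : A} (hX : star X * X = 1) (χ : characterSpace ℂ A) : ‖χ X‖ = 1 := by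
  have h : χ (star X * X) = 1 := by rw [hX, map_one]
  rw [map_mul, map_star] at h
  have h2 := congrArg norm h
  rw [norm_mul, norm_star, norm_one] at h2
  nlinarith [norm_nonneg (χ X)]

lemma char_exp {X : A} (hX : star X * X = 1) (χ : characterSpace ℂ A) :
    χ X = Complex.exp (((χ X).arg : ℝ) * Complex.I) := by
  have := Complex.norm_mul_exp_arg_mul_I (χ X)
  rw [char_unit hX, Complex.ofReal_one, one_mul] at this
  exact this.symm

lemma char_star_exp {X : A} (hX : star X * X = 1) (χ : characterSpace ℂ A) :
    χ (star X) = Complex.exp ((-(χ X).arg : ℝ) * Complex.I) := by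
  rw [map_star]
  conv_lhs => rw [char_exp hX χ]
  rw [Complex.star_def, ← Complex.exp_conj]
  simp

lemma arg_exp_of (t : ℝ) (h : |t| ≤ 3 * (Real.pi / 4)) : (Complex.exp ((t : ℝ) * Complex.I)).arg = t := by
  rw [Complex.arg_exp_mul_I]
  rw [toIocMod_eq_self]
  have := abs_le.mp h
  have := Real.pi_pos
  constructor <;> linarith

theorem rel_T_abs (ι : A →⋆ₐ[ℂ] (H →L[ℂ] H)) (X Y : A) (hX : star X * X = 1) (hY : star Y * Y = 1)
    (cg ch : ℝ → A →⋆ₐ[ℂ] A) (v : H) (hv : ‖v‖ = 1) (δ : ℝ) (hδ : δ ≤ 1/100)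
    (hcg : ∀ s a, ‖inner ℂ v (ι (cg s a) v) - inner ℂ v (ι a v)‖ ≤ 2 * δ * ‖a‖)
    (hch : ∀ s a, ‖inner ℂ v (ι (ch s a) v) - inner ℂ v (ι a v)‖ ≤ 2 * δ * ‖a‖)
    (gX : ∀ s, cg s X = X) (gY : cg 1 Y = Y * X * X) (gY' : cg (-1) Y = Y * star X * star X)
    (hhY : ∀ s, ch s Y = Y) (hhX : ch 1 X = X * Y) (hhX' : ch (-1) X = X * star Y)
    (hvX : ‖ι X v - v‖ ≤ δ) (hvY : ‖ι Y v - v‖ ≤ δ) (a : A)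
    (ha : ∀ χ : characterSpace ℂ A, χ X = 1 → χ a = 1) : 1/4 ≤ ‖ι a v‖ ^ 2 := by
  have hδ0 : 0 ≤ δ := (norm_nonneg _).trans hvX
  letI : MeasurableSpace (characterSpace ℂ A) := borel _
  haveI : BorelSpace (characterSpace ℂ A) := ⟨rfl⟩
  let ψ : A →ₗ[ℂ] ℂ :=
    { toFun := fun a => inner ℂ v (ι a v)
      map_add' := by intro a b; simp [inner_add_right]
      map_smul' := by intro c a; simp [inner_smul_right] }
  have hψs : ∀ a, ψ (star a * a) = ((‖ι a v‖ ^ 2 : ℝ) : ℂ) := by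
    intro a
    change inner ℂ v (ι (star a * a) v) = _
    rw [map_mul, map_star, ContinuousLinearMap.star_eq_adjoint, ContinuousLinearMap.mul_apply,
      ContinuousLinearMap.adjoint_inner_right, inner_self_eq_norm_sq_to_K]
    simp
  obtain ⟨μ, hμr, hμf, hμ⟩ := exists_measure ψ (by
    intro a; rw [hψs, Complex.ofReal_re]; positivity)
  have hintegr : ∀ g : characterSpace ℂ A → ℝ, Continuous g → Integrable g μ := fun g hg =>
    hg.integrable_of_hasCompactSupport (HasCompactSupport.of_compactSpace _)
  have cev : ∀ a : A, Continuous fun χ : characterSpace ℂ A => χ a := fun a =>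
    (gelfandTransform ℂ A a).continuous
  have ofRre : ∀ (f : C(characterSpace ℂ A, ℝ)) (b : A), (∀ χ : characterSpace ℂ A, χ b = f χ) → ofR f = b := by
    intro f b hb
    exact ext_char fun χ => by rw [ofR_apply, hb]
  -- total mass
  have hmass : μ.real Set.univ = 1 := by
    have := hμ (ContinuousMap.const _ 1)
    rw [ofRre _ 1 (by intro χ; simp)] at this
    simp at this
    rw [this]
    change (inner ℂ v (ι 1 v)).re = 1
    rw [map_one, ContinuousLinearMap.one_apply, inner_self_eq_norm_sq_to_K, hv]
    simp
  let x : characterSpace ℂ A → ℝ := fun χ => (χ X).arg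
  let y : characterSpace ℂ A → ℝ := fun χ => (χ Y).arg
  have hx : Measurable x := Complex.measurable_arg.comp (cev X).measurable
  have hy : Measurable y := Complex.measurable_arg.comp (cev Y).measurable
  have comp_bd : ∀ c : A →⋆ₐ[ℂ] A, (∀ a, ‖inner ℂ v (ι (c a) v) - inner ℂ v (ι a v)‖ ≤ 2 * δ * ‖a‖) →
      ∀ E, MeasurableSet E → μ.real (CharacterSpace.compContinuousMap c ⁻¹' E) ≤ μ.real E + 2 * δ := by
    intro c hc E hE
    refine meas_comp μ _ (ContinuousMap.continuous _) _ ?_ E hE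
    intro f hf
    have h1 := hμ (f.comp (CharacterSpace.compContinuousMap c))
    rw [ofRre _ (c (ofR f)) (by
      intro χ
      exact ofR_apply f (CharacterSpace.compContinuousMap c χ))] at h1
    have h1' : ∫ χ, f (CharacterSpace.compContinuousMap c χ) ∂μ = (ψ (c (ofR f))).re := h1
    rw [h1', hμ f]
    have h2 : ‖ofR (A := A) f‖ ≤ 1 := norm_le_char zero_le_one (by
      intro χ
      rw [ofR_apply, Complex.norm_real, Real.norm_eq_abs, abs_le]
      constructor <;> linarith [(hf χ).1, (hf χ).2])
    have h3 := (Complex.abs_re_le_norm _).trans (hc (ofR f))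
    have h4 := (abs_le.mp h3).2
    rw [Complex.sub_re] at h4
    change (inner ℂ v (ι (c (ofR f)) v)).re ≤ (inner ℂ v (ι (ofR f) v)).re + _
    nlinarith
  have comp_app : ∀ (c : A →⋆ₐ[ℂ] A) χ (b : A), (CharacterSpace.compContinuousMap c χ) b = χ (c b) := by
    intro c χ b; rfl
  -- tail
  have tail : ∀ Z : A, star Z * Z = 1 → ‖ι Z v - v‖ ≤ δ →
      μ.real {χ : characterSpace ℂ A | Real.pi / 4 < |(χ Z).arg|} ≤ 4 * δ := by
    intro Z hZ hvZ
    set B : Set (characterSpace ℂ A) := {χ : characterSpace ℂ A | Real.pi / 4 < |(χ Z).arg|}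
    have mB : MeasurableSet B := measurableSet_lt measurable_const
      (Complex.measurable_arg.comp (cev Z).measurable).norm
    have h1 : ∫ χ : characterSpace ℂ A, (1 - (χ Z).re) ∂μ ≤ δ := by
      have h0 : Continuous fun χ : characterSpace ℂ A => (1 - (χ Z).re) :=
        continuous_const.sub (Complex.continuous_re.comp (cev Z))
      have := hμ ⟨_, h0⟩
      rw [ofRre _ (1 - (1/2 : ℂ) • (Z + star Z)) (by
        intro χ
        rw [map_sub, map_one, map_smul, map_add, map_star]
        simp
        rw [Complex.add_conj]
        push_cast
        ring)] at this
      have e : (ψ (1 - (1/2 : ℂ) • (Z + star Z))).re = - (inner ℂ v (ι Z v - v)).re := by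
        change (inner ℂ v (ι (1 - (1/2 : ℂ) • (Z + star Z)) v)).re = _
        have e1 : inner ℂ v (ι (star Z) v) = conj (inner ℂ v (ι Z v)) := by
          rw [map_star, ContinuousLinearMap.star_eq_adjoint, ContinuousLinearMap.adjoint_inner_right, inner_conj_symm]
        rw [map_sub, map_smul, map_add, map_one]
        simp only [ContinuousLinearMap.sub_apply, ContinuousLinearMap.smul_apply, ContinuousLinearMap.add_apply,
          ContinuousLinearMap.one_apply, inner_sub_right, inner_smul_right, inner_add_right, e1]
        rw [Complex.add_conj]
        have : ((1/2 : ℂ) * ((2 * (inner ℂ v (ι Z v)).re : ℝ) : ℂ)) = (((inner ℂ v (ι Z v)).re : ℝ) : ℂ) := by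
          push_cast; ring
        rw [this]
        simp
      rw [e] at this
      have h5 : ‖inner ℂ v (ι Z v - v)‖ ≤ δ := (norm_inner_le_norm _ _).trans (by rw [hv, one_mul]; exact hvZ)
      have h6 := (abs_le.mp ((Complex.abs_re_le_norm _).trans h5)).1
      have h7 : ∫ χ : characterSpace ℂ A, (1 - (χ Z).re) ∂μ = - (inner ℂ v (ι Z v - v)).re := this
      linarith
    have h2 : (1/4 : ℝ) * μ.real B ≤ ∫ χ : characterSpace ℂ A, (1 - (χ Z).re) ∂μ := by
      rw [← integral_indicator_one mB, ← integral_const_mul]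
      refine integral_mono (((integrable_const 1).indicator mB).const_mul _)
        (hintegr _ (continuous_const.sub (Complex.continuous_re.comp (cev Z)))) ?_
      intro χ
      have hre : (χ Z).re = Real.cos (χ Z).arg := by
        conv_lhs => rw [char_exp hZ χ]
        rw [Complex.exp_ofReal_mul_I_re]
      simp only [hre]
      by_cases hχ : χ ∈ B
      · have hχ' : Real.pi / 4 < |(χ Z).arg| := hχ
        have hc : Real.cos (χ Z).arg ≤ Real.cos (Real.pi / 4) := by
          rw [← Real.cos_abs (χ Z).arg]
          exact Real.cos_le_cos_of_nonneg_of_le_pi (by positivity) (Complex.abs_arg_le_pi _) hχ'.le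
        rw [Real.cos_pi_div_four] at hc
        have : Real.sqrt 2 ≤ 3/2 := by
          rw [Real.sqrt_le_left (by norm_num)]; norm_num
        simp [hχ]; linarith
      · simp [hχ, Real.cos_le_one]
    linarith
  have tl : μ.real {χ : characterSpace ℂ A | Real.pi / 4 < |x χ| ∨ Real.pi / 4 < |y χ|} ≤ 8 * δ := by
    refine (measureReal_union_le {χ : characterSpace ℂ A | Real.pi / 4 < |x χ|} {χ | Real.pi / 4 < |y χ|}).trans ?_
    have h1 := tail X hX hvX
    have h2 := tail Y hY hvY
    change _ ≤ _ at h1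
    simp only [x, y]
    linarith
  have main := sector_meas μ x y hx hy (Real.pi / 4) (2 * δ) (8 * δ)
    (fun s => CharacterSpace.compContinuousMap (cg s)) (fun s => CharacterSpace.compContinuousMap (ch s))
    (fun s _ => comp_bd _ (hcg s)) (fun s _ => comp_bd _ (hch s))
    (by
      intro s hs χ h1 h2
      refine ⟨by simp only [x, comp_app, gX], ?_⟩
      have e : χ (cg s Y) = Complex.exp (((y χ + 2 * s * x χ : ℝ) : ℂ) * Complex.I) := by
        rcases hs with rfl | rfl
        · rw [gY, map_mul, map_mul, char_exp hX, char_exp hY, ← Complex.exp_add, ← Complex.exp_add]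
          congr 1; simp only [x, y]; push_cast; ring
        · rw [gY', map_mul, map_mul, char_star_exp hX, char_exp hY, ← Complex.exp_add, ← Complex.exp_add]
          congr 1; simp only [x, y]; push_cast; ring
      change (χ (cg s Y)).arg = _
      rw [e, arg_exp_of]
      have := abs_le.mp h1
      have := abs_le.mp h2
      rw [abs_le]
      rcases hs with rfl | rfl <;> constructor <;> linarith)
    (by
      intro s hs χ h1 h2
      refine ⟨?_, by simp only [y, comp_app, hhY]⟩
      have e : χ (ch s X) = Complex.exp (((x χ + s * y χ : ℝ) : ℂ) * Complex.I) := by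
        rcases hs with rfl | rfl
        · rw [hhX, map_mul, char_exp hX, char_exp hY, ← Complex.exp_add]
          congr 1; simp only [x, y]; push_cast; ring
        · rw [hhX', map_mul, char_star_exp hY, char_exp hX, ← Complex.exp_add]
          congr 1; simp only [x, y]; push_cast; ring
      change (χ (ch s X)).arg = _
      rw [e, arg_exp_of]
      have := abs_le.mp h1
      have := abs_le.mp h2
      rw [abs_le]
      rcases hs with rfl | rfl <;> constructor <;> linarith)
    tl
  rw [hmass] at main
  set Z : Set (characterSpace ℂ A) := {k | x k = 0 ∧ y k = 0}
  have mZ : MeasurableSet Z := (hx (measurableSet_singleton 0)).inter (hy (measurableSet_singleton 0))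
  have hZ : 1/4 ≤ μ.real Z := by linarith
  refine hZ.trans ?_
  have ca : Continuous fun χ : characterSpace ℂ A => ‖χ a‖ ^ 2 := (cev a).norm.pow 2
  have h8 := hμ ⟨_, ca⟩
  rw [ofRre _ (star a * a) (by
    intro χ
    rw [map_mul, map_star]
    have := Complex.conj_mul' (χ a)
    simp only [ContinuousMap.coe_mk]
    push_cast
    exact this), hψs, Complex.ofReal_re] at h8
  rw [← h8, ← integral_indicator_one mZ]
  refine integral_mono ((integrable_const 1).indicator mZ) (hintegr _ ca) ?_
  intro χ
  by_cases hχ : χ ∈ Z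
  · have h9 : χ X = 1 := by
      rw [char_exp hX χ]
      have : (χ X).arg = 0 := hχ.1
      rw [this]; simp
    simp [hχ, ha χ h9]
  · simp [hχ]

end abs
end DistalProof
end

section
set_option linter.all false
namespace DistalProof
open MeasureTheory WeakDual Filter Topology ComplexConjugate

section conc
variable {H : Type*} [NormedAddCommGroup H] [InnerProductSpace ℂ H] [CompleteSpace H]

/-- the von Neumann algebra generated by X, Y -/
noncomputable def VN (X Y : H →L[ℂ] H) : StarSubalgebra ℂ (H →L[ℂ] H) :=
  StarSubalgebra.centralizer ℂ (StarSubalgebra.centralizer ℂ {X, Y} : Set (H →L[ℂ] H))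

instance VN_closed (X Y : H →L[ℂ] H) : IsClosed (VN X Y : Set (H →L[ℂ] H)) := by
  unfold VN
  rw [StarSubalgebra.coe_centralizer]
  exact Set.isClosed_centralizer _

lemma mem_VN {X Y T : H →L[ℂ] H} : T ∈ VN X Y ↔
    ∀ Z ∈ StarSubalgebra.centralizer ℂ ({X, Y} : Set (H →L[ℂ] H)), Z * T = T * Z := by
  unfold VN
  rw [StarSubalgebra.mem_centralizer_iff]
  constructor
  · intro h Z hZ; exact (h Z hZ).1
  · intro h Z hZ; exact ⟨h Z hZ, h _ (star_mem hZ)⟩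

variable (X Y : unitary (H →L[ℂ] H))

lemma mem_C_iff {Z : H →L[ℂ] H} : Z ∈ StarSubalgebra.centralizer ℂ ({(X : H →L[ℂ] H), (Y : H →L[ℂ] H)} : Set (H →L[ℂ] H)) ↔
    ∀ W ∈ Subgroup.closure {X, Y}, (W : H →L[ℂ] H) * Z = Z * W := by
  rw [StarSubalgebra.mem_centralizer_iff]
  have key : ∀ W : unitary (H →L[ℂ] H), (W : H →L[ℂ] H) * Z = Z * W → (star (W : H →L[ℂ] H)) * Z = Z * star (W : H →L[ℂ] H) := by
    intro W h
    calc star (W : H →L[ℂ] H) * Z = star (W : H →L[ℂ] H) * (Z * W) * star (W : H →L[ℂ] H) := by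
          rw [mul_assoc, mul_assoc, Unitary.mul_star_self_of_mem W.2, mul_one]
      _ = _ := by rw [← h, ← mul_assoc, Unitary.star_mul_self_of_mem W.2, one_mul]
  constructor
  · intro h W hW
    induction hW using Subgroup.closure_induction with
    | mem x hx =>
      rcases hx with rfl | rfl
      · exact (h _ (by simp)).1
      · exact (h _ (by simp)).1
    | one => simp
    | mul a b _ _ ha hb =>
      rw [Submonoid.coe_mul, mul_assoc, hb, ← mul_assoc, ha, mul_assoc]
    | inv a _ ha =>
      exact key a ha
  · intro h Z' hZ'
    rcases hZ' with rfl | rfl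
    · have := h X (Subgroup.subset_closure (by simp)); exact ⟨this, key _ this⟩
    · have := h Y (Subgroup.subset_closure (by simp)); exact ⟨this, key _ this⟩

lemma VN_conj (u : unitary (H →L[ℂ] H)) (h1 : u * X * u⁻¹ ∈ Subgroup.closure {X, Y})
    (h2 : u * Y * u⁻¹ ∈ Subgroup.closure {X, Y}) (T : H →L[ℂ] H) (hT : T ∈ VN (X : H →L[ℂ] H) Y) :
    (u : H →L[ℂ] H) * T * star (u : H →L[ℂ] H) ∈ VN (X : H →L[ℂ] H) Y := by
  rw [mem_VN] at hT ⊢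
  intro Z hZ
  have uu := Unitary.mul_star_self_of_mem u.2
  have uu' := Unitary.star_mul_self_of_mem u.2
  have hc : star (u : H →L[ℂ] H) * Z * u ∈ StarSubalgebra.centralizer ℂ ({(X : H →L[ℂ] H), (Y : H →L[ℂ] H)} : Set (H →L[ℂ] H)) := by
    rw [mem_C_iff] at hZ ⊢
    have aux : ∀ W ∈ Subgroup.closure {X, Y}, u * W * u⁻¹ ∈ Subgroup.closure {X, Y} := by
      intro W hW
      have : Subgroup.closure {X, Y} ≤ (Subgroup.closure {X, Y}).comap (MulAut.conj u).toMonoidHom := by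
        rw [Subgroup.closure_le]
        rintro w (rfl | rfl)
        · exact h1
        · exact h2
      exact this hW
    intro W hW
    have h3 := hZ _ (aux W hW)
    have e : ((u * W * u⁻¹ : unitary (H →L[ℂ] H)) : H →L[ℂ] H) = u * W * star (u : H →L[ℂ] H) := rfl
    rw [e] at h3
    calc (W : H →L[ℂ] H) * (star (u : H →L[ℂ] H) * Z * u)
        = star (u : H →L[ℂ] H) * ((u : H →L[ℂ] H) * W * star (u : H →L[ℂ] H) * Z) * u := by
          simp only [← mul_assoc]; rw [uu']; simp
      _ = star (u : H →L[ℂ] H) * Z * u * W := by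
          rw [h3]; simp only [mul_assoc]; rw [uu']; simp
  have h4 := hT _ hc
  calc Z * ((u : H →L[ℂ] H) * T * star (u : H →L[ℂ] H))
      = u * (star (u : H →L[ℂ] H) * Z * u * T) * star (u : H →L[ℂ] H) := by
        simp only [← mul_assoc]; rw [uu]; simp
    _ = _ := by rw [h4]; simp only [mul_assoc]; rw [uu]; simp

/-- conjugation on VN -/
noncomputable def VNconj (u : unitary (H →L[ℂ] H)) (h1 : u * X * u⁻¹ ∈ Subgroup.closure {X, Y})
    (h2 : u * Y * u⁻¹ ∈ Subgroup.closure {X, Y}) : VN (X : H →L[ℂ] H) Y →⋆ₐ[ℂ] VN (X : H →L[ℂ] H) Y where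
  toFun T := ⟨u * T * star (u : H →L[ℂ] H), VN_conj X Y u h1 h2 T T.2⟩
  map_one' := by ext1; simp [Unitary.mul_star_self_of_mem u.2]
  map_mul' a b := by
    ext1
    simp only [MulMemClass.coe_mul]
    have uu' := Unitary.star_mul_self_of_mem u.2
    have : ∀ T : H →L[ℂ] H, star (u : H →L[ℂ] H) * (u * T) = T := fun T => by rw [← mul_assoc, uu', one_mul]
    simp only [mul_assoc, this]
  map_zero' := by ext1; simp
  map_add' a b := by ext1; simp [mul_add, add_mul]
  commutes' c := by
    ext1
    simp [Algebra.algebraMap_eq_smul_one, Unitary.mul_star_self_of_mem u.2]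
  map_star' a := by
    ext1
    simp [mul_assoc]

lemma inner_conj_bd (u : unitary (H →L[ℂ] H)) (v : H) (hv : ‖v‖ = 1) (δ : ℝ) (hu : ‖(u : H →L[ℂ] H) v - v‖ ≤ δ)
    (T : H →L[ℂ] H) :
    ‖inner ℂ v (((u : H →L[ℂ] H) * T * star (u : H →L[ℂ] H)) v) - inner ℂ v (T v)‖ ≤ 2 * δ * ‖T‖ := by
  set w := star (u : H →L[ℂ] H) v with hw
  have uw : (u : H →L[ℂ] H) w = v := by
    rw [hw, ← ContinuousLinearMap.mul_apply, Unitary.mul_star_self_of_mem u.2]; simp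
  have hn : ∀ z, ‖(u : H →L[ℂ] H) z‖ = ‖z‖ := fun z => by
    exact (Unitary.linearIsometryEquiv u).norm_map z
  have hwv : ‖w - v‖ ≤ δ := by
    rw [← hn, map_sub, uw, ← norm_neg]; simpa using hu
  have hwn : ‖w‖ = 1 := by rw [← hn, uw, hv]
  have e : inner ℂ v (((u : H →L[ℂ] H) * T * star (u : H →L[ℂ] H)) v) = inner ℂ w (T w) := by
    rw [mul_assoc, ContinuousLinearMap.mul_apply, ContinuousLinearMap.mul_apply, ← hw]
    conv_lhs => rw [← uw]
    exact (Unitary.linearIsometryEquiv u).inner_map_map w (T w)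
  rw [e]
  have : inner ℂ w (T w) - inner ℂ v (T v) = inner ℂ (w - v) (T w) + inner ℂ v (T (w - v)) := by
    rw [inner_sub_left, map_sub, inner_sub_right]; ring
  rw [this]
  have b1 : ‖inner ℂ (w - v) (T w)‖ ≤ δ * ‖T‖ := (norm_inner_le_norm _ _).trans (by
    have := T.le_opNorm w; rw [hwn, mul_one] at this
    exact mul_le_mul hwv this (norm_nonneg _) ((norm_nonneg _).trans hwv))
  have b2 : ‖inner ℂ v (T (w - v))‖ ≤ δ * ‖T‖ := (norm_inner_le_norm _ _).trans (by
    have := T.le_opNorm (w - v); rw [hv, one_mul]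
    refine this.trans ?_
    rw [mul_comm]; exact mul_le_mul_of_nonneg_right hwv (norm_nonneg _))
  refine (norm_add_le _ _).trans ?_
  linarith

theorem rel_T (g h : unitary (H →L[ℂ] H)) (hXY : X * Y = Y * X)
    (hgX : g * X * g⁻¹ = X) (hgY : g * Y * g⁻¹ = Y * X * X) (hhY : h * Y * h⁻¹ = Y) (hhX : h * X * h⁻¹ = X * Y)
    (v : H) (hv : ‖v‖ = 1)
    (vX : ‖(X : H →L[ℂ] H) v - v‖ ≤ 1/100) (vY : ‖(Y : H →L[ℂ] H) v - v‖ ≤ 1/100)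
    (vg : ‖(g : H →L[ℂ] H) v - v‖ ≤ 1/100) (vh : ‖(h : H →L[ℂ] H) v - v‖ ≤ 1/100) :
    ∃ w : H, w ≠ 0 ∧ (X : H →L[ℂ] H) w = w := by
  have mX : X ∈ Subgroup.closure {X, Y} := Subgroup.subset_closure (by simp)
  have mY : Y ∈ Subgroup.closure {X, Y} := Subgroup.subset_closure (by simp)
  have hgX' : g⁻¹ * X * g⁻¹⁻¹ = X := by
    have := congrArg (fun z => g⁻¹ * z * g) hgX; simp [mul_assoc] at this ⊢; exact this.symm
  have hgY' : g⁻¹ * Y * g⁻¹⁻¹ = Y * X⁻¹ * X⁻¹ := by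
    have h0 : g * (Y * X⁻¹ * X⁻¹) * g⁻¹ = Y := by
      calc g * (Y * X⁻¹ * X⁻¹) * g⁻¹ = (g * Y * g⁻¹) * (g * X * g⁻¹)⁻¹ * (g * X * g⁻¹)⁻¹ := by group
        _ = Y := by rw [hgX, hgY]; group
    conv_lhs => rw [← h0]
    group
  have hhY' : h⁻¹ * Y * h⁻¹⁻¹ = Y := by
    have := congrArg (fun z => h⁻¹ * z * h) hhY; simp [mul_assoc] at this ⊢; exact this.symm
  have hhX' : h⁻¹ * X * h⁻¹⁻¹ = X * Y⁻¹ := by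
    have h0 : h * (X * Y⁻¹) * h⁻¹ = X := by
      calc h * (X * Y⁻¹) * h⁻¹ = (h * X * h⁻¹) * (h * Y * h⁻¹)⁻¹ := by group
        _ = X := by rw [hhX, hhY]; group
    conv_lhs => rw [← h0]
    group
  have hinv : ∀ u : unitary (H →L[ℂ] H), ‖(u : H →L[ℂ] H) v - v‖ ≤ 1/100 → ‖((u⁻¹ : unitary (H →L[ℂ] H)) : H →L[ℂ] H) v - v‖ ≤ 1/100 := by
    intro u hu
    have hn : ∀ z, ‖(u : H →L[ℂ] H) z‖ = ‖z‖ := fun z => (Unitary.linearIsometryEquiv u).norm_map z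
    rw [← hn, map_sub, ← ContinuousLinearMap.mul_apply, ← Submonoid.coe_mul, mul_inv_cancel, ← norm_neg]
    simpa using hu
  have comm : ∀ a b : VN (X : H →L[ℂ] H) Y, a * b = b * a := by
    intro a b
    apply Subtype.ext
    have ha := a.2
    have hb := b.2
    rw [mem_VN] at ha hb
    apply hb
    rw [mem_C_iff]
    intro W hW
    apply ha
    rw [mem_C_iff]
    intro W' hW'
    have hcl : ∀ W ∈ Subgroup.closure {X, Y}, ∀ W' ∈ Subgroup.closure {X, Y}, W * W' = W' * W := by
      have hcc : Subgroup.closure {X, Y} ≤ Subgroup.centralizer {X, Y} := by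
        rw [Subgroup.closure_le]
        rintro w (rfl | rfl) <;> rw [SetLike.mem_coe, Subgroup.mem_centralizer_iff] <;> rintro z (rfl | rfl)
        · rfl
        · exact hXY.symm
        · exact hXY
        · rfl
      have hcc2 : Subgroup.closure {X, Y} ≤ Subgroup.centralizer (Subgroup.closure {X, Y} : Set (unitary (H →L[ℂ] H))) := by
        rw [Subgroup.closure_le]
        intro w hw z hz
        have := Subgroup.mem_centralizer_iff.mp (hcc hz)
        exact (this w hw).symm
      intro W hW W' hW'
      exact (Subgroup.mem_centralizer_iff.mp (hcc2 hW) W' hW').symm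
    exact congrArg Subtype.val (hcl W' hW' W hW)
  letI : CommCStarAlgebra (VN (X : H →L[ℂ] H) Y) := { StarSubalgebra.cstarAlgebra (VN (X : H →L[ℂ] H) (Y : H →L[ℂ] H)) with mul_comm := comm }
  have hmem : ∀ W ∈ Subgroup.closure {X, Y}, (W : H →L[ℂ] H) ∈ VN (X : H →L[ℂ] H) Y := by
    intro W hW
    rw [mem_VN]
    intro Z hZ
    exact ((mem_C_iff X Y).mp hZ W hW).symm
  let X' : VN (X : H →L[ℂ] H) Y := ⟨X, hmem X mX⟩
  let Y' : VN (X : H →L[ℂ] H) Y := ⟨Y, hmem Y mY⟩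
  let cg : ℝ → (VN (X : H →L[ℂ] H) Y →⋆ₐ[ℂ] VN (X : H →L[ℂ] H) Y) := fun s =>
    if s = 1 then VNconj X Y g (by rw [hgX]; exact mX) (by rw [hgY]; exact mul_mem (mul_mem mY mX) mX)
    else VNconj X Y g⁻¹ (by rw [hgX']; exact mX) (by rw [hgY']; exact mul_mem (mul_mem mY (inv_mem mX)) (inv_mem mX))
  let ch : ℝ → (VN (X : H →L[ℂ] H) Y →⋆ₐ[ℂ] VN (X : H →L[ℂ] H) Y) := fun s =>
    if s = 1 then VNconj X Y h (by rw [hhX]; exact mul_mem mX mY) (by rw [hhY]; exact mY)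
    else VNconj X Y h⁻¹ (by rw [hhX']; exact mul_mem mX (inv_mem mY)) (by rw [hhY']; exact mY)
  have n1 : ¬ ((-1 : ℝ) = 1) := by norm_num
  have key := rel_T_abs (VN (X : H →L[ℂ] H) Y).subtype X' Y'
    (Subtype.ext (Unitary.star_mul_self_of_mem X.2)) (Subtype.ext (Unitary.star_mul_self_of_mem Y.2)) cg ch v hv (1/100) le_rfl
    (by
      intro s a
      by_cases hs : s = 1
      · simp only [cg, hs, if_true]; exact inner_conj_bd g v hv _ vg a
      · simp only [cg, hs, if_false]; exact inner_conj_bd g⁻¹ v hv _ (hinv g vg) a)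
    (by
      intro s a
      by_cases hs : s = 1
      · simp only [ch, hs, if_true]; exact inner_conj_bd h v hv _ vh a
      · simp only [ch, hs, if_false]; exact inner_conj_bd h⁻¹ v hv _ (hinv h vh) a)
    (by
      intro s
      by_cases hs : s = 1
      · simp only [cg, hs, if_true]; have hh0 := congrArg Subtype.val hgX; exact Subtype.ext hh0
      · simp only [cg, hs, if_false]; have hh0 := congrArg Subtype.val hgX'; exact Subtype.ext hh0)
    (by simp only [cg, if_true]; have hh0 := congrArg Subtype.val hgY; exact Subtype.ext hh0)
    (by simp only [cg, n1, if_false]; have hh0 := congrArg Subtype.val hgY'; exact Subtype.ext hh0)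
    (by
      intro s
      by_cases hs : s = 1
      · simp only [ch, hs, if_true]; have hh0 := congrArg Subtype.val hhY; exact Subtype.ext hh0
      · simp only [ch, hs, if_false]; have hh0 := congrArg Subtype.val hhY'; exact Subtype.ext hh0)
    (by simp only [ch, if_true]; have hh0 := congrArg Subtype.val hhX; exact Subtype.ext hh0)
    (by simp only [ch, n1, if_false]; have hh0 := congrArg Subtype.val hhX'; exact Subtype.ext hh0)
    vX vY
  have hnX : ‖(X : H →L[ℂ] H)‖ ≤ 1 := ContinuousLinearMap.opNorm_le_bound _ zero_le_one (fun z => by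
    rw [one_mul]; exact ((Unitary.linearIsometryEquiv X).norm_map z).le)
  have lim := ContinuousLinearMap.tendsto_birkhoffAverage_orthogonalProjection (X : H →L[ℂ] H) hnX v
  set w := ((X : H →L[ℂ] H).eqLocus (1 : H →L[ℂ] H)).orthogonalProjectionOnto v with hw
  refine ⟨w, ?_, w.2⟩
  intro hw0
  rw [hw0] at lim
  have lim2 : Tendsto (fun n => ‖birkhoffAverage ℂ (X : H →L[ℂ] H) _root_.id n v‖ ^ 2) atTop (𝓝 0) := by
    simpa using (lim.norm.pow 2)
  have : ∀ᶠ n : ℕ in atTop, 1/4 ≤ ‖birkhoffAverage ℂ (X : H →L[ℂ] H) _root_.id n v‖ ^ 2 := by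
    filter_upwards [eventually_ge_atTop 1] with n hn
    have h1 := key ((n : ℂ)⁻¹ • ∑ j ∈ Finset.range n, X' ^ j) (by
      intro χ hχ
      rw [map_smul, map_sum]
      simp only [map_pow, hχ, one_pow]
      have : (n : ℂ) ≠ 0 := by exact_mod_cast (by omega)
      simp [this])
    convert h1 using 3
    unfold birkhoffAverage birkhoffSum
    rw [map_smul, map_sum]
    simp only [map_pow, ContinuousLinearMap.smul_apply, ContinuousLinearMap.sum_apply]
    congr 1
    refine Finset.sum_congr rfl fun j _ => ?_
    rw [ContinuousLinearMap.coe_pow']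
    rfl
  have := ge_of_tendsto lim2 this
  norm_num at this

end conc
end DistalProof
end

section
set_option linter.all false
open MeasureTheory Filter Topology
namespace DistalProof

section SLn
variable {n : ℕ}
abbrev SLR (n : ℕ) := Matrix.SpecialLinearGroup (Fin n) ℝ

/-- elementary matrix -/
noncomputable abbrev El {i j : Fin n} (h : i ≠ j) (t : ℝ) : SLR n :=
  Matrix.SpecialLinearGroup.transvection h t

/-- block matrix embedding of two by two matrices in rows i,j -/
noncomputable def emb (i j : Fin n) (p q r s : ℝ) : Matrix (Fin n) (Fin n) ℝ :=
  1 + (p-1) • Matrix.single i i (1:ℝ) + q • Matrix.single i j (1:ℝ) + r • Matrix.single j i (1:ℝ)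
    + (s-1) • Matrix.single j j (1:ℝ)

lemma emb_mul {i j : Fin n} (h : i ≠ j) (p q r s p' q' r' s' : ℝ) :
    emb i j p q r s * emb i j p' q' r' s' =
      emb i j (p*p'+q*r') (p*q'+q*s') (r*p'+s*r') (r*q'+s*s') := by
  have h' := h.symm
  unfold emb
  simp only [mul_add, add_mul, mul_smul_comm, smul_mul_assoc, Matrix.single_mul_single_same, one_mul, mul_one,
    Matrix.single_mul_single_of_ne _ _ _ _ h, Matrix.single_mul_single_of_ne _ _ _ _ h', add_zero, zero_add, smul_zero]
  module

lemma El_eq {i j : Fin n} (h : i ≠ j) (t : ℝ) : (El h t : SLR n).1 = emb i j 1 t 0 1 := by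
  rw [Matrix.SpecialLinearGroup.transvection_coe]; simp [emb, Matrix.smul_single]
lemma El_eq' {i j : Fin n} (h : i ≠ j) (t : ℝ) : (El h.symm t : SLR n).1 = emb i j 1 0 t 1 := by
  rw [Matrix.SpecialLinearGroup.transvection_coe]; simp [emb, Matrix.smul_single]
lemma diag2n_eq {i j : Fin n} (h : i ≠ j) (a : ℝ) (ha : a ≠ 0) :
    (Matrix.SpecialLinearGroup.diag2n h a ha : SLR n).1 = emb i j a 0 0 a⁻¹ := by
  rw [Matrix.SpecialLinearGroup.diag2n_coe]
  unfold emb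
  ext x y
  simp only [Matrix.smul_single, smul_eq_mul, mul_one, zero_smul, Matrix.add_apply, Matrix.single_apply, Matrix.diagonal_apply, Matrix.one_apply]
  by_cases hxy : x = y
  · subst hxy
    by_cases hx : x = i
    · subst hx; simp [h.symm]
    · by_cases hx2 : x = j
      · subst hx2; simp [h, hx, Ne.symm hx]
      · simp [hx, hx2, Ne.symm hx, Ne.symm hx2]
  · have : ∀ k : Fin n, ¬ (k = x ∧ k = y) := fun k hk => hxy (hk.1.symm.trans hk.2)
    simp [hxy, this]

lemma diag2n_decomp {i j : Fin n} (h : i ≠ j) (a : ℝ) (ha : a ≠ 0) :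
    (Matrix.SpecialLinearGroup.diag2n h a ha : SLR n) =
      El h a * El h.symm (-a⁻¹) * El h a * El h (-1) * El h.symm 1 * El h (-1) := by
  apply Subtype.ext
  simp only [Matrix.SpecialLinearGroup.coe_mul]
  rw [diag2n_eq]
  simp only [El_eq h, El_eq' h]
  simp only [emb_mul h]
  congr 1 <;> field_simp <;> ring

lemma mautner_id {i j : Fin n} (h : i ≠ j) (t : ℝ) (ht : t ≠ 0) :
    El h t * El h.symm (1/t) * El h (-(t/2)) =
      Matrix.SpecialLinearGroup.diag2n h 2 two_ne_zero * El h.symm (2/t) := by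
  apply Subtype.ext
  simp only [Matrix.SpecialLinearGroup.coe_mul]
  rw [diag2n_eq]
  simp only [El_eq h, El_eq' h]
  simp only [emb_mul h]
  congr 1 <;> field_simp <;> ring

lemma El_comm {i j k l : Fin n} (hij : i ≠ j) (hkl : k ≠ l) (h1 : j ≠ k) (h2 : l ≠ i) (s t : ℝ) :
    El hij s * El hkl t = El hkl t * El hij s := by
  apply Subtype.ext
  simp only [Matrix.SpecialLinearGroup.coe_mul, Matrix.SpecialLinearGroup.transvection_coe]
  simp only [mul_add, add_mul, one_mul, mul_one, Matrix.single_mul_single_of_ne _ _ _ _ h1,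
    Matrix.single_mul_single_of_ne _ _ _ _ h2]
  abel

lemma El_commutator {k i l : Fin n} (hki : k ≠ i) (hil : i ≠ l) (hkl : k ≠ l) (s t : ℝ) :
    El hki s * El hil t = El hil t * El hki s * El hkl (s*t) := by
  apply Subtype.ext
  simp only [Matrix.SpecialLinearGroup.coe_mul, Matrix.SpecialLinearGroup.transvection_coe]
  simp only [mul_add, add_mul, one_mul, mul_one, Matrix.single_mul_single_same,
    Matrix.single_mul_single_of_ne _ _ _ _ hkl.symm, Matrix.single_mul_single_of_ne _ _ _ _ hki.symm, add_zero, zero_mul]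
  abel

lemma El_conj {i j : Fin n} (h : i ≠ j) {k l : Fin n} (hkl : k ≠ l) (t c : ℝ)
    (hc : (if k = i then (2:ℝ) else if k = j then 2⁻¹ else 1) * c = (if l = i then (2:ℝ) else if l = j then 2⁻¹ else 1)) :
    Matrix.SpecialLinearGroup.diag2n h 2 two_ne_zero * El hkl (t * c) =
      El hkl t * Matrix.SpecialLinearGroup.diag2n h 2 two_ne_zero := by
  apply Subtype.ext
  simp only [Matrix.SpecialLinearGroup.coe_mul, Matrix.SpecialLinearGroup.transvection_coe]
  rw [Matrix.SpecialLinearGroup.diag2n_coe]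
  simp only [mul_add, add_mul, one_mul, mul_one]
  congr 1
  ext x y
  simp only [Matrix.diagonal_mul, Matrix.mul_diagonal, Matrix.single_apply]
  by_cases hx : k = x ∧ l = y
  · obtain ⟨rfl, rfl⟩ := hx
    simp only [and_self, if_true]
    rw [← hc]; ring
  · simp [hx]

/-- A subgroup of SL_n containing all elementary matrices is everything. -/
lemma top_of_El (hn : 3 ≤ n) (K : Subgroup (SLR n))
    (hK : ∀ (i j : Fin n) (h : i ≠ j) (t : ℝ), El h t ∈ K) (g : SLR n) : g ∈ K := by
  haveI : Nontrivial (Fin n) := Fin.nontrivial_iff_two_le.2 (by omega)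
  refine Matrix.SpecialLinearGroup.diagonal_transvection_induction' (fun g => g ∈ K) g ?_ hK
    (fun A B => K.mul_mem)
  intro i j hij c hc
  rw [diag2n_decomp]
  exact K.mul_mem (K.mul_mem (K.mul_mem (K.mul_mem (K.mul_mem (hK _ _ _ _) (hK _ _ _ _)) (hK _ _ _ _)) (hK _ _ _ _)) (hK _ _ _ _)) (hK _ _ _ _)

lemma El_cont {i j : Fin n} (h : i ≠ j) : Continuous (fun t : ℝ => (El h t : SLR n)) := by
  refine continuous_induced_rng.2 ?_
  refine continuous_matrix fun a b => ?_
  show Continuous (fun t : ℝ => ((1 : Matrix (Fin n) (Fin n) ℝ) + Matrix.single i j t) a b)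
  simp only [Matrix.add_apply, Matrix.single_apply]
  by_cases hh : i = a ∧ j = b <;> simp [hh] <;> fun_prop

lemma El_zero {i j : Fin n} (h : i ≠ j) : (El h 0 : SLR n) = 1 := by
  simp

lemma El_nat {i j : Fin n} (h : i ≠ j) (t : ℝ) (k : ℕ) : (El h t : SLR n) ^ k = El h (k * t) := by
  induction k with
  | zero => simp
  | succ k ih =>
    rw [pow_succ, ih, ← Matrix.SpecialLinearGroup.transvection_add]
    congr 1; push_cast; ring

variable {H : Type*} [NormedAddCommGroup H] [InnerProductSpace ℂ H]

lemma lie_mul_apply (a b : H ≃ₗᵢ[ℂ] H) (x : H) : (a * b) x = a (b x) := rfl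

/-- stabilizer of a vector -/
def stabv {G : Type*} [Group G] (U : G →* (H ≃ₗᵢ[ℂ] H)) (w : H) : Subgroup G where
  carrier := {g | U g w = w}
  mul_mem' {a b} ha hb := by
    have ha : U a w = w := ha
    have hb : U b w = w := hb
    show U (a*b) w = w
    rw [map_mul, lie_mul_apply, hb, ha]
  one_mem' := by show U 1 w = w; simp
  inv_mem' {a} ha := by
    have ha : U a w = w := ha
    show U a⁻¹ w = w
    rw [map_inv]
    exact (LinearIsometryEquiv.symm_apply_eq (U a)).2 ha.symm

lemma mem_stabv {G : Type*} [Group G] (U : G →* (H ≃ₗᵢ[ℂ] H)) (w : H) (g : G) :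
    g ∈ stabv U w ↔ U g w = w := Iff.rfl

theorem mautner (hn : 3 ≤ n) (U : SLR n →* (H ≃ₗᵢ[ℂ] H)) (w : H)
    (hcont : Tendsto (fun g => U g w) (𝓝 1) (𝓝 w)) {i j : Fin n} (hij : i ≠ j)
    (hfix : U (El hij 1) w = w) (g : SLR n) : U g w = w := by
  set f : SLR n → ℝ := fun g => ‖U g w - w‖ with hf
  have hf0 : Tendsto f (𝓝 1) (𝓝 0) := by
    have := (hcont.sub_const w).norm
    simpa using this
  have hE : ∀ {k l : Fin n} (h : k ≠ l), Tendsto (fun t : ℝ => f (El h t)) (𝓝 0) (𝓝 0) := by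
    intro k l h
    have h2 := (El_cont h).tendsto 0
    rw [El_zero] at h2
    exact hf0.comp h2
  have key : ∀ {a b : SLR n}, f a = 0 ↔ U a w = w := by
    intro a b; simp [hf, sub_eq_zero]
  set K := stabv U w with hK
  have hfixK : El hij 1 ∈ K := hfix
  have hnat : ∀ k : ℕ, El hij (k:ℝ) ∈ K := by
    intro k
    have := K.pow_mem hfixK k
    rwa [El_nat, mul_one] at this
  set a : SLR n := Matrix.SpecialLinearGroup.diag2n hij 2 two_ne_zero with ha
  have hfm : ∀ x y : SLR n, f (x * y) ≤ f x + f y := by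
    intro x y
    simp only [hf, map_mul, lie_mul_apply]
    calc ‖U x (U y w) - w‖ = ‖(U x (U y w) - U x w) + (U x w - w)‖ := by congr 1; abel
      _ ≤ ‖U x (U y w) - U x w‖ + ‖U x w - w‖ := norm_add_le _ _
      _ = ‖U y w - w‖ + ‖U x w - w‖ := by rw [← map_sub, LinearIsometryEquiv.norm_map]
      _ = _ := add_comm _ _
  have hfinv : ∀ x : SLR n, f x⁻¹ = f x := by
    intro x
    simp only [hf]
    rw [← LinearIsometryEquiv.norm_map (U x) (U x⁻¹ w - w), map_sub, ← lie_mul_apply, ← map_mul]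
    simp [norm_sub_rev]
  have hfK : ∀ x ∈ K, f x = 0 := by
    intro x hx
    have hx : U x w = w := hx
    simp [hf, hx]
  have haK : U a w = w := by
    have hle : ∀ k : ℕ, 0 < k → f a ≤ f (El hij.symm (1/(2*k:ℝ))) + f (El hij.symm (2/(2*k:ℝ))) := by
      intro k hk
      have hk' : (2*k:ℝ) ≠ 0 := by positivity
      have := mautner_id hij (2*k:ℝ) hk'
      have h3 : a = El hij (2*k:ℝ) * El hij.symm (1/(2*k:ℝ)) * El hij (-(2*k/2:ℝ)) * (El hij.symm (2/(2*k:ℝ)))⁻¹ := by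
        rw [this]; simp [ha]
      have e1 : f (El hij (2*k:ℝ)) = 0 := by
        apply hfK; have := hnat (2*k); push_cast at this; exact this
      have e2 : f (El hij (-(2*k/2:ℝ))) = 0 := by
        apply hfK
        show Matrix.SpecialLinearGroup.transvection hij (-(2*k/2:ℝ)) ∈ K
        rw [← Matrix.SpecialLinearGroup.transvection_inv]
        apply K.inv_mem
        have := hnat k
        convert this using 2; ring
      have e3 := hfinv (El hij.symm (2/(2*k:ℝ)))
      have i1 := hfm (El hij (2*k:ℝ) * El hij.symm (1/(2*k:ℝ)) * El hij (-(2*k/2:ℝ))) (El hij.symm (2/(2*k:ℝ)))⁻¹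
      have i2 := hfm (El hij (2*k:ℝ) * El hij.symm (1/(2*k:ℝ))) (El hij (-(2*k/2:ℝ)))
      have i3 := hfm (El hij (2*k:ℝ)) (El hij.symm (1/(2*k:ℝ)))
      rw [← h3] at i1
      linarith
    have l1 : Tendsto (fun k : ℕ => (1/(2*k:ℝ))) atTop (𝓝 0) := by
      have := (tendsto_one_div_atTop_nhds_zero_nat (𝕜 := ℝ)).const_mul (1/2:ℝ)
      rw [mul_zero] at this
      refine this.congr fun k => ?_
      rw [one_div_mul_one_div]
    have l2 : Tendsto (fun k : ℕ => (2/(2*k:ℝ))) atTop (𝓝 0) := by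
      have := l1.const_mul 2
      rw [mul_zero] at this
      refine this.congr fun k => ?_
      ring
    have l3 := ((hE hij.symm).comp l1).add ((hE hij.symm).comp l2)
    rw [add_zero] at l3
    have l4 : f a ≤ 0 := ge_of_tendsto l3 (by
      filter_upwards [eventually_gt_atTop 0] with k hk
      exact hle k hk)
    exact (key (b := 1)).1 (le_antisymm l4 (norm_nonneg _))
  have haKm : a ∈ K := haK
  -- contraction
  have hconj : ∀ (x y : SLR n), a * x = y * a → f y = f x := by
    intro x y hxy
    have e0 : f a = 0 := hfK a haKm
    have e0' : f a⁻¹ = 0 := by rw [hfinv, e0]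
    apply le_antisymm
    · have : y = a * x * a⁻¹ := by rw [hxy]; simp
      have i1 := hfm (a*x) a⁻¹
      have i2 := hfm a x
      rw [← this] at i1; linarith
    · have : x = a⁻¹ * y * a := by rw [mul_assoc, ← hxy]; simp
      have i1 := hfm (a⁻¹*y) a
      have i2 := hfm a⁻¹ y
      rw [← this] at i1; linarith
  have hcontr : ∀ {k l : Fin n} (h : k ≠ l) (c : ℝ), |c| < 1 → (∀ t, f (El h t) = f (El h (t*c))) →
      ∀ t, El h t ∈ K := by
    intro k l h c hc hh t
    have e : ∀ m : ℕ, f (El h t) = f (El h (t * c^m)) := by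
      intro m
      induction m with
      | zero => simp
      | succ m ih => rw [ih, hh (t * c^m), pow_succ, mul_assoc]
    have lim : Tendsto (fun m : ℕ => t * c^m) atTop (𝓝 0) := by
      have := (tendsto_pow_atTop_nhds_zero_of_abs_lt_one hc).const_mul t
      simpa using this
    have l2 := (hE h).comp lim
    have l3 : Tendsto (fun m : ℕ => f (El h t)) atTop (𝓝 0) := l2.congr fun m => (e m).symm
    have : f (El h t) = 0 := tendsto_nhds_unique tendsto_const_nhds l3
    exact (key (b := 1)).1 this
  have hA : ∀ {k l : Fin n} (h : k ≠ l) (c : ℝ), |c| < 1 →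
      ((if k = i then (2:ℝ) else if k = j then 2⁻¹ else 1) * c = (if l = i then (2:ℝ) else if l = j then 2⁻¹ else 1)) →
      ∀ t, El h t ∈ K := by
    intro k l h c hc hh
    exact hcontr h c hc fun t => hconj _ _ (El_conj hij h t c hh)
  have hB : ∀ {k l : Fin n} (h : k ≠ l) (c : ℝ), |c| < 1 →
      ((if k = i then (2:ℝ) else if k = j then 2⁻¹ else 1) = (if l = i then (2:ℝ) else if l = j then 2⁻¹ else 1) * c) →
      ∀ t, El h t ∈ K := by
    intro k l h c hc hh
    by_cases hc0 : c = 0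
    · exfalso
      rw [hc0, mul_zero] at hh
      revert hh
      split_ifs <;> norm_num
    refine hcontr h c hc fun t => ?_
    refine (hconj _ _ ?_).symm
    have := El_conj hij h (t*c) c⁻¹ (by rw [hh]; field_simp)
    rw [mul_assoc, mul_inv_cancel₀ hc0, mul_one] at this
    exact this
  have hji := hij.symm
  have hrow : ∀ l (h : i ≠ l) t, El h t ∈ K := by
    intro l h t
    by_cases hl : l = j
    · refine hA h (1/4) (by norm_num [abs_of_pos]) ?_ t
      simp [hl, hji]; norm_num
    · refine hA h (1/2) (by norm_num [abs_of_pos]) ?_ t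
      simp [hl, h.symm]
  have hcol : ∀ l (h : l ≠ i) t, El h t ∈ K := by
    intro l h t
    by_cases hl : l = j
    · refine hB h (1/4) (by norm_num [abs_of_pos]) ?_ t
      simp [hl, hji]; norm_num
    · refine hB h (1/2) (by norm_num [abs_of_pos]) ?_ t
      simp [hl, h]
  refine top_of_El hn K ?_ g
  intro k l h t
  by_cases hk : i = k
  · subst hk; exact hrow l h t
  by_cases hl : l = i
  · subst hl; exact hcol k h t
  have h1 : k ≠ i := fun h => hk h.symm
  have h2 : i ≠ l := fun h => hl h.symm
  have := El_commutator h1 h2 h t 1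
  rw [mul_one] at this
  have h3 : El h t = (El h2 1 * El h1 t)⁻¹ * (El h1 t * El h2 1) := by rw [this]; group
  rw [h3]
  exact K.mul_mem (K.inv_mem (K.mul_mem (hrow _ _ _) (hcol _ _ _))) (K.mul_mem (hcol _ _ _) (hrow _ _ _))

end SLn
end DistalProof
end

section
set_option linter.all false
open MeasureTheory Filter Topology
open scoped ENNReal
namespace DistalProof

section FD
variable {G : Type*} [Group G] [TopologicalSpace G] [IsTopologicalGroup G] [SecondCountableTopology G]
  [MeasurableSpace G] [BorelSpace G]

theorem exists_cocycle (Γ : Subgroup G) [DiscreteTopology Γ] :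
    ∃ c : G → Γ, (∀ γ, MeasurableSet {x | c x = γ}) ∧ ∀ x (γ : Γ), c (x * γ) = γ⁻¹ * c x := by
  classical
  haveI : Countable Γ := countable_of_Lindelof_of_discrete
  have hW : ∃ W ∈ 𝓝 (1:G), ∀ γ : Γ, (γ:G) ∈ W → γ = 1 := by
    have h1 : ({1} : Set Γ) ∈ 𝓝 (1:Γ) := by simp
    rw [nhds_subtype_eq_comap] at h1
    obtain ⟨W, hW, hs⟩ := h1
    exact ⟨W, hW, fun γ hγ => hs hγ⟩
  obtain ⟨W, hW, hW1⟩ := hW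
  have hV : ∀ x : G, ∃ V : Set G, IsOpen V ∧ x ∈ V ∧ ∀ y ∈ V, ∀ z ∈ V, y⁻¹ * z ∈ W := by
    intro x
    have hc : ContinuousAt (fun q : G × G => q.1⁻¹ * q.2) (x, x) := by fun_prop
    have h2 : (fun q : G × G => q.1⁻¹ * q.2) ⁻¹' W ∈ 𝓝 (x, x) := hc (by simpa using hW)
    rw [mem_nhds_prod_iff'] at h2
    obtain ⟨u, v, hu, hxu, hv, hxv, hs⟩ := h2
    exact ⟨u ∩ v, hu.inter hv, ⟨hxu, hxv⟩, fun y hy z hz => hs (show (y, z) ∈ u ×ˢ v from ⟨hy.1, hz.2⟩)⟩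
  choose V hVo hVx hVW using hV
  obtain ⟨s, hs, hsu⟩ := TopologicalSpace.countable_cover_nhds fun x => (hVo x).mem_nhds (hVx x)
  have hsne : s.Nonempty := by
    by_contra h
    rw [Set.not_nonempty_iff_eq_empty] at h
    rw [h] at hsu
    have : (1:G) ∈ (Set.univ : Set G) := trivial
    rw [← hsu] at this
    simp at this
  obtain ⟨e, he⟩ := hs.exists_eq_range hsne
  have hcov : ∀ x : G, ∃ i : ℕ, ∃ γ : Γ, x * γ ∈ V (e i) := by
    intro x
    have : x ∈ (Set.univ : Set G) := trivial
    rw [← hsu, he] at this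
    simp only [Set.mem_range, Set.iUnion_exists, Set.iUnion_iUnion_eq', Set.mem_iUnion] at this
    obtain ⟨i, hi⟩ := this
    exact ⟨i, 1, by simpa using hi⟩
  have hmin := fun x => Nat.find_spec (hcov x)
  choose c hc using hmin
  have huniq : ∀ (x : G) i (γ γ' : Γ), x * γ ∈ V (e i) → x * γ' ∈ V (e i) → γ = γ' := by
    intro x i γ γ' h1 h2
    have h3 := hVW _ _ h1 _ h2
    have h4 : (x * (γ:G))⁻¹ * (x * γ') = ((γ⁻¹ * γ' : Γ) : G) := by push_cast; group
    rw [h4] at h3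
    have := hW1 _ h3
    rw [inv_mul_eq_one] at this
    exact this
  refine ⟨c, ?_, ?_⟩
  · intro γ
    have : {x | c x = γ} = ⋃ i : ℕ, ({x : G | x * γ ∈ V (e i)} ∩ ⋂ j : ℕ, ⋂ (_ : j < i), ⋂ γ' : Γ, {x : G | x * γ' ∈ V (e j)}ᶜ) := by
      ext x
      simp only [Set.mem_ofPred_eq, Set.mem_iUnion, Set.mem_inter_iff, Set.mem_iInter, Set.mem_compl_iff]
      constructor
      · rintro rfl
        refine ⟨_, hc x, fun j hj γ' h => ?_⟩
        exact Nat.find_min (hcov x) hj ⟨γ', h⟩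
      · rintro ⟨i, hi, hj⟩
        have : Nat.find (hcov x) = i := by
          rw [Nat.find_eq_iff]
          exact ⟨⟨γ, hi⟩, fun j hji ⟨γ', h⟩ => hj j hji γ' h⟩
        have h1 := hc x
        rw [this] at h1
        exact huniq x i _ _ h1 hi
    rw [this]
    refine MeasurableSet.iUnion fun i => MeasurableSet.inter ?_ (MeasurableSet.iInter fun j => MeasurableSet.iInter fun _ => MeasurableSet.iInter fun γ' => MeasurableSet.compl ?_)
    · exact ((hVo (e i)).preimage (continuous_mul_const (γ:G))).measurableSet
    · exact ((hVo (e j)).preimage (continuous_mul_const (γ':G))).measurableSet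
  · intro x γ
    have hh : ∀ i, (∃ γ' : Γ, x * γ * γ' ∈ V (e i)) ↔ ∃ γ' : Γ, x * γ' ∈ V (e i) := by
      intro i
      constructor
      · rintro ⟨γ', h⟩; exact ⟨γ * γ', by push_cast; rwa [← mul_assoc]⟩
      · rintro ⟨γ', h⟩; exact ⟨γ⁻¹ * γ', by push_cast; convert h using 1; group⟩
    have hi : Nat.find (hcov (x * γ)) = Nat.find (hcov x) := by
      rw [Nat.find_eq_iff]
      refine ⟨(hh _).2 (Nat.find_spec (hcov x)), fun j hj h => Nat.find_min (hcov x) hj ((hh _).1 h)⟩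
    have h1 := hc (x * γ)
    rw [hi] at h1
    have h2 := hc x
    have h3 : γ * c (x*γ) = c x := huniq x _ _ _ (by push_cast; rwa [← mul_assoc]) h2
    rw [← h3]; group

/-- Borel cocycle section for a discrete subgroup -/
structure Cocyc (Γ : Subgroup G) where
  c : G → Γ
  meas : ∀ γ, MeasurableSet {x | c x = γ}
  eqv : ∀ x (γ : Γ), c (x * γ) = γ⁻¹ * c x

variable {Γ : Subgroup G}
/-- the fundamental domain -/
def Cocyc.F (C : Cocyc Γ) : Set G := {x | C.c x = 1}

lemma Cocyc.measF (C : Cocyc Γ) : MeasurableSet C.F := C.meas 1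
lemma Cocyc.memF (C : Cocyc Γ) (x : G) : x * C.c x ∈ C.F := by
  show C.c (x * C.c x) = 1
  rw [C.eqv]; simp

variable (μ : Measure G)

lemma Cocyc.isFD (C : Cocyc Γ) : IsFundamentalDomain Γ.op C.F μ := by
  refine IsFundamentalDomain.mk' C.measF.nullMeasurableSet ?_
  intro x
  refine ⟨⟨MulOpposite.op (C.c x : G), by simp⟩, ?_, ?_⟩
  · exact C.memF x
  · rintro ⟨y, hy⟩ h
    have hy' : MulOpposite.unop y ∈ Γ := hy
    have h : C.c (x * ((⟨MulOpposite.unop y, hy'⟩ : Γ) : G)) = 1 := h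
    rw [C.eqv, inv_mul_eq_one] at h
    apply Subtype.ext
    show y = _
    rw [← h]; rfl

/-- left translate of cocycle -/
def Cocyc.tr (C : Cocyc Γ) (g : G) : Cocyc Γ where
  c x := C.c (g * x)
  meas γ := by
    have := (measurable_const_mul g) (C.meas γ)
    exact this
  eqv x γ := by rw [← mul_assoc, C.eqv]

lemma Cocyc.aesm [DiscreteTopology Γ] (C : Cocyc Γ) {E : Type*} [TopologicalSpace E] [TopologicalSpace.PseudoMetrizableSpace E] (f : Γ → G → E)
    (hf : ∀ γ, AEStronglyMeasurable (f γ) (μ.restrict {x | C.c x = γ})) :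
    AEStronglyMeasurable (fun x => f (C.c x) x) μ := by
  haveI : Countable Γ := countable_of_Lindelof_of_discrete
  have hU : (⋃ γ : Γ, {x | C.c x = γ}) = Set.univ := by
    ext x; simp
  rw [← Measure.restrict_univ (μ := μ), ← hU, aestronglyMeasurable_iUnion_iff]
  intro γ
  refine (hf γ).congr ?_
  filter_upwards [ae_restrict_mem (C.meas γ)] with x hx
  have hx : C.c x = γ := hx
  rw [hx]

variable [μ.IsHaarMeasure] [μ.IsMulRightInvariant] [DiscreteTopology Γ]

lemma Cocyc.setLIntegral (C : Cocyc Γ) (g : G) (f : G → ℝ≥0∞) (hf : ∀ x (γ : Γ), f (x * γ) = f x) :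
    ∫⁻ x in C.F, f (g * x) ∂μ = ∫⁻ x in C.F, f x ∂μ := by
  haveI : Countable Γ := countable_of_Lindelof_of_discrete
  haveI : Countable Γ.op := inferInstance
  have h1 : ∫⁻ x in C.F, f (g * x) ∂μ = ∫⁻ x in (C.tr g⁻¹).F, f x ∂μ := by
    have mp := (measurePreserving_mul_left μ g).setLIntegral_comp_preimage_emb
      (MeasurableEquiv.mulLeft g).measurableEmbedding f (C.tr g⁻¹).F
    rw [← mp]
    have : (fun x => g * x) ⁻¹' (C.tr g⁻¹).F = C.F := by
      ext x
      show C.c (g⁻¹ * (g * x)) = 1 ↔ C.c x = 1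
      simp
    rw [this]
  rw [h1]
  refine ((C.tr g⁻¹).isFD μ).setLIntegral_eq (C.isFD μ) f ?_
  rintro ⟨y, hy⟩ x
  exact hf x ⟨MulOpposite.unop y, hy⟩

lemma Cocyc.ae_of_F (C : Cocyc Γ) (P : G → Prop) (hP : ∀ x (γ : Γ), P (x * γ) ↔ P x)
    (h : ∀ᵐ x ∂(μ.restrict C.F), P x) : ∀ᵐ x ∂μ, P x := by
  haveI : Countable Γ := countable_of_Lindelof_of_discrete
  rw [ae_iff] 
  refine (C.isFD μ).measure_zero_of_invariant _ ?_ ?_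
  · rintro ⟨y, hy⟩
    ext x
    rw [Set.mem_smul_set_iff_inv_smul_mem]
    show (¬ P (x * ((⟨MulOpposite.unop y, hy⟩ : Γ)⁻¹ : Γ))) ↔ ¬ P x
    rw [hP]
  · rw [ae_iff, Measure.restrict_apply' C.measF] at h
    exact h

lemma Cocyc.ae_mul (g : G) (P : G → Prop) (h : ∀ᵐ x ∂μ, P x) : ∀ᵐ x ∂μ, P (g * x) :=
  (measurePreserving_mul_left μ g).quasiMeasurePreserving.ae h

lemma Cocyc.ae_mul_right (g : G) (P : G → Prop) (h : ∀ᵐ x ∂μ, P x) : ∀ᵐ x ∂μ, P (x * g) :=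
  (measurePreserving_mul_right μ g).quasiMeasurePreserving.ae h

lemma bound2 {α : Type*} [MeasurableSpace α] (ν : Measure α) {E : Type*} [NormedAddCommGroup E]
    (f : α → E) (hf : AEStronglyMeasurable f ν) (A : Set α) (hA : MeasurableSet A) (C : ℝ)
    (h : ∀ x ∈ Aᶜ, ‖f x‖ ≤ C) :
    eLpNorm f 2 ν ≤ eLpNorm f 2 (ν.restrict A) + ν Aᶜ ^ (1/2:ℝ) * ENNReal.ofReal C := by
  have e : f = A.indicator f + Aᶜ.indicator f := (Set.indicator_self_add_compl A f).symm
  calc eLpNorm f 2 ν = eLpNorm (A.indicator f + Aᶜ.indicator f) 2 ν := by rw [← e]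
    _ ≤ eLpNorm (A.indicator f) 2 ν + eLpNorm (Aᶜ.indicator f) 2 ν :=
      eLpNorm_add_le (hf.indicator hA) (hf.indicator hA.compl) (by norm_num)
    _ ≤ _ := by
      rw [eLpNorm_indicator_eq_eLpNorm_restrict hA, eLpNorm_indicator_eq_eLpNorm_restrict hA.compl]
      gcongr
      have := eLpNorm_le_of_ae_bound (p := 2) (μ := ν.restrict Aᶜ) (f := f) (C := C)
        ((ae_restrict_iff' hA.compl).2 (ae_of_all _ h))
      simpa using this

end FD
end DistalProof
end

section
set_option linter.all false
open MeasureTheory Filter Topology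
open scoped ENNReal
namespace DistalProof

theorem induce_abs {G : Type*} [Group G] {P : Type*} [AddCommGroup P] [Module ℂ P] {K : Type*}
    [NormedAddCommGroup K] [InnerProductSpace ℂ K]
    (r : P →ₗ[ℂ] K) (hr : Function.Surjective r) (L : G → P →ₗ[ℂ] P) (L1 : ∀ p, L 1 p = p)
    (Lm : ∀ g h p, L (g*h) p = L g (L h p)) (hL : ∀ g p, ‖r (L g p)‖ = ‖r p‖) :
    ∃ U : G →* (K ≃ₗᵢ[ℂ] K), ∀ g p, U g (r p) = r (L g p) := by
  classical
  choose e he using hr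
  have hwd : ∀ g p q, r p = r q → r (L g p) = r (L g q) := by
    intro g p q h
    rw [← sub_eq_zero, ← map_sub, ← map_sub, ← norm_eq_zero, hL, map_sub, h, sub_self, norm_zero]
  let V : G → K →ₗᵢ[ℂ] K := fun g =>
    { toFun := fun f => r (L g (e f))
      map_add' := fun f f' => by
        rw [← map_add, ← map_add]
        apply hwd
        rw [map_add, he, he, he]
      map_smul' := fun a f => by
        rw [RingHom.id_apply, ← map_smul, ← map_smul]
        apply hwd
        rw [map_smul, he, he]
      norm_map' := fun f => by
        show ‖r (L g (e f))‖ = _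
        rw [hL, he] }
  have hV : ∀ g p, V g (r p) = r (L g p) := by
    intro g p
    exact hwd g _ _ (he _)
  have hVV : ∀ g h f, V (g*h) f = V g (V h f) := by
    intro g h f
    rw [← he f]
    rw [hV, hV, hV, Lm]
  have hV1 : ∀ f, V 1 f = f := by
    intro f
    rw [← he f, hV, L1]
  let W : G → (K ≃ₗᵢ[ℂ] K) := fun g =>
    LinearIsometryEquiv.mk (LinearEquiv.ofLinear (V g).toLinearMap (V g⁻¹).toLinearMap
      (by ext f; show V g (V g⁻¹ f) = f; rw [← hVV]; simp [hV1])
      (by ext f; show V g⁻¹ (V g f) = f; rw [← hVV]; simp [hV1])) (fun f => (V g).norm_map f)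
  refine ⟨{ toFun := W, map_one' := ?_, map_mul' := ?_ }, ?_⟩
  · ext f; exact hV1 f
  · intro g h; ext f; exact hVV g h f
  · intro g p; exact hV g p

section Ind
variable {G : Type*} [Group G] [TopologicalSpace G] [IsTopologicalGroup G] [SecondCountableTopology G]
  [MeasurableSpace G] [BorelSpace G] {Γ : Subgroup G} [DiscreteTopology Γ]
  (C : Cocyc Γ) (μ : Measure G) [μ.IsHaarMeasure] [μ.IsMulRightInvariant]
  {H : Type*} [NormedAddCommGroup H] [InnerProductSpace ℂ H] (π : Γ →* (H ≃ₗᵢ[ℂ] H))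

/-- equivariant functions, square integrable on the fundamental domain -/
def IndP : Submodule ℂ (G → H) where
  carrier := {p | AEStronglyMeasurable p μ ∧ (∀ x (γ : Γ), p (x * γ) = π γ⁻¹ (p x)) ∧ MemLp p 2 (μ.restrict C.F)}
  add_mem' {p q} hp hq := ⟨hp.1.add hq.1, fun x γ => by simp only [Pi.add_apply, map_add, hp.2.1, hq.2.1], hp.2.2.add hq.2.2⟩
  zero_mem' := ⟨aestronglyMeasurable_zero, fun x γ => by simp, MemLp.zero⟩
  smul_mem' a p hp := ⟨hp.1.const_smul a, fun x γ => by simp only [Pi.smul_apply, map_smul, hp.2.1], hp.2.2.const_smul a⟩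

lemma mem_IndP (p : G → H) : p ∈ IndP C μ π ↔ AEStronglyMeasurable p μ ∧ (∀ x (γ : Γ), p (x * γ) = π γ⁻¹ (p x)) ∧ MemLp p 2 (μ.restrict C.F) := Iff.rfl

lemma eLpNorm_tr (g : G) (p : G → H) (hp : ∀ x (γ : Γ), ‖p (x * γ)‖ = ‖p x‖) :
    eLpNorm (fun x => p (g * x)) 2 (μ.restrict C.F) = eLpNorm p 2 (μ.restrict C.F) := by
  rw [eLpNorm_eq_lintegral_rpow_enorm_toReal (by norm_num) (by norm_num), eLpNorm_eq_lintegral_rpow_enorm_toReal (by norm_num) (by norm_num)]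
  congr 1
  exact C.setLIntegral μ g (fun x => ‖p x‖ₑ ^ (2:ℝ≥0∞).toReal) (fun x γ => by
    rw [← ofReal_norm, ← ofReal_norm, hp])

lemma aesm_tr (g : G) (p : G → H) (hp : AEStronglyMeasurable p μ) :
    AEStronglyMeasurable (fun x => p (g * x)) μ :=
  hp.comp_quasiMeasurePreserving (measurePreserving_mul_left μ g).quasiMeasurePreserving

variable {π C μ} in
lemma IndP_tr (g : G) {p : G → H} (hp : p ∈ IndP C μ π) : (fun x => p (g * x)) ∈ IndP C μ π := by
  refine ⟨aesm_tr μ g p hp.1, fun x γ => by show p (g * (x * γ)) = π γ⁻¹ (p (g * x)); rw [← mul_assoc, hp.2.1], (aesm_tr μ g p hp.1).restrict, ?_⟩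
  rw [eLpNorm_tr C μ g p (fun x γ => by rw [hp.2.1, LinearIsometryEquiv.norm_map])]
  exact hp.2.2.2

/-- restriction map to L2 -/
noncomputable def indr : IndP C μ π →ₗ[ℂ] Lp H 2 (μ.restrict C.F) where
  toFun p := p.2.2.2.toLp p.1
  map_add' p q := rfl
  map_smul' a p := rfl

lemma indr_norm (p : IndP C μ π) : ‖indr C μ π p‖ = (eLpNorm p.1 2 (μ.restrict C.F)).toReal :=
  Lp.norm_toLp p.1 p.2.2.2

lemma indr_eq_iff (p q : IndP C μ π) : indr C μ π p = indr C μ π q ↔ p.1 =ᵐ[μ.restrict C.F] q.1 :=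
  MemLp.toLp_eq_toLp_iff p.2.2.2 q.2.2.2

lemma indr_surj : Function.Surjective (indr C μ π) := by
  intro f
  let p : G → H := fun x => π (C.c x) (f (x * C.c x))
  have hpF : ∀ᵐ x ∂(μ.restrict C.F), p x = f x := by
    filter_upwards [ae_restrict_mem C.measF] with x hx
    have hx : C.c x = 1 := hx
    show π (C.c x) (f (x * C.c x)) = _
    rw [hx]; simp
  have hp : p ∈ IndP C μ π := by
    refine ⟨?_, ?_, ?_⟩
    · refine C.aesm μ (fun γ x => π γ (f (x * γ))) fun γ => ?_
      refine (π γ).continuous.comp_aestronglyMeasurable ?_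
      refine AEStronglyMeasurable.restrict ?_
      exact ((Lp.stronglyMeasurable f).comp_measurable (measurable_mul_const (γ:G))).aestronglyMeasurable
    · intro x γ
      show π (C.c (x * γ)) (f (x * γ * C.c (x * γ))) = π γ⁻¹ (π (C.c x) (f (x * C.c x)))
      rw [C.eqv, map_mul, lie_mul_apply]
      congr 3
      push_cast; group
    · exact (memLp_congr_ae hpF).2 (Lp.memLp f)
  refine ⟨⟨p, hp⟩, ?_⟩
  refine Lp.ext ?_
  exact (MemLp.coeFn_toLp hp.2.2).trans hpF

/-- translation on IndP -/
def indL (g : G) : IndP C μ π →ₗ[ℂ] IndP C μ π where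
  toFun p := ⟨fun x => p.1 (g⁻¹ * x), IndP_tr g⁻¹ p.2⟩
  map_add' p q := rfl
  map_smul' a p := rfl

theorem exists_ind : ∃ U : G →* (Lp H 2 (μ.restrict C.F) ≃ₗᵢ[ℂ] Lp H 2 (μ.restrict C.F)),
    ∀ g p, U g (indr C μ π p) = indr C μ π (indL C μ π g p) := by
  refine induce_abs (indr C μ π) (indr_surj C μ π) (indL C μ π) ?_ ?_ ?_
  · intro p; apply Subtype.ext; ext x
    show p.1 (1⁻¹ * x) = p.1 x
    simp
  · intro g h p; apply Subtype.ext; ext x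
    show p.1 ((g*h)⁻¹ * x) = p.1 (h⁻¹ * (g⁻¹ * x))
    congr 1; group
  · intro g p
    rw [indr_norm, indr_norm]
    congr 1
    exact eLpNorm_tr C μ g⁻¹ p.1 (fun x γ => by rw [p.2.2.1, LinearIsometryEquiv.norm_map])

/-- truncation -/
noncomputable def trunc (v : H) : H := (((max 1 ‖v‖)⁻¹ : ℝ) : ℂ) • v

lemma trunc_cont : Continuous (trunc : H → H) := by
  unfold trunc
  refine Continuous.smul (Complex.continuous_ofReal.comp (Continuous.inv₀ (continuous_const.max continuous_norm) fun v => ?_)) continuous_id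
  have : 1 ≤ max 1 ‖v‖ := le_max_left _ _
  linarith

lemma trunc_le (v : H) : ‖trunc v‖ ≤ 1 := by
  unfold trunc
  have : 1 ≤ max 1 ‖v‖ := le_max_left _ _
  rw [norm_smul, Complex.norm_real, norm_inv, Real.norm_of_nonneg (by linarith), inv_mul_le_iff₀ (by linarith), mul_one]
  exact le_max_right _ _

lemma trunc_le' (v : H) : ‖trunc v‖ ≤ ‖v‖ := by
  unfold trunc
  have : 1 ≤ max 1 ‖v‖ := le_max_left _ _
  rw [norm_smul, Complex.norm_real, norm_inv, Real.norm_of_nonneg (by linarith), inv_mul_le_iff₀ (by linarith)]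
  nlinarith [norm_nonneg v]

lemma trunc_eq_zero (v : H) : trunc v = 0 ↔ v = 0 := by
  unfold trunc
  have : 1 ≤ max 1 ‖v‖ := le_max_left _ _
  rw [smul_eq_zero]
  constructor
  · rintro (h | h)
    · rw [Complex.ofReal_eq_zero, inv_eq_zero] at h; linarith
    · exact h
  · exact Or.inr

lemma trunc_map (u : H ≃ₗᵢ[ℂ] H) (v : H) : trunc (u v) = u (trunc v) := by
  unfold trunc
  rw [LinearIsometryEquiv.norm_map]
  exact (map_smul u _ v).symm

lemma trunc_mem (p : G → H) (hp : p ∈ IndP C μ π) : (fun x => trunc (p x)) ∈ IndP C μ π := by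
  have h1 := trunc_cont.comp_aestronglyMeasurable hp.1
  refine ⟨h1, fun x γ => by show trunc (p (x * γ)) = π γ⁻¹ (trunc (p x)); rw [hp.2.1, trunc_map], ?_⟩
  exact hp.2.2.of_le h1.restrict (ae_of_all _ fun x => trunc_le' _)

/-- G-fixed equivariant functions give Γ-fixed vectors -/
theorem fixed_of_inv [LocallyCompactSpace G] (p : IndP C μ π) (hp : indr C μ π p ≠ 0)
    (hfix : ∀ g, indr C μ π (indL C μ π g p) = indr C μ π p) :
    ∃ h : H, h ≠ 0 ∧ ∀ γ, π γ h = h := by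
  have h1 : ∀ g : G, ∀ᵐ x ∂μ, p.1 (g * x) = p.1 x := by
    intro g
    refine C.ae_of_F μ _ (fun x γ => ?_) ?_
    · rw [← mul_assoc, p.2.2.1, p.2.2.1]
      exact (π γ⁻¹).injective.eq_iff
    · have := (indr_eq_iff C μ π _ _).1 (hfix g⁻¹)
      filter_upwards [this] with x hx
      have hx : p.1 ((g⁻¹)⁻¹ * x) = p.1 x := hx
      rwa [inv_inv] at hx
  set p0 := p.2.1.mk p.1 with hp0
  have hsm : StronglyMeasurable p0 := p.2.1.stronglyMeasurable_mk
  have hae : ∀ᵐ x ∂μ, p.1 x = p0 x := p.2.1.ae_eq_mk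
  have h2 : ∀ᵐ g ∂μ, ∀ᵐ x ∂μ, p0 (g * x) = p0 x := by
    refine ae_of_all _ fun g => ?_
    filter_upwards [h1 g, hae, Cocyc.ae_mul μ g _ hae] with x a b c
    rw [← c, a, b]
  have hms : MeasurableSet {q : G × G | p0 (q.1 * q.2) = p0 q.2} :=
    (hsm.comp_measurable (measurable_fst.mul measurable_snd)).measurableSet_eq_fun (hsm.comp_measurable measurable_snd)
  rw [Measure.ae_ae_comm hms] at h2
  obtain ⟨x0, hx0⟩ := h2.exists
  have h3 : ∀ᵐ y ∂μ, p0 y = p0 x0 := by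
    have := Cocyc.ae_mul_right μ x0⁻¹ _ hx0
    filter_upwards [this] with y hy
    simpa using hy
  have h4 : ∀ᵐ y ∂μ, p.1 y = p0 x0 := by
    filter_upwards [h3, hae] with y a b
    rw [b, a]
  refine ⟨p0 x0, ?_, ?_⟩
  · intro h0
    apply hp
    rw [← map_zero (indr C μ π), indr_eq_iff]
    refine ae_restrict_of_ae ?_
    filter_upwards [h4] with y hy
    rw [hy, h0]; rfl
  · intro γ
    have h5 := Cocyc.ae_mul_right μ ((γ⁻¹ : Γ):G) _ h4
    obtain ⟨y, hy1, hy2⟩ := (h4.and h5).exists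
    rw [p.2.2.1, hy1] at hy2
    simpa using hy2

end Ind
end DistalProof
end

section
set_option linter.all false
open MeasureTheory Filter Topology
open scoped ENNReal
namespace DistalProof

section Ind
variable {G : Type*} [Group G] [TopologicalSpace G] [IsTopologicalGroup G] [SecondCountableTopology G]
  [MeasurableSpace G] [BorelSpace G] [LocallyCompactSpace G] [T2Space G] {Γ : Subgroup G} [DiscreteTopology Γ]
  (C : Cocyc Γ) (μ : Measure G) [μ.IsHaarMeasure] [μ.IsMulRightInvariant]

lemma fin_restrict (hF : μ C.F ≠ ∞) : IsFiniteMeasure (μ.restrict C.F) :=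
  ⟨by rw [Measure.restrict_apply_univ]; exact hF.lt_top⟩

theorem ind_cont {H : Type*} [NormedAddCommGroup H] [InnerProductSpace ℂ H] (π : Γ →* (H ≃ₗᵢ[ℂ] H))
    (hF : μ C.F ≠ ∞) (p : IndP C μ π) (hb : ∀ x, ‖p.1 x‖ ≤ 1) :
    Tendsto (fun g => indr C μ π (indL C μ π g p)) (𝓝 1) (𝓝 (indr C μ π p)) := by
  rw [tendsto_iff_norm_sub_tendsto_zero]
  have e1 : ∀ g, ‖indr C μ π (indL C μ π g p) - indr C μ π p‖ =
      (eLpNorm (fun x => p.1 (g⁻¹ * x) - p.1 x) 2 (μ.restrict C.F)).toReal := by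
    intro g
    rw [← map_sub, indr_norm]; rfl
  simp only [e1]
  rw [← ENNReal.toReal_zero]
  refine (ENNReal.tendsto_toReal ENNReal.zero_ne_top).comp ?_
  rw [ENNReal.tendsto_nhds_zero]
  intro ε hε
  obtain ⟨δ, hδ, hδε⟩ : ∃ δ : ℝ≥0∞, δ ≠ 0 ∧ δ ^ (1/2:ℝ) * ENNReal.ofReal 2 ≤ ε / 2 := by
    by_cases hT : ε = ⊤
    · refine ⟨1, one_ne_zero, ?_⟩
      rw [hT, ENNReal.top_div_of_ne_top (by norm_num)]
      exact le_top
    refine ⟨(ε/4)^2, by simp [hε.ne'], ?_⟩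
    rw [← ENNReal.rpow_natCast, ← ENNReal.rpow_mul]
    have e4 : (4:ℝ≥0∞) = 2 * 2 := by norm_num
    have e2 : ENNReal.ofReal 2 = 2 := by norm_num
    rw [e2, show ((2:ℕ):ℝ) * (1/2) = 1 by norm_num, ENNReal.rpow_one, e4, ENNReal.div_eq_inv_mul,
      ENNReal.mul_inv (by norm_num) (by norm_num), ENNReal.div_eq_inv_mul]
    refine le_of_eq ?_
    calc 2⁻¹ * 2⁻¹ * ε * 2 = 2⁻¹ * ε * (2⁻¹ * 2) := by ring
      _ = _ := by rw [ENNReal.inv_mul_cancel (by norm_num) (by norm_num), mul_one]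
  obtain ⟨K, hKF, hKc, hK⟩ := C.measF.exists_isCompact_sdiff_lt hF hδ
  obtain ⟨K0, hK0c, hK0⟩ := exists_compact_mem_nhds (1:G)
  let K' : Set G := (fun q : G × G => q.1⁻¹ * q.2) '' (K0 ×ˢ K)
  have hK'c : IsCompact K' := (hK0c.prod hKc).image (by fun_prop)
  have hK' : ∀ g ∈ K0, ∀ x ∈ K, g⁻¹ * x ∈ K' := fun g hg x hx => ⟨(g, x), ⟨hg, hx⟩, rfl⟩
  have hKK' : K ⊆ K' := fun x hx => by simpa using hK' 1 (mem_of_mem_nhds hK0) x hx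
  let f : G → H := K'.indicator p.1
  have hfm : MemLp f 2 μ := by
    rw [memLp_indicator_iff_restrict hK'c.measurableSet]
    haveI : IsFiniteMeasure (μ.restrict K') := ⟨by rw [Measure.restrict_apply_univ]; exact hK'c.measure_lt_top⟩
    exact MemLp.of_bound p.2.1.restrict 1 (ae_of_all _ hb)
  let fL : Lp H 2 μ := hfm.toLp f
  haveI : Fact ((2:ℝ≥0∞) ≠ ∞) := ⟨by norm_num⟩
  have hlim : Tendsto (fun g : G => eLpNorm (fun x => f (g⁻¹ * x) - f x) 2 μ) (𝓝 1) (𝓝 0) := by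
    have h1 : Continuous (fun g : G => (DomMulAct.mk g⁻¹ : Gᵈᵐᵃ) • fL) := by
      have : Continuous (fun g : G => (DomMulAct.mk g⁻¹ : Gᵈᵐᵃ)) := DomMulAct.continuous_mk.comp continuous_inv
      exact this.smul continuous_const
    have h2 := h1.tendsto 1
    rw [tendsto_iff_edist_tendsto_0] at h2
    refine h2.congr fun g => ?_
    have h3 : (DomMulAct.mk (1:G)⁻¹ : Gᵈᵐᵃ) • fL = fL := by simp
    rw [h3, DomMulAct.mk_smul_toLp, Lp.edist_toLp_toLp]
    rfl
  have hlim' := (ENNReal.tendsto_nhds_zero.1 hlim) (ε/2) (by simpa using hε.ne')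
  filter_upwards [hlim', hK0] with g hg hgK
  have hsm : AEStronglyMeasurable (fun x => p.1 (g⁻¹ * x) - p.1 x) (μ.restrict C.F) :=
    ((aesm_tr μ g⁻¹ p.1 p.2.1).sub p.2.1).restrict
  refine (bound2 (μ.restrict C.F) _ hsm K hKc.measurableSet 2 (fun x _ => ?_)).trans ?_
  · refine (norm_sub_le _ _).trans ?_
    linarith [hb (g⁻¹ * x), hb x]
  rw [← ENNReal.add_halves ε]
  refine add_le_add ?_ ?_
  · rw [Measure.restrict_restrict_of_subset hKF]
    refine le_trans (le_of_eq ?_) ((eLpNorm_mono_measure (fun x => f (g⁻¹ * x) - f x) (Measure.restrict_le_self (s := K))).trans hg)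
    refine eLpNorm_congr_ae ?_
    filter_upwards [ae_restrict_mem hKc.measurableSet] with x hx
    show _ = K'.indicator p.1 (g⁻¹ * x) - K'.indicator p.1 x
    rw [Set.indicator_of_mem (hKK' hx), Set.indicator_of_mem (hK' g hgK x hx)]
  · refine le_trans ?_ hδε
    gcongr
    rw [Measure.restrict_apply hKc.measurableSet.compl]
    refine le_trans (measure_mono ?_) hK.le
    rintro x ⟨h1, h2⟩
    exact ⟨h2, h1⟩

/-- the equivariant function attached to a vector -/
def indv {H : Type*} [NormedAddCommGroup H] [InnerProductSpace ℂ H] (π : Γ →* (H ≃ₗᵢ[ℂ] H)) (v : H) : G → H :=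
  fun x => π (C.c x) v

lemma indv_mem {H : Type*} [NormedAddCommGroup H] [InnerProductSpace ℂ H] (π : Γ →* (H ≃ₗᵢ[ℂ] H)) (v : H)
    (hF : μ C.F ≠ ∞) : indv C π v ∈ IndP C μ π := by
  haveI := fin_restrict C μ hF
  have h1 : AEStronglyMeasurable (indv C π v) μ :=
    C.aesm μ (fun γ _ => π γ v) fun γ => aestronglyMeasurable_const
  refine ⟨h1, fun x γ => ?_, MemLp.of_bound h1.restrict ‖v‖ (ae_of_all _ fun x => ?_)⟩
  · unfold indv
    rw [C.eqv, map_mul, lie_mul_apply]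
  · unfold indv
    rw [LinearIsometryEquiv.norm_map]

lemma F_ne_zero : μ C.F ≠ 0 := by
  intro h
  have := C.ae_of_F μ (fun _ => False) (fun _ _ => Iff.rfl) (by
    rw [Measure.restrict_eq_zero.2 h]; simp)
  exact this.exists.elim fun _ h => h

lemma indv_norm {H : Type*} [NormedAddCommGroup H] [InnerProductSpace ℂ H] (π : Γ →* (H ≃ₗᵢ[ℂ] H)) (v : H)
    (hF : μ C.F ≠ ∞) (hv : ‖v‖ = 1) :
    ‖indr C μ π ⟨_, indv_mem C μ π v hF⟩‖ = (μ C.F ^ (1/2:ℝ)).toReal := by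
  rw [indr_norm]
  congr 1
  have : eLpNorm (indv C π v) 2 (μ.restrict C.F) = eLpNorm (fun _ : G => (1:ℝ)) 2 (μ.restrict C.F) := by
    refine eLpNorm_congr_norm_ae (ae_of_all _ fun x => ?_)
    unfold indv
    rw [LinearIsometryEquiv.norm_map, hv]; simp
  show eLpNorm (indv C π v) 2 _ = _
  rw [this, eLpNorm_const' _ (by norm_num) (by norm_num)]
  simp

theorem ind_approx (hF : μ C.F ≠ ∞) (g : G) : ∃ Q : Finset Γ, ∀ {H : Type} [NormedAddCommGroup H] [InnerProductSpace ℂ H]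
    (π : Γ →* (H ≃ₗᵢ[ℂ] H)) (v : H), ‖v‖ = 1 → (∀ q ∈ Q, ‖π q v - v‖ ≤ 1/1000) →
    ‖indr C μ π (indL C μ π g ⟨_, indv_mem C μ π v hF⟩) - indr C μ π ⟨_, indv_mem C μ π v hF⟩‖
      ≤ 1/100 * (μ C.F ^ (1/2:ℝ)).toReal := by
  haveI : Countable Γ := countable_of_Lindelof_of_discrete
  haveI := fin_restrict C μ hF
  set ν := μ.restrict C.F with hν
  have hνu : ν Set.univ = μ C.F := by rw [hν, Measure.restrict_apply_univ]
  have hm : ∀ γ, MeasurableSet {x | C.c (g⁻¹ * x) = γ} := (C.tr g⁻¹).meas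
  have hsum : ∑' γ : Γ, ν {x | C.c (g⁻¹ * x) = γ} ≠ ∞ := by
    rw [← measure_iUnion (fun a b hab => by
      rw [Function.onFun, Set.disjoint_left]
      intro x hx hy
      have hx : C.c (g⁻¹ * x) = a := hx
      have hy : C.c (g⁻¹ * x) = b := hy
      exact hab (hx.symm.trans hy)) hm]
    exact measure_ne_top _ _
  have ht := ENNReal.tendsto_tsum_compl_atTop_zero hsum
  have hpos : 0 < μ C.F * ENNReal.ofReal (1/1000)^2 := by
    have := F_ne_zero C μ
    positivity
  obtain ⟨Q, hQ⟩ := ((ENNReal.tendsto_nhds_zero.1 ht) _ hpos).exists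
  refine ⟨Q, ?_⟩
  intro H _ _ π v hv hq
  rw [← map_sub, indr_norm, ← ENNReal.toReal_ofReal (show (0:ℝ) ≤ 1/100 by norm_num), ← ENNReal.toReal_mul]
  have hfin : μ C.F ^ (1/2:ℝ) ≠ ∞ := ENNReal.rpow_ne_top_of_nonneg (by norm_num) hF
  refine ENNReal.toReal_mono (ENNReal.mul_ne_top ENNReal.ofReal_ne_top hfin) ?_
  set A : Set G := ⋃ γ ∈ Q, {x | C.c (g⁻¹ * x) = γ} with hA
  have hAm : MeasurableSet A := Finset.measurableSet_biUnion _ fun γ _ => hm γ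
  have hAc : ν Aᶜ ≤ μ C.F * ENNReal.ofReal (1/1000)^2 := by
    refine le_trans ?_ hQ
    refine le_trans (measure_mono ?_) (measure_iUnion_le (fun b : {x // x ∉ Q} => {x | C.c (g⁻¹ * x) = b.1}))
    intro x hx
    rw [Set.mem_iUnion]
    refine ⟨⟨C.c (g⁻¹ * x), fun h => hx ?_⟩, rfl⟩
    rw [hA, Set.mem_iUnion₂]
    exact ⟨_, h, rfl⟩
  set w : G → H := fun x => indv C π v (g⁻¹ * x) - indv C π v x with hw
  have hmem := indv_mem C μ π v hF
  have hsm : AEStronglyMeasurable w ν := ((aesm_tr μ g⁻¹ _ hmem.1).sub hmem.1).restrict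
  have hb := bound2 ν w hsm A hAm 2 (fun x _ => by
    refine (norm_sub_le _ _).trans ?_
    unfold indv
    rw [LinearIsometryEquiv.norm_map, LinearIsometryEquiv.norm_map, hv]; norm_num)
  have hb1 : eLpNorm w 2 (ν.restrict A) ≤ μ C.F ^ (1/2:ℝ) * ENNReal.ofReal (1/1000) := by
    have h1 := eLpNorm_le_of_ae_bound (p := 2) (μ := ν.restrict A) (f := w) (C := 1/1000) (by
      filter_upwards [ae_restrict_mem hAm, ae_restrict_of_ae (ae_restrict_mem C.measF)] with x hx hxF
      rw [hA, Set.mem_iUnion₂] at hx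
      obtain ⟨γ, hγ, hxγ⟩ := hx
      have hxγ : C.c (g⁻¹ * x) = γ := hxγ
      have hxF : C.c x = 1 := hxF
      show ‖π (C.c (g⁻¹ * x)) v - π (C.c x) v‖ ≤ _
      rw [hxγ, hxF]
      simpa using hq γ hγ)
    refine h1.trans ?_
    rw [ENNReal.toReal_ofNat, ← one_div]
    have h2 : (ν.restrict A) Set.univ ≤ μ C.F := by
      rw [Measure.restrict_apply_univ, ← hνu]
      exact measure_mono (Set.subset_univ _)
    exact mul_le_mul' (ENNReal.rpow_le_rpow h2 (by norm_num)) le_rfl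
  have hb2 : ν Aᶜ ^ (1/2:ℝ) * ENNReal.ofReal 2 ≤ μ C.F ^ (1/2:ℝ) * ENNReal.ofReal (2/1000) := by
    calc ν Aᶜ ^ (1/2:ℝ) * ENNReal.ofReal 2 ≤ (μ C.F * ENNReal.ofReal (1/1000)^2)^(1/2:ℝ) * ENNReal.ofReal 2 := by
          gcongr
      _ = _ := by
          rw [ENNReal.mul_rpow_of_nonneg _ _ (by norm_num), mul_assoc]
          congr 1
          rw [← ENNReal.rpow_natCast, ← ENNReal.rpow_mul]
          rw [show ((2:ℕ):ℝ) * (1/2) = 1 by norm_num, ENNReal.rpow_one, ← ENNReal.ofReal_mul (by norm_num)]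
          congr 1; norm_num
  show eLpNorm w 2 ν ≤ _
  calc eLpNorm w 2 ν ≤ _ := hb
    _ ≤ _ := add_le_add hb1 hb2
    _ = μ C.F ^ (1/2:ℝ) * ENNReal.ofReal (3/1000) := by
      rw [← mul_add, ← ENNReal.ofReal_add (by norm_num) (by norm_num)]; norm_num
    _ ≤ _ := by
      rw [mul_comm]
      exact mul_le_mul' (ENNReal.ofReal_le_ofReal (by norm_num)) le_rfl

end Ind

/-- Kazhdan's property (T) -/
def KazhdanT (Γ : Type) [Group Γ] : Prop :=
  ∃ Q : Finset Γ, ∃ ε : ℝ, 0 < ε ∧ ∀ (H : Type) [NormedAddCommGroup H] [InnerProductSpace ℂ H] [CompleteSpace H]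
    (π : Γ →* (H ≃ₗᵢ[ℂ] H)) (v : H), ‖v‖ = 1 → (∀ q ∈ Q, ‖π q v - v‖ ≤ ε) →
    ∃ w : H, w ≠ 0 ∧ ∀ γ, π γ w = w

noncomputable instance topG (n : ℕ) : IsTopologicalGroup (SLR n) := Matrix.SpecialLinearGroup.topologicalGroup
instance scG (n : ℕ) : SecondCountableTopology (SLR n) :=
  haveI : SecondCountableTopology (Matrix (Fin n) (Fin n) ℝ) :=
    inferInstanceAs (SecondCountableTopology (Fin n → Fin n → ℝ))
  (Matrix.SpecialLinearGroup.isClosedEmbedding_val (n := Fin n) (R := ℝ)).isEmbedding.secondCountableTopology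
instance t2G (n : ℕ) : T2Space (SLR n) :=
  (Matrix.SpecialLinearGroup.isClosedEmbedding_val (n := Fin n) (R := ℝ)).isEmbedding.t2Space
instance lcG (n : ℕ) : LocallyCompactSpace (SLR n) :=
  haveI : LocallyCompactSpace (Matrix (Fin n) (Fin n) ℝ) :=
    inferInstanceAs (LocallyCompactSpace (Fin n → Fin n → ℝ))
  (Matrix.SpecialLinearGroup.isClosedEmbedding_val (n := Fin n) (R := ℝ)).locallyCompactSpace
instance boG (n : ℕ) : BorelSpace (SLR n) := ⟨rfl⟩

lemma exists_third {n : ℕ} (hn : 3 ≤ n) (i j : Fin n) : ∃ k : Fin n, k ≠ i ∧ k ≠ j := by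
  have : ({i, j} : Finset (Fin n)).card < (Finset.univ : Finset (Fin n)).card := by
    rw [Finset.card_univ, Fintype.card_fin]
    exact lt_of_le_of_lt Finset.card_le_two (by omega)
  obtain ⟨k, _, hk⟩ := Finset.exists_mem_notMem_of_card_lt_card this
  simp only [Finset.mem_insert, Finset.mem_singleton, not_or] at hk
  exact ⟨k, hk⟩

lemma unimod {n : ℕ} (hn : 3 ≤ n) (μ : Measure (SLR n)) [μ.IsHaarMeasure] : μ.IsMulRightInvariant := by
  have h1 : ∀ g : SLR n, g ∈ (Measure.modularCharacter (G := SLR n)).ker := by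
    refine top_of_El hn _ ?_
    intro i j h t
    obtain ⟨k, hki, hkj⟩ := exists_third hn i j
    have h2 := El_commutator hki.symm hkj h t 1
    rw [mul_one] at h2
    have h3 := congrArg (Measure.modularCharacter (G := SLR n)) h2
    rw [map_mul, map_mul, map_mul] at h3
    rw [MonoidHom.mem_ker]
    have p1 : ∀ x : SLR n, Measure.modularCharacter x ≠ 0 := by
      intro x h0
      have : Measure.modularCharacter (x * x⁻¹) = (1:NNReal) := by simp
      rw [map_mul, h0, zero_mul] at this
      exact zero_ne_one this
    have h4 := mul_ne_zero (p1 (El hkj 1)) (p1 (El hki.symm t))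
    rw [mul_comm (Measure.modularCharacter (El hki.symm t))] at h3
    exact (mul_eq_left₀ h4).1 h3.symm
  refine ⟨fun g => ?_⟩
  rw [Measure.map_right_mul_eq_modularCharacterFun_smul μ g]
  have : Measure.modularCharacterFun g = 1 := h1 g
  rw [this, one_smul]

theorem rel_T_SL {n : ℕ} {i1 i2 i3 : Fin n} (h12 : i1 ≠ i2) (h13 : i1 ≠ i3) (h23 : i2 ≠ i3)
    {K : Type*} [NormedAddCommGroup K] [InnerProductSpace ℂ K] [CompleteSpace K] (U : SLR n →* (K ≃ₗᵢ[ℂ] K))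
    (u : K) (hu : ‖u‖ = 1) (hX : ‖U (El h13 1) u - u‖ ≤ 1/100) (hY : ‖U (El h23 1) u - u‖ ≤ 1/100)
    (hg : ‖U (El h12 2) u - u‖ ≤ 1/100) (hh : ‖U (El h12.symm 1) u - u‖ ≤ 1/100) :
    ∃ z : K, z ≠ 0 ∧ U (El h13 1) z = z := by
  let Φ : SLR n →* unitary (K →L[ℂ] K) := (Unitary.linearIsometryEquiv.symm.toMonoidHom).comp U
  have r1 : El h13 1 * El h23 1 = El h23 1 * (El h13 1 : SLR n) := El_comm _ _ h23.symm h13.symm _ _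
  have r2 : El h12 2 * El h13 1 * (El h12 2)⁻¹ = (El h13 1 : SLR n) := by
    rw [El_comm h12 h13 h12.symm h13.symm]; group
  have r3 : El h12 2 * El h23 1 * (El h12 2)⁻¹ = (El h23 1 * El h13 1 * El h13 1 : SLR n) := by
    rw [El_commutator h12 h23 h13]
    rw [mul_assoc (El h23 1), El_comm h12 h13 h12.symm h13.symm]
    have : (El h13 (2*1) : SLR n) = El h13 1 * El h13 1 := by
      rw [← Matrix.SpecialLinearGroup.transvection_add]; norm_num
    rw [this]; group
  have r4 : El h12.symm 1 * El h23 1 * (El h12.symm 1)⁻¹ = (El h23 1 : SLR n) := by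
    rw [El_comm h12.symm h23 h12 h23.symm]; group
  have r5 : El h12.symm 1 * El h13 1 * (El h12.symm 1)⁻¹ = (El h13 1 * El h23 1 : SLR n) := by
    rw [El_commutator h12.symm h13 h23, mul_assoc (El h13 1), El_comm h12.symm h23 h12 h23.symm, mul_one]
    group
  exact rel_T (Φ (El h13 1)) (Φ (El h23 1)) (Φ (El h12 2)) (Φ (El h12.symm 1))
    (by rw [← map_mul, ← map_mul, r1]) (by rw [← map_inv, ← map_mul, ← map_mul, r2])
    (by rw [← map_inv, ← map_mul, ← map_mul, ← map_mul, ← map_mul, r3])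
    (by rw [← map_inv, ← map_mul, ← map_mul, r4]) (by rw [← map_inv, ← map_mul, ← map_mul, ← map_mul, r5])
    u hu hX hY hg hh

theorem kazhdan_lattice {n : ℕ} (hn : 3 ≤ n) (Γ : Subgroup (SLR n)) (hΓ : Γ.IsLattice) : KazhdanT Γ := by
  classical
  obtain ⟨hd, μ, hμ, F, hF, hFt⟩ := hΓ
  haveI := hμ
  haveI := unimod hn μ
  haveI := hd
  haveI : Countable Γ := countable_of_Lindelof_of_discrete
  obtain ⟨c, hc1, hc2⟩ := exists_cocycle Γ
  let C : Cocyc Γ := ⟨c, hc1, hc2⟩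
  have hCF : μ C.F ≠ ∞ := by
    rw [(C.isFD μ).measure_eq hF]; exact hFt.ne
  let i1 : Fin n := ⟨0, by omega⟩
  let i2 : Fin n := ⟨1, by omega⟩
  let i3 : Fin n := ⟨2, by omega⟩
  have h12 : i1 ≠ i2 := by simp [i1, i2]
  have h13 : i1 ≠ i3 := by simp [i1, i3]
  have h23 : i2 ≠ i3 := by simp [i2, i3]
  obtain ⟨QX, hX⟩ := ind_approx C μ hCF (El h13 1)
  obtain ⟨QY, hY⟩ := ind_approx C μ hCF (El h23 1)
  obtain ⟨Qg, hg⟩ := ind_approx C μ hCF (El h12 2)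
  obtain ⟨Qh, hh⟩ := ind_approx C μ hCF (El h12.symm 1)
  refine ⟨QX ∪ QY ∪ Qg ∪ Qh, 1/1000, by norm_num, ?_⟩
  intro H _ _ _ π v hv hq
  obtain ⟨U, hU⟩ := exists_ind C μ π
  set w := indr C μ π ⟨_, indv_mem C μ π v hCF⟩ with hw
  set N : ℝ := (μ C.F ^ (1/2:ℝ)).toReal with hN
  have hwN : ‖w‖ = N := indv_norm C μ π v hCF hv
  have hNpos : 0 < N := by
    apply ENNReal.toReal_pos
    · simp [F_ne_zero C μ]
    · exact ENNReal.rpow_ne_top_of_nonneg (by norm_num) hCF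
  let u : Lp H 2 (μ.restrict C.F) := ((N⁻¹ : ℝ) : ℂ) • w
  have hu : ‖u‖ = 1 := by
    rw [norm_smul, Complex.norm_real, norm_inv, Real.norm_of_nonneg hNpos.le, hwN]; field_simp
  have hbd : ∀ g : SLR n, ‖indr C μ π (indL C μ π g ⟨_, indv_mem C μ π v hCF⟩) - w‖ ≤ 1/100 * N → ‖U g u - u‖ ≤ 1/100 := by
    intro g hg
    rw [← hU] at hg
    rw [map_smul, ← smul_sub, norm_smul, Complex.norm_real, norm_inv, Real.norm_of_nonneg hNpos.le]
    rw [inv_mul_le_iff₀ hNpos, mul_comm]; exact hg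
  obtain ⟨z, hz0, hz⟩ := rel_T_SL h12 h13 h23 U u hu
    (hbd _ (hX π v hv fun q h => hq q (by simp [h]))) (hbd _ (hY π v hv fun q h => hq q (by simp [h])))
    (hbd _ (hg π v hv fun q h => hq q (by simp [h]))) (hbd _ (hh π v hv fun q h => hq q (by simp [h])))
  obtain ⟨p, rfl⟩ := indr_surj C μ π z
  let p' : IndP C μ π := ⟨_, trunc_mem C μ π p.1 p.2⟩
  have hp'0 : indr C μ π p' ≠ 0 := by
    intro h
    apply hz0
    rw [← map_zero (indr C μ π), indr_eq_iff] at h ⊢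
    filter_upwards [h] with x hx
    exact (trunc_eq_zero _).1 hx
  have hfix : U (El h13 1) (indr C μ π p') = indr C μ π p' := by
    rw [hU, indr_eq_iff] at hz ⊢
    filter_upwards [hz] with x hx
    exact congrArg trunc hx
  have hcont : Tendsto (fun g => U g (indr C μ π p')) (𝓝 1) (𝓝 (indr C μ π p')) := by
    simp only [hU]
    exact ind_cont C μ π hCF p' fun x => trunc_le _
  have hall := mautner hn U _ hcont h13 hfix
  exact fixed_of_inv C μ π p' hp'0 fun g => by rw [← hU]; exact hall g

end DistalProof
end

section
set_option linter.all false
open MeasureTheory Filter Topology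
namespace DistalProof

/-- positive definite real kernels -/
structure PDK {X : Type*} (k : X → X → ℝ) : Prop where
  symm : ∀ x y, k x y = k y x
  pos : ∀ (s : Finset X) (c : X → ℝ), 0 ≤ ∑ x ∈ s, ∑ y ∈ s, c x * c y * k x y

section GNS
open ComplexConjugate

/-- the pre-inner product attached to a kernel -/
noncomputable def gcore {X : Type*} (k : X → X → ℝ) (hk : PDK k) : PreInnerProductSpace.Core ℂ (X →₀ ℂ) where
  inner f h := f.sum fun x a => h.sum fun y b => conj a * b * (k x y : ℂ)
  conj_inner_symm f h := by
    classical
    simp only [Finsupp.sum, map_sum, map_mul, Complex.conj_conj, Complex.conj_ofReal]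
    rw [Finset.sum_comm]
    refine Finset.sum_congr rfl fun x _ => Finset.sum_congr rfl fun y _ => ?_
    rw [hk.symm y x]; ring
  re_inner_nonneg f := by
    have h1 := hk.pos f.support (fun x => (f x).re)
    have h2 := hk.pos f.support (fun x => (f x).im)
    have h3 := add_nonneg h1 h2
    simp only [Finsupp.sum]
    rw [map_sum]
    simp only [map_sum]
    rw [← Finset.sum_add_distrib] at h3
    refine le_of_le_of_eq h3 (Finset.sum_congr rfl fun x _ => ?_)
    rw [← Finset.sum_add_distrib]
    refine Finset.sum_congr rfl fun y _ => ?_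
    simp [Complex.mul_re, Complex.mul_im]
    ring
  add_left f g h := by
    classical
    rw [Finsupp.sum_add_index']
    · intro x; simp
    · intro x a b
      simp only [Finsupp.sum, map_add, add_mul, Finset.sum_add_distrib]
  smul_left f h r := by
    classical
    rw [Finsupp.sum_smul_index']
    · simp only [Finsupp.sum, Finset.mul_sum, smul_eq_mul, map_mul]
      refine Finset.sum_congr rfl fun x _ => Finset.sum_congr rfl fun y _ => by ring
    · intro x; simp

theorem ext_rep {Γ : Type*} [Group Γ] {E : Type*} [SeminormedAddCommGroup E] [InnerProductSpace ℂ E]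
    (T : Γ →* (E →ₗ[ℂ] E)) (hT : ∀ g x, ‖T g x‖ = ‖x‖) :
    ∃ π : Γ →* (UniformSpace.Completion E ≃ₗᵢ[ℂ] UniformSpace.Completion E),
      ∀ g (x : E), π g (x : UniformSpace.Completion E) = ((T g x : E) : UniformSpace.Completion E) := by
  let L : Γ → (E →L[ℂ] E) := fun g => (T g).mkContinuous 1 fun x => by rw [hT, one_mul]
  let M : Γ → (UniformSpace.Completion E →L[ℂ] UniformSpace.Completion E) := fun g => (L g).completion
  have hM : ∀ g (x : E), M g (x : UniformSpace.Completion E) = ((T g x : E) : UniformSpace.Completion E) := by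
    intro g x
    exact ContinuousLinearMap.completion_apply_coe (L g) x
  have h1 : ∀ x, M 1 x = x := by
    intro x
    induction x using UniformSpace.Completion.induction_on with
    | hp => exact isClosed_eq (M 1).continuous continuous_id
    | ih a => rw [hM, map_one]; rfl
  have h2 : ∀ g h x, M (g * h) x = M g (M h x) := by
    intro g h x
    induction x using UniformSpace.Completion.induction_on with
    | hp => exact isClosed_eq (M _).continuous ((M _).continuous.comp (M _).continuous)
    | ih a => rw [hM, hM, hM, map_mul]; rfl
  have h3 : ∀ g x, ‖M g x‖ = ‖x‖ := by
    intro g x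
    induction x using UniformSpace.Completion.induction_on with
    | hp => exact isClosed_eq (M _).continuous.norm continuous_norm
    | ih a => rw [hM, UniformSpace.Completion.norm_coe, UniformSpace.Completion.norm_coe, hT]
  let π : Γ → (UniformSpace.Completion E ≃ₗᵢ[ℂ] UniformSpace.Completion E) := fun g =>
    { toLinearEquiv := LinearEquiv.ofLinear (M g).toLinearMap (M g⁻¹).toLinearMap
        (LinearMap.ext fun x => by
          show M g (M g⁻¹ x) = x
          rw [← h2, mul_inv_cancel, h1])
        (LinearMap.ext fun x => by
          show M g⁻¹ (M g x) = x
          rw [← h2, inv_mul_cancel, h1])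
      norm_map' := h3 g }
  refine ⟨⟨⟨π, LinearIsometryEquiv.ext h1⟩, fun g h => LinearIsometryEquiv.ext (h2 g h)⟩, hM⟩

theorem gns {Γ : Type} [Group Γ] (k : Γ → Γ → ℝ) (hk : PDK k) (hinv : ∀ g x y, k (g * x) (g * y) = k x y) :
    ∃ (H : Type) (_ : NormedAddCommGroup H) (_ : InnerProductSpace ℂ H) (_ : CompleteSpace H)
      (π : Γ →* (H ≃ₗᵢ[ℂ] H)) (v : H), ∀ γ, inner ℂ v (π γ v) = (k 1 γ : ℂ) := by
  classical
  let c := gcore k hk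
  letI : SeminormedAddCommGroup (Γ →₀ ℂ) := InnerProductSpace.Core.toSeminormedAddCommGroup (c := c)
  letI : InnerProductSpace ℂ (Γ →₀ ℂ) := InnerProductSpace.ofCore c
  have hin : ∀ f h : Γ →₀ ℂ, inner ℂ f h = f.sum fun x a => h.sum fun y b => conj a * b * (k x y : ℂ) := fun _ _ => rfl
  let T : Γ →* ((Γ →₀ ℂ) →ₗ[ℂ] (Γ →₀ ℂ)) :=
    { toFun := fun g => Finsupp.lmapDomain ℂ ℂ (fun x => g * x)
      map_one' := by
        ext x y; simp
      map_mul' := fun g h => by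
        ext x y; simp [mul_assoc] }
  have hT : ∀ g f, ‖T g f‖ = ‖f‖ := by
    intro g f
    have h0 : inner ℂ (T g f) (T g f) = inner ℂ f f := by
      rw [hin, hin]
      show (Finsupp.mapDomain _ f).sum _ = _
      rw [Finsupp.sum_mapDomain_index_inj (mul_right_injective g)]
      refine Finsupp.sum_congr fun x _ => ?_
      show (Finsupp.mapDomain _ f).sum _ = _
      rw [Finsupp.sum_mapDomain_index_inj (mul_right_injective g)]
      simp only [hinv]
    rw [@norm_eq_sqrt_re_inner ℂ, @norm_eq_sqrt_re_inner ℂ, h0]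
  obtain ⟨π, hπ⟩ := ext_rep T hT
  refine ⟨UniformSpace.Completion (Γ →₀ ℂ), inferInstance, inferInstance, inferInstance, π,
    ((Finsupp.single 1 1 : Γ →₀ ℂ) : UniformSpace.Completion (Γ →₀ ℂ)), fun γ => ?_⟩
  rw [hπ, UniformSpace.Completion.inner_coe, hin]
  show _ = _
  simp [T]
  
end GNS

/-- fixed vectors -/
def fixW {Γ : Type*} [Group Γ] {H : Type*} [NormedAddCommGroup H] [InnerProductSpace ℂ H]
    (π : Γ →* (H ≃ₗᵢ[ℂ] H)) : Submodule ℂ H where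
  carrier := {v | ∀ γ, π γ v = v}
  add_mem' := fun {a b} ha hb γ => by rw [map_add, ha, hb]
  zero_mem' := fun γ => map_zero _
  smul_mem' := fun c x hx γ => by rw [map_smul, hx]

lemma fixW_closed {Γ : Type*} [Group Γ] {H : Type*} [NormedAddCommGroup H] [InnerProductSpace ℂ H]
    (π : Γ →* (H ≃ₗᵢ[ℂ] H)) : IsClosed (fixW π : Set H) := by
  have : (fixW π : Set H) = ⋂ γ, {v | π γ v = v} := by ext v; simp [fixW]
  rw [this]
  exact isClosed_iInter fun γ => isClosed_eq (π γ).continuous continuous_id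

theorem orth_bound {Γ : Type} [Group Γ] (Q : Finset Γ) (ε : ℝ) (hε : 0 < ε)
    (hQ : ∀ (H : Type) [NormedAddCommGroup H] [InnerProductSpace ℂ H] [CompleteSpace H]
    (π : Γ →* (H ≃ₗᵢ[ℂ] H)) (v : H), ‖v‖ = 1 → (∀ q ∈ Q, ‖π q v - v‖ ≤ ε) →
    ∃ w : H, w ≠ 0 ∧ ∀ γ, π γ w = w)
    {H : Type} [NormedAddCommGroup H] [InnerProductSpace ℂ H] [CompleteSpace H]
    (π : Γ →* (H ≃ₗᵢ[ℂ] H)) (v : H) (hv : v ∈ (fixW π)ᗮ) (η : ℝ) (hη : 0 ≤ η) (h : ∀ q ∈ Q, ‖π q v - v‖ ≤ η) :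
    ‖v‖ * ε ≤ η := by
  by_contra hlt
  push Not at hlt
  have hv0 : 0 < ‖v‖ := by
    by_contra h0
    have : ‖v‖ = 0 := le_antisymm (not_lt.1 h0) (norm_nonneg _)
    rw [this, zero_mul] at hlt; linarith
  have hinv : ∀ γ, ∀ x ∈ (fixW π)ᗮ, π γ x ∈ (fixW π)ᗮ := by
    intro γ x hx
    rw [Submodule.mem_orthogonal] at hx ⊢
    intro u hu
    have hu' : π γ u = u := hu γ
    rw [← hu', LinearIsometryEquiv.inner_map_map]
    exact hx u hu
  let K := (fixW π)ᗮ
  let ρ : Γ → (K ≃ₗᵢ[ℂ] K) := fun g =>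
    { toFun := fun x => ⟨π g x, hinv g x x.2⟩
      map_add' := fun x y => Subtype.ext (map_add (π g) x.1 y.1)
      map_smul' := fun c x => Subtype.ext (map_smul (π g) c x.1)
      invFun := fun x => ⟨π g⁻¹ x, hinv g⁻¹ x x.2⟩
      left_inv := fun x => Subtype.ext (by
        show π g⁻¹ (π g x.1) = x.1
        rw [← lie_mul_apply, ← map_mul, inv_mul_cancel, map_one]; rfl)
      right_inv := fun x => Subtype.ext (by
        show π g (π g⁻¹ x.1) = x.1
        rw [← lie_mul_apply, ← map_mul, mul_inv_cancel, map_one]; rfl)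
      norm_map' := fun x => (π g).norm_map x.1 }
  let R : Γ →* (K ≃ₗᵢ[ℂ] K) := ⟨⟨ρ, LinearIsometryEquiv.ext fun x => Subtype.ext (by
      show π 1 x.1 = x.1
      rw [map_one]; rfl)⟩, fun g h => LinearIsometryEquiv.ext fun x => Subtype.ext (by
      show π (g * h) x.1 = π g (π h x.1)
      rw [map_mul, lie_mul_apply])⟩
  let r : ℂ := ((‖v‖⁻¹ : ℝ) : ℂ)
  have hr : ‖r‖ = ‖v‖⁻¹ := by
    simp [r]
  let u : K := ⟨r • v, K.smul_mem _ hv⟩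
  have hu : ‖u‖ = 1 := by
    show ‖r • v‖ = 1
    rw [norm_smul, hr]; field_simp
  obtain ⟨w, hw0, hw⟩ := hQ K R u hu (fun q hq => by
    show ‖π q (r • v) - r • v‖ ≤ ε
    rw [map_smul, ← smul_sub, norm_smul, hr, inv_mul_le_iff₀ hv0]
    exact (h q hq).trans hlt.le)
  apply hw0
  have hw1 : w.1 ∈ fixW π := fun γ => congrArg Subtype.val (hw γ)
  have := (Submodule.mem_orthogonal _ _).1 w.2 _ hw1
  exact Subtype.ext (inner_self_eq_zero.1 this)

theorem Tstar {Γ : Type} [Group Γ] (hT : KazhdanT Γ) (δ : ℝ) (hδ : 0 < δ) :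
    ∃ Q : Finset Γ, ∃ ε : ℝ, 0 < ε ∧ ∀ k : Γ → Γ → ℝ, PDK k → (∀ g x y, k (g * x) (g * y) = k x y) → k 1 1 = 1 →
      (∀ q ∈ Q, 1 - k 1 q ≤ ε) → ∀ γ, 1 - k 1 γ ≤ δ := by
  obtain ⟨Q, ε, hε, hQ⟩ := hT
  refine ⟨Q, δ * ε^2/4, by positivity, ?_⟩
  intro k hk hinv h1 hq γ
  obtain ⟨H, _, _, _, π, v, hv⟩ := gns k hk hinv
  have hvn : ‖v‖^2 = 1 := by
    have := hv 1
    rw [map_one, h1] at this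
    have h2 : inner ℂ v v = (1:ℂ) := by simpa using this
    rw [@norm_sq_eq_re_inner ℂ, h2]; simp
  have hdist : ∀ g, ‖π g v - v‖^2 = 2 * (1 - k 1 g) := by
    intro g
    rw [@norm_sub_sq ℂ, LinearIsometryEquiv.norm_map, hvn, inner_re_symm, hv]
    simp; ring
  haveI : CompleteSpace (fixW π) := (fixW_closed π).completeSpace_coe
  obtain ⟨a, ha, b, hb, hab⟩ := (fixW π).exists_add_mem_mem_orthogonal v
  have hsub : ∀ g, π g v - v = π g b - b := by
    intro g
    have : π g a = a := ha g
    rw [hab, map_add, this]; abel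
  have hb1 := orth_bound Q ε hε hQ π b hb (Real.sqrt (δ * ε^2/2)) (Real.sqrt_nonneg _) (fun q h => by
    rw [← hsub]
    apply Real.le_sqrt_of_sq_le
    rw [hdist]
    linarith [hq q h])
  have hb2 : (‖b‖ * ε)^2 ≤ δ * ε^2/2 := by
    calc (‖b‖ * ε)^2 ≤ (Real.sqrt (δ * ε^2/2))^2 := by gcongr
      _ = _ := Real.sq_sqrt (by positivity)
  have hb3 : ‖b‖^2 ≤ δ/2 := by
    have : ‖b‖^2 * ε^2 ≤ δ/2 * ε^2 := by nlinarith
    exact le_of_mul_le_mul_right this (by positivity)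
  have h4 : ‖π γ v - v‖ ≤ 2 * ‖b‖ := by
    rw [hsub]
    refine (norm_sub_le _ _).trans ?_
    rw [LinearIsometryEquiv.norm_map]; linarith
  have h5 : ‖π γ v - v‖^2 ≤ (2 * ‖b‖)^2 := by gcongr
  rw [hdist] at h5
  nlinarith

end DistalProof
end

section
set_option linter.all false
open MeasureTheory Filter Topology
namespace DistalProof

lemma PDK.comp {X Y : Type*} {k : X → X → ℝ} (hk : PDK k) (f : Y → X) : PDK (fun x y => k (f x) (f y)) := by
  classical
  refine ⟨fun x y => hk.symm _ _, fun s c => ?_⟩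
  have := hk.pos (s.image f) (fun z => ∑ x ∈ s with f x = z, c x)
  refine le_of_le_of_eq this ?_
  have e : ∀ (F : X → Y → ℝ), ∑ z ∈ s.image f, ∑ x ∈ s with f x = z, F z x = ∑ x ∈ s, F (f x) x := by
    intro F
    rw [← Finset.sum_fiberwise_of_maps_to (g := f) (t := s.image f) (fun x hx => Finset.mem_image_of_mem f hx)]
    refine Finset.sum_congr rfl fun z _ => Finset.sum_congr rfl fun x hx => ?_
    rw [(Finset.mem_filter.1 hx).2]
  have h1 : ∀ z w, (∑ x ∈ s with f x = z, c x) * (∑ y ∈ s with f y = w, c y) * k z w =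
      ∑ x ∈ s with f x = z, ∑ y ∈ s with f y = w, c x * c y * k z w := by
    intro z w
    rw [Finset.sum_mul_sum, Finset.sum_mul]
    refine Finset.sum_congr rfl fun x _ => ?_
    rw [Finset.sum_mul]
  simp only [h1]
  have h2 : ∀ z, ∑ w ∈ s.image f, ∑ x ∈ s with f x = z, ∑ y ∈ s with f y = w, c x * c y * k z w
      = ∑ x ∈ s with f x = z, ∑ y ∈ s, c x * c y * k z (f y) := by
    intro z
    rw [Finset.sum_comm]
    refine Finset.sum_congr rfl fun x _ => ?_
    exact e (fun w y => c x * c y * k z w)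
  simp only [h2]
  exact e (fun z x => ∑ y ∈ s, c x * c y * k z (f y))

lemma PDK.weight {X : Type*} {k : X → X → ℝ} (hk : PDK k) (f : X → ℝ) : PDK (fun x y => f x * f y * k x y) := by
  refine ⟨fun x y => by rw [hk.symm]; ring, fun s c => ?_⟩
  refine le_of_le_of_eq (hk.pos s (fun x => c x * f x)) ?_
  exact Finset.sum_congr rfl fun x _ => Finset.sum_congr rfl fun y _ => by ring

lemma PDK.sum {X ι : Type*} (I : Finset ι) {k : ι → X → X → ℝ} (hk : ∀ i ∈ I, PDK (k i)) :
    PDK (fun x y => ∑ i ∈ I, k i x y) := by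
  refine ⟨fun x y => Finset.sum_congr rfl fun i hi => (hk i hi).symm x y, fun s c => ?_⟩
  have : ∑ x ∈ s, ∑ y ∈ s, c x * c y * ∑ i ∈ I, k i x y = ∑ i ∈ I, ∑ x ∈ s, ∑ y ∈ s, c x * c y * k i x y := by
    simp only [Finset.mul_sum]
    rw [Finset.sum_comm (s := I)]
    refine Finset.sum_congr rfl fun x _ => ?_
    rw [Finset.sum_comm]
  rw [this]
  exact Finset.sum_nonneg fun i hi => (hk i hi).pos s c

lemma PDK.smul {X : Type*} {k : X → X → ℝ} (hk : PDK k) {r : ℝ} (hr : 0 ≤ r) : PDK (fun x y => r * k x y) := by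
  have := hk.weight (fun _ => Real.sqrt r)
  simpa only [Real.mul_self_sqrt hr] using this

lemma PDK.one {X : Type*} : PDK (fun _ _ : X => (1:ℝ)) := by
  refine ⟨fun _ _ => rfl, fun s c => ?_⟩
  simp only [mul_one]
  rw [← Finset.sum_mul_sum]
  exact mul_self_nonneg _

lemma PDK.lim {X : Type*} {k : ℕ → X → X → ℝ} (hk : ∀ n, PDK (k n)) {l : X → X → ℝ}
    (h : ∀ x y, Tendsto (fun n => k n x y) atTop (𝓝 (l x y))) : PDK l := by
  refine ⟨fun x y => ?_, fun s c => ?_⟩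
  · refine tendsto_nhds_unique (h x y) ((h y x).congr fun n => (hk n).symm y x)
  · refine ge_of_tendsto' (tendsto_finsetSum s fun x _ => tendsto_finsetSum s fun y _ => (h x y).const_mul (c x * c y))
      fun n => (hk n).pos s c

lemma PDK.eqk {X Y : Type*} [DecidableEq Y] (f : X → Y) : PDK (fun x y => if f x = f y then (1:ℝ) else 0) := by
  have : PDK (fun a b : Y => if a = b then (1:ℝ) else 0) := by
    refine ⟨fun a b => by simp only [eq_comm], fun s c => ?_⟩
    refine Finset.sum_nonneg fun x hx => ?_
    rw [Finset.sum_eq_single x]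
    · simp only [if_true, mul_one]; exact mul_self_nonneg _
    · intro y _ hy; rw [if_neg (Ne.symm hy), mul_zero]
    · intro h; exact absurd hx h
  exact this.comp f

lemma PDK.le_one {X : Type*} {k : X → X → ℝ} (hk : PDK k) (h1 : ∀ x, k x x = 1) (x y : X) : k x y ≤ 1 := by
  classical
  by_cases hxy : x = y
  · rw [hxy, h1]
  have := hk.pos {x, y} (fun z => if z = x then 1 else -1)
  rw [Finset.sum_pair hxy, Finset.sum_pair hxy, Finset.sum_pair hxy] at this
  simp only [if_true, if_neg (Ne.symm hxy), h1, hk.symm y x] at this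
  linarith

/-- Rigidity of positive definite functions -/
def TS (Γ : Type) [Group Γ] : Prop := ∀ δ : ℝ, 0 < δ → 
    ∃ Q : Finset Γ, ∃ ε : ℝ, 0 < ε ∧ ∀ k : Γ → Γ → ℝ, PDK k → (∀ g x y, k (g * x) (g * y) = k x y) → k 1 1 = 1 →
      (∀ q ∈ Q, 1 - k 1 q ≤ ε) → ∀ γ, 1 - k 1 γ ≤ δ

theorem TS.fg {Γ : Type} [Group Γ] (h : TS Γ) : Group.FG Γ := by
  classical
  obtain ⟨Q, ε, hε, hQ⟩ := h (1/2) (by norm_num)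
  refine ⟨⟨Q, ?_⟩⟩
  rw [eq_top_iff]
  intro γ _
  set Λ := Subgroup.closure (Q : Set Γ)
  have h1 := hQ (fun x y => if (QuotientGroup.mk x : Γ ⧸ Λ) = QuotientGroup.mk y then 1 else 0) (PDK.eqk _)
    (fun g x y => by simp only [QuotientGroup.eq, mul_inv_rev, mul_assoc, inv_mul_cancel_left]) (by simp)
    (fun q hq => by
      have : (QuotientGroup.mk 1 : Γ ⧸ Λ) = QuotientGroup.mk q := by
        rw [QuotientGroup.eq, inv_one, one_mul]; exact Subgroup.subset_closure hq
      rw [if_pos this]; linarith) γ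
  by_contra hγ
  have h2 : ¬ (QuotientGroup.mk 1 : Γ ⧸ Λ) = QuotientGroup.mk γ := by
    rw [QuotientGroup.eq, inv_one, one_mul]; exact hγ
  rw [if_neg h2] at h1
  norm_num at h1

theorem TS.finiteIndex {Γ : Type} [Group Γ] (h : TS Γ) (Γ' : Subgroup Γ) [Γ'.FiniteIndex] : TS Γ' := by
  classical
  intro δ hδ
  haveI : Fintype (Γ ⧸ Γ') := Fintype.ofFinite _
  set m : ℝ := ((Fintype.card (Γ ⧸ Γ') : ℕ) : ℝ) with hm
  have hm0 : 0 < m := by rw [hm]; exact_mod_cast Fintype.card_pos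
  obtain ⟨Q, ε, hε, hQ⟩ := h (δ/m) (by positivity)
  let s : Γ ⧸ Γ' → Γ := fun q => if q = QuotientGroup.mk 1 then 1 else q.out
  have hs : ∀ q : Γ ⧸ Γ', (QuotientGroup.mk (s q) : Γ ⧸ Γ') = q := by
    intro q
    by_cases hq : q = QuotientGroup.mk 1
    · rw [hq]; simp [s]
    · simp only [s, if_neg hq, QuotientGroup.out_eq']
  let c : Γ → Γ' := fun x => ⟨x⁻¹ * s (QuotientGroup.mk x), by
    rw [← QuotientGroup.eq, hs]⟩
  have hc : ∀ x (γ : Γ'), c (x * γ) = γ⁻¹ * c x := by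
    intro x γ
    have : (QuotientGroup.mk (x * γ) : Γ ⧸ Γ') = QuotientGroup.mk x := by
      rw [QuotientGroup.mk_mul_of_mem _ γ.2]
    apply Subtype.ext
    show (x * γ)⁻¹ * s _ = (γ:Γ)⁻¹ * (x⁻¹ * s _)
    rw [this]; group
  have hc1 : c 1 = 1 := by
    apply Subtype.ext
    show (1:Γ)⁻¹ * s _ = 1
    simp [s]
  let Q' : Finset Γ' := Finset.image (fun p : Γ × (Γ ⧸ Γ') => (c (s p.2))⁻¹ * c (p.1⁻¹ * s p.2)) (Q ×ˢ Finset.univ)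
  refine ⟨Q', ε, hε, ?_⟩
  intro k hk hinv h1 hq γ
  let f : Γ → Γ → Γ → ℝ := fun x y z => k (c (x⁻¹ * z)) (c (y⁻¹ * z))
  have hf : ∀ x y z (γ : Γ'), f x y (z * γ) = f x y z := by
    intro x y z γ
    show k (c (x⁻¹ * (z * γ))) (c (y⁻¹ * (z * γ))) = _
    rw [← mul_assoc, ← mul_assoc, hc, hc, hinv]
  have hf' : ∀ x y z w, (QuotientGroup.mk z : Γ ⧸ Γ') = QuotientGroup.mk w → f x y z = f x y w := by
    intro x y z w hzw
    rw [QuotientGroup.eq] at hzw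
    have := hf x y z ⟨_, hzw⟩
    rw [← this]; simp
  let K : Γ → Γ → ℝ := fun x y => m⁻¹ * ∑ q : Γ ⧸ Γ', f x y (s q)
  have hkd : ∀ x, k x x = 1 := by
    intro x
    have := hinv x 1 1
    rw [mul_one] at this
    rw [this, h1]
  have hK : PDK K := (PDK.sum Finset.univ fun q _ => hk.comp (fun x => c (x⁻¹ * s q))).smul (by positivity)
  have hKinv : ∀ g x y, K (g * x) (g * y) = K x y := by
    intro g x y
    show m⁻¹ * _ = m⁻¹ * _
    congr 1
    refine Fintype.sum_equiv (MulAction.toPerm g⁻¹ : Equiv.Perm (Γ ⧸ Γ')) _ _ fun q => ?_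
    have : f (g * x) (g * y) (s q) = f x y (g⁻¹ * s q) := by
      show k (c ((g * x)⁻¹ * s q)) (c ((g * y)⁻¹ * s q)) = k (c (x⁻¹ * (g⁻¹ * s q))) (c (y⁻¹ * (g⁻¹ * s q)))
      simp only [mul_inv_rev, mul_assoc]
    rw [this]
    apply hf'
    rw [hs]
    show _ = g⁻¹ • q
    conv_rhs => rw [← hs q]
    rfl
  have hK1 : K 1 1 = 1 := by
    show m⁻¹ * ∑ q : Γ ⧸ Γ', k _ _ = 1
    simp only [hkd]
    rw [Finset.sum_const, Finset.card_univ, nsmul_eq_mul, mul_one, ← hm]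
    field_simp
  have hKe : ∀ x y, m * (1 - K x y) = ∑ q : Γ ⧸ Γ', (1 - f x y (s q)) := by
    intro x y
    rw [Finset.sum_sub_distrib, Finset.sum_const, Finset.card_univ, nsmul_eq_mul, mul_one, ← hm]
    show m * (1 - m⁻¹ * _) = _
    field_simp
  have key := hQ K hK hKinv hK1 (fun q hqQ => by
    have h2 : m * (1 - K 1 q) ≤ m * ε := by
      rw [hKe]
      have : m * ε = ∑ q : Γ ⧸ Γ', ε := by
        rw [Finset.sum_const, Finset.card_univ, nsmul_eq_mul, ← hm]
      rw [this]
      refine Finset.sum_le_sum fun p _ => ?_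
      have h3 := hq ((c (s p))⁻¹ * c (q⁻¹ * s p)) (Finset.mem_image.2 ⟨(q, p), by simp [hqQ], rfl⟩)
      have h4 := hinv (c (s p)) 1 ((c (s p))⁻¹ * c (q⁻¹ * s p))
      rw [mul_one, mul_inv_cancel_left] at h4
      rw [← h4] at h3
      show 1 - k (c (1⁻¹ * s p)) (c (q⁻¹ * s p)) ≤ ε
      rw [inv_one, one_mul]; exact h3
    exact le_of_mul_le_mul_left h2 hm0) γ
  have h5 : m * (1 - K 1 γ) ≤ δ := by
    calc m * (1 - K 1 γ) ≤ m * (δ/m) := by gcongr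
      _ = δ := by field_simp
  rw [hKe] at h5
  have h6 := Finset.single_le_sum (f := fun q => 1 - f 1 γ (s q)) (fun q _ => by
    have := hk.le_one hkd (c ((1:Γ)⁻¹ * s q)) (c ((γ:Γ)⁻¹ * s q))
    show 0 ≤ 1 - k _ _
    linarith) (Finset.mem_univ (QuotientGroup.mk 1 : Γ ⧸ Γ'))
  have h7 : f 1 γ (s (QuotientGroup.mk 1)) = k 1 γ := by
    show k (c (1⁻¹ * s _)) (c ((γ:Γ)⁻¹ * s _)) = _
    have e1 : s (QuotientGroup.mk 1) = 1 := by simp [s]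
    have e2 := hc 1 γ⁻¹
    rw [e1, inv_one, mul_one, mul_one, hc1]
    rw [hc1, one_mul] at e2
    simp only [InvMemClass.coe_inv] at e2
    rw [e2]; simp
  have h6' : 1 - f 1 γ (s (QuotientGroup.mk 1)) ≤ _ := h6
  rw [h7] at h6'
  exact h6'.trans h5

lemma PDK.cosk {X : Type*} (f : X → ℝ) : PDK (fun x y => Real.cos (f y - f x)) := by
  have h1 := (PDK.one (X := X)).weight (fun x => Real.cos (f x))
  have h2 := (PDK.one (X := X)).weight (fun x => Real.sin (f x))
  have h3 := PDK.sum (Finset.univ : Finset Bool) (k := fun b x y => if b then Real.cos (f x) * Real.cos (f y) * 1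
    else Real.sin (f x) * Real.sin (f y) * 1) (fun b _ => by
    cases b
    · simpa using h2
    · simpa using h1)
  convert h3 using 3 with x y
  rw [Real.cos_sub]; simp; ring

theorem TS.no_Z {Γ : Type} [Group Γ] (h : TS Γ) (φ : Γ →* Multiplicative ℤ) (hφ : Function.Surjective φ) : False := by
  classical
  obtain ⟨Q, ε, hε, hQ⟩ := h 1 one_pos
  have h1 : ∀ q ∈ Q, ∀ᶠ t in 𝓝 (0:ℝ), 1 - Real.cos (t * ((φ q).toAdd : ℝ)) ≤ ε := by
    intro q _
    have : Continuous fun t : ℝ => 1 - Real.cos (t * ((φ q).toAdd : ℝ)) := by fun_prop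
    have h2 := this.tendsto 0
    simp only [zero_mul, Real.cos_zero, sub_self] at h2
    exact (h2.eventually (gt_mem_nhds hε)).mono fun _ h => h.le
  have h2 := (Finset.eventually_all Q).2 h1
  have h3 : Tendsto (fun N : ℕ => Real.pi / ((N:ℝ)+1)) atTop (𝓝 0) :=
    tendsto_const_nhds.div_atTop (tendsto_natCast_atTop_atTop.atTop_add tendsto_const_nhds)
  obtain ⟨N, hN⟩ := (h3.eventually h2).exists
  obtain ⟨γ, hγ⟩ := hφ (Multiplicative.ofAdd (N+1 : ℤ))
  have := hQ (fun x y => Real.cos (Real.pi / ((N:ℝ)+1) * ((φ y).toAdd : ℝ) - Real.pi / ((N:ℝ)+1) * ((φ x).toAdd : ℝ)))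
    (PDK.cosk _) (fun g x y => by
      congr 1
      simp only [map_mul, toAdd_mul, Int.cast_add]; ring) (by simp) (fun q hq => by simpa using hN q hq) γ
  simp only [map_one, toAdd_one, Int.cast_zero, mul_zero, sub_zero, hγ, toAdd_ofAdd] at this
  have e : Real.pi / ((N:ℝ)+1) * (((N:ℤ)+1 : ℤ) : ℝ) = Real.pi := by
    push_cast; field_simp
  rw [e, Real.cos_pi] at this
  norm_num at this

theorem TS.finite_abelian {Γ : Type} [Group Γ] (h : TS Γ) {M : Type*} [Monoid M] (ρ : Γ →* M)
    (hc : ∀ g h, ρ g * ρ h = ρ h * ρ g) : (Set.range ρ).Finite := by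
  classical
  haveI := h.fg
  let ρ' := ρ.toHomUnits
  have hc' : ∀ g h, ρ' g * ρ' h = ρ' h * ρ' g := fun g h => Units.ext (hc g h)
  letI : CommGroup ρ'.range :=
    { (inferInstance : Group ρ'.range) with
      mul_comm := by
        rintro ⟨_, a, rfl⟩ ⟨_, b, rfl⟩
        exact Subtype.ext (hc' a b) }
  obtain ⟨ι, j, _, _, p, hp, e, ⟨f⟩⟩ := CommGroup.equiv_free_prod_prod_multiplicative_zmod ρ'.range
  by_cases hj : Nonempty j
  · exfalso
    obtain ⟨j0⟩ := hj
    refine h.no_Z (((Pi.evalMonoidHom _ j0).comp ((MonoidHom.fst _ _).comp f.toMonoidHom)).comp ρ'.rangeRestrict) ?_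
    intro z
    obtain ⟨a, ha⟩ := f.surjective (fun _ => z, 1)
    obtain ⟨g, rfl⟩ := ρ'.rangeRestrict_surjective a
    refine ⟨g, ?_⟩
    show (f (ρ'.rangeRestrict g)).1 j0 = z
    rw [ha]
  · haveI := not_nonempty_iff.1 hj
    haveI : ∀ i, NeZero (p i ^ e i) := fun i => ⟨pow_ne_zero _ (hp i).ne_zero⟩
    haveI : ∀ i, Finite (Multiplicative (ZMod (p i ^ e i))) := fun i => inferInstanceAs (Finite (ZMod (p i ^ e i)))
    haveI : Finite ρ'.range := Finite.of_equiv _ f.toEquiv.symm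
    have : (Set.range ρ) ⊆ (fun u : ρ'.range => ((u : Mˣ) : M)) '' Set.univ := by
      rintro _ ⟨g, rfl⟩
      exact ⟨⟨ρ' g, g, rfl⟩, trivial, rfl⟩
    exact (Set.finite_univ.image _).subset this

end DistalProof
end

section
set_option linter.all false
open MeasureTheory Filter Topology
namespace DistalProof

theorem TS.bdd {Γ : Type} [Group Γ] (h : TS Γ) (L : Γ → ℝ) (hL : ∀ γ, 1 ≤ L γ) (hL1 : L 1 = 1)
    (hP : ∀ t : ℝ, 0 < t → PDK fun x y => (L (x⁻¹ * y)) ^ (-t)) : ∃ C, ∀ γ, L γ ≤ C := by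
  classical
  obtain ⟨Q, ε, hε, hQ⟩ := h (1/2) (by norm_num)
  have h1 : ∀ q ∈ Q, ∀ᶠ t in 𝓝 (0:ℝ), 1 - (L q) ^ (-t) ≤ ε := by
    intro q _
    have : Continuous fun t : ℝ => 1 - (L q) ^ (-t) :=
      continuous_const.sub (Real.continuous_const_rpow (by linarith [hL q]) |>.comp continuous_neg)
    have h2 := this.tendsto 0
    simp only [neg_zero, Real.rpow_zero, sub_self] at h2
    exact (h2.eventually (gt_mem_nhds hε)).mono fun _ h => h.le
  have h2 := (Finset.eventually_all Q).2 h1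
  obtain ⟨t, ht, ht0⟩ := ((h2.filter_mono nhdsWithin_le_nhds).and (self_mem_nhdsWithin (s := Set.Ioi (0:ℝ)))).exists
  have ht0 : 0 < t := ht0
  refine ⟨2 ^ (1/t), fun γ => ?_⟩
  have h3 := hQ (fun x y => (L (x⁻¹ * y)) ^ (-t)) (hP t ht0) (fun g x y => by
    simp only [mul_inv_rev, mul_assoc, inv_mul_cancel_left]) (by simp [hL1]) (fun q hq => by simpa using ht q hq) γ
  have hp : 0 < L γ := by linarith [hL γ]
  simp only [inv_one, one_mul] at h3
  rw [Real.rpow_neg hp.le] at h3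
  have h4 : 0 < L γ ^ t := Real.rpow_pos_of_pos hp t
  have h5 : L γ ^ t ≤ 2 := by
    have : (1:ℝ)/2 ≤ (L γ ^ t)⁻¹ := by linarith
    rw [le_inv_comm₀ (by norm_num) h4] at this
    simpa using this
  calc L γ = (L γ ^ t) ^ (1/t) := by
        rw [← Real.rpow_mul hp.le, mul_one_div_cancel ht0.ne', Real.rpow_one]
    _ ≤ _ := Real.rpow_le_rpow h4.le h5 (by positivity)

/-- Ultrametric kernels are positive definite -/
theorem PDK.ultra {X : Type*} (κ : X → X → ℝ) (h0 : ∀ x y, 0 ≤ κ x y) (hs : ∀ x y, κ x y = κ y x)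
    (hu : ∀ x y z, min (κ x y) (κ y z) ≤ κ x z) : PDK κ := by
  classical
  have h1 : ∀ s : ℝ, PDK (fun x y => if s < κ x y then (1:ℝ) else 0) := by
    intro s
    have h2 := (PDK.eqk (fun x : X => {z | s < κ x z})).weight (fun x => if s < κ x x then 1 else 0)
    convert h2 using 3 with x y
    by_cases hxy : s < κ x y
    · have hyx : s < κ y x := by rw [hs]; exact hxy
      have e1 : s < κ x x := lt_of_lt_of_le (lt_min hxy hyx) (hu x y x)
      have e2 : s < κ y y := lt_of_lt_of_le (lt_min hyx hxy) (hu y x y)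
      have e3 : {z | s < κ x z} = {z | s < κ y z} := by
        ext z
        exact ⟨fun h => lt_of_lt_of_le (lt_min hyx h) (hu y x z), fun h => lt_of_lt_of_le (lt_min hxy h) (hu x y z)⟩
      rw [if_pos hxy, if_pos e1, if_pos e2, if_pos e3]; norm_num
    · rw [if_neg hxy]
      by_cases e2 : s < κ y y
      · have e3 : ¬ {z | s < κ x z} = {z | s < κ y z} := by
          intro h
          have : y ∈ {z | s < κ x z} := by rw [h]; exact e2
          exact hxy this
        rw [if_neg e3, mul_zero]
      · rw [if_neg e2, mul_zero, zero_mul]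
  refine PDK.lim (k := fun n x y => ((n:ℝ))⁻¹ * ∑ j ∈ Finset.range (n*n), if (j:ℝ)/n < κ x y then (1:ℝ) else 0)
    (fun n => (PDK.sum _ fun j _ => h1 _).smul (by positivity)) fun x y => ?_
  have h2 := (tendsto_nat_ceil_mul_div_atTop (h0 x y)).comp tendsto_natCast_atTop_atTop
  refine h2.congr' ?_
  filter_upwards [eventually_ge_atTop (⌈κ x y⌉₊), eventually_gt_atTop 0] with n hn hn0
  have hn0' : (0:ℝ) < n := by exact_mod_cast hn0
  have e1 : ∀ j : ℕ, ((j:ℝ)/n < κ x y) ↔ j < ⌈κ x y * n⌉₊ := by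
    intro j
    rw [Nat.lt_ceil, div_lt_iff₀ hn0']
  simp only [e1, Function.comp]
  rw [Finset.sum_boole]
  have e2 : (Finset.range (n*n)).filter (fun j => j < ⌈κ x y * n⌉₊) = Finset.range ⌈κ x y * n⌉₊ := by
    ext j
    simp only [Finset.mem_filter, Finset.mem_range, and_iff_right_iff_imp]
    intro hj
    refine lt_of_lt_of_le hj ?_
    rw [Nat.ceil_le]
    push_cast
    exact mul_le_mul_of_nonneg_right ((Nat.le_ceil _).trans (by exact_mod_cast hn)) hn0'.le
  rw [e2, Finset.card_range]
  field_simp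

lemma choose_nonneg (t : ℝ) (ht : 0 < t) (n : ℕ) : 0 ≤ Ring.choose (t + n - 1) n := by
  have h1 := Ring.descPochhammer_eq_factorial_smul_choose (t + n - 1) n
  have h2 : 0 ≤ (descPochhammer ℝ n).eval (t + n - 1) := descPochhammer_nonneg (by linarith)
  have h3 : (descPochhammer ℤ n).smeval (t + n - 1) = (descPochhammer ℝ n).eval (t + n - 1) := by
    rw [← Polynomial.aeval_eq_smeval, ← descPochhammer_map (Int.castRingHom ℝ), Polynomial.eval_map, Polynomial.aeval_def]
    rfl
  rw [h3, nsmul_eq_mul] at h1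
  rw [h1] at h2
  exact nonneg_of_mul_nonneg_right h2 (by positivity)

theorem PDK.arch {X : Type*} (u : X → Fin 3 → ℝ) (hu : ∀ x, ∑ i, u x i ^ 2 < 1) (t : ℝ) (ht : 0 < t) :
    PDK (fun x y => 1 / (1 - ∑ i, u x i * u y i) ^ t) := by
  have h1 : ∀ n : ℕ, PDK (fun x y => (∑ i, u x i * u y i)^n) := by
    intro n
    induction n with
    | zero => simpa using PDK.one
    | succ n ih =>
      have := PDK.sum (Finset.univ : Finset (Fin 3)) fun i _ => ih.weight (fun x => u x i)
      convert this using 3 with x y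
      rw [pow_succ', Finset.sum_mul]
  have hc : ∀ x y, |∑ i, u x i * u y i| < 1 := by
    intro x y
    have h2 := Finset.sum_mul_sq_le_sq_mul_sq Finset.univ (u x) (u y)
    rw [← sq_lt_one_iff_abs_lt_one]
    have a1 := hu x
    have a2 := hu y
    have a3 : 0 ≤ ∑ i, u y i ^ 2 := Finset.sum_nonneg fun i _ => sq_nonneg _
    nlinarith
  refine PDK.lim (k := fun N x y => ∑ n ∈ Finset.range N, Ring.choose (t + n - 1) n * (∑ i, u x i * u y i)^n)
    (fun N => PDK.sum _ fun n _ => (h1 n).smul (choose_nonneg t ht n)) fun x y => ?_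
  have h3 := (Real.one_div_one_sub_rpow_hasFPowerSeriesOnBall_zero t).hasSum (y := ∑ i, u x i * u y i) (by
    simp only [Metric.mem_eball, edist_dist, dist_zero_right, Real.norm_eq_abs]
    rw [ENNReal.ofReal_lt_one]; exact hc x y)
  have h4 := h3.tendsto_sum_nat
  simp only [zero_add] at h4
  convert h4 using 3 with N n
  simp [FormalMultilinearSeries.ofScalars]

abbrev M2 (K : Type*) := Matrix (Fin 2) (Fin 2) K

/-- representations to `SL₂`, up to sign -/
structure PR (Γ : Type) [Group Γ] (K : Type*) [CommRing K] where
  M : Γ → M2 K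
  det : ∀ g, (M g).det = 1
  mul : ∀ g h, M (g * h) = M g * M h ∨ M (g * h) = -(M g * M h)

def PR.map {Γ : Type} [Group Γ] {K K' : Type*} [CommRing K] [CommRing K'] (R : PR Γ K) (σ : K →+* K') : PR Γ K' where
  M g := (R.M g).map σ
  det g := by
    have := RingHom.map_det σ (R.M g)
    rw [R.det, map_one] at this
    exact this.symm
  mul g h := by
    rcases R.mul g h with e | e
    · left; rw [e, Matrix.map_mul]
    · right
      rw [e]
      ext i j; simp [Matrix.mul_apply]

section
variable {Γ : Type} [Group Γ] {K : Type*} [CommRing K] (R : PR Γ K)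

lemma PR.adj (g : Γ) : (R.M g).adjugate * R.M g = 1 := by
  rw [Matrix.adjugate_mul, R.det, one_smul]

lemma PR.one : R.M 1 = 1 ∨ R.M 1 = -1 := by
  have h := R.mul 1 1
  rw [mul_one] at h
  have h1 := R.adj 1
  rcases h with e | e
  · left
    have := congrArg (fun z => (R.M 1).adjugate * z) e
    simp only [← mul_assoc, h1, one_mul] at this
    exact this.symm
  · right
    have := congrArg (fun z => (R.M 1).adjugate * z) e
    simp only [mul_neg, ← mul_assoc, h1, one_mul] at this
    rw [this, neg_neg]

lemma PR.invmul (x y : Γ) : R.M (x⁻¹ * y) = (R.M x).adjugate * R.M y ∨ R.M (x⁻¹ * y) = -((R.M x).adjugate * R.M y) := by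
  have h := R.mul x (x⁻¹ * y)
  rw [mul_inv_cancel_left] at h
  rcases h with e | e
  · left; rw [e, ← mul_assoc, R.adj, one_mul]
  · right; rw [e, mul_neg, ← mul_assoc, R.adj, one_mul, neg_neg]

lemma PR.tr_sq (g : Γ) : (R.M (g * g)).trace = (R.M g).trace ^ 2 - 2 ∨ (R.M (g * g)).trace = -((R.M g).trace ^ 2 - 2) := by
  have hd := R.det g
  rw [Matrix.det_fin_two] at hd
  have h0 : (R.M g * R.M g).trace = (R.M g).trace ^ 2 - 2 := by
    simp only [Matrix.trace_fin_two, Matrix.mul_apply, Fin.sum_univ_two]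
    linear_combination (-2) * hd
  rcases R.mul g g with e | e
  · left; rw [e, h0]
  · right; rw [e, Matrix.trace_neg, h0]

end

section NA
variable {K : Type*} [Field K] (v : AbsoluteValue K ℝ) 

noncomputable def nN (A : M2 K) : ℝ := Finset.univ.sup' ⟨((0:Fin 2),(0:Fin 2)), Finset.mem_univ _⟩ (fun p : Fin 2 × Fin 2 => v (A p.1 p.2))

lemma le_nN (A : M2 K) (i j : Fin 2) : v (A i j) ≤ nN v A :=
  Finset.le_sup' (fun p : Fin 2 × Fin 2 => v (A p.1 p.2)) (Finset.mem_univ (i, j))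

lemma nN_eq (A : M2 K) : ∃ i j, nN v A = v (A i j) := by
  obtain ⟨p, _, hp⟩ := Finset.exists_mem_eq_sup' (s := Finset.univ) ⟨((0:Fin 2),(0:Fin 2)), Finset.mem_univ _⟩ (fun p : Fin 2 × Fin 2 => v (A p.1 p.2))
  exact ⟨p.1, p.2, hp⟩

lemma nN_nonneg (A : M2 K) : 0 ≤ nN v A := (v.nonneg _).trans (le_nN v A 0 0)

lemma nN_neg (A : M2 K) : nN v (-A) = nN v A := by
  unfold nN; simp

lemma nN_adj_le (A : M2 K) : nN v A.adjugate ≤ nN v A := by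
  obtain ⟨i, j, h⟩ := nN_eq v A.adjugate
  rw [h, Matrix.adjugate_fin_two]
  fin_cases i <;> fin_cases j <;> simp [le_nN]

lemma nN_adj (A : M2 K) : nN v A.adjugate = nN v A := by
  refine le_antisymm (nN_adj_le v A) ?_
  have := nN_adj_le v A.adjugate
  rwa [Matrix.adjugate_adjugate _ (by simp), Fintype.card_fin, pow_zero, one_smul] at this

lemma nN_one : nN v (1 : M2 K) = 1 := by
  obtain ⟨i, j, h⟩ := nN_eq v (1 : M2 K)
  refine le_antisymm ?_ (by simpa using le_nN v (1 : M2 K) 0 0)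
  rw [h]
  fin_cases i <;> fin_cases j <;> simp

lemma plucker {g h k : M2 K} (i j a b : Fin 2) : ∃ i' j', (g.adjugate * h) i j * k a b =
    (g.adjugate * k) i b * h a j + (h.adjugate * k) j' b * g a i' ∨ (g.adjugate * h) i j * k a b =
    (g.adjugate * k) i b * h a j + -((h.adjugate * k) j' b * g a i') := by
  refine ⟨1 - i, 1 - j, ?_⟩
  simp only [Matrix.adjugate_fin_two]
  fin_cases i <;> fin_cases j <;> fin_cases a <;> fin_cases b <;>
    simp [Matrix.mul_apply, Fin.sum_univ_two] <;> first | (left; ring1) | (right; ring1)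

lemma four_pt (hv : IsNonarchimedean v) (g h k : M2 K) : nN v (g.adjugate * h) * nN v k ≤
    max (nN v (g.adjugate * k) * nN v h) (nN v (h.adjugate * k) * nN v g) := by
  obtain ⟨i, j, h1⟩ := nN_eq v (g.adjugate * h)
  obtain ⟨a, b, h2⟩ := nN_eq v k
  obtain ⟨i', j', e⟩ := plucker (g := g) (h := h) (k := k) i j a b
  rw [h1, h2, ← map_mul]
  have b1 : v ((g.adjugate * k) i b * h a j) ≤ nN v (g.adjugate * k) * nN v h := by
    rw [map_mul]
    exact mul_le_mul (le_nN _ _ _ _) (le_nN _ _ _ _) (v.nonneg _) (nN_nonneg _ _)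
  have b2 : v ((h.adjugate * k) j' b * g a i') ≤ nN v (h.adjugate * k) * nN v g := by
    rw [map_mul]
    exact mul_le_mul (le_nN _ _ _ _) (le_nN _ _ _ _) (v.nonneg _) (nN_nonneg _ _)
  rcases e with e | e
  · rw [e]
    exact (hv _ _).trans (max_le_max b1 b2)
  · rw [e]
    refine (hv _ _).trans (max_le_max b1 ?_)
    rw [map_neg_eq_map]; exact b2

lemma nN_ge_one (hv : IsNonarchimedean v) (A : M2 K) (hA : A.det = 1) : 1 ≤ nN v A := by
  by_contra h
  push Not at h
  have h0 := nN_nonneg v A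
  have hm : ∀ i j k l, v (A i j * A k l) < 1 := by
    intro i j k l
    rw [map_mul]
    have := mul_le_mul (le_nN v A i j) (le_nN v A k l) (v.nonneg _) h0
    nlinarith
  rw [Matrix.det_fin_two, sub_eq_add_neg] at hA
  have h2 := hv (A 0 0 * A 1 1) (-(A 0 1 * A 1 0))
  rw [hA, map_one, map_neg_eq_map] at h2
  exact absurd (lt_of_le_of_lt h2 (max_lt (hm _ _ _ _) (hm _ _ _ _))) (lt_irrefl _)

theorem TS.na {Γ : Type} [Group Γ] (h : TS Γ) (hv : IsNonarchimedean v) (R : PR Γ K) (γ : Γ) : v (R.M γ).trace ≤ 1 := by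
  have hge : ∀ g, 1 ≤ nN v (R.M g) := fun g => nN_ge_one v hv _ (R.det g)
  have hW : ∀ x y, nN v (R.M (x⁻¹ * y)) = nN v ((R.M x).adjugate * R.M y) := by
    intro x y
    rcases R.invmul x y with e | e
    · rw [e]
    · rw [e, nN_neg]
  have hWs : ∀ x y, nN v (R.M (x⁻¹ * y)) = nN v (R.M (y⁻¹ * x)) := by
    intro x y
    rw [hW, hW, ← nN_adj, Matrix.adjugate_mul_distrib, Matrix.adjugate_adjugate _ (by simp), Fintype.card_fin, pow_zero, one_smul]
  have hp : ∀ x, 0 < nN v (R.M x) := fun x => by linarith [hge x]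
  let κ : Γ → Γ → ℝ := fun x y => nN v (R.M x) * nN v (R.M y) / nN v (R.M (x⁻¹ * y))
  have hκ0 : ∀ x y, 0 ≤ κ x y := fun x y => div_nonneg (mul_nonneg (hp _).le (hp _).le) (hp _).le
  have hκs : ∀ x y, κ x y = κ y x := fun x y => by
    show _ / _ = _ / _
    rw [hWs, mul_comm]
  have hκu : ∀ x y z, min (κ x y) (κ y z) ≤ κ x z := by
    intro x y z
    have := four_pt v hv (R.M x) (R.M z) (R.M y)
    rw [← hW, ← hW, ← hW, hWs z y] at this
    rcases le_max_iff.1 this with q | q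
    · refine min_le_of_left_le ?_
      show _ / _ ≤ _ / _
      rw [div_le_div_iff₀ (hp _) (hp _)]
      nlinarith [mul_le_mul_of_nonneg_left q (hp x).le]
    · refine min_le_of_right_le ?_
      show _ / _ ≤ _ / _
      rw [div_le_div_iff₀ (hp _) (hp _)]
      nlinarith [mul_le_mul_of_nonneg_left q (hp z).le]
  obtain ⟨C, hC⟩ := h.bdd (fun g => nN v (R.M g)) hge (by
      rcases R.one with e | e
      · rw [e, nN_one]
      · rw [e, nN_neg, nN_one]) (by
    intro t ht
    have h1 := (PDK.ultra (fun x y => κ x y ^ t) (fun x y => Real.rpow_nonneg (hκ0 _ _) _) (fun x y => by rw [hκs])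
      (fun x y z => by
        rcases min_le_iff.1 (hκu x y z) with q | q
        · exact min_le_of_left_le (Real.rpow_le_rpow (hκ0 _ _) q ht.le)
        · exact min_le_of_right_le (Real.rpow_le_rpow (hκ0 _ _) q ht.le))).weight (fun x => nN v (R.M x) ^ (-t))
    convert h1 using 3 with x y
    show _ = _ * (_ / _) ^ t
    rw [Real.div_rpow (mul_nonneg (hp _).le (hp _).le) (hp _).le, Real.mul_rpow (hp _).le (hp _).le,
      Real.rpow_neg (hp _).le, Real.rpow_neg (hp _).le, Real.rpow_neg (hp _).le]
    have a1 := Real.rpow_pos_of_pos (hp x) t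
    have a2 := Real.rpow_pos_of_pos (hp y) t
    field_simp)
  have htr : ∀ g, v (R.M g).trace ≤ C := by
    intro g
    rw [Matrix.trace_fin_two]
    exact (hv _ _).trans ((max_le (le_nN _ _ _ _) (le_nN _ _ _ _)).trans (hC g))
  have hbdd : BddAbove (Set.range fun g => v (R.M g).trace) := ⟨C, by rintro _ ⟨g, rfl⟩; exact htr g⟩
  set S := max (⨆ g, v (R.M g).trace) 1 with hS
  have h1 : ∀ g, v (R.M g).trace ≤ S := fun g => (le_ciSup hbdd g).trans (le_max_left _ _)
  have h2 : ∀ g, v (R.M g).trace ^ 2 ≤ S := by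
    intro g
    have e : (R.M g).trace ^ 2 = ((R.M g).trace ^ 2 - 2) + 2 := by ring
    rw [← map_pow, e]
    refine (hv _ _).trans (max_le ?_ ?_)
    · rcases R.tr_sq g with q | q
      · rw [← q]; exact h1 _
      · rw [← map_neg_eq_map v, ← q]; exact h1 _
    · refine le_trans ?_ (le_max_right _ _)
      have := hv 1 1
      norm_num at this
      exact this
  have hS1 : 1 ≤ S := le_max_right _ _
  have h3 : S ≤ Real.sqrt S := by
    refine max_le (ciSup_le fun g => Real.le_sqrt_of_sq_le (h2 g)) ?_
    exact Real.one_le_sqrt.2 hS1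
  have h4 : S ≤ 1 := by
    have := Real.sq_sqrt (show 0 ≤ S by linarith)
    have h5 : 0 ≤ Real.sqrt S := Real.sqrt_nonneg _
    nlinarith
  exact (h1 γ).trans h4

end NA

section AR

noncomputable def aN (A : M2 ℂ) : ℝ := (∑ i, ∑ j, Complex.normSq (A i j)) / 2
noncomputable def a0 (A : M2 ℂ) : ℝ := ∑ i, ∑ j, Complex.normSq (A i j)
noncomputable def av (A : M2 ℂ) : Fin 3 → ℝ := ![
  Complex.normSq (A 0 0) + Complex.normSq (A 0 1) - Complex.normSq (A 1 0) - Complex.normSq (A 1 1),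
  2 * ((A 0 0).re * (A 1 0).re + (A 0 0).im * (A 1 0).im + (A 0 1).re * (A 1 1).re + (A 0 1).im * (A 1 1).im),
  2 * ((A 0 0).im * (A 1 0).re - (A 0 0).re * (A 1 0).im + (A 0 1).im * (A 1 1).re - (A 0 1).re * (A 1 1).im)]

lemma aN_adj (A B : M2 ℂ) : aN (A.adjugate * B) = (a0 A * a0 B - ∑ i, av A i * av B i) / 4 := by
  simp only [aN, a0, av, Matrix.adjugate_fin_two, Fin.sum_univ_two, Fin.sum_univ_three, Matrix.mul_apply, Complex.normSq_apply]
  simp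
  ring

lemma aN_neg (A : M2 ℂ) : aN (-A) = aN A := by simp [aN]
lemma aN_one : aN 1 = 1 := by simp [aN, Fin.sum_univ_two]

theorem TS.ar {Γ : Type} [Group Γ] (h : TS Γ) (R : PR Γ ℂ) (γ : Γ) : ‖(R.M γ).trace‖ ≤ 2 := by
  have hW : ∀ x y, aN (R.M (x⁻¹ * y)) = aN ((R.M x).adjugate * R.M y) := by
    intro x y
    rcases R.invmul x y with e | e
    · rw [e]
    · rw [e, aN_neg]
  have hd : ∀ x, a0 (R.M x) * a0 (R.M x) - ∑ i, av (R.M x) i * av (R.M x) i = 4 := by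
    intro x
    have := aN_adj (R.M x) (R.M x)
    rw [R.adj, aN_one] at this
    linarith
  have ha0 : ∀ A : M2 ℂ, 0 ≤ a0 A := fun A => Finset.sum_nonneg fun i _ => Finset.sum_nonneg fun j _ => Complex.normSq_nonneg _
  have hsq : ∀ x, 0 ≤ ∑ i, av (R.M x) i * av (R.M x) i := fun x => Finset.sum_nonneg fun i _ => mul_self_nonneg _
  have hge : ∀ x, 2 ≤ a0 (R.M x) := by
    intro x
    nlinarith [hd x, hsq x, ha0 (R.M x)]
  have haN : ∀ A, aN A = a0 A / 2 := fun A => rfl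
  obtain ⟨C, hC⟩ := h.bdd (fun g => aN (R.M g)) (fun g => by rw [haN]; linarith [hge g]) (by
      rcases R.one with e | e
      · rw [e, aN_one]
      · rw [e, aN_neg, aN_one]) (by
    intro t ht
    let u : Γ → Fin 3 → ℝ := fun x i => av (R.M x) i / a0 (R.M x)
    have hu : ∀ x, ∑ i, u x i ^ 2 < 1 := by
      intro x
      have hp : 0 < a0 (R.M x) := by linarith [hge x]
      have : ∑ i, u x i ^ 2 = (∑ i, av (R.M x) i * av (R.M x) i) / (a0 (R.M x))^2 := by
        rw [Finset.sum_div]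
        refine Finset.sum_congr rfl fun i _ => ?_
        show (_ / _)^2 = _
        rw [div_pow]; ring
      rw [this, div_lt_one (by positivity)]
      nlinarith [hd x]
    have h1 := (PDK.arch u hu t ht).weight (fun x => (a0 (R.M x) / 2) ^ (-t))
    convert h1 using 3 with x y
    have hpx : 0 < a0 (R.M x) := by linarith [hge x]
    have hpy : 0 < a0 (R.M y) := by linarith [hge y]
    have e : aN (R.M (x⁻¹ * y)) = (a0 (R.M x) / 2) * (a0 (R.M y) / 2) * (1 - ∑ i, u x i * u y i) := by
      rw [hW, aN_adj]
      have : ∑ i, u x i * u y i = (∑ i, av (R.M x) i * av (R.M y) i) / (a0 (R.M x) * a0 (R.M y)) := by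
        rw [Finset.sum_div]
        refine Finset.sum_congr rfl fun i _ => ?_
        show (_ / _) * (_ / _) = _
        rw [div_mul_div_comm]
      rw [this]
      field_simp
      ring
    have hpos : 0 < 1 - ∑ i, u x i * u y i := by
      have h2 : 0 < aN (R.M (x⁻¹ * y)) := by rw [haN]; linarith [hge (x⁻¹ * y)]
      rw [e] at h2
      exact (mul_pos_iff_of_pos_left (by positivity)).1 h2
    rw [e, Real.mul_rpow (by positivity) hpos.le, Real.mul_rpow (by positivity) (by positivity), Real.rpow_neg hpos.le, one_div])
  have hbd : ∀ g, ‖(R.M g).trace‖ ≤ 2 * C + 2 := by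
    intro g
    have h1 := hC g
    have h2 : ‖(R.M g).trace‖ ≤ ‖R.M g 0 0‖ + ‖R.M g 1 1‖ := by
      rw [Matrix.trace_fin_two]; exact norm_add_le _ _
    simp only [aN, Fin.sum_univ_two, Complex.normSq_eq_norm_sq] at h1
    nlinarith [sq_nonneg (‖R.M g 0 0‖ - 1), sq_nonneg (‖R.M g 1 1‖ - 1), sq_nonneg ‖R.M g 0 1‖, sq_nonneg ‖R.M g 1 0‖]
  have hbdd : BddAbove (Set.range fun g => ‖(R.M g).trace‖) := ⟨_, by rintro _ ⟨g, rfl⟩; exact hbd g⟩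
  set S := ⨆ g, ‖(R.M g).trace‖ with hS
  have h1 : ∀ g, ‖(R.M g).trace‖ ≤ S := fun g => le_ciSup hbdd g
  have hS0 : 0 ≤ S := (norm_nonneg _).trans (h1 1)
  have h2 : ∀ g, ‖(R.M g).trace‖ ^ 2 ≤ S + 2 := by
    intro g
    have e : (R.M g).trace ^ 2 = ((R.M g).trace ^ 2 - 2) + 2 := by ring
    rw [← norm_pow, e]
    refine (norm_add_le _ _).trans (add_le_add ?_ (by simp))
    rcases R.tr_sq g with q | q
    · rw [← q]; exact h1 _
    · rw [← norm_neg, ← q]; exact h1 _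
  have h3 : S ≤ Real.sqrt (S + 2) := ciSup_le fun g => Real.le_sqrt_of_sq_le (h2 g)
  have h4 : S ≤ 2 := by
    have h5 := Real.sq_sqrt (show 0 ≤ S + 2 by linarith)
    have h6 : 0 ≤ Real.sqrt (S+2) := Real.sqrt_nonneg _
    nlinarith
  exact (h1 γ).trans h4

end AR

end DistalProof
end

section
set_option linter.all false
namespace DistalProof

lemma exists_hom_of_basis {S M ι : Type} [Field S] [Field M] [Algebra ℚ S] [Algebra ℚ M] [IsAlgClosed M]
    (x : ι → S) (hx : IsTranscendenceBasis ℚ x) (y : ι → M) (hy : AlgebraicIndependent ℚ y) :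
    ∃ σ : S →+* M, ∀ i, σ (x i) = y i := by
  let A := Algebra.adjoin ℚ (Set.range x)
  let f : A →+* M := ((MvPolynomial.aeval y).comp (hx.1.aevalEquiv.symm : A →ₐ[ℚ] MvPolynomial ι ℚ)).toRingHom
  have hf : Function.Injective f := by
    intro a b hab
    exact hx.1.aevalEquiv.symm.injective (hy hab)
  letI : Algebra A M := f.toAlgebra
  haveI : FaithfulSMul A M := (faithfulSMul_iff_algebraMap_injective A M).2 hf
  haveI : Algebra.IsAlgebraic A S := hx.isAlgebraic
  haveI : Module.IsTorsionFree A M := inferInstance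
  haveI : Module.IsTorsionFree A S := inferInstance
  let σ : S →ₐ[A] M := IsAlgClosed.lift
  refine ⟨σ.toRingHom, fun i => ?_⟩
  have h1 := σ.commutes ⟨x i, Algebra.subset_adjoin ⟨i, rfl⟩⟩
  have h2 : (hx.1.aevalEquiv.symm : A →ₐ[ℚ] MvPolynomial ι ℚ) ⟨x i, Algebra.subset_adjoin ⟨i, rfl⟩⟩ = MvPolynomial.X i := by
    show hx.1.aevalEquiv.symm _ = _
    rw [AlgEquiv.symm_apply_eq]
    apply Subtype.ext
    simp
  refine Eq.trans h1 ?_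
  show (MvPolynomial.aeval y) ((hx.1.aevalEquiv.symm : A →ₐ[ℚ] MvPolynomial ι ℚ) ⟨x i, Algebra.subset_adjoin ⟨i, rfl⟩⟩) = _
  rw [h2, MvPolynomial.aeval_X]

lemma scale_inj (t : Type) (N : ℚ) (hN : N ≠ 0) :
    Function.Injective (MvPolynomial.aeval (R := ℚ) (fun i : t => (MvPolynomial.C N * MvPolynomial.X i : MvPolynomial t ℚ))) := by
  have e2 : (MvPolynomial.aeval (R := ℚ) (fun i : t => (MvPolynomial.C N⁻¹ * MvPolynomial.X i : MvPolynomial t ℚ))).comp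
      (MvPolynomial.aeval (fun i : t => (MvPolynomial.C N * MvPolynomial.X i : MvPolynomial t ℚ))) = AlgHom.id ℚ (MvPolynomial t ℚ) := by
    ext1 i
    simp only [AlgHom.comp_apply, MvPolynomial.aeval_X, map_mul, MvPolynomial.algHom_C, AlgHom.id_apply]
    rw [MvPolynomial.algebraMap_eq, ← mul_assoc, ← MvPolynomial.C_mul, mul_inv_cancel₀ hN, MvPolynomial.C_1, one_mul]
  intro p q hpq
  have h1 := AlgHom.congr_fun e2 p
  have h2 := AlgHom.congr_fun e2 q
  rw [AlgHom.comp_apply, AlgHom.id_apply] at h1 h2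
  rw [← h1, ← h2, hpq]

lemma exists_scaling (x : ℂ) (hx : Transcendental ℚ x) (N : ℚ) (hN : N ≠ 0) : ∃ σ : ℂ →+* ℂ, σ x = N * x := by
  obtain ⟨t, hxt, ht⟩ := exists_isTranscendenceBasis_superset (R := ℚ) (A := ℂ) (s := {x})
    ((algebraicIndependent_singleton_iff (⟨x, rfl⟩ : ({x} : Set ℂ))).2 hx)
  have hy : AlgebraicIndependent ℚ (fun i : t => (N:ℂ) * (i:ℂ)) := by
    have e : (MvPolynomial.aeval (R := ℚ) (fun i : t => (N:ℂ) * (i:ℂ))) =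
        (MvPolynomial.aeval (fun i : t => (i:ℂ))).comp
          (MvPolynomial.aeval (fun i : t => MvPolynomial.C N * MvPolynomial.X i)) := by
      ext i
      simp
    show Function.Injective _
    rw [e]
    rw [AlgHom.coe_comp]
    refine Function.Injective.comp (g := (MvPolynomial.aeval (R := ℚ) (fun i : t => (i:ℂ)))) ht.1 ?_
    exact scale_inj _ N hN
  obtain ⟨σ, hσ⟩ := exists_hom_of_basis _ ht _ hy
  exact ⟨σ, hσ ⟨x, hxt rfl⟩⟩

lemma PR.map_trace {Γ : Type} [Group Γ] {K K' : Type*} [CommRing K] [CommRing K'] (R : PR Γ K) (σ : K →+* K') (g : Γ) :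
    ((R.map σ).M g).trace = σ (R.M g).trace := by
  simp [PR.map, Matrix.trace_fin_two]

lemma TS.algebraic {Γ : Type} [Group Γ] (h : TS Γ) (R : PR Γ ℂ) (γ : Γ) : IsAlgebraic ℚ (R.M γ).trace := by
  by_contra hx
  have hx0 : (R.M γ).trace ≠ 0 := by
    intro e; rw [e] at hx; exact hx isAlgebraic_zero
  obtain ⟨n, hn⟩ := exists_nat_gt (2 / ‖(R.M γ).trace‖)
  have hp : 0 < ‖(R.M γ).trace‖ := norm_pos_iff.2 hx0
  have hn0 : (0:ℝ) < n := lt_trans (by positivity) hn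
  obtain ⟨σ, hσ⟩ := exists_scaling _ hx (n:ℚ) (by
    have : n ≠ 0 := by rintro rfl; simp at hn0
    exact_mod_cast this)
  have h1 := h.ar (R.map σ) γ
  rw [PR.map_trace, hσ, norm_mul] at h1
  rw [div_lt_iff₀ hp] at hn
  simp at h1
  linarith

lemma PR.entries {Γ : Type} [Group Γ] (R : PR Γ ℂ) (hfg : Group.FG Γ) :
    ∃ s : Finset ℂ, ∀ g i j, R.M g i j ∈ Algebra.adjoin ℚ (s : Set ℂ) := by
  classical
  obtain ⟨Q, hQ⟩ := hfg.out
  refine ⟨Q.biUnion fun q => Finset.univ.image fun p : Fin 2 × Fin 2 => R.M q p.1 p.2, fun g => ?_⟩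
  set A := Algebra.adjoin ℚ ((Q.biUnion fun q => Finset.univ.image fun p : Fin 2 × Fin 2 => R.M q p.1 p.2 : Finset ℂ) : Set ℂ) with hA
  have hone : ∀ i j, R.M 1 i j ∈ A := by
    intro i j
    have h01 : ∀ i j, (1 : M2 ℂ) i j ∈ A := by
      intro i j
      rw [Matrix.one_apply]; split_ifs
      · exact A.one_mem
      · exact A.zero_mem
    rcases R.one with e | e <;> rw [e]
    · exact h01 i j
    · exact A.neg_mem (h01 i j)
  have hmul : ∀ a b : M2 ℂ, (∀ i j, a i j ∈ A) → (∀ i j, b i j ∈ A) → ∀ i j, (a * b) i j ∈ A := by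
    intro a b ha hb i j
    rw [Matrix.mul_apply]
    exact A.sum_mem fun k _ => A.mul_mem (ha _ _) (hb _ _)
  have hg : g ∈ Subgroup.closure (Q : Set Γ) := by rw [hQ]; trivial
  induction hg using Subgroup.closure_induction with
  | mem x hx =>
    intro i j
    refine Algebra.subset_adjoin ?_
    simp only [Finset.coe_biUnion, Set.mem_iUnion]
    exact ⟨x, hx, Finset.mem_coe.2 (Finset.mem_image.2 ⟨(i, j), Finset.mem_univ _, rfl⟩)⟩
  | one => exact hone
  | mul x y _ _ hx hy =>
    intro i j
    rcases R.mul x y with e | e <;> rw [e]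
    · exact hmul _ _ hx hy i j
    · exact A.neg_mem (hmul _ _ hx hy i j)
  | inv x _ hx =>
    intro i j
    have hadj : ∀ i j, (R.M x).adjugate i j ∈ A := by
      intro i j
      rw [Matrix.adjugate_fin_two]
      fin_cases i <;> fin_cases j <;> simp [hx]
    have := R.invmul x 1
    rw [mul_one] at this
    rcases this with e | e <;> rw [e]
    · exact hmul _ _ hadj hone i j
    · exact A.neg_mem (hmul _ _ hadj hone i j)

def PR.restrict {Γ : Type} [Group Γ] (R : PR Γ ℂ) (A : Subalgebra ℚ ℂ) (hA : ∀ g i j, R.M g i j ∈ A) : PR Γ A where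
  M g := Matrix.of fun i j => ⟨R.M g i j, hA g i j⟩
  det g := by
    have := R.det g
    rw [Matrix.det_fin_two] at this ⊢
    exact Subtype.ext this
  mul g h := by
    rcases R.mul g h with e | e
    · left
      ext i j
      have := congrFun (congrFun e i) j
      rw [Matrix.mul_apply] at this ⊢
      simpa using this
    · right
      ext i j
      have := congrFun (congrFun e i) j
      rw [Matrix.neg_apply, Matrix.mul_apply] at this ⊢
      simpa using this

open IsDedekindDomain NumberField in
lemma TS.integral {Γ : Type} [Group Γ] (h : TS Γ) {L : Type} [Field L] [NumberField L] (R : PR Γ L) (γ : Γ) :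
    IsIntegral ℤ (R.M γ).trace := by
  have h1 : (R.M γ).trace ∈ (algebraMap (𝓞 L) L).range := by
    refine HeightOneSpectrum.mem_integers_of_valuation_le_one L _ fun v => ?_
    have h2 := TS.na (HeightOneSpectrum.adicAbv L v) h (HeightOneSpectrum.isNonarchimedean_adicAbv L v) R γ
    rw [HeightOneSpectrum.adicAbv_def] at h2
    have h3 : WithZeroMulInt.toNNReal (HeightOneSpectrum.absNorm_ne_zero v) (v.valuation L (R.M γ).trace) ≤ 1 := by exact_mod_cast h2
    exact (WithZeroMulInt.toNNReal_le_one_iff (HeightOneSpectrum.one_lt_absNorm_nnreal v)).1 h3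
  obtain ⟨y, hy⟩ := h1
  rw [← hy]
  exact y.2

lemma nf_of (L : Type) [Field L] [inst : Algebra ℚ L] [Module.Finite ℚ L] : NumberField L := by
  haveI : CharZero L := algebraRat.charZero L
  have e : inst = DivisionRing.toRatAlgebra := Subsingleton.elim _ _
  subst e
  exact ⟨⟩

theorem TS.finite_traces {Γ : Type} [Group Γ] (h : TS Γ) (R : PR Γ ℂ) : (Set.range fun γ => (R.M γ).trace).Finite := by
  obtain ⟨s, hs⟩ := R.entries h.fg
  set A := Algebra.adjoin ℚ (s : Set ℂ) with hA
  let RA := R.restrict A hs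
  obtain ⟨m, hm⟩ := Ideal.exists_maximal A
  haveI : Algebra.FiniteType ℚ A := (Subalgebra.fg_iff_finiteType A).1 ⟨s, rfl⟩
  letI : Field (A ⧸ m) := Ideal.Quotient.field m
  haveI : Algebra.FiniteType ℚ (A ⧸ m) := Algebra.FiniteType.of_surjective (Ideal.Quotient.mkₐ ℚ m) (Ideal.Quotient.mkₐ_surjective ℚ m)
  haveI : Module.Finite ℚ (A ⧸ m) := finite_of_finite_type_of_isJacobsonRing ℚ (A ⧸ m)
  haveI : NumberField (A ⧸ m) := nf_of _
  let RL := RA.map (Ideal.Quotient.mk m)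
  have hfin := NumberField.Embeddings.finite_of_norm_le (A ⧸ m) ℂ 2
  have htr : ∀ γ, ((RA.M γ).trace : ℂ) = (R.M γ).trace := by
    intro γ
    simp [RA, PR.restrict, Matrix.trace_fin_two]
  have hfin2 : (Set.range fun γ => (RL.M γ).trace).Finite := by
    refine hfin.subset ?_
    rintro _ ⟨γ, rfl⟩
    refine ⟨h.integral RL γ, fun φ => ?_⟩
    have := h.ar (RL.map φ) γ
    rwa [PR.map_trace] at this
  have hinj : ∀ γ δ, (RL.M γ).trace = (RL.M δ).trace → (R.M γ).trace = (R.M δ).trace := by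
    intro γ δ e
    by_contra hne
    rw [PR.map_trace, PR.map_trace, Ideal.Quotient.mk_eq_mk_iff_sub_mem] at e
    have halg : IsAlgebraic ℚ ((R.M γ).trace - (R.M δ).trace) := (h.algebraic R γ).sub (h.algebraic R δ)
    set z : A := (RA.M γ).trace - (RA.M δ).trace with hz
    have hzc : (z : ℂ) = (R.M γ).trace - (R.M δ).trace := by rw [hz]; push_cast; rw [htr, htr]
    have hz0 : (z : ℂ) ≠ 0 := by rw [hzc]; exact sub_ne_zero.2 hne
    have hinv : (z : ℂ)⁻¹ ∈ A := by
      have hi : IsIntegral ℚ (z:ℂ) := by rw [hzc]; exact halg.isIntegral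
      exact A.inv_mem_of_algebraic (x := z) (by rw [hzc]; exact halg)
    have hu : IsUnit z := IsUnit.of_mul_eq_one ⟨(z:ℂ)⁻¹, hinv⟩ (Subtype.ext (mul_inv_cancel₀ hz0))
    exact hm.ne_top (Ideal.eq_top_of_isUnit_mem _ e hu)
  classical
  have : (Set.range fun γ => (R.M γ).trace) ⊆ (fun y => if hy : ∃ γ, (RL.M γ).trace = y then (R.M hy.choose).trace else 0) '' (Set.range fun γ => (RL.M γ).trace) := by
    rintro _ ⟨γ, rfl⟩
    refine ⟨_, ⟨γ, rfl⟩, ?_⟩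
    have hy : ∃ γ', (RL.M γ').trace = (RL.M γ).trace := ⟨γ, rfl⟩
    show (if hy : ∃ γ', (RL.M γ').trace = (RL.M γ).trace then (R.M hy.choose).trace else 0) = _
    rw [dif_pos hy]
    exact hinj _ _ hy.choose_spec
  exact (hfin2.image _).subset this

end DistalProof
end

section
set_option linter.all false
open Matrix
namespace DistalProof

/-- the imaginary quaternion attached to a vector -/
noncomputable def XS (v : Fin 3 → ℝ) : M2 ℂ :=
  !![Complex.I * v 0, v 1 + Complex.I * v 2; -v 1 + Complex.I * v 2, -(Complex.I * v 0)]

lemma XS_inj {v w : Fin 3 → ℝ} (h : XS v = XS w) : v = w := by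
  have h0 := congrFun (congrFun h 0) 0
  have h1 := congrFun (congrFun h 0) 1
  simp [XS] at h0 h1
  have h2 := congrArg Complex.re h1
  have h3 := congrArg Complex.im h1
  simp at h2 h3
  ext i
  fin_cases i
  · exact h0
  · exact h2
  · exact h3

/-- `M` is a lift of the map `T` to `SU(2)` -/
structure Lft (T : (Fin 3 → ℝ) → Fin 3 → ℝ) (M : M2 ℂ) (ε : ℂ) : Prop where
  det : M.det = 1
  herm : Mᴴ = M.adjugate
  eps : ε = 1 ∨ ε = -1
  comm : ∀ w, XS (T w) * M = ε • (M * XS w)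

lemma Lft.sq {T M ε} (h : Lft T M ε) : ε * ε = 1 := by
  rcases h.eps with e | e <;> rw [e] <;> norm_num

lemma Lft.mul {T T' M M' ε ε'} (h : Lft T M ε) (h' : Lft T' M' ε') : Lft (fun w => T (T' w)) (M * M') (ε * ε') where
  det := by rw [det_mul, h.det, h'.det, one_mul]
  herm := by rw [conjTranspose_mul, h.herm, h'.herm, adjugate_mul_distrib]
  eps := by rcases h.eps with e | e <;> rcases h'.eps with e' | e' <;> simp [e, e']
  comm w := by
    rw [← mul_assoc, h.comm, smul_mul_assoc, mul_assoc, h'.comm, mul_smul_comm, smul_smul, mul_assoc]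

lemma adj_adj (M : M2 ℂ) : M.adjugate.adjugate = M := by
  rw [adjugate_adjugate _ (by simp)]; simp

lemma Lft.inv {T T' M ε} (h : Lft T M ε) (hT : ∀ w, T (T' w) = w) : Lft T' M.adjugate ε where
  det := by rw [det_adjugate, h.det]; simp
  herm := by rw [adj_adj, ← h.herm, conjTranspose_conjTranspose]
  eps := h.eps
  comm w := by
    have h1 := h.comm (T' w)
    rw [hT] at h1
    have h2 : M.adjugate * M = 1 := by rw [adjugate_mul, h.det, one_smul]
    have h3 : M * M.adjugate = 1 := by rw [mul_adjugate, h.det, one_smul]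
    calc XS (T' w) * M.adjugate = M.adjugate * M * XS (T' w) * M.adjugate := by rw [h2, one_mul]
      _ = ε • (M.adjugate * (ε • (M * XS (T' w))) * M.adjugate) := by
        rw [mul_smul_comm, smul_mul_assoc, smul_smul, h.sq, one_smul, mul_assoc M.adjugate M]
      _ = ε • (M.adjugate * XS w * (M * M.adjugate)) := by rw [← h1]; simp only [mul_assoc]
      _ = _ := by rw [h3, mul_one]

lemma Lft.id : Lft (fun w => w) 1 1 where
  det := det_one
  herm := by simp
  eps := Or.inl rfl
  comm w := by simp

lemma Lft.refl (n : Fin 3 → ℝ) (hn : n 0 ^ 2 + n 1 ^ 2 + n 2 ^ 2 = 1) :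
    Lft (fun w i => w i - 2 * (n 0 * w 0 + n 1 * w 1 + n 2 * w 2) * n i) (XS n) (-1) where
  det := by
    have h : ((n 0 : ℂ))^2 + (n 1 : ℂ)^2 + (n 2 : ℂ)^2 = 1 := by exact_mod_cast hn
    rw [det_fin_two]
    simp [XS]
    linear_combination h - ((n 0 : ℂ)^2 + (n 2:ℂ)^2) * Complex.I_sq
  herm := by
    rw [adjugate_fin_two]
    ext i j
    fin_cases i <;> fin_cases j <;> simp [XS] <;> ring
  eps := Or.inr rfl
  comm w := by
    have h : ((n 0 : ℂ))^2 + (n 1 : ℂ)^2 + (n 2 : ℂ)^2 = 1 := by exact_mod_cast hn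
    have hI := Complex.I_sq
    set s : ℂ := (n 0 * w 0 + n 1 * w 1 + n 2 * w 2) with hs
    ext i j
    fin_cases i <;> fin_cases j <;> simp [XS, Matrix.mul_apply, Fin.sum_univ_two] <;> rw [← hs]
    · linear_combination 2 * s * h - 2 * s * ((n 0 : ℂ)^2 + (n 2:ℂ)^2) * hI + 2 * (n 0 * w 0 + n 2 * w 2 : ℂ) * hI - 2 * hs
    · ring
    · ring
    · linear_combination 2 * s * h - 2 * s * ((n 0 : ℂ)^2 + (n 2:ℂ)^2) * hI + 2 * (n 0 * w 0 + n 2 * w 2 : ℂ) * hI - 2 * hs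

abbrev E3 := EuclideanSpace ℝ (Fin 3)

lemma exists_lft_iso (T : E3 ≃ₗᵢ[ℝ] E3) : ∃ M ε, Lft (fun w => (T (WithLp.toLp 2 w)).ofLp) M ε := by
  have hT : T ∈ Subgroup.closure (Set.range fun v : E3 => Submodule.reflection (Submodule.span ℝ {v})ᗮ) := by
    rw [LinearIsometryEquiv.reflections_generate]; trivial
  induction hT using Subgroup.closure_induction with
  | one => exact ⟨1, 1, Lft.id⟩
  | mul x y _ _ hx hy =>
    obtain ⟨M, ε, h⟩ := hx
    obtain ⟨M', ε', h'⟩ := hy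
    exact ⟨_, _, h.mul h'⟩
  | inv x _ hx =>
    obtain ⟨M, ε, h⟩ := hx
    exact ⟨_, _, h.inv (fun w => by simp)⟩
  | mem x hx =>
    obtain ⟨v, rfl⟩ := hx
    by_cases hv : v = 0
    · refine ⟨1, 1, ?_⟩
      subst hv
      convert Lft.id using 2 with w
      rw [Submodule.reflection_orthogonal_apply, Submodule.reflection_singleton_apply]
      simp
    · have hp : 0 < ‖v‖ := norm_pos_iff.2 hv
      have hsq : ‖v‖ ^ 2 = v 0 ^ 2 + v 1 ^ 2 + v 2 ^ 2 := by
        rw [EuclideanSpace.real_norm_sq_eq, Fin.sum_univ_three]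
      refine ⟨XS (fun i => ‖v‖⁻¹ * v i), -1, ?_⟩
      convert Lft.refl (fun i => ‖v‖⁻¹ * v i) (by field_simp; rw [hsq]) using 1
      ext w i
      rw [Submodule.reflection_orthogonal_apply, Submodule.reflection_singleton_apply]
      have : inner ℝ v (WithLp.toLp 2 w) = v 0 * w 0 + v 1 * w 1 + v 2 * w 2 := by
        rw [PiLp.inner_apply, Fin.sum_univ_three]; simp; ring
      rw [this]
      simp
      field_simp

lemma exists_lft (A : Matrix (Fin 3) (Fin 3) ℝ) (hA : A * Aᵀ = 1) : ∃ M ε, Lft (fun w => A *ᵥ w) M ε := by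
  have hA2 : Aᵀ * A = 1 := mul_eq_one_comm.1 hA
  let f : E3 →ₗᵢ[ℝ] E3 := ⟨Matrix.toEuclideanLin A, fun v => by
    have h : ‖Matrix.toEuclideanLin A v‖ ^ 2 = ‖v‖ ^ 2 := by
      rw [EuclideanSpace.real_norm_sq_eq, EuclideanSpace.real_norm_sq_eq]
      have h1 : (A *ᵥ v.ofLp) ⬝ᵥ (A *ᵥ v.ofLp) = v.ofLp ⬝ᵥ v.ofLp := by
        rw [dotProduct_mulVec, vecMul_mulVec, ← dotProduct_mulVec, hA2, one_mulVec]
      simp only [dotProduct, ← sq] at h1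
      exact h1
    exact (pow_left_inj₀ (norm_nonneg _) (norm_nonneg _) two_ne_zero).1 h⟩
  exact exists_lft_iso (f.toLinearIsometryEquiv rfl)

lemma Lft.unique {T M M' ε ε'} (h : Lft T M ε) (h' : Lft T M' ε') : M' = M ∨ M' = -M := by
  have h2 : M.adjugate * M = 1 := by rw [adjugate_mul, h.det, one_smul]
  have h3 : M * M.adjugate = 1 := by rw [mul_adjugate, h.det, one_smul]
  set N := M.adjugate * M' with hN
  have hM' : M' = M * N := by rw [hN, ← mul_assoc, h3, one_mul]
  have hdN : N.det = 1 := by rw [hN, det_mul, det_adjugate, h.det, h'.det]; simp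
  have hc : ∀ w, ε • (XS w * N) = ε' • (N * XS w) := by
    intro w
    have h1 := h'.comm w
    rw [hM', ← mul_assoc, h.comm, smul_mul_assoc, mul_assoc, mul_assoc] at h1
    have h4 := congrArg (fun Y => M.adjugate * Y) h1
    simp only [mul_smul_comm, ← mul_assoc, h2, one_mul] at h4
    exact h4
  have hc0 := hc ![1,0,0]
  have hc1 := hc ![0,1,0]
  have hc2 := hc ![0,0,1]
  rw [det_fin_two] at hdN
  have key : (∀ w, XS w * N = N * XS w) ∨ (∀ w, XS w * N = - (N * XS w)) := by
    rcases h.eps with e | e <;> rcases h'.eps with e' | e' <;> subst e <;> subst e'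
    · left; intro w; simpa using hc w
    · right; intro w; simpa using hc w
    · right; intro w; have := hc w; rw [neg_smul, one_smul, one_smul] at this; rw [← this, neg_neg]
    · left; intro w; simpa using hc w
  rcases key with k | k
  · have k0 := k ![1,0,0]
    have k1 := k ![0,1,0]
    rw [← Matrix.ext_iff] at k0 k1
    have a1 := k0 0 1
    have a2 := k0 1 0
    have a3 := k1 0 1
    simp [XS, Matrix.mul_apply, Fin.sum_univ_two] at a1 a2 a3
    have b1 : N 0 1 = 0 := by
      have : Complex.I * N 0 1 = 0 := by linear_combination a1 / 2
      simpa using this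
    have b2 : N 1 0 = 0 := by
      have : Complex.I * N 1 0 = 0 := by linear_combination - a2 / 2
      simpa using this
    have b3 : N 0 0 = 1 ∨ N 0 0 = -1 := by
      rw [b1, a3] at hdN
      rw [← sq_eq_one_iff]
      linear_combination hdN
    rcases b3 with b3 | b3
    · left
      have : N = 1 := by
        ext i j; fin_cases i <;> fin_cases j <;> simp [b1, b2, b3, a3]
      rw [hM', this, mul_one]
    · right
      have : N = -1 := by
        ext i j; fin_cases i <;> fin_cases j <;> simp [b1, b2, b3, a3]
      rw [hM', this, mul_neg, mul_one]
  · exfalso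
    have k0 := k ![1,0,0]
    have k1 := k ![0,1,0]
    have k2 := k ![0,0,1]
    rw [← Matrix.ext_iff] at k0 k1 k2
    have a1 := k0 0 0
    have a3 := k1 0 0
    have a4 := k2 0 0
    simp [XS, Matrix.mul_apply, Fin.sum_univ_two] at a1 a3 a4
    have b1 : N 0 0 = 0 := by
      have : Complex.I * N 0 0 = 0 := by linear_combination a1 / 2
      simpa using this
    have b2 : N 0 1 = 0 := by
      have : Complex.I * N 0 1 = 0 := by linear_combination a4 / 2 - Complex.I * a3 / 2
      simpa using this
    rw [b1, b2] at hdN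
    simp at hdN

lemma finite_range_of {α β γ : Type*} [Nonempty β] (f : γ → α) (g : γ → β) (hf : (Set.range f).Finite)
    (h : ∀ x y, f x = f y → g x = g y) : (Set.range g).Finite := by
  have h1 : g.FactorsThrough f := fun x y e => h x y e
  refine (hf.image (Function.extend f g fun _ => Classical.arbitrary β)).subset ?_
  rintro _ ⟨x, rfl⟩
  exact ⟨f x, ⟨x, rfl⟩, h1.extend_apply _ x⟩

lemma trace_dist (M M' : M2 ℂ) (h : M.det = 1) (h' : M'.det = 1) (hh : Mᴴ = M.adjugate) (hh' : M'ᴴ = M'.adjugate) :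
    ∑ i, ∑ j, ‖M i j - M' i j‖ ^ 2 = 4 - 2 * ((M.adjugate * M').trace).re := by
  have e : ∀ A : M2 ℂ, ((∑ i, ∑ j, ‖A i j‖ ^ 2 : ℝ) : ℂ) = (Aᴴ * A).trace := by
    intro A
    simp only [Matrix.trace_fin_two, Matrix.mul_apply, Fin.sum_univ_two, Matrix.conjTranspose_apply]
    push_cast
    simp only [← Complex.conj_mul']
    simp only [Complex.star_def]
    ring
  have h1 := e (M - M')
  have e1 : (M - M')ᴴ * (M - M') = M.adjugate * M - M.adjugate * M' - M'.adjugate * M + M'.adjugate * M' := by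
    rw [conjTranspose_sub, hh, hh']; noncomm_ring
  have e2 : (M'.adjugate * M).trace = star ((M.adjugate * M').trace) := by
    rw [← trace_conjTranspose, conjTranspose_mul, ← hh, conjTranspose_conjTranspose, hh']
  rw [e1, trace_add, trace_sub, trace_sub, e2, adjugate_mul, adjugate_mul, h, h'] at h1
  have h2 := congrArg Complex.re h1
  rw [Complex.ofReal_re] at h2
  simp only [Matrix.sub_apply] at h2
  rw [h2]
  simp
  ring

theorem TS.finite_O3 {Γ : Type} [Group Γ] (hΓ : TS Γ) (ρ : Γ → Matrix (Fin 3) (Fin 3) ℝ) (hmul : ∀ g h, ρ (g * h) = ρ g * ρ h)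
    (hρ : ∀ g, ρ g * (ρ g)ᵀ = 1) : (Set.range ρ).Finite := by
  choose M ε hM using fun g => exists_lft (ρ g) (hρ g)
  let R : PR Γ ℂ := ⟨M, fun g => (hM g).det, fun g h => by
    have h1 := (hM g).mul (hM h)
    have h2 := hM (g * h)
    simp only [mulVec_mulVec, ← hmul] at h1
    exact h1.unique h2⟩
  have hft := hΓ.finite_traces R
  have hD : ∀ g h, ∃ γ, (∑ i, ∑ j, ‖M g i j - M h i j‖ ^ 2 = 4 - 2 * ((M γ).trace).re) ∨
      (∑ i, ∑ j, ‖M g i j - M h i j‖ ^ 2 = 4 + 2 * ((M γ).trace).re) := by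
    intro g h
    refine ⟨g⁻¹ * h, ?_⟩
    rw [trace_dist _ _ (hM g).det (hM h).det (hM g).herm (hM h).herm]
    rcases R.invmul g h with e | e
    · left; rw [show M (g⁻¹ * h) = _ from e]
    · right; rw [show M (g⁻¹ * h) = _ from e]; simp; ring
  have hF : (Set.range fun p : Γ × Γ => ∑ i, ∑ j, ‖M p.1 i j - M p.2 i j‖ ^ 2).Finite := by
    refine ((hft.image fun z => 4 - 2 * z.re).union (hft.image fun z => 4 + 2 * z.re)).subset ?_
    rintro _ ⟨⟨g, h⟩, rfl⟩
    obtain ⟨γ, e | e⟩ := hD g h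
    · exact Or.inl ⟨_, ⟨γ, rfl⟩, e.symm⟩
    · exact Or.inr ⟨_, ⟨γ, rfl⟩, e.symm⟩
  have hc : ∃ c : ℝ, 0 < c ∧ ∀ g h, ∑ i, ∑ j, ‖M g i j - M h i j‖ ^ 2 < c → M g = M h := by
    have h0 : ∀ᶠ c in nhdsWithin (0:ℝ) (Set.Ioi 0), ∀ y ∈ (Set.range fun p : Γ × Γ => ∑ i, ∑ j, ‖M p.1 i j - M p.2 i j‖ ^ 2), y ≠ 0 → c ≤ y ∨ y < 0 := by
      rw [Filter.eventually_all_finite hF]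
      intro y hy
      by_cases hy0 : y = 0
      · exact Filter.Eventually.of_forall fun c h => absurd hy0 h
      · rcases lt_or_gt_of_ne hy0 with hl | hl
        · exact Filter.Eventually.of_forall fun c h => Or.inr hl
        · filter_upwards [mem_nhdsWithin_of_mem_nhds (Iic_mem_nhds hl)] with c hc _
          exact Or.inl hc
    obtain ⟨c, hc, hc0⟩ := (h0.and self_mem_nhdsWithin).exists
    refine ⟨c, hc0, fun g h hlt => ?_⟩
    have h1 := hc _ ⟨(g, h), rfl⟩
    have hnn : 0 ≤ ∑ i, ∑ j, ‖M g i j - M h i j‖ ^ 2 := by positivity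
    have h2 : ∑ i, ∑ j, ‖M g i j - M h i j‖ ^ 2 = 0 := by
      by_contra hne
      rcases h1 hne with h3 | h3
      · exact absurd hlt (not_lt.2 h3)
      · exact absurd hnn (not_le.2 h3)
    simp only [Fin.sum_univ_two] at h2
    have z00 := sq_nonneg ‖M g 0 0 - M h 0 0‖
    have z01 := sq_nonneg ‖M g 0 1 - M h 0 1‖
    have z10 := sq_nonneg ‖M g 1 0 - M h 1 0‖
    have z11 := sq_nonneg ‖M g 1 1 - M h 1 1‖
    ext i j
    rw [← sub_eq_zero, ← norm_eq_zero, ← sq_eq_zero_iff]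
    fin_cases i <;> fin_cases j <;> simp only [Fin.zero_eta, Fin.mk_one] <;> linarith
  obtain ⟨c, hc0, hc⟩ := hc
  have hMfin : (Set.range M).Finite := by
    let f : Γ → (Fin 2 → Fin 2 → ℂ) := fun g i j => M g i j
    have hb : Set.range f ⊆ Metric.closedBall 0 2 := by
      rintro _ ⟨g, rfl⟩
      rw [mem_closedBall_zero_iff]
      refine (pi_norm_le_iff_of_nonneg (by norm_num)).2 fun i => (pi_norm_le_iff_of_nonneg (by norm_num)).2 fun j => ?_
      have h1 := (hM g).herm
      have h2 := (hM g).det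
      rw [adjugate_fin_two] at h1
      rw [← Matrix.ext_iff] at h1
      have a1 := h1 0 0
      have a2 := h1 0 1
      simp at a1 a2
      rw [det_fin_two, ← a1] at h2
      have a3 : M g 0 1 = - (starRingEnd ℂ) (M g 1 0) := by rw [a2, neg_neg]
      rw [a3] at h2
      have h3 : ‖M g 0 0‖ ^ 2 + ‖M g 1 0‖ ^ 2 = 1 := by
        have : ((‖M g 0 0‖ ^ 2 + ‖M g 1 0‖ ^ 2 : ℝ) : ℂ) = 1 := by
          push_cast
          rw [← Complex.conj_mul', ← Complex.conj_mul']
          linear_combination h2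
        exact_mod_cast this
      have n1 : ‖M g 1 1‖ = ‖M g 0 0‖ := by rw [← a1, Complex.norm_conj]
      have n2 : ‖M g 0 1‖ = ‖M g 1 0‖ := by rw [a3, norm_neg, Complex.norm_conj]
      show ‖M g i j‖ ≤ 2
      have b1 : ‖M g 0 0‖ ≤ 2 := by nlinarith [norm_nonneg (M g 0 0), sq_nonneg ‖M g 1 0‖]
      have b2 : ‖M g 1 0‖ ≤ 2 := by nlinarith [norm_nonneg (M g 1 0), sq_nonneg ‖M g 0 0‖]
      fin_cases i <;> fin_cases j <;> simp only [Fin.zero_eta, Fin.mk_one] <;> linarith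
    have htb : TotallyBounded (Set.range f) := ((isCompact_closedBall _ _).totallyBounded).subset hb
    rw [Metric.totallyBounded_iff] at htb
    have hs : 0 < Real.sqrt c := Real.sqrt_pos.2 hc0
    obtain ⟨t, htf, ht⟩ := htb (Real.sqrt c / 4) (by positivity)
    have hch : ∀ g, ∃ y, y ∈ t ∧ dist (f g) y < Real.sqrt c / 4 := by
      intro g
      have := ht ⟨g, rfl⟩
      simp only [Set.mem_iUnion, Metric.mem_ball] at this
      obtain ⟨y, hy, h⟩ := this
      exact ⟨y, hy, h⟩
    choose y hy hyd using hch
    refine finite_range_of y M (htf.subset ?_) ?_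
    · rintro _ ⟨g, rfl⟩; exact hy g
    · intro g h e
      refine hc g h ?_
      have hd : dist (f g) (f h) < Real.sqrt c / 2 := by
        have h1 := dist_triangle_right (f g) (f h) (y g)
        have h2 := hyd g
        have h3 := hyd h
        rw [← e] at h3
        linarith
      have hij : ∀ i j, ‖M g i j - M h i j‖ ^ 2 < c / 4 := by
        intro i j
        have h1 : ‖M g i j - M h i j‖ ≤ dist (f g) (f h) := by
          rw [← dist_eq_norm]
          exact (dist_le_pi_dist (f g i) (f h i) j).trans (dist_le_pi_dist (f g) (f h) i)
        have h2 : ‖M g i j - M h i j‖ ^ 2 < (Real.sqrt c / 2) ^ 2 :=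
          pow_lt_pow_left₀ (h1.trans_lt hd) (norm_nonneg _) two_ne_zero
        rw [div_pow, Real.sq_sqrt hc0.le] at h2
        linarith
      simp only [Fin.sum_univ_two]
      linarith [hij 0 0, hij 0 1, hij 1 0, hij 1 1]
  have hpair : (Set.range fun g => (M g, ε g)).Finite := by
    refine (hMfin.prod (Set.toFinite ({1, -1} : Set ℂ))).subset ?_
    rintro _ ⟨g, rfl⟩
    exact ⟨⟨g, rfl⟩, (hM g).eps⟩
  refine finite_range_of _ ρ hpair fun g h e => ?_
  obtain ⟨e1, e2⟩ := Prod.mk.inj e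
  refine Matrix.ext_of_mulVec_single fun i => XS_inj ?_
  have h1 := (hM g).comm (Pi.single i 1)
  have h2 := (hM h).comm (Pi.single i 1)
  rw [e1, e2, ← h2] at h1
  have h3 := congrArg (fun Y => Y * (M h).adjugate) h1
  simpa only [mul_assoc, mul_adjugate, (hM h).det, one_smul, mul_one] using h3

theorem TS.finite_O {Γ : Type} [Group Γ] (hΓ : TS Γ) (k : ℕ) (hk : k ≤ 3) (ρ : Γ →* Matrix (Fin k) (Fin k) ℝ)
    (hρ : ∀ g, ρ g * (ρ g)ᵀ = 1) : (Set.range ρ).Finite := by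
  let e : Fin k ⊕ Fin (3 - k) ≃ Fin 3 := finSumFinEquiv.trans (finCongr (by omega))
  let P : Matrix (Fin k) (Fin k) ℝ → Matrix (Fin 3) (Fin 3) ℝ := fun A => (fromBlocks A 0 0 1).submatrix e.symm e.symm
  have hfin := hΓ.finite_O3 (fun g => P (ρ g)) (fun g h => by
      simp only [P, map_mul]
      rw [submatrix_mul_equiv, fromBlocks_multiply]
      simp) (fun g => by
      simp only [P]
      rw [transpose_submatrix, submatrix_mul_equiv, fromBlocks_transpose, fromBlocks_multiply]
      simp [hρ])
  refine finite_range_of _ ρ hfin fun g h eq => ?_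
  have h1 := congrArg (fun B => B.submatrix e e) eq
  simp only [P, submatrix_submatrix, Equiv.symm_comp_self, submatrix_id_id] at h1
  exact (fromBlocks_inj.1 h1).1

end DistalProof
end

section
set_option linter.all false
namespace DistalProof

theorem final
    (n : ℕ) (hn : 3 ≤ n)
    (Γ : Subgroup (Matrix.SpecialLinearGroup (Fin n) ℝ)) (hΓ : Γ.IsLattice)
    (S : Type*) [MetricSpace S] [CompactSpace S] [ConnectedSpace S]
    [ChartedSpace (EuclideanSpace ℝ (Fin 2)) S]
    (φ : Γ →* (S ≃ₜ S)) :
    ¬ ((∀ x y : S, x ≠ y → 0 < ⨅ g : Γ, dist (φ g x) (φ g y)) ∧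
        (∀ x : S, Dense (Set.range fun g : Γ => φ g x))) := by
  rintro ⟨hdist, hmin⟩
  have hT : TS Γ := fun δ hδ => Tstar (kazhdan_lattice hn Γ hΓ) δ hδ
  letI : MulAction Γ S :=
    { smul := fun g x => φ g x
      one_smul := fun x => by
        show φ 1 x = x
        rw [map_one]; rfl
      mul_smul := fun g h x => by
        show φ (g * h) x = φ g (φ h x)
        rw [map_mul]; rfl }
  haveI : ContinuousConstSMul Γ S := ⟨fun g => (φ g).continuous⟩
  have hD : DistalA.DM Γ S :=
    { distal := fun x y hxy => ⟨_, hdist x y hxy, fun g =>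
        ciInf_le ⟨0, by rintro _ ⟨g, rfl⟩; exact dist_nonneg⟩ g⟩
      minimal := hmin }
  refine DistalA.no_DM hD (fun k hk ρ hρ => hT.finite_O k hk ρ hρ) fun Γ' hΓ' m ρ hρ hc => ?_
  haveI := hΓ'
  exact (hT.finiteIndex Γ').finite_abelian ρ hc

end DistalProof
end

/-- **Distal higher rank lattice actions on surfaces.**
Let `Γ` be a lattice in `SL(n, ℝ)`, `n ≥ 3`, and let `S` be a closed surface (a compact
connected 2-dimensional topological manifold without boundary, here carrying a compatible
metric).  Then no action of `Γ` on `S` by homeomorphisms is both distal and minimal. -/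
theorem no_distal_minimal_action_of_higher_rank_lattice_on_surface
    (n : ℕ) (hn : 3 ≤ n)
    (Γ : Subgroup (Matrix.SpecialLinearGroup (Fin n) ℝ)) (hΓ : Γ.IsLattice)
    (S : Type*) [MetricSpace S] [CompactSpace S] [ConnectedSpace S]
    [ChartedSpace (EuclideanSpace ℝ (Fin 2)) S]
    (φ : Γ →* (S ≃ₜ S)) :
    ¬ ((∀ x y : S, x ≠ y → 0 < ⨅ g : Γ, dist (φ g x) (φ g y)) ∧
        (∀ x : S, Dense (Set.range fun g : Γ => φ g x))) := by
  exact DistalProof.final n hn Γ hΓ S φ
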